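/- For every Θ > 0 there exist λ₁, λ₂ ∈ ℝ with λ₁ + λ₂ > 0 and functions u, v ∈ H¹(ℝ³ × 𝕋) with u > 0 and v > 0 everywhere, ‖u‖₂ = ‖v‖₂ = Θ, such that (u,v) is a weak solution of the coupled system −Δ_{x,y}u + λ₁ u = u³ + u v², −Δ_{x,y}v + λ₂ v = v³ + v u² on ℝ³ × 𝕋; that is, for every smooth compactly supported test function φ on ℝ³ × 𝕋 one has ∫_{ℝ³×𝕋}(∇_{x,y}u·∇_{x,y}φ + λ₁ u φ) dx dy = ∫_{ℝ³×𝕋}(u³ + u v²)φ dx dy and ∫_{ℝ³×𝕋}(∇_{x,y}v·∇_{x,y}φ + λ₂ v φ) dx dy = ∫_{ℝ³×𝕋}(v³ + v u²)φ dx dy. Moreover (u,v) can be taken to be a minimizer of m_Θ, i.e. (u,v) ∈ V_Θ with I(u,v) = m_Θ. -/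

import Mathlib

noncomputable section

open MeasureTheory Real Filter

namespace Waveguide

/-- A point of the waveguide `ℝ³ × 𝕋`, modelled as `ℝ³ × ℝ` with functions that are
`2π`-periodic in the second coordinate. -/
abbrev Pt : Type := (Fin 3 → ℝ) × ℝ

/-- The fundamental domain `ℝ³ × (0, 2π]` of the waveguide `ℝ³ × 𝕋`. -/
def Dom : Set Pt := Set.univ ×ˢ Set.Ioc 0 (2 * π)

/-- `2π`-periodicity in the `y` variable. -/
def PeriodicY (u : Pt → ℝ) : Prop := ∀ x y, u (x, y + 2 * π) = u (x, y)

/-- The `i`-th horizontal coordinate direction. -/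
def ex (i : Fin 3) : Pt := (fun j => if j = i then 1 else 0, 0)

/-- The vertical (periodic) direction. -/
def ey : Pt := (0, 1)

/-- `i`-th partial derivative in the `x` variables. -/
def gradx (u : Pt → ℝ) (p : Pt) (i : Fin 3) : ℝ := fderiv ℝ u p (ex i)

/-- Partial derivative in the `y` variable, `u_y`. -/
def grady (u : Pt → ℝ) (p : Pt) : ℝ := fderiv ℝ u p ey

/-- `|∇_x u|²`. -/
def gradSqX (u : Pt → ℝ) (p : Pt) : ℝ := ∑ i, (gradx u p i) ^ 2

/-- `|∇_{x,y} u|²`. -/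
def gradSq (u : Pt → ℝ) (p : Pt) : ℝ := gradSqX u p + (grady u p) ^ 2

/-- Membership in (a regular repesentative of) `H¹(ℝ³ × 𝕋)`, for real valued functions. -/
structure H1 (u : Pt → ℝ) : Prop where
  periodic : PeriodicY u
  diff : Differentiable ℝ u
  memL2 : IntegrableOn (fun p => (u p) ^ 2) Dom
  memGrad : IntegrableOn (fun p => gradSq u p) Dom
  memL4 : IntegrableOn (fun p => (u p) ^ 4) Dom

/-- The `L²(ℝ³ × 𝕋)` norm. -/
def l2 (u : Pt → ℝ) : ℝ := Real.sqrt (∫ p in Dom, (u p) ^ 2)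

/-- `u ∈ S_Θ`. -/
def inS (Θ : ℝ) (u : Pt → ℝ) : Prop := H1 u ∧ l2 u = Θ

/-- The nonlinear density `u⁴ + 2u²v² + v⁴`. -/
def nonlin (u v : Pt → ℝ) (p : Pt) : ℝ :=
  (u p) ^ 4 + 2 * (u p) ^ 2 * (v p) ^ 2 + (v p) ^ 4

/-- The energy functional `I(u,v)`. -/
def energy (u v : Pt → ℝ) : ℝ :=
  (1 / 2) * (∫ p in Dom, (gradSq u p + gradSq v p))
    - (1 / 4) * ∫ p in Dom, nonlin u v p

/-- The semivirial functional `Q(u,v)`. -/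
def svirial (u v : Pt → ℝ) : ℝ :=
  (∫ p in Dom, (gradSqX u p + gradSqX v p))
    - (3 / 4) * ∫ p in Dom, nonlin u v p

/-- The ground-state level `m_Θ`. -/
def mlevel (Θ : ℝ) : ℝ :=
  sInf {c | ∃ u v : Pt → ℝ, inS Θ u ∧ inS Θ v ∧ svirial u v = 0 ∧ energy u v = c}

/-- `(u,v)` is a minimizer of `m_Θ`: it lies in `V_Θ` and attains the infimum. -/
def isMinimizer (Θ : ℝ) (u v : Pt → ℝ) : Prop :=
  inS Θ u ∧ inS Θ v ∧ svirial u v = 0 ∧ energy u v = mlevel Θ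

/-- Smooth, compactly supported (in `x`) test function on the waveguide. -/
def TestFun (φ : Pt → ℝ) : Prop :=
  ContDiff ℝ (⊤ : ℕ∞) φ ∧ PeriodicY φ ∧
    ∃ K : Set (Fin 3 → ℝ), IsCompact K ∧ ∀ p : Pt, p.1 ∉ K → φ p = 0

/-- `u` is a weak solution of `-Δ_{x,y} u + lam u = f` on `ℝ³ × 𝕋`. -/
def WeakSol (lam : ℝ) (u f : Pt → ℝ) : Prop :=
  ∀ φ : Pt → ℝ, TestFun φ →
    (∫ p in Dom,
        ((∑ i, gradx u p i * gradx φ p i) + grady u p * grady φ p + lam * u p * φ p))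
      = ∫ p in Dom, f p * φ p

/-- The mass-preserving rescaling `u^τ(x,y) = τ^{3/2} u(τx, y)`. -/
def scaleX (τ : ℝ) (u : Pt → ℝ) : Pt → ℝ :=
  fun p => τ ^ ((3 : ℝ) / 2) * u (τ • p.1, p.2)

/-- `u` is independent of the `y` variable, i.e. `u_y = 0` (a.e.). -/
def Yindep (u : Pt → ℝ) : Prop := ∀ᵐ p : Pt ∂volume, grady u p = 0

/-- The functional `J_μ(u,v)`. -/
def Jfun (μ : ℝ) (u v : Pt → ℝ) : ℝ :=
  (1 / 2) * (∫ p in Dom,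
      (gradSqX u p + μ * (grady u p) ^ 2 + gradSqX v p + μ * (grady v p) ^ 2))
    - (1 / 4) * ∫ p in Dom, nonlin u v p

/-- The level `m_{1,μ}`. -/
def m1 (μ : ℝ) : ℝ :=
  sInf {c | ∃ u v : Pt → ℝ, inS 1 u ∧ inS 1 v ∧ svirial u v = 0 ∧ Jfun μ u v = c}

/-- `(u,v)` is a minimizer of `m_{1,μ}`. -/
def isMinimizerJ (μ : ℝ) (u v : Pt → ℝ) : Prop :=
  inS 1 u ∧ inS 1 v ∧ svirial u v = 0 ∧ Jfun μ u v = m1 μ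

/-! ### Objects on `ℝ³` -/

abbrev Pt3 : Type := Fin 3 → ℝ

def e3 (i : Fin 3) : Pt3 := fun j => if j = i then 1 else 0

def grad3 (w : Pt3 → ℝ) (x : Pt3) (i : Fin 3) : ℝ := fderiv ℝ w x (e3 i)

def gradSq3 (w : Pt3 → ℝ) (x : Pt3) : ℝ := ∑ i, (grad3 w x i) ^ 2

/-- Membership in (a regular representative of) `H¹(ℝ³)`. -/
structure H1R3 (w : Pt3 → ℝ) : Prop where
  diff : Differentiable ℝ w
  memL2 : Integrable (fun x => (w x) ^ 2)
  memGrad : Integrable (fun x => gradSq3 w x)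
  memL4 : Integrable (fun x => (w x) ^ 4)

/-- The `L²(ℝ³)` norm. -/
def l2R3 (w : Pt3 → ℝ) : ℝ := Real.sqrt (∫ x, (w x) ^ 2)

def nonlin3 (u v : Pt3 → ℝ) (x : Pt3) : ℝ :=
  (u x) ^ 4 + 2 * (u x) ^ 2 * (v x) ^ 2 + (v x) ^ 4

/-- The limit energy `Î(u,v)` on `ℝ³`. -/
def Ihat (u v : Pt3 → ℝ) : ℝ :=
  (1 / 2) * (∫ x, (gradSq3 u x + gradSq3 v x)) - (1 / 4) * ∫ x, nonlin3 u v x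

/-- The virial `Q̂(u,v)` on `ℝ³`. -/
def Qhat (u v : Pt3 → ℝ) : ℝ :=
  (∫ x, (gradSq3 u x + gradSq3 v x)) - (3 / 4) * ∫ x, nonlin3 u v x

/-- The ground-state energy `m̂_ρ` on `ℝ³`. -/
def mhat (ρ : ℝ) : ℝ :=
  sInf {c | ∃ u v : Pt3 → ℝ, H1R3 u ∧ H1R3 v ∧ l2R3 u = ρ ∧ l2R3 v = ρ ∧
    Qhat u v = 0 ∧ Ihat u v = c}

/-! ### Knothe maps and the sharp Sobolev inequality -/

lemma exists_cdf_inverse {Γ γ : ℝ → ℝ} (hd : ∀ s, HasDerivAt Γ (γ s) s) (hpos : ∀ s, 0 < γ s)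
    {R : ℝ} (hR : 0 < R) (h0 : Γ (-R) = 0) (h1 : Γ R = 1) :
    ∃ J : ℝ → ℝ, ∀ c ∈ Set.Ioo (0 : ℝ) 1,
      J c ∈ Set.Ioo (-R) R ∧ Γ (J c) = c ∧ HasDerivAt J (γ (J c))⁻¹ c := by
  have hmono : StrictMono Γ := strictMono_of_hasDerivAt_pos hd hpos
  have hcont : Continuous Γ := continuous_iff_continuousAt.2 fun s => (hd s).continuousAt
  have hex : ∀ c ∈ Set.Ioo (0 : ℝ) 1, ∃ s ∈ Set.Ioo (-R) R, Γ s = c := by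
    intro c hc
    have := intermediate_value_Ioo (by linarith : -R ≤ R) hcont.continuousOn
    rw [h0, h1] at this
    exact this hc
  choose! J hJ using hex
  refine ⟨J, fun c hc => ⟨(hJ c hc).1, (hJ c hc).2, ?_⟩⟩
  have hJG : ∀ s ∈ Set.Ioo (-R) R, J (Γ s) = s := by
    intro s hs
    have : Γ s ∈ Set.Ioo (0 : ℝ) 1 := ⟨h0 ▸ hmono hs.1, h1 ▸ hmono hs.2⟩
    exact hmono.injective (hJ _ this).2
  have hcJ : ContinuousAt J c := by
    have hm : StrictMonoOn J (Set.Ioo 0 1) := by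
      intro a ha b hb hab
      rw [← hmono.lt_iff_lt, (hJ a ha).2, (hJ b hb).2]
      exact hab
    refine hm.continuousAt_of_image_mem_nhds (Ioo_mem_nhds hc.1 hc.2) ?_
    have : Set.Ioo (-R) R ⊆ J '' Set.Ioo 0 1 := fun s hs =>
      ⟨Γ s, ⟨h0 ▸ hmono hs.1, h1 ▸ hmono hs.2⟩, hJG s hs⟩
    exact mem_of_superset (Ioo_mem_nhds (hJ c hc).1.1 (hJ c hc).1.2) this
  refine HasDerivAt.of_local_left_inverse hcJ (hd _) (hpos _).ne' ?_
  filter_upwards [Ioo_mem_nhds hc.1 hc.2] with y hy using (hJ y hy).2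

/-- `T` pushes the density `F` forward to the density `G` on the set `B`. -/
def Transports {E : Type*} [MeasurableSpace E] (μ : Measure E) (T : E → E) (F G : E → ℝ)
    (B : Set E) : Prop :=
  ∀ φ : E → ENNReal, Measurable φ →
    ∫⁻ e, φ (T e) * ENNReal.ofReal (F e) ∂μ = ∫⁻ e in B, φ e * ENNReal.ofReal (G e) ∂μ

lemma hasDerivAt_integral_Iic {f : ℝ → ℝ} (hf : Continuous f) (hi : Integrable f) (t : ℝ) :
    HasDerivAt (fun t => ∫ s in Set.Iic t, f s) (f t) t := by
  have h : (fun t => ∫ s in Set.Iic t, f s)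
      = fun t => (∫ s in Set.Iic 0, f s) + ∫ s in (0 : ℝ)..t, f s := by
    funext t
    rw [← intervalIntegral.integral_Iic_sub_Iic hi.integrableOn hi.integrableOn]
    ring
  rw [h]
  exact (intervalIntegral.integral_hasDerivAt_right (hf.intervalIntegrable _ _)
    hf.stronglyMeasurable.stronglyMeasurableAtFilter hf.continuousAt).const_add _

lemma exists_monotone_transport {f g : ℝ → ℝ} (hf : Continuous f) (hi : Integrable f)
    (hfpos : ∀ t, 0 < f t) (hg : Continuous g) (hgpos : ∀ s, 0 < g s) {R : ℝ} (hR : 0 < R) :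
    ∃ τ : ℝ → ℝ, (∀ t, τ t ∈ Set.Ioo (-R) R) ∧
      (∀ t, HasDerivAt τ (f t * (∫ s in (-R)..R, g s) / ((∫ s, f s) * g (τ t))) t) ∧
      (∀ t, (∫ s in (-R)..(τ t), g s) / (∫ s in (-R)..R, g s)
        = (∫ s in Set.Iic t, f s) / ∫ s, f s) ∧
      StrictMono τ ∧ Set.range τ = Set.Ioo (-R) R := by
  have ha : 0 < ∫ s, f s :=
    integral_pos_of_integrable_nonneg_nonzero (x := 0) hf hi (fun t => (hfpos t).le) (hfpos 0).ne'
  have hb : 0 < ∫ s in (-R)..R, g s :=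
    intervalIntegral.intervalIntegral_pos_of_pos (hg.intervalIntegrable _ _) hgpos (by linarith)
  set a := ∫ s, f s
  set b := ∫ s in (-R)..R, g s
  have hG : ∀ s, HasDerivAt (fun s => (∫ r in (-R)..s, g r) / b) (g s / b) s := fun s =>
    (intervalIntegral.integral_hasDerivAt_right (hg.intervalIntegrable _ _)
      hg.stronglyMeasurable.stronglyMeasurableAtFilter hg.continuousAt).div_const _
  obtain ⟨J, hJ⟩ := exists_cdf_inverse hG (fun s => div_pos (hgpos s) hb) hR (by simp)
    (div_self hb.ne')
  have hF : ∀ t, HasDerivAt (fun t => (∫ s in Set.Iic t, f s) / a) (f t / a) t := fun t =>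
    (hasDerivAt_integral_Iic hf hi t).div_const _
  have hmem : ∀ t, (∫ s in Set.Iic t, f s) / a ∈ Set.Ioo (0 : ℝ) 1 := by
    intro t
    have h1 : 0 < ∫ s in Set.Iic t, f s := by
      rw [setIntegral_pos_iff_support_of_nonneg_ae (ae_of_all _ fun t => (hfpos t).le)
        hi.integrableOn]
      have : Function.support f = Set.univ := by
        ext t; simp [(hfpos t).ne']
      simp [this]
    have h2 : 0 < ∫ s in Set.Ioi t, f s := by
      rw [setIntegral_pos_iff_support_of_nonneg_ae (ae_of_all _ fun t => (hfpos t).le)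
        hi.integrableOn]
      have : Function.support f = Set.univ := by
        ext t; simp [(hfpos t).ne']
      simp [this]
    have h3 : (∫ s in Set.Iic t, f s) + ∫ s in Set.Ioi t, f s = a :=
      intervalIntegral.integral_Iic_add_Ioi hi.integrableOn hi.integrableOn
    exact ⟨div_pos h1 ha, by rw [div_lt_one ha]; linarith⟩
  have hder : ∀ t, HasDerivAt (fun t => J ((∫ s in Set.Iic t, f s) / a))
      (f t * b / (a * g (J ((∫ s in Set.Iic t, f s) / a)))) t := by
    intro t
    have := (hJ _ (hmem t)).2.2.comp t (hF t)
    refine this.congr_deriv ?_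
    rw [inv_div]
    ring
  refine ⟨fun t => J ((∫ s in Set.Iic t, f s) / a), fun t => (hJ _ (hmem t)).1, hder,
    fun t => (hJ _ (hmem t)).2.1, ?_, ?_⟩
  · refine strictMono_of_hasDerivAt_pos hder fun t => ?_
    have := hfpos t
    have := hgpos (J ((∫ s in Set.Iic t, f s) / a))
    positivity
  · have hGmono := strictMono_of_hasDerivAt_pos hG (fun s => div_pos (hgpos s) hb)
    ext s
    constructor
    · rintro ⟨t, rfl⟩
      exact (hJ _ (hmem t)).1
    · intro hs
      have h0 : 0 < (∫ r in (-R)..s, g r) / b := by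
        have := hGmono hs.1
        simpa using this
      have h1 : (∫ r in (-R)..s, g r) / b < 1 := by
        have := hGmono hs.2
        simp only at this
        rwa [div_self hb.ne'] at this
      have hcF : Continuous (fun t => (∫ s in Set.Iic t, f s) / a) :=
        continuous_iff_continuousAt.2 fun t => (hF t).continuousAt
      have hbot : Tendsto (fun t => (∫ s in Set.Iic t, f s) / a) atBot (nhds 0) := by
        simpa using (tendsto_integral_Iic_zero (f := f) (μ := volume) tendsto_id).div_const a
      have htop : Tendsto (fun t => (∫ s in Set.Iic t, f s) / a) atTop (nhds 1) := by
        have h3 : ∀ t, (∫ s in Set.Iic t, f s) = a - ∫ s in Set.Ioi t, f s := by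
          intro t
          have : (∫ s in Set.Iic t, f s) + ∫ s in Set.Ioi t, f s = a :=
            intervalIntegral.integral_Iic_add_Ioi hi.integrableOn hi.integrableOn
          linarith
        simp only [h3]
        have := ((tendsto_integral_Ioi_zero (f := f) (μ := volume) tendsto_id).const_sub
          a).div_const a
        simpa [div_self ha.ne'] using this
      obtain ⟨t, ht⟩ := mem_range_of_exists_le_of_exists_ge hcF
        (hbot.eventually (ge_mem_nhds h0)).exists (htop.eventually (le_mem_nhds h1)).exists
      refine ⟨t, ?_⟩
      have := (hJ _ (hmem t)).2.1
      simp only [ht] at this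
      simp only [ht]
      exact hGmono.injective this

lemma exists_transport_succ {E : Type*} [MeasurableSpace E] {μ : Measure E} [SFinite μ]
    {T : E → E} {F G : E × ℝ → ℝ} {B : Set E} (hT : Measurable T) (hF : Measurable F)
      (hFc : ∀ e, Continuous fun t => F (e, t))
    (hFi : ∀ e, Integrable fun t => F (e, t)) (hFp : ∀ p, 0 < F p) (hG : Measurable G)
    (hGc : ∀ e, Continuous fun t => G (e, t)) (hGp : ∀ p, 0 < G p) {R : ℝ} (hR : 0 < R)
    (htr : Transports μ T (fun e => ∫ t, F (e, t)) (fun e => ∫ s in (-R)..R, G (e, s)) B) :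
    ∃ τ : E × ℝ → ℝ, Measurable τ ∧ (∀ p, τ p ∈ Set.Ioo (-R) R) ∧
      (∀ e t, HasDerivAt (fun t => τ (e, t))
        (F (e, t) * (∫ s in (-R)..R, G (T e, s)) / ((∫ s, F (e, s)) * G (T e, τ (e, t)))) t) ∧
      Transports (μ.prod volume) (fun p => (T p.1, τ p)) F G (B ×ˢ Set.Ioo (-R) R) := by
  have hgpos : ∀ e, 0 < ∫ s in (-R)..R, G (e, s) := fun e =>
    intervalIntegral.intervalIntegral_pos_of_pos ((hGc e).intervalIntegrable _ _)
      (fun s => hGp _) (by linarith)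
  have hfpos : ∀ e, 0 < ∫ t, F (e, t) := fun e =>
    integral_pos_of_integrable_nonneg_nonzero (x := 0) (hFc e) (hFi e) (fun t => (hFp _).le)
      (hFp _).ne'
  choose τ h1 h2 h3 h4 h5 using fun e => exists_monotone_transport (hFc e) (hFi e)
    (fun t => hFp (e, t)) (hGc (T e)) (fun t => hGp (T e, t)) hR
  have hm : Measurable (fun p : E × ℝ => τ p.1 p.2) := by
    have hmF : Measurable fun p : E × ℝ =>
        (∫ s in Set.Iic p.2, F (p.1, s)) / ∫ s, F (p.1, s) := by
      have e1 : (fun p : E × ℝ => ∫ s in Set.Iic p.2, F (p.1, s))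
          = fun p => ∫ s, (Set.indicator {q : (E × ℝ) × ℝ | q.2 ≤ q.1.2}
            (fun q => F (q.1.1, q.2))) (p, s) := by
        funext p
        rw [← integral_indicator measurableSet_Iic]
        congr 1
      have m1 : Measurable fun p : E × ℝ => ∫ s in Set.Iic p.2, F (p.1, s) := by
        rw [e1]
        refine (StronglyMeasurable.integral_prod_right' ?_).measurable
        exact ((hF.comp (by fun_prop : Measurable fun q : (E × ℝ) × ℝ => (q.1.1, q.2))).indicator
          (measurableSet_le (by fun_prop) (by fun_prop))).stronglyMeasurable
      refine m1.div ?_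
      exact (hF.stronglyMeasurable.integral_prod_right'.measurable).comp measurable_fst
    have hmG : ∀ s, Measurable fun p : E × ℝ =>
        (∫ r in (-R)..s, G (T p.1, r)) / (∫ r in (-R)..R, G (T p.1, r)) := by
      have : ∀ s, Measurable fun e : E => ∫ r in (-R)..s, G (e, r) := by
        intro s
        simp only [intervalIntegral]
        exact (hG.stronglyMeasurable.integral_prod_right'.measurable).sub
          (hG.stronglyMeasurable.integral_prod_right'.measurable)
      intro s
      exact ((this s).comp (hT.comp measurable_fst)).div ((this R).comp (hT.comp measurable_fst))
    refine measurable_of_Iio fun s => ?_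
    have : (fun p : E × ℝ => τ p.1 p.2) ⁻¹' Set.Iio s
        = {p | (∫ r in Set.Iic p.2, F (p.1, r)) / (∫ r, F (p.1, r))
          < (∫ r in (-R)..s, G (T p.1, r)) / (∫ r in (-R)..R, G (T p.1, r))} := by
      ext p
      have hmono : StrictMono fun s =>
          (∫ r in (-R)..s, G (T p.1, r)) / (∫ r in (-R)..R, G (T p.1, r)) := by
        refine strictMono_of_hasDerivAt_pos (f' := fun s => G (T p.1, s) /
          (∫ r in (-R)..R, G (T p.1, r))) (fun s => ?_) (fun s => div_pos (hGp _) (hgpos _))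
        exact (intervalIntegral.integral_hasDerivAt_right ((hGc _).intervalIntegrable _ _)
          (hGc _).stronglyMeasurable.stronglyMeasurableAtFilter (hGc _).continuousAt).div_const _
      simp only [Set.mem_preimage, Set.mem_Iio, Set.mem_ofPred_eq]
      rw [← h3, hmono.lt_iff_lt]
    rw [this]
    exact measurableSet_lt hmF (hmG s)
  refine ⟨fun p => τ p.1 p.2, hm, fun p => h1 _ _, fun e t => h2 e t, ?_⟩
  intro φ hφ
  have hφG : Measurable fun e => (∫⁻ s in Set.Ioo (-R) R, φ (e, s) * ENNReal.ofReal (G (e, s))) :=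
    (hφ.mul hG.ennreal_ofReal).lintegral_prod_right'
  have hGb : Measurable fun e : E => ∫ r in (-R)..R, G (e, r) := by
    simp only [intervalIntegral]
    exact (hG.stronglyMeasurable.integral_prod_right'.measurable).sub
      (hG.stronglyMeasurable.integral_prod_right'.measurable)
  have hFb : Measurable fun e : E => ∫ r, F (e, r) :=
    hF.stronglyMeasurable.integral_prod_right'.measurable
  have key : ∀ e, ∫⁻ t, φ (T e, τ e t) * ENNReal.ofReal (F (e, t))
      = (∫⁻ s in Set.Ioo (-R) R, φ (T e, s) * ENNReal.ofReal (G (T e, s)))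
        * (ENNReal.ofReal (∫ r in (-R)..R, G (T e, r)))⁻¹ * ENNReal.ofReal (∫ r, F (e, r)) := by
    intro e
    rw [← h5 e, ← Set.image_univ,
      lintegral_image_eq_lintegral_deriv_mul_of_monotoneOn MeasurableSet.univ
      (fun t _ => (h2 e t).hasDerivWithinAt) ((h4 e).monotone.monotoneOn _), Measure.restrict_univ,
      mul_assoc, ← lintegral_mul_const _ (by
        refine Measurable.mul ?_ ?_
        · refine Measurable.ennreal_ofReal ?_
          exact ((hFc e).measurable.mul_const _).div (((hGc (T e)).measurable.comp
            (hm.comp measurable_prodMk_left)).const_mul _)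
        · exact ((hφ.mul hG.ennreal_ofReal).comp
            (measurable_const.prodMk (hm.comp measurable_prodMk_left)) ))]
    refine lintegral_congr fun t => ?_
    have hg := hgpos (T e)
    have hf := hfpos e
    have hGt := hGp (T e, τ e t)
    have hFt := hFp (e, t)
    rw [← ENNReal.ofReal_inv_of_pos hg, ← ENNReal.ofReal_mul (by positivity)]
    rw [mul_comm (ENNReal.ofReal _) (φ _ * _), mul_assoc, mul_assoc, ← mul_assoc (ENNReal.ofReal _),
      ← ENNReal.ofReal_mul hGt.le, ← ENNReal.ofReal_mul (by positivity)]
    congr 2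
    field_simp
  have hmm : Measurable fun p : E × ℝ => φ (T p.1, τ p.1 p.2) * ENNReal.ofReal (F p) :=
    (hφ.comp ((hT.comp measurable_fst).prodMk hm)).mul hF.ennreal_ofReal
  simp only
  rw [lintegral_prod _ hmm.aemeasurable]
  simp_rw [key]
  rw [htr (fun e => (∫⁻ s in Set.Ioo (-R) R, φ (e, s) * ENNReal.ofReal (G (e, s)))
        * (ENNReal.ofReal (∫ r in (-R)..R, G (e, r)))⁻¹)
    (hφG.mul hGb.ennreal_ofReal.inv)]
  have hmG : Measurable fun p : E × ℝ => φ p * ENNReal.ofReal (G p) :=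
    hφ.mul hG.ennreal_ofReal
  rw [← Measure.prod_restrict, lintegral_prod _ hmG.aemeasurable]
  refine lintegral_congr fun e => ?_
  rw [mul_assoc, ENNReal.inv_mul_cancel, mul_one]
  · simpa using hgpos e
  · exact ENNReal.ofReal_ne_top

/-- The Gaussian weight `exp (-4 t²)`. -/
def gw (t : ℝ) : ℝ := Real.exp (-4 * t ^ 2)

lemma gw_pos (t : ℝ) : 0 < gw t := Real.exp_pos _

lemma gw_le_one (t : ℝ) : gw t ≤ 1 := Real.exp_le_one_iff.2 (by nlinarith [sq_nonneg t])

lemma continuous_gw : Continuous gw := by unfold gw; fun_prop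

lemma integrable_gw : Integrable gw := integrable_exp_neg_mul_sq (by norm_num)

lemma integral_gw_pos : 0 < ∫ t, gw t :=
  integral_pos_of_integrable_nonneg_nonzero (x := 0) continuous_gw integrable_gw
    (fun t => (gw_pos t).le) (gw_pos 0).ne'

/-- `F` is continuous and comparable to the weight `w`. -/
structure Comparable {E : Type*} [TopologicalSpace E] (w F : E → ℝ) : Prop where
  cont : Continuous F
  wpos : ∀ e, 0 < w e
  bounds : ∃ c C, 0 < c ∧ 0 < C ∧ ∀ e, c * w e ≤ F e ∧ F e ≤ C * w e

/-- The product of a weight with the one-dimensional Gaussian weight. -/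
def wprod {E : Type*} (w : E → ℝ) (p : E × ℝ) : ℝ := w p.1 * gw p.2

namespace Comparable

variable {E : Type*} [TopologicalSpace E] {w F : E → ℝ}

lemma pos (h : Comparable w F) (e : E) : 0 < F e := by
  obtain ⟨c, C, hc, hC, hb⟩ := h.bounds
  exact (mul_pos hc (h.wpos e)).trans_le (hb e).1

lemma integrable_section {F : E × ℝ → ℝ} (h : Comparable (wprod w) F) (e : E) :
    Integrable fun t => F (e, t) := by
  obtain ⟨c, C, hc, hC, hb⟩ := h.bounds
  refine Integrable.mono' ((integrable_gw.const_mul (w e)).const_mul C)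
    (h.cont.comp (by fun_prop)).aestronglyMeasurable (ae_of_all _ fun t => ?_)
  rw [Real.norm_of_nonneg (h.pos _).le]
  exact (hb _).2

lemma marginal [FirstCountableTopology E] {F : E × ℝ → ℝ}
    (hw0 : ∀ e, 0 < w e) (hw1 : ∀ e, w e ≤ 1)
    (h : Comparable (wprod w) F) : Comparable w fun e => ∫ t, F (e, t) := by
  obtain ⟨c, C, hc, hC, hb⟩ := h.bounds
  refine ⟨?_, hw0, c * ∫ t, gw t, C * ∫ t, gw t, mul_pos hc integral_gw_pos,
    mul_pos hC integral_gw_pos, fun e => ⟨?_, ?_⟩⟩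
  · refine continuous_of_dominated (bound := fun t => C * gw t)
      (fun e => (h.cont.comp (by fun_prop)).aestronglyMeasurable)
      (fun e => ae_of_all _ fun t => ?_) (integrable_gw.const_mul C)
      (ae_of_all _ fun t => h.cont.comp (by fun_prop))
    rw [Real.norm_of_nonneg (h.pos _).le]
    refine (hb _).2.trans (mul_le_mul_of_nonneg_left ?_ hC.le)
    exact mul_le_of_le_one_left (gw_pos t).le (hw1 e)
  · have : c * (∫ t, gw t) * w e = ∫ t, c * (w e * gw t) := by
      rw [integral_const_mul, integral_const_mul]; ring
    rw [this]
    exact integral_mono ((integrable_gw.const_mul (w e)).const_mul c) (h.integrable_section e)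
      fun t => (hb (e, t)).1
  · have : C * (∫ t, gw t) * w e = ∫ t, C * (w e * gw t) := by
      rw [integral_const_mul, integral_const_mul]; ring
    rw [this]
    exact integral_mono (h.integrable_section e) ((integrable_gw.const_mul (w e)).const_mul C)
      fun t => (hb (e, t)).2

end Comparable

/-- `G` is continuous, positive, and bounded above and below on `B`. -/
structure BoxDensity {E : Type*} [TopologicalSpace E] (B : Set E) (G : E → ℝ) : Prop where
  cont : Continuous G
  pos : ∀ e, 0 < G e
  bounds : ∃ c C, 0 < c ∧ 0 < C ∧ ∀ e ∈ B, c ≤ G e ∧ G e ≤ C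

lemma BoxDensity.marginal {E : Type*} [TopologicalSpace E] [FirstCountableTopology E]
    {B : Set E} {R : ℝ} (hR : 0 < R) {G : E × ℝ → ℝ}
    (h : BoxDensity (B ×ˢ Set.Ioo (-R) R) G) :
    BoxDensity B fun e => ∫ s in (-R)..R, G (e, s) := by
  obtain ⟨c, C, hc, hC, hb⟩ := h.bounds
  have hi : ∀ e, IntervalIntegrable (fun s => G (e, s)) volume (-R) R := fun e =>
    (h.cont.comp (by fun_prop)).intervalIntegrable _ _
  refine ⟨?_, fun e => ?_, c * (2 * R), C * (2 * R), by positivity, by positivity, fun e he => ?_⟩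
  · exact intervalIntegral.continuous_parametric_intervalIntegral_of_continuous'
      (by exact h.cont) _ _
  · exact intervalIntegral.intervalIntegral_pos_of_pos (hi e) (fun s => h.pos _) (by linarith)
  · constructor
    · have : c * (2 * R) = ∫ s in (-R)..R, c := by
        rw [intervalIntegral.integral_const, smul_eq_mul]; ring
      rw [this]
      exact intervalIntegral.integral_mono_on_of_le_Ioo (by linarith) (by simp) (hi e)
        fun s hs => (hb _ ⟨he, hs⟩).1
    · have : C * (2 * R) = ∫ s in (-R)..R, C := by
        rw [intervalIntegral.integral_const, smul_eq_mul]; ring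
      rw [this]
      exact intervalIntegral.integral_mono_on_of_le_Ioo (by linarith) (hi e) (by simp)
        fun s hs => (hb _ ⟨he, hs⟩).2

lemma knothe_step {E : Type*} [TopologicalSpace E] [MeasurableSpace E] [BorelSpace E]
    [SecondCountableTopology E] {μ : Measure E} [SFinite μ]
    {T : E → E} {w : E → ℝ} {F G : E × ℝ → ℝ} {B : Set E} {R : ℝ} (hR : 0 < R)
    (hw0 : ∀ e, 0 < w e) (hw1 : ∀ e, w e ≤ 1) (hT : Measurable T) (hTB : ∀ e, T e ∈ B)
    (hF : Comparable (wprod w) F) (hG : BoxDensity (B ×ˢ Set.Ioo (-R) R) G)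
    (htr : Transports μ T (fun e => ∫ t, F (e, t)) (fun e => ∫ s in (-R)..R, G (e, s)) B) :
    ∃ τ D : E × ℝ → ℝ, Measurable τ ∧ Measurable D ∧ (∀ p, τ p ∈ Set.Ioo (-R) R) ∧
      (∀ e t, HasDerivAt (fun t => τ (e, t)) (D (e, t)) t) ∧ (∃ C, ∀ p, 0 < D p ∧ D p ≤ C) ∧
      (∀ p, D p = F p * (∫ s in (-R)..R, G (T p.1, s)) /
        ((∫ s, F (p.1, s)) * G (T p.1, τ p))) ∧
      Transports (μ.prod volume) (fun p => (T p.1, τ p)) F G (B ×ˢ Set.Ioo (-R) R) := by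
  have hFm := hF.marginal hw0 hw1
  have hGm := hG.marginal hR
  obtain ⟨τ, h1, h2, h3, h4⟩ := exists_transport_succ hT hF.cont.measurable
    (fun e => hF.cont.comp (by fun_prop)) hF.integrable_section hF.pos hG.cont.measurable
    (fun e => hG.cont.comp (by fun_prop)) hG.pos hR htr
  refine ⟨τ, fun p => F p * (∫ s in (-R)..R, G (T p.1, s)) /
        ((∫ s, F (p.1, s)) * G (T p.1, τ p)), h1, ?_, h2, h3, ?_, fun _ => rfl, h4⟩
  · refine (hF.cont.measurable.mul (hGm.cont.measurable.comp (hT.comp measurable_fst))).div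
      ((hFm.cont.measurable.comp measurable_fst).mul
      (hG.cont.measurable.comp ((hT.comp measurable_fst).prodMk h1)))
  · obtain ⟨c1, C1, hc1, hC1, hb1⟩ := hF.bounds
    obtain ⟨c2, C2, hc2, hC2, hb2⟩ := hFm.bounds
    obtain ⟨c3, C3, hc3, hC3, hb3⟩ := hG.bounds
    obtain ⟨c4, C4, hc4, hC4, hb4⟩ := hGm.bounds
    refine ⟨C1 * C4 / (c2 * c3), fun p => ⟨?_, ?_⟩⟩
    · have a1 := hF.pos p
      have a2 := hGm.pos (T p.1)
      have a3 := hFm.pos p.1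
      have a4 := hG.pos (T p.1, τ p)
      positivity
    · have hwp := hw0 p.1
      have e1 : C1 * C4 / (c2 * c3) = (C1 * w p.1 * C4) / ((c2 * w p.1) * c3) := by
        field_simp
      rw [e1]
      have a1 : F p ≤ C1 * w p.1 := by
        refine (hb1 p).2.trans (mul_le_mul_of_nonneg_left ?_ hC1.le)
        exact mul_le_of_le_one_right hwp.le (gw_le_one _)
      have a2 := (hb4 (T p.1) (hTB _)).2
      have a3 := (hb2 p.1).1
      have a4 := (hb3 (T p.1, τ p) ⟨hTB _, h2 p⟩).1
      have a5 := (hGm.pos (T p.1)).le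
      have a6 := (hFm.pos p.1).le
      refine div_le_div₀ (by positivity) (mul_le_mul a1 a2 a5 (by positivity)) (by positivity)
        (mul_le_mul a3 a4 hc3.le a6)

/-- Four-dimensional space as an iterated product. -/
abbrev Q4 : Type := ((ℝ × ℝ) × ℝ) × ℝ

/-- The coordinate directions of `Q4`. -/
def e4 : Fin 4 → Q4 :=
  ![(((1, 0), 0), 0), (((0, 1), 0), 0), (((0, 0), 1), 0), (((0, 0), 0), 1)]

/-- The open cube in `Q4`. -/
def box4 (R : ℝ) : Set Q4 :=
  ((Set.Ioo (-R) R ×ˢ Set.Ioo (-R) R) ×ˢ Set.Ioo (-R) R) ×ˢ Set.Ioo (-R) R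

/-- The Gaussian weight on `Q4`. -/
def gw4 : Q4 → ℝ := wprod (wprod (wprod gw))

lemma wprod_pos {E : Type*} {w : E → ℝ} (h : ∀ e, 0 < w e) (p : E × ℝ) : 0 < wprod w p :=
  mul_pos (h _) (gw_pos _)

lemma wprod_le_one {E : Type*} {w : E → ℝ} (h1 : ∀ e, w e ≤ 1) (p : E × ℝ) :
    wprod w p ≤ 1 :=
  mul_le_one₀ (h1 _) (gw_pos _).le (gw_le_one _)

lemma knothe_base {R : ℝ} (hR : 0 < R) {F G : ℝ → ℝ} (hF : Comparable gw F)
    (hG : BoxDensity (Set.Ioo (-R) R) G) (hFG : ∫ t, F t = ∫ s in (-R)..R, G s) :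
    ∃ τ D : ℝ → ℝ, Measurable τ ∧ Measurable D ∧ (∀ p, τ p ∈ Set.Ioo (-R) R) ∧
      (∀ t, HasDerivAt τ (D t) t) ∧ (∃ C, ∀ p, 0 < D p ∧ D p ≤ C) ∧
      (∀ p, D p = F p / G (τ p)) ∧
      Transports volume τ F G (Set.Ioo (-R) R) := by
  have hF' : Comparable (wprod fun _ : Unit => (1 : ℝ)) (fun p : Unit × ℝ => F p.2) := by
    obtain ⟨c, C, hc, hC, hb⟩ := hF.bounds
    refine ⟨hF.cont.comp continuous_snd, wprod_pos fun _ => one_pos, c, C, hc, hC, fun e => ?_⟩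
    simpa [wprod] using hb e.2
  have hG' : BoxDensity (Set.univ ×ˢ Set.Ioo (-R) R) (fun p : Unit × ℝ => G p.2) := by
    obtain ⟨c, C, hc, hC, hb⟩ := hG.bounds
    exact ⟨hG.cont.comp continuous_snd, fun e => hG.pos _, c, C, hc, hC, fun e he => hb _ he.2⟩
  have hFpos : 0 < ∫ t, F t :=
    integral_pos_of_integrable_nonneg_nonzero (x := 0) hF.cont (hF'.integrable_section ())
      (fun t => (hF.pos _).le) (hF.pos _).ne'
  obtain ⟨τ, D, h1, h2, h3, h4, ⟨C, h5⟩, h6, h7⟩ := knothe_step (μ := Measure.dirac ())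
    (T := fun e => e) hR (fun _ => one_pos) (fun _ => le_rfl) measurable_id
    (fun _ => Set.mem_univ _) hF' hG' (by
      intro φ hφ
      simp [hFG])
  refine ⟨fun t => τ ((), t), fun t => D ((), t), h1.comp (by fun_prop), h2.comp (by fun_prop),
    fun p => h3 _, fun t => h4 () t, ⟨C, fun p => h5 _⟩, fun p => ?_, ?_⟩
  · simp only [h6]
    rw [← hFG]
    have := (hG.pos (τ ((), p))).ne'
    have := hFpos.ne'
    field_simp
  · intro φ hφ
    have := h7 (fun p => φ p.2) (hφ.comp measurable_snd)
    rw [← Measure.prod_restrict] at this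
    have hm1 : Measurable fun p : Unit × ℝ => φ (τ p) * ENNReal.ofReal (F p.2) :=
      (hφ.comp h1).mul (hF.cont.measurable.comp measurable_snd).ennreal_ofReal
    have hm2 : Measurable fun p : Unit × ℝ => φ p.2 * ENNReal.ofReal (G p.2) :=
      (hφ.comp measurable_snd).mul (hG.cont.measurable.comp measurable_snd).ennreal_ofReal
    rw [lintegral_prod _ hm1.aemeasurable, lintegral_prod _ hm2.aemeasurable] at this
    simpa using this

lemma exists_knothe {R : ℝ} (hR : 0 < R) {F G : Q4 → ℝ} (hF : Comparable gw4 F)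
    (hG : BoxDensity (box4 R) G)
    (hFG : ∫ a, ∫ b, ∫ c, ∫ d, F (((a, b), c), d) =
      ∫ a in (-R)..R, ∫ b in (-R)..R, ∫ c in (-R)..R, ∫ d in (-R)..R, G (((a, b), c), d)) :
    ∃ τ D : Fin 4 → Q4 → ℝ, (∀ i, Measurable (τ i)) ∧ (∀ i, Measurable (D i)) ∧
      (∀ i p, τ i p ∈ Set.Ioo (-R) R) ∧
      (∀ i p, HasLineDerivAt ℝ (τ i) (D i p) p (e4 i)) ∧
      (∃ C, ∀ i p, 0 < D i p ∧ D i p ≤ C) ∧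
      (∀ p, ∏ i, D i p = F p / G (((τ 0 p, τ 1 p), τ 2 p), τ 3 p)) ∧
      Transports volume (fun p => (((τ 0 p, τ 1 p), τ 2 p), τ 3 p)) F G (box4 R) := by
  have p1 := gw_pos
  have p2 := wprod_pos p1
  have p3 := wprod_pos p2
  have l1 := gw_le_one
  have l2 := wprod_le_one l1
  have l3 := wprod_le_one l2
  have F3 := Comparable.marginal p3 l3 hF
  have F2 := Comparable.marginal p2 l2 F3
  have F1 := Comparable.marginal p1 l1 F2
  have G3 := hG.marginal hR
  have G2 := G3.marginal hR
  have G1 := G2.marginal hR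
  have m1 : MeasurableSet (Set.Ioo (-R) R) := measurableSet_Ioo
  have m2 := m1.prod m1
  have m3 := m2.prod m1
  obtain ⟨τ1, D1, mt1, md1, ht1, hd1, ⟨C1, hC1⟩, hD1, tr1⟩ := knothe_base hR F1 G1 hFG
  obtain ⟨τ2, D2, mt2, md2, ht2, hd2, ⟨C2, hC2⟩, hD2, tr2⟩ := knothe_step hR p1 l1 mt1 ht1
    F2 G2 tr1
  have mT2 : Measurable fun p : ℝ × ℝ => (τ1 p.1, τ2 p) := (mt1.comp measurable_fst).prodMk mt2
  have hT2 : ∀ p : ℝ × ℝ, (τ1 p.1, τ2 p) ∈ Set.Ioo (-R) R ×ˢ Set.Ioo (-R) R :=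
    fun p => ⟨ht1 _, ht2 _⟩
  obtain ⟨τ3, D3, mt3, md3, ht3, hd3, ⟨C3, hC3⟩, hD3, tr3⟩ := knothe_step hR p2 l2 mT2 hT2
    F3 G3 tr2
  have mT3 : Measurable fun p : (ℝ × ℝ) × ℝ => ((τ1 p.1.1, τ2 p.1), τ3 p) :=
    (mT2.comp measurable_fst).prodMk mt3
  have hT3 : ∀ p : (ℝ × ℝ) × ℝ, ((τ1 p.1.1, τ2 p.1), τ3 p) ∈
      (Set.Ioo (-R) R ×ˢ Set.Ioo (-R) R) ×ˢ Set.Ioo (-R) R :=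
    fun p => ⟨hT2 _, ht3 _⟩
  obtain ⟨τ4, D4, mt4, md4, ht4, hd4, ⟨C4, hC4⟩, hD4, tr4⟩ := knothe_step hR p3 l3 mT3 hT3
    hF hG tr3
  refine ⟨![fun p => τ1 p.1.1.1, fun p => τ2 p.1.1, fun p => τ3 p.1, τ4],
    ![fun p => D1 p.1.1.1, fun p => D2 p.1.1, fun p => D3 p.1, D4], ?_, ?_, ?_, ?_, ?_, ?_, tr4⟩
  · intro i
    fin_cases i
    · exact mt1.comp (by fun_prop)
    · exact mt2.comp (by fun_prop)
    · exact mt3.comp (by fun_prop)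
    · exact mt4
  · intro i
    fin_cases i
    · exact md1.comp (by fun_prop)
    · exact md2.comp (by fun_prop)
    · exact md3.comp (by fun_prop)
    · exact md4
  · intro i p
    fin_cases i
    · exact ht1 _
    · exact ht2 _
    · exact ht3 _
    · exact ht4 _
  · rintro i ⟨⟨⟨a, b⟩, c⟩, d⟩
    fin_cases i
    · have := (hd1 (a + 0)).comp_const_add a 0
      simpa [HasLineDerivAt, e4] using this
    · have := (hd2 a (b + 0)).comp_const_add b 0
      simpa [HasLineDerivAt, e4] using this
    · have := (hd3 (a, b) (c + 0)).comp_const_add c 0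
      simpa [HasLineDerivAt, e4] using this
    · have := (hd4 ((a, b), c) (d + 0)).comp_const_add d 0
      simpa [HasLineDerivAt, e4] using this
  · refine ⟨max (max C1 C2) (max C3 C4), fun i p => ?_⟩
    fin_cases i
    · exact ⟨(hC1 _).1, (hC1 _).2.trans (by simp)⟩
    · exact ⟨(hC2 _).1, (hC2 _).2.trans (by simp)⟩
    · exact ⟨(hC3 _).1, (hC3 _).2.trans (by simp)⟩
    · exact ⟨(hC4 _).1, (hC4 _).2.trans (by simp)⟩
  · intro p
    rw [Fin.prod_univ_four]
    simp only [Matrix.cons_val]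
    rw [hD1, hD2, hD3, hD4]
    have a1 := (F1.pos p.1.1.1).ne'
    have a2 := (F2.pos p.1.1).ne'
    have a3 := (F3.pos p.1).ne'
    have b1 := (G1.pos (τ1 p.1.1.1)).ne'
    have b2 := (G2.pos (τ1 p.1.1.1, τ2 p.1.1)).ne'
    have b3 := (G3.pos ((τ1 p.1.1.1, τ2 p.1.1), τ3 p.1)).ne'
    have b4 := (hG.pos (((τ1 p.1.1.1, τ2 p.1.1), τ3 p.1), τ4 p)).ne'
    field_simp

/-- The squared Euclidean norm on `Q4`. -/
def q4 (p : Q4) : ℝ := p.1.1.1 ^ 2 + p.1.1.2 ^ 2 + p.1.2 ^ 2 + p.2 ^ 2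

lemma q4_nonneg (p : Q4) : 0 ≤ q4 p := by unfold q4; positivity

lemma continuous_q4 : Continuous q4 := by unfold q4; fun_prop

/-- The Aubin–Talenti profile on `Q4`. -/
def tal (p : Q4) : ℝ := 1 / (1 + q4 p)

lemma tal_pos (p : Q4) : 0 < tal p := by
  have := q4_nonneg p
  unfold tal; positivity

lemma tal_le_one (p : Q4) : tal p ≤ 1 := by
  have := q4_nonneg p
  unfold tal
  rw [div_le_one (by linarith)]
  linarith

lemma continuous_tal : Continuous tal :=
  continuous_const.div (continuous_const.add continuous_q4) fun p =>
    (by have := q4_nonneg p; positivity)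

lemma tal_mul (p : Q4) : tal p * (1 + q4 p) = 1 := by
  have := q4_nonneg p
  unfold tal
  field_simp

lemma measurableSet_box4 (R : ℝ) : MeasurableSet (box4 R) :=
  ((measurableSet_Ioo.prod measurableSet_Ioo).prod measurableSet_Ioo).prod measurableSet_Ioo

lemma q4_le_of_mem_box4 {R : ℝ} {p : Q4} (hp : p ∈ box4 R) : q4 p ≤ 4 * R ^ 2 := by
  have h : ∀ x ∈ Set.Ioo (-R) R, x ^ 2 ≤ R ^ 2 := fun x hx =>
    sq_le_sq' hx.1.le hx.2.le
  have h1 := h _ hp.1.1.1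
  have h2 := h _ hp.1.1.2
  have h3 := h _ hp.1.2
  have h4 := h _ hp.2
  unfold q4
  linarith

lemma integrableOn_box4 {f : Q4 → ℝ} (hf : Continuous f) (R : ℝ) : IntegrableOn f (box4 R) := by
  have : box4 R ⊆ Metric.closedBall 0 R := by
    intro p hp
    rw [mem_closedBall_zero_iff]
    have h : ∀ x ∈ Set.Ioo (-R) R, ‖x‖ ≤ R := fun x hx => abs_le.2 ⟨hx.1.le, hx.2.le⟩
    exact max_le (max_le (max_le (h _ hp.1.1.1) (h _ hp.1.1.2)) (h _ hp.1.2)) (h _ hp.2)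
  exact (hf.continuousOn.integrableOn_compact (isCompact_closedBall 0 R)).mono_set this

lemma le_quarter_sum_of_pow_four_eq {x a b c d : ℝ} (ha : 0 ≤ a) (hb : 0 ≤ b)
    (hc : 0 ≤ c) (hd : 0 ≤ d) (h : x ^ 4 = a * b * c * d) : x ≤ (a + b + c + d) / 4 := by
  have h1 : 4 * (a * b) ≤ (a + b) ^ 2 := by nlinarith [sq_nonneg (a - b)]
  have h2 : 4 * (c * d) ≤ (c + d) ^ 2 := by nlinarith [sq_nonneg (c - d)]
  have h3 : 4 * ((a + b) * (c + d)) ≤ (a + b + c + d) ^ 2 := by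
    nlinarith [sq_nonneg (a + b - c - d)]
  have h4 : (4 * (a * b)) * (4 * (c * d)) ≤ (a + b) ^ 2 * (c + d) ^ 2 :=
    mul_le_mul h1 h2 (by positivity) (by positivity)
  have h5 : (4 * ((a + b) * (c + d))) ^ 2 ≤ ((a + b + c + d) ^ 2) ^ 2 :=
    pow_le_pow_left₀ (by positivity) h3 2
  have h6 : x ^ 4 ≤ ((a + b + c + d) / 4) ^ 4 := by
    rw [h]; nlinarith
  exact le_of_pow_le_pow_left₀ (by norm_num) (by positivity) h6

lemma integral_Q4 {f : Q4 → ℝ} (hf : Integrable f) :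
    ∫ p, f p = ∫ a, ∫ b, ∫ c, ∫ d, f (((a, b), c), d) := by
  have h1 : Integrable f ((volume : Measure ((ℝ × ℝ) × ℝ)).prod volume) := hf
  have h2 : Integrable _ ((volume : Measure (ℝ × ℝ)).prod (volume : Measure ℝ)) :=
    h1.integral_prod_left
  have h3 : Integrable _ ((volume : Measure ℝ).prod (volume : Measure ℝ)) := h2.integral_prod_left
  calc ∫ p, f p = ∫ p, f p ∂((volume : Measure ((ℝ × ℝ) × ℝ)).prod volume) := rfl
    _ = _ := integral_prod _ h1
    _ = _ := integral_prod _ h2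
    _ = _ := integral_prod _ h3

lemma setIntegral_box4 {f : Q4 → ℝ} {R : ℝ} (hR : 0 < R) (hf : Continuous f) :
    ∫ p in box4 R, f p =
      ∫ a in (-R)..R, ∫ b in (-R)..R, ∫ c in (-R)..R, ∫ d in (-R)..R, f (((a, b), c), d) := by
  have hR' : -R ≤ R := by linarith
  simp only [intervalIntegral.integral_of_le hR', integral_Ioc_eq_integral_Ioo]
  have h1 := integrableOn_box4 hf R
  unfold box4 at h1 ⊢
  rw [IntegrableOn, Measure.volume_eq_prod, ← Measure.prod_restrict] at h1
  have h2 := h1.integral_prod_left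
  rw [Measure.volume_eq_prod, ← Measure.prod_restrict] at h2
  have h3 := h2.integral_prod_left
  rw [Measure.volume_eq_prod, ← Measure.prod_restrict] at h3
  rw [Measure.volume_eq_prod, ← Measure.prod_restrict, integral_prod _ h1,
    Measure.volume_eq_prod, ← Measure.prod_restrict, integral_prod _ h2,
    Measure.volume_eq_prod, ← Measure.prod_restrict, integral_prod _ h3]

instance isAddHaarMeasure_R2 : (volume : Measure (ℝ × ℝ)).IsAddHaarMeasure := by
  rw [Measure.volume_eq_prod]; infer_instance

instance isAddHaarMeasure_R3 : (volume : Measure ((ℝ × ℝ) × ℝ)).IsAddHaarMeasure := by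
  rw [Measure.volume_eq_prod]; infer_instance

instance isAddHaarMeasure_Q4 : (volume : Measure Q4).IsAddHaarMeasure := by
  rw [Measure.volume_eq_prod]; infer_instance

lemma sq_le_of_young {k a b A : ℝ} (hk : 0 < k) (ha : 0 < a) (hb : 0 ≤ b) (hA : 0 ≤ A)
    (h : ∀ s, 0 < s → k ^ 4 * a ≤ 3 * k / 4 * (s / 2 * (k ^ 4 * b) + 1 / (2 * s) * A)) :
    k ^ 2 * a ^ 2 ≤ 9 / 16 * b * A := by
  rcases hb.eq_or_lt with rfl | hb
  · exfalso
    have h' := h ((A + 1) / (k ^ 3 * a)) (by positivity)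
    have e : 3 * k / 4 * ((A + 1) / (k ^ 3 * a) / 2 * (k ^ 4 * 0)
        + 1 / (2 * ((A + 1) / (k ^ 3 * a))) * A)
        = (k ^ 4 * a) * (3 / 8 * (A / (A + 1))) := by field_simp; ring
    rw [e] at h'
    have h1 : A / (A + 1) ≤ 1 := by rw [div_le_one (by linarith)]; linarith
    have : 0 < k ^ 4 * a := by positivity
    nlinarith
  · have h' := h (4 * a / (3 * b * k)) (by positivity)
    have e : 3 * k / 4 *
        (4 * a / (3 * b * k) / 2 * (k ^ 4 * b) + 1 / (2 * (4 * a / (3 * b * k))) * A)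
        = k ^ 4 * a / 2 + 9 / 32 * (b * k ^ 2 * A / a) := by
      field_simp
      ring
    rw [e] at h'
    have h2 : k ^ 4 * a ^ 2 ≤ 9 / 16 * (b * k ^ 2 * A) := by
      have h3 := mul_le_mul_of_nonneg_right h' ha.le
      have e2 : (k ^ 4 * a / 2 + 9 / 32 * (b * k ^ 2 * A / a)) * a
          = k ^ 4 * a ^ 2 / 2 + 9 / 32 * (b * k ^ 2 * A) := by field_simp
      rw [e2] at h3
      nlinarith
    have hk2' : 0 < k ^ 2 := by positivity
    refine le_of_mul_le_mul_left ?_ hk2'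
    nlinarith

set_option maxHeartbeats 1000000 in
lemma knothe_inequality {f : Q4 → ℝ} (hd : Differentiable ℝ f) (hpos : ∀ p, 0 < f p)
    (hc : Comparable gw4 fun p => f p ^ 4) (h4 : Integrable fun p => f p ^ 4)
    (h3 : Integrable fun p => f p ^ 3)
    (hg : ∀ i, Integrable fun p => (fderiv ℝ f p (e4 i)) ^ 2) {R : ℝ} (hR : 0 < R) :
    √(∫ p, f p ^ 4) * (∫ p in box4 R, tal p ^ 3) ^ 2
      ≤ 9 / 16 * (∫ p in box4 R, q4 p * tal p ^ 4) * √(∫ p in box4 R, tal p ^ 4)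
        * ∫ p, ∑ i, (fderiv ℝ f p (e4 i)) ^ 2 := by
  have hbpos : 0 < volume (box4 R) := by
    have : IsOpen (box4 R) := ((isOpen_Ioo.prod isOpen_Ioo).prod isOpen_Ioo).prod isOpen_Ioo
    exact this.measure_pos _ ⟨0, by simp [box4, hR]⟩
  have ipos : ∀ {h : Q4 → ℝ}, Continuous h → (∀ p, 0 < h p) → 0 < ∫ p in box4 R, h p := by
    intro h hh hp
    rw [setIntegral_pos_iff_support_of_nonneg_ae (ae_of_all _ fun t => (hp t).le)
      (integrableOn_box4 hh R)]
    have : Function.support h = Set.univ := by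
      ext t; simp [(hp t).ne']
    simpa [this] using hbpos
  have ct := continuous_tal
  have cq := continuous_q4
  set N := ∫ p, f p ^ 4 with hN
  set J := ∫ p in box4 R, tal p ^ 4 with hJ
  set a := ∫ p in box4 R, tal p ^ 3 with ha
  set b := ∫ p in box4 R, q4 p * tal p ^ 4 with hb
  set A := ∫ p, ∑ i, (fderiv ℝ f p (e4 i)) ^ 2 with hA
  have hJpos : 0 < J := ipos (by fun_prop) fun p => pow_pos (tal_pos p) 4
  have hapos : 0 < a := ipos (by fun_prop) fun p => pow_pos (tal_pos p) 3
  have hNpos : 0 < N := integral_pos_of_integrable_nonneg_nonzero (x := 0)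
    (hd.continuous.pow 4) h4 (fun p => (pow_pos (hpos p) 4).le) (pow_pos (hpos 0) 4).ne'
  have hbpos : 0 ≤ b := integral_nonneg fun p => mul_nonneg (q4_nonneg p) (pow_pos (tal_pos p) 4).le
  set k := √(√(N / J)) with hk
  have hkpos : 0 < k := Real.sqrt_pos.2 (Real.sqrt_pos.2 (div_pos hNpos hJpos))
  have hk2 : k ^ 2 = √(N / J) := Real.sq_sqrt (Real.sqrt_nonneg _)
  have hk4 : k ^ 4 = N / J := by
    rw [show k ^ 4 = (k ^ 2) ^ 2 by ring, hk2, Real.sq_sqrt (div_pos hNpos hJpos).le]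
  have hG : BoxDensity (box4 R) fun p => k ^ 4 * tal p ^ 4 := by
    refine ⟨by fun_prop, fun p => mul_pos (by positivity) (pow_pos (tal_pos p) 4),
      k ^ 4 * (1 / (1 + 4 * R ^ 2)) ^ 4, k ^ 4, by positivity, by positivity, fun p hp => ⟨?_, ?_⟩⟩
    · gcongr
      unfold tal
      have := q4_nonneg p
      exact one_div_le_one_div_of_le (by positivity) (by linarith [q4_le_of_mem_box4 hp])
    · exact mul_le_of_le_one_right (by positivity) (pow_le_one₀ (tal_pos p).le (tal_le_one p))
  obtain ⟨τ, D, mτ, mD, hτ, hD, ⟨C, hDC⟩, hprod, htr⟩ := exists_knothe hR hc hG (by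
    refine (integral_Q4 h4).symm.trans (Eq.trans ?_
      (setIntegral_box4 (f := fun p => k ^ 4 * tal p ^ 4) hR (by fun_prop)))
    rw [integral_const_mul, hk4, ← hN, ← hJ]
    field_simp)
  have hτ' : ∀ i p, |τ i p| ≤ R := fun i p => abs_le.2 ⟨(hτ i p).1.le, (hτ i p).2.le⟩
  set T : Q4 → Q4 := fun p => (((τ 0 p, τ 1 p), τ 2 p), τ 3 p) with hT
  have mT : Measurable T := (((mτ 0).prodMk (mτ 1)).prodMk (mτ 2)).prodMk (mτ 3)
  have hTq : ∀ p, q4 (T p) = ∑ i, τ i p ^ 2 := by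
    intro p
    rw [Fin.sum_univ_four]
    rfl
  have hTb : ∀ p, T p ∈ box4 R := fun p => ⟨⟨⟨hτ 0 p, hτ 1 p⟩, hτ 2 p⟩, hτ 3 p⟩
  -- the transport identity for nonnegative continuous functions
  have tr : ∀ h : Q4 → ℝ, Continuous h → (∀ p, 0 ≤ h p) →
      ∫ p, h (T p) * f p ^ 4 = ∫ p in box4 R, h p * (k ^ 4 * tal p ^ 4) := by
    intro h hh hnn
    have m1 : Measurable fun p => h (T p) := hh.measurable.comp mT
    rw [integral_eq_lintegral_of_nonneg_ae
      (ae_of_all _ fun p => mul_nonneg (hnn _) (pow_pos (hpos p) 4).le)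
      (m1.mul (hd.continuous.pow 4).measurable).aestronglyMeasurable,
      integral_eq_lintegral_of_nonneg_ae
      (ae_of_all _ fun p => mul_nonneg (hnn _)
        (mul_nonneg (by positivity) (pow_pos (tal_pos p) 4).le))
      (Continuous.aestronglyMeasurable (by fun_prop))]
    have := htr (fun p => ENNReal.ofReal (h p)) hh.measurable.ennreal_ofReal
    congr 1
    simp only [ENNReal.ofReal_mul (hnn _)]
    exact this
  have tr1 : ∫ p, (1 + q4 (T p)) * f p ^ 4 = k ^ 4 * a := by
    rw [tr (fun p => 1 + q4 p) (by fun_prop) fun p => (by have := q4_nonneg p; positivity), ha,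
      ← integral_const_mul]
    refine integral_congr_ae (ae_of_all _ fun p => ?_)
    simp only
    linear_combination k ^ 4 * tal p ^ 3 * tal_mul p
  have tr2 : ∫ p, q4 (T p) * f p ^ 4 = k ^ 4 * b := by
    rw [tr q4 cq q4_nonneg, hb, ← integral_const_mul]
    exact integral_congr_ae (ae_of_all _ fun p => by ring)
  have hqm : Measurable fun p => q4 (T p) := cq.measurable.comp mT
  have hq4 : Integrable fun p => q4 (T p) * f p ^ 4 := by
    refine (h4.bdd_mul (c := 4 * R ^ 2) hqm.aestronglyMeasurable (ae_of_all _ fun p => ?_))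
    rw [Real.norm_of_nonneg (q4_nonneg _)]
    exact q4_le_of_mem_box4 (hTb p)
  have h1q4 : Integrable fun p => (1 + q4 (T p)) * f p ^ 4 := by
    exact (h4.add hq4).congr (ae_of_all _ fun p => by simp only [Pi.add_apply]; ring)
  have hDi : ∀ i, Integrable fun p => D i p * f p ^ 3 := fun i => by
    refine (h3.bdd_mul (c := C) (mD i).aestronglyMeasurable (ae_of_all _ fun p => ?_))
    rw [Real.norm_of_nonneg (hDC i p).1.le]
    exact (hDC i p).2
  have mfd : ∀ i, Measurable fun p => fderiv ℝ f p (e4 i) := fun i =>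
    measurable_fderiv_apply_const ℝ f (e4 i)
  have hfd : ∀ i, Integrable fun p => f p ^ 2 * fderiv ℝ f p (e4 i) := fun i => by
    refine Integrable.mono' (h4.add (hg i))
      ((hd.continuous.pow 2).measurable.mul (mfd i)).aestronglyMeasurable (ae_of_all _ fun p => ?_)
    rw [Real.norm_eq_abs, abs_le]
    simp only [Pi.add_apply]
    constructor <;> nlinarith [sq_nonneg (f p ^ 2 - fderiv ℝ f p (e4 i)),
      sq_nonneg (f p ^ 2 + fderiv ℝ f p (e4 i))]
  have hτfd : ∀ i, Integrable fun p => τ i p * (3 * (f p ^ 2 * fderiv ℝ f p (e4 i))) := fun i =>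
    ((hfd i).const_mul 3).bdd_mul (c := R) (mτ i).aestronglyMeasurable
      (ae_of_all _ fun p => hτ' i p)
  have ibp : ∀ i, ∫ p, D i p * f p ^ 3
      = - ∫ p, τ i p * (3 * (f p ^ 2 * fderiv ℝ f p (e4 i))) := by
    intro i
    have := integral_bilinear_hasLineDerivAt_right_eq_neg_left_of_integrable
      (μ := (volume : Measure Q4)) (B := ContinuousLinearMap.mul ℝ ℝ) (f := τ i) (f' := D i)
      (g := fun p => f p ^ 3) (g' := fun p => 3 * (f p ^ 2 * fderiv ℝ f p (e4 i))) (v := e4 i)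
      (by simpa using hDi i) (by simpa using hτfd i)
      (by
        simpa using h3.bdd_mul (c := R) (mτ i).aestronglyMeasurable
          (ae_of_all _ fun p => hτ' i p))
      (fun p _ => hD i p) (fun p _ => by
        have := (((hd p).hasFDerivAt).pow 3).hasLineDerivAt (e4 i)
        convert this using 1
        simp [mul_assoc])
    simp only [ContinuousLinearMap.mul_apply'] at this
    linarith
  have hsumA : Integrable fun p => ∑ i, (fderiv ℝ f p (e4 i)) ^ 2 :=
    integrable_finsetSum _ fun i _ => hg i
  -- arithmetic-geometric mean inequality
  have amgm : ∀ p, (1 + q4 (T p)) * f p ^ 4 ≤ k / 4 * ∑ i, D i p * f p ^ 3 := by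
    intro p
    have ht := tal_pos (T p)
    have hfp := hpos p
    have h := hprod p
    rw [Fin.prod_univ_four] at h
    have : f p / (k * tal (T p)) ≤ (D 0 p + D 1 p + D 2 p + D 3 p) / 4 := by
      refine le_quarter_sum_of_pow_four_eq (hDC 0 p).1.le (hDC 1 p).1.le (hDC 2 p).1.le
        (hDC 3 p).1.le ?_
      rw [h, div_pow, mul_pow]
    have e1 : f p / (k * tal (T p)) = (1 + q4 (T p)) * f p / k := by
      have := tal_mul (T p)
      field_simp
      linear_combination -this
    rw [e1, div_le_iff₀ hkpos] at this
    rw [Fin.sum_univ_four]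
    have h3 := mul_le_mul_of_nonneg_right this (pow_pos hfp 3).le
    nlinarith
  have step1 : k ^ 4 * a ≤ -(3 * k / 4) * ∫ p, ∑ i, τ i p * (f p ^ 2 * fderiv ℝ f p (e4 i)) := by
    have hFG : ∫ p, ∑ i, D i p * f p ^ 3
        = - (3 * ∫ p, ∑ i, τ i p * (f p ^ 2 * fderiv ℝ f p (e4 i))) := by
      rw [integral_finsetSum _ fun i _ => hDi i, ← integral_const_mul]
      simp_rw [Finset.mul_sum, ibp]
      rw [integral_finsetSum, ← Finset.sum_neg_distrib]
      · refine Finset.sum_congr rfl fun i _ => ?_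
        congr 1
        exact integral_congr_ae (ae_of_all _ fun p => by ring)
      · intro i _
        refine (hτfd i).congr (ae_of_all _ fun p => by ring)
    calc k ^ 4 * a = ∫ p, (1 + q4 (T p)) * f p ^ 4 := tr1.symm
      _ ≤ ∫ p, k / 4 * ∑ i, D i p * f p ^ 3 :=
        integral_mono h1q4 ((integrable_finsetSum _ fun i _ => hDi i).const_mul _) amgm
      _ = _ := by rw [integral_const_mul, hFG]; ring
  -- Young's inequality
  have step2 : ∀ s, 0 < s → -∫ p, ∑ i, τ i p * (f p ^ 2 * fderiv ℝ f p (e4 i))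
      ≤ s / 2 * (k ^ 4 * b) + 1 / (2 * s) * A := by
    intro s hs
    rw [← integral_neg, ← tr2, hA, ← integral_const_mul, ← integral_const_mul,
      ← integral_add (hq4.const_mul _) (hsumA.const_mul _)]
    refine integral_mono ?_ ((hq4.const_mul _).add (hsumA.const_mul _)) fun p => ?_
    · refine (integrable_finsetSum _ fun i _ => ?_).neg
      exact (hfd i).bdd_mul (c := R) (mτ i).aestronglyMeasurable (ae_of_all _ fun p => hτ' i p)
    · rw [hTq, Finset.sum_mul, Finset.mul_sum, Finset.mul_sum, ← Finset.sum_add_distrib,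
        ← Finset.sum_neg_distrib]
      refine Finset.sum_le_sum fun i _ => ?_
      have : s / 2 * (τ i p ^ 2 * f p ^ 4) + 1 / (2 * s) * fderiv ℝ f p (e4 i) ^ 2
          + τ i p * (f p ^ 2 * fderiv ℝ f p (e4 i))
          = 1 / (2 * s) * (s * τ i p * f p ^ 2 + fderiv ℝ f p (e4 i)) ^ 2 := by
        field_simp
        ring
      have h0 : 0 ≤ 1 / (2 * s) * (s * τ i p * f p ^ 2 + fderiv ℝ f p (e4 i)) ^ 2 := by positivity
      linarith
  have key : k ^ 2 * a ^ 2 ≤ 9 / 16 * b * A :=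
    sq_le_of_young hkpos hapos hbpos
      (integral_nonneg fun p => Finset.sum_nonneg fun i _ => sq_nonneg _) fun s hs =>
      step1.trans (by nlinarith [mul_le_mul_of_nonneg_left (step2 s hs) hkpos.le])
  rw [hk2, Real.sqrt_div' _ hJpos.le] at key
  have hsJ : 0 < √J := Real.sqrt_pos.2 hJpos
  rw [div_mul_eq_mul_div, div_le_iff₀ hsJ] at key
  linarith

/-- The Gaussian `exp (-|p|²)` on `Q4`. -/
def gau (p : Q4) : ℝ := Real.exp (-q4 p)

lemma gau_pos (p : Q4) : 0 < gau p := Real.exp_pos _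

lemma integrable_exp_neg_mul_q4 {c : ℝ} (hc : 0 < c) :
    Integrable fun p : Q4 => Real.exp (-c * q4 p) := by
  have h := integrable_exp_neg_mul_sq hc
  have h2 := (h.mul_prod h).mul_prod h
  have h3 := h2.mul_prod h
  refine h3.congr (ae_of_all _ fun p => ?_)
  simp only [← Real.exp_add]
  congr 1
  unfold q4
  ring

lemma hasFDerivAt_q4_apply (p : Q4) : DifferentiableAt ℝ q4 p := by
  unfold q4; fun_prop

lemma contDiff_q4 : ContDiff ℝ 1 q4 := by unfold q4; fun_prop

lemma contDiff_gau : ContDiff ℝ 1 gau := by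
  unfold gau; exact contDiff_q4.neg.exp

/-- The coordinates on `Q4`. -/
def co4 : Fin 4 → Q4 → ℝ := ![fun p => p.1.1.1, fun p => p.1.1.2, fun p => p.1.2, fun p => p.2]

lemma fderiv_q4 (p : Q4) (i : Fin 4) : fderiv ℝ q4 p (e4 i) = 2 * co4 i p := by
  have h0 := hasFDerivAt_id (𝕜 := ℝ) p
  have h1 := h0.fst.fst.fst
  have h2 := h0.fst.fst.snd
  have h3 := h0.fst.snd
  have h4 := h0.snd
  have h : HasFDerivAt q4 _ p := (((h1.pow 2).add (h2.pow 2)).add (h3.pow 2)).add (h4.pow 2)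
  rw [h.fderiv]
  fin_cases i <;> simp [e4, co4]

lemma co4_sq_le (i : Fin 4) (p : Q4) : co4 i p ^ 2 ≤ q4 p := by
  unfold q4
  fin_cases i <;> simp [co4] <;> nlinarith [sq_nonneg p.1.1.1, sq_nonneg p.1.1.2,
    sq_nonneg p.1.2, sq_nonneg p.2]

lemma fderiv_gau (p : Q4) (i : Fin 4) : fderiv ℝ gau p (e4 i) = -(2 * co4 i p) * gau p := by
  have h : HasFDerivAt gau _ p := (hasFDerivAt_q4_apply p).hasFDerivAt.neg.exp
  rw [h.fderiv]
  simp only [_root_.smul_apply, _root_.neg_apply, fderiv_q4, smul_eq_mul,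
    Pi.neg_apply]
  unfold gau
  ring

lemma gau_pow_four (p : Q4) : gau p ^ 4 = gw4 p := by
  simp only [gau, gw4, wprod, gw]
  rw [← Real.exp_nat_mul, ← Real.exp_add, ← Real.exp_add, ← Real.exp_add]
  congr 1
  unfold q4
  push_cast
  ring

lemma integrable_fderiv_gau_sq (i : Fin 4) :
    Integrable fun p => (fderiv ℝ gau p (e4 i)) ^ 2 := by
  refine Integrable.mono' ((integrable_exp_neg_mul_q4 one_pos).const_mul 4)
    (((measurable_fderiv_apply_const ℝ gau (e4 i)).pow_const 2).aestronglyMeasurable)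
    (ae_of_all _ fun p => ?_)
  rw [Real.norm_of_nonneg (sq_nonneg _), fderiv_gau]
  have h1 := co4_sq_le i p
  have h2 : q4 p * gau p ≤ 1 := by
    unfold gau
    rw [Real.exp_neg, ← div_eq_mul_inv, div_le_one (Real.exp_pos _)]
    linarith [Real.add_one_le_exp (q4 p)]
  have h3 : Real.exp (-1 * q4 p) = gau p := by unfold gau; ring_nf
  rw [h3]
  have := gau_pos p
  calc (-(2 * co4 i p) * gau p) ^ 2 = 4 * (co4 i p ^ 2 * gau p) * gau p := by ring
    _ ≤ 4 * (q4 p * gau p) * gau p := by gcongr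
    _ ≤ 4 * 1 * gau p := by gcongr
    _ = _ := by ring

/-- Regularised modulus: `√(f² + δ² gau²)`. -/
def regmod (f : Q4 → ℝ) (δ : ℝ) (p : Q4) : ℝ := √(f p ^ 2 + δ ^ 2 * gau p ^ 2)

lemma box_sobolev {f : Q4 → ℝ} (hf : ContDiff ℝ 1 f) (hs : HasCompactSupport f)
    {R : ℝ} (hR : 0 < R) :
    √(∫ p, f p ^ 4) * (∫ p in box4 R, tal p ^ 3) ^ 2
      ≤ 9 / 16 * (∫ p in box4 R, q4 p * tal p ^ 4) * √(∫ p in box4 R, tal p ^ 4)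
        * ∫ p, ∑ i, (fderiv ℝ f p (e4 i)) ^ 2 := by
  have hfi : ∀ i, Integrable fun p => (fderiv ℝ f p (e4 i)) ^ 2 := by
    intro i
    have h1 : Continuous fun p => fderiv ℝ f p (e4 i) :=
      (hf.continuous_fderiv one_ne_zero).clm_apply continuous_const
    refine (h1.pow 2).integrable_of_hasCompactSupport ?_
    refine (hs.fderiv (𝕜 := ℝ)).mono ?_
    intro p hp
    simp only [Function.mem_support] at hp ⊢
    intro h0
    simp [h0] at hp
  have hgi := integrable_fderiv_gau_sq
  -- a bound `|f| ≤ C gau`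
  obtain ⟨C, hC0, hC⟩ : ∃ C, 0 < C ∧ ∀ p, f p ^ 2 ≤ C ^ 2 * gau p ^ 2 := by
    have hcont : Continuous fun p => f p / gau p :=
      hf.continuous.div contDiff_gau.continuous fun p => (gau_pos p).ne'
    have hsupp : HasCompactSupport fun p => f p / gau p := by
      refine hs.mono fun p hp => ?_
      simp only [Function.mem_support] at hp ⊢
      intro h0
      simp [h0] at hp
    obtain ⟨C, hC⟩ := hsupp.exists_bound_of_continuous hcont
    refine ⟨|C| + 1, by positivity, fun p => ?_⟩
    have h1 := (hC p).trans (le_abs_self C)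
    rw [norm_div, Real.norm_of_nonneg (gau_pos p).le, div_le_iff₀ (gau_pos p)] at h1
    rw [← mul_pow, ← sq_abs (f p)]
    refine pow_le_pow_left₀ (abs_nonneg _) ?_ 2
    rw [Real.norm_eq_abs] at h1
    nlinarith [gau_pos p]
  have main : ∀ δ : ℝ, 0 < δ → √(∫ p, f p ^ 4) * (∫ p in box4 R, tal p ^ 3) ^ 2
      ≤ 9 / 16 * (∫ p in box4 R, q4 p * tal p ^ 4) * √(∫ p in box4 R, tal p ^ 4)
        * ((∫ p, ∑ i, (fderiv ℝ f p (e4 i)) ^ 2)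
          + δ ^ 2 * ∫ p, ∑ i, (fderiv ℝ gau p (e4 i)) ^ 2) := by
    intro δ hδ
    set g := regmod f δ with hg
    have hrad : ∀ p, 0 < f p ^ 2 + δ ^ 2 * gau p ^ 2 := fun p => by
      have := gau_pos p
      positivity
    have hgpos : ∀ p, 0 < g p := fun p => Real.sqrt_pos.2 (hrad p)
    have hgsq : ∀ p, g p ^ 2 = f p ^ 2 + δ ^ 2 * gau p ^ 2 := fun p => Real.sq_sqrt (hrad p).le
    have hgub : ∀ p, g p ^ 2 ≤ (C ^ 2 + δ ^ 2) * gau p ^ 2 := fun p => by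
      rw [hgsq, add_mul]; linarith [hC p]
    have hdg : Differentiable ℝ g := fun p => by
      refine DifferentiableAt.sqrt ?_ (hrad p).ne'
      have h1 := (hf.differentiable one_ne_zero) p
      have h2 := (contDiff_gau.differentiable one_ne_zero) p
      fun_prop
    have hfg : ∀ p i, g p * fderiv ℝ g p (e4 i)
        = f p * fderiv ℝ f p (e4 i) + δ ^ 2 * (gau p * fderiv ℝ gau p (e4 i)) := by
      intro p i
      have h1 : HasFDerivAt (fun p => g p ^ 2) _ p := (hdg p).hasFDerivAt.pow 2
      have h2 : HasFDerivAt (fun p => f p ^ 2 + δ ^ 2 * gau p ^ 2) _ p :=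
        ((hf.differentiable one_ne_zero p).hasFDerivAt.pow 2).add
          (((contDiff_gau.differentiable one_ne_zero p).hasFDerivAt.pow 2).const_mul (δ ^ 2))
      have h3 : (fun p => g p ^ 2) = fun p => f p ^ 2 + δ ^ 2 * gau p ^ 2 := funext hgsq
      rw [h3] at h1
      have := congrArg (fun L => L (e4 i)) (h1.unique h2)
      simp at this
      linarith
    have hfgsq : ∀ p i, (fderiv ℝ g p (e4 i)) ^ 2
        ≤ (fderiv ℝ f p (e4 i)) ^ 2 + δ ^ 2 * (fderiv ℝ gau p (e4 i)) ^ 2 := by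
      intro p i
      have h1 := hfg p i
      have h2 : g p ^ 2 * (fderiv ℝ g p (e4 i)) ^ 2
          ≤ g p ^ 2 * ((fderiv ℝ f p (e4 i)) ^ 2 + δ ^ 2 * (fderiv ℝ gau p (e4 i)) ^ 2) := by
        rw [← mul_pow, h1, hgsq]
        nlinarith [sq_nonneg (δ * (f p * fderiv ℝ gau p (e4 i) - gau p * fderiv ℝ f p (e4 i)))]
      exact le_of_mul_le_mul_left h2 (pow_pos (hgpos p) 2)
    have hgint : ∀ i, Integrable fun p => (fderiv ℝ g p (e4 i)) ^ 2 := fun i => by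
      refine Integrable.mono' ((hfi i).add ((hgi i).const_mul (δ ^ 2)))
        (((measurable_fderiv_apply_const ℝ g (e4 i)).pow_const 2).aestronglyMeasurable)
        (ae_of_all _ fun p => ?_)
      rw [Real.norm_of_nonneg (sq_nonneg _)]
      exact hfgsq p i
    set C' := √(C ^ 2 + δ ^ 2) with hC'
    have hC'pos : 0 < C' := Real.sqrt_pos.2 (by positivity)
    have hgle : ∀ p, g p ≤ C' * gau p := fun p => by
      refine (sq_le_sq₀ (hgpos p).le (mul_nonneg hC'pos.le (gau_pos p).le)).1 ?_
      rw [mul_pow, hC', Real.sq_sqrt (by positivity)]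
      exact hgub p
    have hgge : ∀ p, δ * gau p ≤ g p := fun p => by
      refine (sq_le_sq₀ (mul_nonneg hδ.le (gau_pos p).le) (hgpos p).le).1 ?_
      rw [hgsq, mul_pow]
      nlinarith [sq_nonneg (f p)]
    have hpowint : ∀ n : ℕ, 0 < n → Integrable fun p => g p ^ n := fun n hn => by
      refine Integrable.mono' ((integrable_exp_neg_mul_q4 (c := n) (by positivity)).const_mul
        (C' ^ n)) (hdg.continuous.pow n).aestronglyMeasurable (ae_of_all _ fun p => ?_)
      rw [Real.norm_of_nonneg (pow_pos (hgpos p) n).le]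
      calc g p ^ n ≤ (C' * gau p) ^ n := pow_le_pow_left₀ (hgpos p).le (hgle p) n
        _ = _ := by
          rw [mul_pow]
          unfold gau
          rw [← Real.exp_nat_mul]
          congr 2
          ring
    have hcomp : Comparable gw4 fun p => g p ^ 4 := by
      refine ⟨hdg.continuous.pow 4, ?_, δ ^ 4, C' ^ 4, by positivity, by positivity,
        fun p => ⟨?_, ?_⟩⟩
      · exact wprod_pos (wprod_pos (wprod_pos gw_pos))
      · rw [← gau_pow_four, ← mul_pow]
        exact pow_le_pow_left₀ (mul_nonneg hδ.le (gau_pos p).le) (hgge p) 4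
      · rw [← gau_pow_four, ← mul_pow]
        exact pow_le_pow_left₀ (hgpos p).le (hgle p) 4
    have key := knothe_inequality hdg hgpos hcomp (hpowint 4 (by norm_num))
      (hpowint 3 (by norm_num)) hgint hR
    refine le_trans ?_ (key.trans ?_)
    · refine mul_le_mul_of_nonneg_right (Real.sqrt_le_sqrt ?_) (sq_nonneg _)
      have hf4 : Integrable fun p => f p ^ 4 := by
        refine (hf.continuous.pow 4).integrable_of_hasCompactSupport (hs.mono fun p hp => ?_)
        simp only [Function.mem_support] at hp ⊢
        intro h0
        simp [h0] at hp
      refine integral_mono hf4 (hpowint 4 (by norm_num)) fun p => ?_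
      have h1 : f p ^ 2 ≤ g p ^ 2 := by
        rw [hgsq]; nlinarith [mul_pos (pow_pos hδ 2) (pow_pos (gau_pos p) 2)]
      calc f p ^ 4 = (f p ^ 2) ^ 2 := by ring
        _ ≤ (g p ^ 2) ^ 2 := pow_le_pow_left₀ (sq_nonneg _) h1 2
        _ = g p ^ 4 := by ring
    · refine mul_le_mul_of_nonneg_left ?_ ?_
      · rw [← integral_const_mul, ← integral_add (integrable_finsetSum _ fun i _ => hfi i)
          ((integrable_finsetSum _ fun i _ => hgi i).const_mul _)]
        refine integral_mono (integrable_finsetSum _ fun i _ => hgint i)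
          ((integrable_finsetSum _ fun i _ => hfi i).add
          ((integrable_finsetSum _ fun i _ => hgi i).const_mul _)) fun p => ?_
        rw [Finset.mul_sum, ← Finset.sum_add_distrib]
        exact Finset.sum_le_sum fun i _ => hfgsq p i
      · refine mul_nonneg (mul_nonneg (by norm_num) ?_) (Real.sqrt_nonneg _)
        exact integral_nonneg fun p => mul_nonneg (q4_nonneg p) (pow_pos (tal_pos p) 4).le
  have hlim : Tendsto (fun δ : ℝ => 9 / 16 * (∫ p in box4 R, q4 p * tal p ^ 4)
      * √(∫ p in box4 R, tal p ^ 4) * ((∫ p, ∑ i, (fderiv ℝ f p (e4 i)) ^ 2)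
          + δ ^ 2 * ∫ p, ∑ i, (fderiv ℝ gau p (e4 i)) ^ 2)) (nhdsWithin 0 (Set.Ioi 0))
      (nhds (9 / 16 * (∫ p in box4 R, q4 p * tal p ^ 4)
      * √(∫ p in box4 R, tal p ^ 4) * ((∫ p, ∑ i, (fderiv ℝ f p (e4 i)) ^ 2)
          + (0 : ℝ) ^ 2 * ∫ p, ∑ i, (fderiv ℝ gau p (e4 i)) ^ 2))) := by
    refine Tendsto.mono_left (Continuous.tendsto ?_ 0) nhdsWithin_le_nhds
    fun_prop
  have := ge_of_tendsto hlim (by filter_upwards [self_mem_nhdsWithin] with δ hδ using main δ hδ)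
  simpa using this

instance isAddHaarMeasure_Pt : (volume : Measure Pt).IsAddHaarMeasure := by
  rw [Measure.volume_eq_prod]; infer_instance

/-- The coordinate directions of `Pt`. -/
def dir : Fin 4 → Pt := ![ex 0, ex 1, ex 2, ey]

/-- The coordinates of a point of `Pt`. -/
def co : Fin 4 → Pt → ℝ := ![fun p => p.1 0, fun p => p.1 1, fun p => p.1 2, fun p => p.2]

lemma gradSq_eq_sum (u : Pt → ℝ) (p : Pt) : gradSq u p = ∑ i, (fderiv ℝ u p (dir i)) ^ 2 := by
  simp [gradSq, gradSqX, gradx, grady, dir, Fin.sum_univ_three, Fin.sum_univ_four]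

/-- The squared Euclidean norm on `Pt`. -/
def nsq (p : Pt) : ℝ := p.1 0 ^ 2 + p.1 1 ^ 2 + p.1 2 ^ 2 + p.2 ^ 2

/-- The profile `1 / (1 + |p|²)` on `Pt`. -/
def bub (p : Pt) : ℝ := 1 / (1 + nsq p)

lemma nsq_nonneg (p : Pt) : 0 ≤ nsq p := by unfold nsq; positivity

lemma contDiff_nsq {n : WithTop ℕ∞} : ContDiff ℝ n nsq := by unfold nsq; fun_prop

lemma bub_pos (p : Pt) : 0 < bub p := by
  have := nsq_nonneg p
  unfold bub; positivity

lemma bub_le_one (p : Pt) : bub p ≤ 1 := by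
  have := nsq_nonneg p
  unfold bub
  rw [div_le_one (by linarith)]
  linarith

lemma bub_mul (p : Pt) : bub p * (1 + nsq p) = 1 := by
  have := nsq_nonneg p
  unfold bub
  field_simp

lemma contDiff_bub {n : WithTop ℕ∞} : ContDiff ℝ n bub := by
  unfold bub
  exact contDiff_const.div (contDiff_const.add contDiff_nsq) fun p => by
    have := nsq_nonneg p
    positivity

lemma contDiff_co (i : Fin 4) {n : WithTop ℕ∞} : ContDiff ℝ n (co i) := by
  fin_cases i <;> simp [co] <;> fun_prop

lemma sum_co_sq (p : Pt) : ∑ i, co i p ^ 2 = nsq p := by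
  simp [co, nsq, Fin.sum_univ_four]

lemma co_sq_le (i : Fin 4) (p : Pt) : co i p ^ 2 ≤ nsq p := by
  rw [← sum_co_sq]
  exact Finset.single_le_sum (f := fun i => co i p ^ 2) (fun i _ => sq_nonneg _) (Finset.mem_univ i)

lemma hasFDerivAt_apply_fst (j : Fin 3) (p : Pt) : HasFDerivAt (fun p : Pt => p.1 j)
    ((ContinuousLinearMap.proj (R := ℝ) (φ := fun _ : Fin 3 => ℝ) j).comp
      (ContinuousLinearMap.fst ℝ (Fin 3 → ℝ) ℝ)) p :=
  ((ContinuousLinearMap.proj (R := ℝ) (φ := fun _ : Fin 3 => ℝ) j).comp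
      (ContinuousLinearMap.fst ℝ (Fin 3 → ℝ) ℝ)).hasFDerivAt

lemma fderiv_co (i j : Fin 4) (p : Pt) : fderiv ℝ (co i) p (dir j) = if j = i then 1 else 0 := by
  have h0 := hasFDerivAt_apply_fst 0 p
  have h1 := hasFDerivAt_apply_fst 1 p
  have h2 := hasFDerivAt_apply_fst 2 p
  have h3 := (hasFDerivAt_id (𝕜 := ℝ) p).snd
  fin_cases i
  · change fderiv ℝ (fun p : Pt => p.1 0) p (dir j) = _
    rw [h0.fderiv]; fin_cases j <;> simp [dir, ex, ey]
  · change fderiv ℝ (fun p : Pt => p.1 1) p (dir j) = _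
    rw [h1.fderiv]; fin_cases j <;> simp [dir, ex, ey]
  · change fderiv ℝ (fun p : Pt => p.1 2) p (dir j) = _
    rw [h2.fderiv]; fin_cases j <;> simp [dir, ex, ey]
  · change fderiv ℝ (fun p : Pt => (id p).2) p (dir j) = _
    rw [h3.fderiv]; fin_cases j <;> simp [dir, ex, ey]

lemma hasFDerivAt_nsq (p : Pt) : HasFDerivAt nsq (∑ i, (2 * co i p) • fderiv ℝ (co i) p) p := by
  have h : HasFDerivAt (fun p => ∑ i, co i p ^ 2) (∑ i, (2 * co i p) • fderiv ℝ (co i) p) p := by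
    refine HasFDerivAt.fun_sum fun i _ => ?_
    have := (((contDiff_co i (n := 1)).differentiable one_ne_zero) p).hasFDerivAt.pow 2
    refine this.congr_fderiv ?_
    simp
  rwa [show (fun p => ∑ i, co i p ^ 2) = nsq from funext sum_co_sq] at h

lemma fderiv_nsq (p : Pt) (j : Fin 4) : fderiv ℝ nsq p (dir j) = 2 * co j p := by
  rw [(hasFDerivAt_nsq p).fderiv]
  simp [fderiv_co]

lemma hasFDerivAt_bub (p : Pt) : HasFDerivAt bub (-(bub p ^ 2) • fderiv ℝ nsq p) p := by
  have hn := nsq_nonneg p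
  have h1 : HasDerivAt (fun t : ℝ => 1 / (1 + t)) (-(1 / (1 + nsq p)) ^ 2) (nsq p) := by
    have := ((hasDerivAt_id (nsq p)).const_add 1).inv (by simp; positivity)
    simp only [one_div]
    refine this.congr_deriv ?_
    simp [div_eq_mul_inv]
  have h2 := h1.comp_hasFDerivAt p (hasFDerivAt_nsq p)
  rw [← (hasFDerivAt_nsq p).fderiv] at h2
  exact h2.congr_fderiv (by unfold bub; rfl)

lemma fderiv_bub_pow_three (p : Pt) (i : Fin 4) :
    fderiv ℝ (fun p => bub p ^ 3) p (dir i) = -6 * co i p * bub p ^ 4 := by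
  rw [((hasFDerivAt_bub p).pow 3).fderiv]
  simp [fderiv_nsq]
  ring

lemma norm_sq_le_nsq (p : Pt) : ‖p‖ ^ 2 ≤ nsq p := by
  have hn := nsq_nonneg p
  rw [← Real.sqrt_le_sqrt_iff hn, Real.sqrt_sq (norm_nonneg _)]
  have h : ∀ i, |co i p| ≤ √(nsq p) := fun i => Real.abs_le_sqrt (co_sq_le i p)
  rw [norm_prod_le_iff]
  refine ⟨(pi_norm_le_iff_of_nonneg (Real.sqrt_nonneg _)).2 fun i => ?_, h 3⟩
  fin_cases i
  exacts [h 0, h 1, h 2]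

lemma finrank_Pt : (Module.finrank ℝ Pt : ℝ) = 4 := by
  simp [Module.finrank_prod]

lemma integrable_japanese {r : ℝ} (hr : 4 < r) :
    Integrable fun p : Pt => (1 + ‖p‖ ^ 2) ^ (-r / 2) :=
  integrable_rpow_neg_one_add_norm_sq (by rw [finrank_Pt]; exact hr)

lemma bub_rpow_le {s : ℝ} (hs : 0 ≤ s) (p : Pt) : bub p ^ s ≤ (1 + ‖p‖ ^ 2) ^ (-s) := by
  have h1 := norm_sq_le_nsq p
  have h0 : 0 < 1 + ‖p‖ ^ 2 := by positivity
  rw [Real.rpow_neg h0.le, ← Real.inv_rpow h0.le]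
  refine Real.rpow_le_rpow (bub_pos p).le ?_ hs
  unfold bub
  rw [one_div]
  gcongr

lemma continuous_bub : Continuous bub := (contDiff_bub (n := 1)).continuous

lemma integrable_bub_pow_three : Integrable fun p => bub p ^ 3 := by
  refine (integrable_japanese (r := 6) (by norm_num)).mono'
    (continuous_bub.pow 3).aestronglyMeasurable (ae_of_all _ fun p => ?_)
  rw [Real.norm_of_nonneg (pow_nonneg (bub_pos p).le 3)]
  have := bub_rpow_le (s := 3) (by norm_num) p
  norm_num at this ⊢
  exact this

lemma integrable_co_mul_bub (i : Fin 4) : Integrable fun p => co i p * bub p ^ 3 := by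
  refine (integrable_japanese (r := 5) (by norm_num)).mono'
    (((contDiff_co i (n := 1)).continuous).mul (continuous_bub.pow 3)).aestronglyMeasurable
    (ae_of_all _ fun p => ?_)
  have hb := bub_pos p
  have h1 : |co i p| ≤ bub p ^ (-(1 / 2) : ℝ) := by
    rw [Real.rpow_neg hb.le, ← Real.sqrt_eq_rpow, ← Real.sqrt_inv]
    refine Real.abs_le_sqrt ((co_sq_le i p).trans ?_)
    unfold bub
    rw [one_div, inv_inv]
    linarith
  have h2 := bub_rpow_le (s := 5 / 2) (by norm_num) p
  rw [norm_mul, Real.norm_of_nonneg (pow_nonneg hb.le 3), Real.norm_eq_abs]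
  calc |co i p| * bub p ^ 3 ≤ bub p ^ (-(1 / 2) : ℝ) * bub p ^ 3 := by gcongr
    _ = bub p ^ (5 / 2 : ℝ) := by
      rw [← Real.rpow_natCast, ← Real.rpow_add hb]; norm_num
    _ ≤ _ := h2
    _ = _ := by norm_num

lemma integrable_mul_bub_pow_four {w : Pt → ℝ} (hw : Continuous w) (h : ∀ p, |w p| ≤ 1 + nsq p) :
    Integrable fun p => w p * bub p ^ 4 := by
  refine integrable_bub_pow_three.mono'
    (hw.mul (continuous_bub.pow 4)).aestronglyMeasurable (ae_of_all _ fun p => ?_)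
  have hb := bub_pos p
  rw [norm_mul, Real.norm_of_nonneg (pow_nonneg hb.le 4), Real.norm_eq_abs]
  calc |w p| * bub p ^ 4 ≤ (1 + nsq p) * bub p ^ 4 := by gcongr; exact h p
    _ = (bub p * (1 + nsq p)) * bub p ^ 3 := by ring
    _ = _ := by rw [bub_mul, one_mul]

lemma integrable_bub_pow_four : Integrable fun p => bub p ^ 4 := by
  have := integrable_mul_bub_pow_four (w := fun _ => 1) continuous_const fun p => by
    simpa using nsq_nonneg p
  simpa using this

lemma integrable_co_sq_bub (i : Fin 4) : Integrable fun p => co i p ^ 2 * bub p ^ 4 :=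
  integrable_mul_bub_pow_four (((contDiff_co i (n := 1)).continuous).pow 2) fun p => by
    rw [abs_of_nonneg (sq_nonneg _)]
    linarith [co_sq_le i p]

/-- `∫ bub⁴`. -/
def Jc : ℝ := ∫ p, bub p ^ 4

lemma integral_bub_pow_three_eq (i : Fin 4) :
    ∫ p, bub p ^ 3 = 6 * ∫ p, co i p ^ 2 * bub p ^ 4 := by
  have h := integral_mul_fderiv_eq_neg_fderiv_mul_of_integrable (μ := (volume : Measure Pt))
    (f := co i) (g := fun p => bub p ^ 3) (v := dir i)
    (by simpa [fderiv_co] using integrable_bub_pow_three)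
    (by
      simp only [fderiv_bub_pow_three]
      refine ((integrable_co_sq_bub i).const_mul (-6)).congr (ae_of_all _ fun p => ?_)
      ring)
    (integrable_co_mul_bub i)
    (fun p _ => (contDiff_co i (n := 1)).differentiable one_ne_zero p)
    (fun p _ => ((contDiff_bub (n := 1)).pow 3).differentiable one_ne_zero p)
  simp only [fderiv_bub_pow_three, fderiv_co, if_true, one_mul] at h
  rw [eq_comm, neg_eq_iff_eq_neg] at h
  rw [h, ← integral_neg, ← integral_const_mul]
  congr 1
  ext p
  ring

lemma integral_nsq_bub : ∫ p, nsq p * bub p ^ 4 = (∫ p, bub p ^ 3) - Jc := by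
  unfold Jc
  rw [← integral_sub integrable_bub_pow_three integrable_bub_pow_four]
  congr 1
  ext p
  have := bub_mul p
  linear_combination (bub p ^ 3) * this

lemma integral_nsq_bub' : ∫ p, nsq p * bub p ^ 4 = 4 / 6 * ∫ p, bub p ^ 3 := by
  have h : ∀ p, nsq p * bub p ^ 4 = ∑ i, co i p ^ 2 * bub p ^ 4 := fun p => by
    rw [← sum_co_sq, Finset.sum_mul]
  simp only [h]
  rw [integral_finsetSum _ fun i _ => integrable_co_sq_bub i]
  have h2 : ∀ i, ∫ p, co i p ^ 2 * bub p ^ 4 = 1 / 6 * ∫ p, bub p ^ 3 := fun i => by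
    rw [integral_bub_pow_three_eq i]; ring
  simp only [h2, Finset.sum_const, Finset.card_univ, Fintype.card_fin, nsmul_eq_mul]
  push_cast
  ring

lemma integral_bub_pow_three : ∫ p, bub p ^ 3 = 3 * Jc := by
  have h1 := integral_nsq_bub
  have h2 := integral_nsq_bub'
  linarith

lemma integral_co_sq_bub (i : Fin 4) : ∫ p, co i p ^ 2 * bub p ^ 4 = Jc / 2 := by
  have h1 := integral_bub_pow_three
  rw [integral_bub_pow_three_eq i] at h1
  linarith

lemma Jc_pos : 0 < Jc := by
  refine integral_pos_of_integrable_nonneg_nonzero (x := 0) (continuous_bub.pow 4)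
    integrable_bub_pow_four (fun p => pow_nonneg (bub_pos p).le 4) ?_
  exact (pow_pos (bub_pos 0) 4).ne'

/-- The coordinate map from `Pt` to `Q4`. -/
def toQ4 : Pt ≃L[ℝ] Q4 :=
  LinearEquiv.toContinuousLinearEquiv
    { toFun := fun p => (((p.1 0, p.1 1), p.1 2), p.2)
      invFun := fun q => (![q.1.1.1, q.1.1.2, q.1.2], q.2)
      map_add' := fun p q => rfl
      map_smul' := fun c p => rfl
      left_inv := fun p => by
        ext i
        · fin_cases i <;> rfl
        · rfl
      right_inv := fun q => rfl }

lemma toQ4_symm_apply (q : Q4) : toQ4.symm q = (![q.1.1.1, q.1.1.2, q.1.2], q.2) := rfl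

lemma measurePreserving_toQ4 : MeasurePreserving toQ4 := by
  have h1 := volume_preserving_piFinSuccAbove (fun _ : Fin 3 => ℝ) (Fin.last 2)
  have h2 := (MeasurePreserving.id (volume : Measure ℝ)).prod (volume_preserving_finTwoArrow ℝ)
  have h3 := Measure.measurePreserving_swap (μ := (volume : Measure ℝ))
    (ν := (volume : Measure (ℝ × ℝ)))
  have h4 := h3.comp (h2.comp h1)
  exact h4.prod (MeasurePreserving.id (volume : Measure ℝ))

lemma q4_toQ4 (p : Pt) : q4 (toQ4 p) = nsq p := rfl

lemma tal_toQ4 (p : Pt) : tal (toQ4 p) = bub p := rfl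

lemma toQ4_symm_e4 (i : Fin 4) : toQ4.symm (e4 i) = dir i := by
  rw [toQ4_symm_apply]
  fin_cases i
  · ext j
    · fin_cases j <;> simp [e4, dir, ex]
    · simp [e4, dir, ex]
  · ext j
    · fin_cases j <;> simp [e4, dir, ex]
    · simp [e4, dir, ex]
  · ext j
    · fin_cases j <;> simp [e4, dir, ex]
    · simp [e4, dir, ex]
  · ext j
    · fin_cases j <;> simp [e4, dir, ey]
    · simp [e4, dir, ey]

lemma integral_comp_toQ4 (f : Q4 → ℝ) : ∫ p, f (toQ4 p) = ∫ q, f q :=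
  measurePreserving_toQ4.integral_comp toQ4.toHomeomorph.measurableEmbedding f

lemma integrable_comp_toQ4 {f : Q4 → ℝ} (h : Integrable fun p => f (toQ4 p)) : Integrable f :=
  (measurePreserving_toQ4.integrable_comp_emb toQ4.toHomeomorph.measurableEmbedding).1 h

lemma tendsto_setIntegral_box4 {f : Q4 → ℝ} (hf : Integrable f) :
    Tendsto (fun n : ℕ => ∫ p in box4 (n + 1), f p) atTop (nhds (∫ p, f p)) := by
  have hU : ⋃ n : ℕ, box4 (n + 1) = Set.univ := by
    refine Set.eq_univ_of_forall fun p => Set.mem_iUnion.2 ?_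
    obtain ⟨n, hn⟩ := exists_nat_gt ‖p‖
    refine ⟨n, ?_⟩
    have h1 := norm_fst_le p
    have h2 := norm_snd_le p
    have h3 := norm_fst_le p.1
    have h4 := norm_snd_le p.1
    have h5 := norm_fst_le p.1.1
    have h6 := norm_snd_le p.1.1
    rw [Real.norm_eq_abs] at h2 h4 h5 h6
    refine ⟨⟨⟨?_, ?_⟩, ?_⟩, ?_⟩ <;> rw [Set.mem_Ioo, ← abs_lt] <;> linarith
  have h := tendsto_setIntegral_of_monotone (s := fun n : ℕ => box4 (n + 1)) (μ := volume) (f := f)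
    (fun n => measurableSet_box4 _) (fun m n hmn => by
      have h : ((m : ℝ) + 1) ≤ n + 1 := by exact_mod_cast Nat.succ_le_succ hmn
      have h2 := Set.Ioo_subset_Ioo (neg_le_neg h) h
      exact Set.prod_mono (Set.prod_mono (Set.prod_mono h2 h2) h2) h2) hf.integrableOn
  rwa [hU, setIntegral_univ] at h

/-- The sharp Sobolev inequality on `ℝ⁴` for compactly supported `C¹` functions. -/
lemma sharp_sobolev {f : Pt → ℝ} (hf : ContDiff ℝ 1 f) (hs : HasCompactSupport f) :
    8 * √Jc * √(∫ p, f p ^ 4) ≤ ∫ p, gradSq f p := by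
  set g : Q4 → ℝ := fun q => f (toQ4.symm q) with hg
  have hgd : ContDiff ℝ 1 g := hf.comp toQ4.symm.contDiff
  have hgs : HasCompactSupport g := hs.comp_homeomorph toQ4.symm.toHomeomorph
  have e1 : ∫ q, g q ^ 4 = ∫ p, f p ^ 4 := by
    rw [← integral_comp_toQ4]; simp [hg]
  have hfd : ∀ q i, fderiv ℝ g q (e4 i) = fderiv ℝ f (toQ4.symm q) (dir i) := fun q i => by
    have : HasFDerivAt g _ q := (hf.differentiable one_ne_zero _).hasFDerivAt.comp q
      toQ4.symm.hasFDerivAt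
    rw [this.fderiv]
    simp [toQ4_symm_e4]
  have e2 : ∫ q, ∑ i, (fderiv ℝ g q (e4 i)) ^ 2 = ∫ p, gradSq f p := by
    rw [← integral_comp_toQ4]
    simp [hfd, gradSq_eq_sum]
  have e3 : ∫ q, tal q ^ 3 = 3 * Jc := by
    rw [← integral_comp_toQ4, ← integral_bub_pow_three]; simp only [tal_toQ4]
  have e4 : ∫ q, tal q ^ 4 = Jc := by
    rw [← integral_comp_toQ4]; simp only [tal_toQ4, Jc]
  have e5 : ∫ q, q4 q * tal q ^ 4 = 2 * Jc := by
    rw [← integral_comp_toQ4]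
    simp only [tal_toQ4, q4_toQ4]
    rw [integral_nsq_bub, integral_bub_pow_three]; ring
  have t3 := tendsto_setIntegral_box4 (f := fun q => tal q ^ 3)
    (integrable_comp_toQ4 (by simpa only [tal_toQ4] using integrable_bub_pow_three))
  have t4 := tendsto_setIntegral_box4 (f := fun q => tal q ^ 4)
    (integrable_comp_toQ4 (by simpa only [tal_toQ4] using integrable_bub_pow_four))
  have t5 := tendsto_setIntegral_box4 (f := fun q => q4 q * tal q ^ 4)
    (integrable_comp_toQ4 (by
      simpa only [tal_toQ4, q4_toQ4] using integrable_mul_bub_pow_four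
        (contDiff_nsq (n := 1)).continuous fun p => by
          rw [abs_of_nonneg (nsq_nonneg p)]; linarith))
  have key := le_of_tendsto_of_tendsto ((tendsto_const_nhds (x := √(∫ q, g q ^ 4))).mul (t3.pow 2))
    (((t5.const_mul (9 / 16)).mul t4.sqrt).mul_const
      (∫ q, ∑ i, (fderiv ℝ g q (Waveguide.e4 i)) ^ 2))
    (Eventually.of_forall fun n => box_sobolev hgd hgs (by positivity))
  rw [e1, e2, e3, e4, e5] at key
  have hJ := Jc_pos
  have hsq : √Jc * √Jc = Jc := Real.mul_self_sqrt hJ.le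
  have hsp : 0 < √Jc := Real.sqrt_pos.2 hJ
  have : (9 / 8 * Jc * √Jc) * (8 * √Jc * √(∫ p, f p ^ 4))
      ≤ (9 / 8 * Jc * √Jc) * ∫ p, gradSq f p := by
    calc (9 / 8 * Jc * √Jc) * (8 * √Jc * √(∫ p, f p ^ 4))
        = 9 * Jc * (√Jc * √Jc) * √(∫ p, f p ^ 4) := by ring
      _ = √(∫ p, f p ^ 4) * (3 * Jc) ^ 2 := by rw [hsq]; ring
      _ ≤ _ := key
      _ = _ := by ring
  exact le_of_mul_le_mul_left this (by positivity)

/-- The strip `ℝ³ × (a, a + 2π]`. -/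
def strip (a : ℝ) : Set Pt := Set.univ ×ˢ Set.Ioc a (a + 2 * π)

lemma strip_zero : strip 0 = Dom := by simp [strip, Dom]

lemma measurableSet_strip (a : ℝ) : MeasurableSet (strip a) :=
  MeasurableSet.univ.prod measurableSet_Ioc

lemma measurableSet_Dom : MeasurableSet Dom := strip_zero ▸ measurableSet_strip 0

/-- The group of periods. -/
abbrev Per : AddSubgroup Pt := AddSubgroup.zmultiples ((0, 2 * π) : Pt)

lemma isAddFundamentalDomain_strip (a : ℝ) : IsAddFundamentalDomain Per (strip a) := by
  refine IsAddFundamentalDomain.mk' (measurableSet_strip a).nullMeasurableSet fun x => ?_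
  have hinj : Function.Injective fun n : ℤ => n • ((0, 2 * π) : Pt) := fun m n h => by
    have := congrArg Prod.snd h
    simp only [Prod.smul_mk] at this
    exact (zsmul_left_strictMono two_pi_pos).injective this
  have : Function.Bijective
      (Set.codRestrict (fun n : ℤ => n • ((0, 2 * π) : Pt)) Per fun n => ⟨n, rfl⟩) :=
    (Equiv.ofInjective _ hinj).bijective
  refine this.existsUnique_iff.2 ?_
  have h := existsUnique_add_zsmul_mem_Ioc two_pi_pos x.2 a
  refine (existsUnique_congr fun n => ?_).2 h
  simp [strip, AddSubgroup.vadd_def, add_comm]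

lemma PeriodicY.vadd {f : Pt → ℝ} (hf : PeriodicY f) (g : Per) (x : Pt) : f (g +ᵥ x) = f x := by
  obtain ⟨g, n, rfl⟩ := g
  have h : Function.Periodic (fun y => f (x.1, y)) (2 * π) := fun y => hf x.1 y
  have h2 := h.zsmul n x.2
  change f (n • ((0, 2 * π) : Pt) + x) = f x
  rw [add_comm, show x + n • ((0, 2 * π) : Pt) = (x.1, x.2 + n • (2 * π)) by ext <;> simp]
  exact h2

namespace PeriodicY

variable {f g : Pt → ℝ}

lemma setIntegral_strip (hf : PeriodicY f) (a : ℝ) : ∫ p in strip a, f p = ∫ p in Dom, f p := by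
  rw [← strip_zero]
  exact (isAddFundamentalDomain_strip a).setIntegral_eq (isAddFundamentalDomain_strip 0) hf.vadd

lemma integrableOn_strip_iff (hf : PeriodicY f) (a : ℝ) :
    IntegrableOn f (strip a) ↔ IntegrableOn f Dom := by
  rw [← strip_zero]
  exact (isAddFundamentalDomain_strip a).integrableOn_iff (isAddFundamentalDomain_strip 0) hf.vadd

lemma comp (hf : PeriodicY f) (F : ℝ → ℝ) : PeriodicY fun p => F (f p) := fun x y => by
  simp only [hf x y]

lemma comp₂ (hf : PeriodicY f) (hg : PeriodicY g) (F : ℝ → ℝ → ℝ) :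
    PeriodicY fun p => F (f p) (g p) := fun x y => by
  simp only [hf x y, hg x y]

lemma add (hf : PeriodicY f) (hg : PeriodicY g) : PeriodicY fun p => f p + g p :=
  hf.comp₂ hg (· + ·)

lemma sub (hf : PeriodicY f) (hg : PeriodicY g) : PeriodicY fun p => f p - g p :=
  hf.comp₂ hg (· - ·)

lemma mul (hf : PeriodicY f) (hg : PeriodicY g) : PeriodicY fun p => f p * g p :=
  hf.comp₂ hg (· * ·)

lemma const_mul (hf : PeriodicY f) (c : ℝ) : PeriodicY fun p => c * f p := hf.comp (c * ·)

lemma pow (hf : PeriodicY f) (n : ℕ) : PeriodicY fun p => f p ^ n := hf.comp (· ^ n)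

lemma sum {ι : Type*} {s : Finset ι} {F : ι → Pt → ℝ} (h : ∀ i ∈ s, PeriodicY (F i)) :
    PeriodicY fun p => ∑ i ∈ s, F i p := fun x y =>
  Finset.sum_congr rfl fun i hi => h i hi x y

lemma comp_add (hf : PeriodicY f) (a : Pt) : PeriodicY fun p => f (p + a) := fun x y => by
  have := hf (x + a.1) (y + a.2)
  change f ((x, y + 2 * π) + a) = f ((x, y) + a)
  rw [show ((x, y + 2 * π) : Pt) + a = (x + a.1, y + a.2 + 2 * π) by
    ext <;> simp; ring, this]
  rfl

lemma fderiv_apply (hf : PeriodicY f) (v : Pt) : PeriodicY fun p => fderiv ℝ f p v := fun x y => by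
  have h : (fun p : Pt => f (p + (0, 2 * π))) = f := by
    ext p
    rw [show p + ((0, 2 * π) : Pt) = (p.1, p.2 + 2 * π) by ext <;> simp]
    exact hf p.1 p.2
  have h2 := fderiv_comp_add_right (𝕜 := ℝ) (f := f) (x := (x, y)) ((0, 2 * π) : Pt)
  rw [h] at h2
  simp only
  rw [h2, show ((x, y) : Pt) + (0, 2 * π) = (x, y + 2 * π) by ext <;> simp]

lemma grady (hf : PeriodicY f) : PeriodicY (Waveguide.grady f) := hf.fderiv_apply ey

lemma gradx (hf : PeriodicY f) (i : Fin 3) : PeriodicY fun p => Waveguide.gradx f p i :=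
  hf.fderiv_apply (ex i)

lemma gradSqX (hf : PeriodicY f) : PeriodicY (Waveguide.gradSqX f) :=
  PeriodicY.sum fun i _ => (hf.gradx i).pow 2

lemma preimage_add_strip (a : Pt) : (fun p => p + a) ⁻¹' strip a.2 = Dom := by
  ext p
  simp [strip, Dom, add_comm a.2]

lemma setIntegral_comp_add (hf : PeriodicY f) (a : Pt) :
    ∫ p in Dom, f (p + a) = ∫ p in Dom, f p := by
  rw [← hf.setIntegral_strip a.2]
  have h := (measurePreserving_add_right (volume : Measure Pt) a).setIntegral_preimage_emb
    (measurableEmbedding_addRight a) f (strip a.2)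
  rw [← h, preimage_add_strip]

lemma integrableOn_comp_add (hf : PeriodicY f) (a : Pt) (h : IntegrableOn f Dom) :
    IntegrableOn (fun p => f (p + a)) Dom := by
  rw [← hf.integrableOn_strip_iff a.2] at h
  have h2 := ((measurePreserving_add_right (volume : Measure Pt) a).integrableOn_comp_preimage
    (measurableEmbedding_addRight a)).2 h
  rw [preimage_add_strip] at h2
  exact h2

end PeriodicY

/-- Anisotropic scaling of `Pt`. -/
def scal (a b : ℝ) (p : Pt) : Pt := (a • p.1, b * p.2)

lemma map_scal {a b : ℝ} (ha : 0 < a) (hb : 0 < b) :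
    Measure.map (scal a b) volume = ENNReal.ofReal ((a ^ 3)⁻¹ * b⁻¹) • (volume : Measure Pt) := by
  have h1 := Measure.map_addHaar_smul (volume : Measure (Fin 3 → ℝ)) ha.ne'
  have h2 := Measure.map_addHaar_smul (volume : Measure ℝ) hb.ne'
  have h := Measure.map_prod_map (volume : Measure (Fin 3 → ℝ)) (volume : Measure ℝ)
    (f := fun x => a • x) (g := fun y => b • y) (by fun_prop) (by fun_prop)
  rw [h1, h2, Measure.prod_smul_left, Measure.prod_smul_right, smul_smul] at h
  rw [Measure.volume_eq_prod, show scal a b = Prod.map (fun x => a • x) (fun y => b • y) from rfl,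
    ← h]
  congr 1
  rw [← ENNReal.ofReal_mul (abs_nonneg _)]
  simp [abs_of_pos ha, abs_of_pos hb]

/-- Anisotropic scaling as a homeomorphism. -/
def scalHomeo {a b : ℝ} (ha : a ≠ 0) (hb : b ≠ 0) : Pt ≃ₜ Pt :=
  (Homeomorph.smulOfNeZero a ha).prodCongr (Homeomorph.mulLeft₀ b hb)

lemma measurableEmbedding_scal {a b : ℝ} (ha : a ≠ 0) (hb : b ≠ 0) :
    MeasurableEmbedding (scal a b) := (scalHomeo ha hb).measurableEmbedding

lemma integral_scal {a b : ℝ} (ha : 0 < a) (hb : 0 < b) (f : Pt → ℝ) :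
    ∫ p, f (scal a b p) = (a ^ 3)⁻¹ * b⁻¹ * ∫ p, f p := by
  rw [← (measurableEmbedding_scal ha.ne' hb.ne').integral_map, map_scal ha hb,
    integral_smul_measure, ENNReal.toReal_ofReal (by positivity), smul_eq_mul]

lemma integrable_scal {a b : ℝ} (ha : 0 < a) (hb : 0 < b) {f : Pt → ℝ} (hf : Integrable f) :
    Integrable fun p => f (scal a b p) := by
  have := (measurableEmbedding_scal ha.ne' hb.ne').integrable_map_iff (μ := volume) (g := f)
  rw [map_scal ha hb] at this
  exact this.1 (hf.smul_measure ENNReal.ofReal_ne_top)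

lemma scal_one_mem_Dom {a : ℝ} (p : Pt) : scal a 1 p ∈ Dom ↔ p ∈ Dom := by
  simp [scal, Dom]

lemma setIntegral_scal {a : ℝ} (ha : 0 < a) (f : Pt → ℝ) :
    ∫ p in Dom, f (scal a 1 p) = (a ^ 3)⁻¹ * ∫ p in Dom, f p := by
  rw [← integral_indicator measurableSet_Dom, ← integral_indicator measurableSet_Dom]
  have h := integral_scal ha one_pos (Dom.indicator f)
  rw [inv_one, mul_one] at h
  rw [← h]
  congr 1
  ext p
  by_cases hp : p ∈ Dom
  · rw [Set.indicator_of_mem ((scal_one_mem_Dom p).2 hp), Set.indicator_of_mem hp]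
  · rw [Set.indicator_of_notMem (mt (scal_one_mem_Dom p).1 hp), Set.indicator_of_notMem hp]

lemma integrableOn_scal {a : ℝ} (ha : 0 < a) {f : Pt → ℝ} (hf : IntegrableOn f Dom) :
    IntegrableOn (fun p => f (scal a 1 p)) Dom := by
  rw [← integrable_indicator_iff measurableSet_Dom] at hf ⊢
  refine (integrable_scal ha one_pos hf).congr (ae_of_all _ fun p => ?_)
  change Dom.indicator f (scal a 1 p) = _
  by_cases hp : p ∈ Dom
  · rw [Set.indicator_of_mem ((scal_one_mem_Dom p).2 hp), Set.indicator_of_mem hp]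
  · rw [Set.indicator_of_notMem (mt (scal_one_mem_Dom p).1 hp), Set.indicator_of_notMem hp]

lemma hasFDerivAt_scal (a b : ℝ) (p : Pt) : HasFDerivAt (scal a b)
    ((a • ContinuousLinearMap.id ℝ (Fin 3 → ℝ)).prodMap (b • ContinuousLinearMap.id ℝ ℝ)) p :=
  ((a • ContinuousLinearMap.id ℝ (Fin 3 → ℝ)).prodMap
    (b • ContinuousLinearMap.id ℝ ℝ)).hasFDerivAt

lemma contDiff_scal (a b : ℝ) {n : WithTop ℕ∞} : ContDiff ℝ n (scal a b) :=
  ((a • ContinuousLinearMap.id ℝ (Fin 3 → ℝ)).prodMap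
    (b • ContinuousLinearMap.id ℝ ℝ)).contDiff

lemma gradx_scal {f : Pt → ℝ} (hf : Differentiable ℝ f) (a b : ℝ) (p : Pt) (i : Fin 3) :
    gradx (fun p => f (scal a b p)) p i = a * gradx f (scal a b p) i := by
  have h : HasFDerivAt (fun p => f (scal a b p)) _ p :=
    (hf _).hasFDerivAt.comp p (hasFDerivAt_scal a b p)
  unfold gradx
  rw [h.fderiv]
  have : ((a • ContinuousLinearMap.id ℝ (Fin 3 → ℝ)).prodMap
    (b • ContinuousLinearMap.id ℝ ℝ)) (ex i) = a • ex i := by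
    ext <;> simp [ex]
  rw [ContinuousLinearMap.comp_apply, this, map_smul, smul_eq_mul]

lemma grady_scal {f : Pt → ℝ} (hf : Differentiable ℝ f) (a b : ℝ) (p : Pt) :
    grady (fun p => f (scal a b p)) p = b * grady f (scal a b p) := by
  have h : HasFDerivAt (fun p => f (scal a b p)) _ p :=
    (hf _).hasFDerivAt.comp p (hasFDerivAt_scal a b p)
  unfold grady
  rw [h.fderiv]
  have : ((a • ContinuousLinearMap.id ℝ (Fin 3 → ℝ)).prodMap
    (b • ContinuousLinearMap.id ℝ ℝ)) ey = b • ey := by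
    ext <;> simp [ey]
  rw [ContinuousLinearMap.comp_apply, this, map_smul, smul_eq_mul]

/-- Fatou's lemma for nonnegative real-valued integrable functions. -/
lemma integral_le_of_fatou {α : Type*} [MeasurableSpace α] {μ : Measure α} {f : ℕ → α → ℝ}
    {g : α → ℝ} {c : ℕ → ℝ} {C : ℝ} (hi : ∀ n, Integrable (f n) μ) (h0 : ∀ n p, 0 ≤ f n p)
    (hc : ∀ n, ∫ p, f n p ∂μ ≤ c n) (hC : Tendsto c atTop (nhds C))
    (hl : ∀ᵐ p ∂μ, Tendsto (fun n => f n p) atTop (nhds (g p))) :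
    Integrable g μ ∧ ∫ p, g p ∂μ ≤ C := by
  have hgm : AEStronglyMeasurable g μ :=
    aestronglyMeasurable_of_tendsto_ae atTop (fun n => (hi n).aestronglyMeasurable) hl
  have hg0 : 0 ≤ᵐ[μ] g := by
    filter_upwards [hl] with p hp
    exact ge_of_tendsto hp (Eventually.of_forall fun n => h0 n p)
  have hlim : Tendsto (fun n => ENNReal.ofReal (c n)) atTop (nhds (ENNReal.ofReal C)) :=
    (ENNReal.continuous_ofReal.tendsto C).comp hC
  have hC0 : 0 ≤ C := ge_of_tendsto hC (Eventually.of_forall fun n =>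
    (integral_nonneg (h0 n)).trans (hc n))
  have key : ∫⁻ p, ENNReal.ofReal (g p) ∂μ ≤ ENNReal.ofReal C := by
    calc ∫⁻ p, ENNReal.ofReal (g p) ∂μ
        = ∫⁻ p, liminf (fun n => ENNReal.ofReal (f n p)) atTop ∂μ := by
          refine lintegral_congr_ae ?_
          filter_upwards [hl] with p hp
          exact (((ENNReal.continuous_ofReal.tendsto _).comp hp).liminf_eq).symm
      _ ≤ liminf (fun n => ∫⁻ p, ENNReal.ofReal (f n p) ∂μ) atTop :=
          lintegral_liminf_le' fun n => (hi n).aemeasurable.ennreal_ofReal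
      _ ≤ liminf (fun n => ENNReal.ofReal (c n)) atTop := by
          refine liminf_le_liminf (Eventually.of_forall fun n => ?_)
          rw [← ofReal_integral_eq_lintegral_ofReal (hi n) (ae_of_all _ (h0 n))]
          exact ENNReal.ofReal_le_ofReal (hc n)
      _ = ENNReal.ofReal C := hlim.liminf_eq
  have hgi : Integrable g μ := by
    refine ⟨hgm, ?_⟩
    rw [hasFiniteIntegral_iff_ofReal hg0]
    exact key.trans_lt ENNReal.ofReal_lt_top
  refine ⟨hgi, ?_⟩
  rw [← ofReal_integral_eq_lintegral_ofReal hgi hg0] at key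
  exact (ENNReal.ofReal_le_ofReal_iff hC0).1 key

lemma scaled_sobolev {f : Pt → ℝ} (hf : ContDiff ℝ 1 f) (hs : HasCompactSupport f) {s : ℝ}
    (hs0 : 0 < s) :
    8 * √Jc * √s * √(∫ p, f p ^ 4) ≤ (∫ p, gradSqX f p) + s ^ 2 * ∫ p, grady f p ^ 2 := by
  have hd : Differentiable ℝ f := hf.differentiable one_ne_zero
  have h := sharp_sobolev (f := fun p => f (scal 1 s p)) (hf.comp (contDiff_scal 1 s))
    (hs.comp_homeomorph (scalHomeo one_ne_zero hs0.ne'))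
  have hcont : ∀ v, Continuous fun p => fderiv ℝ f p v := fun v =>
    (hf.continuous_fderiv one_ne_zero).clm_apply continuous_const
  have hFG : ∀ v, Integrable fun p => (fderiv ℝ f p v) ^ 2 := fun v => by
    have h1 : HasCompactSupport fun p => fderiv ℝ f p v := hs.fderiv_apply ℝ v
    have h2 : HasCompactSupport fun p => (fderiv ℝ f p v) ^ 2 :=
      h1.comp_left (g := fun t : ℝ => t ^ 2) (by simp)
    exact ((hcont v).pow 2).integrable_of_hasCompactSupport h2
  have e1 : ∫ p, f (scal 1 s p) ^ 4 = s⁻¹ * ∫ p, f p ^ 4 := by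
    rw [integral_scal one_pos hs0 (fun p => f p ^ 4)]; simp
  have e2 : ∫ p, gradSq (fun p => f (scal 1 s p)) p =
      s⁻¹ * ((∫ p, gradSqX f p) + s ^ 2 * ∫ p, grady f p ^ 2) := by
    have : ∀ p, gradSq (fun p => f (scal 1 s p)) p =
        (fun p => gradSqX f p + s ^ 2 * grady f p ^ 2) (scal 1 s p) := fun p => by
      simp only [gradSq, gradSqX, gradx_scal hd, grady_scal hd]
      simp only [one_mul]
      ring
    simp only [this]
    rw [integral_scal one_pos hs0 (fun p => gradSqX f p + s ^ 2 * grady f p ^ 2), integral_add,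
      integral_const_mul]
    · simp
    · exact integrable_finsetSum _ fun i _ => hFG (ex i)
    · exact (hFG ey).const_mul _
  rw [e1, e2, Real.sqrt_mul (by positivity)] at h
  have h3 : s * √(s⁻¹) = √s := by
    rw [Real.sqrt_inv]
    field_simp
    rw [Real.sq_sqrt hs0.le]
  generalize (∫ p, gradSqX f p) + s ^ 2 * ∫ p, grady f p ^ 2 = G at h ⊢
  generalize √(∫ p, f p ^ 4) = N at h ⊢
  calc 8 * √Jc * √s * N = s * (8 * √Jc * (√(s⁻¹) * N)) := by
        rw [← h3]; ring
    _ ≤ s * (s⁻¹ * G) := by gcongr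
    _ = _ := by field_simp

/-- Vanishing outside a set whose projection to `ℝ³` is compact. -/
def XCompact (f : Pt → ℝ) : Prop := ∃ K : Set (Fin 3 → ℝ), IsCompact K ∧ ∀ p : Pt, p.1 ∉ K → f p = 0

lemma XCompact.mono {f g : Pt → ℝ} (h : XCompact f) (hg : ∀ p, f p = 0 → g p = 0) : XCompact g := by
  obtain ⟨K, hK, h0⟩ := h
  exact ⟨K, hK, fun p hp => hg p (h0 p hp)⟩

lemma XCompact.fderiv_apply {f : Pt → ℝ} (h : XCompact f) (v : Pt) :
    XCompact fun p => fderiv ℝ f p v := by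
  obtain ⟨K, hK, h0⟩ := h
  refine ⟨K, hK, fun p hp => ?_⟩
  have : f =ᶠ[nhds p] fun _ => (0 : ℝ) := by
    have ho : IsOpen {p : Pt | p.1 ∉ K} := hK.isClosed.isOpen_compl.preimage continuous_fst
    filter_upwards [ho.mem_nhds hp] with q hq
    exact h0 q hq
  change fderiv ℝ f p v = 0
  rw [this.fderiv_eq]
  simp

lemma XCompact.integrableOn {f : Pt → ℝ} (h : XCompact f) (hf : Continuous f) :
    IntegrableOn f Dom := by
  obtain ⟨K, hK, h0⟩ := h
  have hc : IntegrableOn f (K ×ˢ Set.Icc 0 (2 * π)) :=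
    hf.continuousOn.integrableOn_compact (hK.prod isCompact_Icc)
  refine hc.of_forall_sdiff_eq_zero measurableSet_Dom fun p hp => h0 p fun hK' => hp.2 ?_
  exact ⟨hK', Set.Ioc_subset_Icc_self hp.1.2⟩

/-- The profile of the partition of unity. -/
def kp (c : ℝ) : ℝ := c / √(c ^ 2 + (1 - c) ^ 2)

lemma kp_denom_pos (c : ℝ) : 0 < c ^ 2 + (1 - c) ^ 2 := by nlinarith [sq_nonneg (2 * c - 1)]

lemma kp_zero : kp 0 = 0 := by simp [kp]

lemma kp_sq_add (c : ℝ) : kp c ^ 2 + kp (1 - c) ^ 2 = 1 := by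
  have h := kp_denom_pos c
  unfold kp
  rw [div_pow, div_pow, Real.sq_sqrt h.le, Real.sq_sqrt (kp_denom_pos _).le]
  rw [show (1 - c) ^ 2 + (1 - (1 - c)) ^ 2 = c ^ 2 + (1 - c) ^ 2 by ring]
  field_simp

lemma contDiff_kp : ContDiff ℝ 1 kp := by
  unfold kp
  refine contDiff_id.div (ContDiff.sqrt (by fun_prop) fun c => (kp_denom_pos c).ne') fun c => ?_
  exact (Real.sqrt_pos.2 (kp_denom_pos c)).ne'

lemma hasDerivAt_kp (c : ℝ) :
    HasDerivAt kp ((1 - c) / (√(c ^ 2 + (1 - c) ^ 2) * (c ^ 2 + (1 - c) ^ 2))) c := by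
  have h := kp_denom_pos c
  have hs := Real.sqrt_pos.2 h
  have h1 : HasDerivAt (fun c : ℝ => c ^ 2 + (1 - c) ^ 2) (2 * c + 2 * (1 - c) * (-1)) c := by
    have := ((hasDerivAt_id c).pow 2).add (((hasDerivAt_id c).const_sub 1).pow 2)
    refine this.congr_deriv (by simp)
  have h2 := (hasDerivAt_id c).div (h1.sqrt h.ne') hs.ne'
  refine h2.congr_deriv ?_
  have hsq := Real.sq_sqrt h.le
  simp only [id]
  rw [div_eq_div_iff (by positivity) (by positivity)]
  set r := √(c ^ 2 + (1 - c) ^ 2)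
  rw [← hsq]
  field_simp
  rw [hsq]
  ring

/-- The cut-off angle. -/
def clampPi (t : ℝ) : ℝ := max (-π) (min t π)

/-- `1 + cos y` on `[-π, π]`, extended by zero. -/
def ccos (y : ℝ) : ℝ := ∫ t in (-π)..y, -Real.sin (clampPi t)

lemma clampPi_of_mem {t : ℝ} (h : |t| ≤ π) : clampPi t = t := by
  obtain ⟨h1, h2⟩ := abs_le.1 h
  rw [clampPi, min_eq_left h2, max_eq_right h1]

lemma sin_clampPi_of_gt {t : ℝ} (h : π ≤ |t|) : Real.sin (clampPi t) = 0 := by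
  rcases le_abs'.1 h with h | h
  · rw [clampPi, min_eq_left (by linarith [pi_pos]), max_eq_left h]; simp
  · rw [clampPi, min_eq_right h, max_eq_right (by linarith [pi_pos])]; simp

lemma continuous_sin_clampPi : Continuous fun t => -Real.sin (clampPi t) := by
  unfold clampPi; fun_prop

lemma hasDerivAt_ccos (y : ℝ) : HasDerivAt ccos (-Real.sin (clampPi y)) y :=
  intervalIntegral.integral_hasDerivAt_right (continuous_sin_clampPi.intervalIntegrable _ _)
    (continuous_sin_clampPi.stronglyMeasurableAtFilter _ _) continuous_sin_clampPi.continuousAt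

lemma contDiff_ccos : ContDiff ℝ 1 ccos := by
  rw [contDiff_one_iff_deriv]
  refine ⟨fun y => (hasDerivAt_ccos y).differentiableAt, ?_⟩
  rw [show deriv ccos = _ from funext fun y => (hasDerivAt_ccos y).deriv]
  exact continuous_sin_clampPi

lemma ccos_of_mem {y : ℝ} (h : |y| ≤ π) : ccos y = 1 + Real.cos y := by
  obtain ⟨h1, h2⟩ := abs_le.1 h
  have : ccos y = ∫ t in (-π)..y, -Real.sin t := by
    refine intervalIntegral.integral_congr fun t ht => ?_
    rw [Set.uIcc_of_le h1] at ht
    rw [clampPi_of_mem (abs_le.2 ⟨ht.1, ht.2.trans h2⟩)]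
  rw [this, intervalIntegral.integral_neg, integral_sin]
  simp [add_comm]

lemma ccos_of_gt {y : ℝ} (h : π ≤ |y|) : ccos y = 0 := by
  have h0 : ∀ a b : ℝ, (∀ t ∈ Set.uIcc a b, π ≤ |t|) → ∫ t in a..b, -Real.sin (clampPi t) = 0 :=
    fun a b hab => by
      rw [intervalIntegral.integral_congr (g := fun _ => 0) fun t ht => by
        simp only [sin_clampPi_of_gt (hab t ht), neg_zero]]
      simp
  rcases le_abs'.1 h with h | h
  · refine h0 _ _ fun t ht => ?_
    rw [Set.uIcc_of_ge h] at ht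
    exact le_abs'.2 (Or.inl ht.2)
  · have h1 : ccos π = 0 := by rw [ccos_of_mem (by rw [abs_of_pos pi_pos])]; simp
    unfold ccos at h1 ⊢
    rw [← intervalIntegral.integral_add_adjacent_intervals (b := π)
      (continuous_sin_clampPi.intervalIntegrable _ _)
      (continuous_sin_clampPi.intervalIntegrable _ _), h1, zero_add]
    refine h0 _ _ fun t ht => ?_
    rw [Set.uIcc_of_le h] at ht
    exact le_abs'.2 (Or.inr ht.1)

lemma integral_eq_of_window {H P : Pt → ℝ} (hP : PeriodicY P) (h1 : ∀ p, |p.2| ≤ π → H p = P p)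
    (h2 : ∀ p, π ≤ |p.2| → H p = 0) : ∫ p, H p = ∫ p in Dom, P p := by
  rw [← hP.setIntegral_strip (-π), ← setIntegral_eq_integral_of_forall_compl_eq_zero
    (s := strip (-π))]
  · refine setIntegral_congr_fun (measurableSet_strip _) fun p hp => h1 p (abs_le.2 ⟨hp.2.1.le, ?_⟩)
    linarith [hp.2.2]
  · intro p hp
    refine h2 p ?_
    by_contra! hlt
    refine hp ⟨Set.mem_univ _, (abs_lt.1 hlt).1, ?_⟩
    linarith [(abs_lt.1 hlt).2]

lemma hasFDerivAt_mul_snd {a : ℝ → ℝ} {a' : ℝ} {z : Pt → ℝ} {p : Pt} (ha : HasDerivAt a a' p.2)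
    (hz : DifferentiableAt ℝ z p) : HasFDerivAt (fun p : Pt => a p.2 * z p)
      (a p.2 • fderiv ℝ z p + z p • (a' • ContinuousLinearMap.snd ℝ (Fin 3 → ℝ) ℝ)) p :=
  (ha.comp_hasFDerivAt p hasFDerivAt_snd).mul hz.hasFDerivAt

lemma gradx_mul_snd {a : ℝ → ℝ} {a' : ℝ} {z : Pt → ℝ} {p : Pt} (ha : HasDerivAt a a' p.2)
    (hz : DifferentiableAt ℝ z p) (i : Fin 3) :
    gradx (fun p : Pt => a p.2 * z p) p i = a p.2 * gradx z p i := by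
  unfold gradx
  rw [(hasFDerivAt_mul_snd ha hz).fderiv]
  simp [ex]

lemma grady_mul_snd {a : ℝ → ℝ} {a' : ℝ} {z : Pt → ℝ} {p : Pt} (ha : HasDerivAt a a' p.2)
    (hz : DifferentiableAt ℝ z p) :
    grady (fun p : Pt => a p.2 * z p) p = a' * z p + a p.2 * grady z p := by
  unfold grady
  rw [(hasFDerivAt_mul_snd ha hz).fderiv]
  simp [ey]
  ring

/-- The derivative of `kp`. -/
def kd (c : ℝ) : ℝ := (1 - c) / (√(c ^ 2 + (1 - c) ^ 2) * (c ^ 2 + (1 - c) ^ 2))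

lemma continuous_kd : Continuous kd := by
  unfold kd
  refine Continuous.div (by fun_prop) (by fun_prop) fun c => ?_
  exact (mul_pos (Real.sqrt_pos.2 (kp_denom_pos c)) (kp_denom_pos c)).ne'

/-- The periodic partition function. -/
def chiP (y : ℝ) : ℝ := kp ((1 + Real.cos y) / 2)

/-- The derivative of `chiP`. -/
def chiD (y : ℝ) : ℝ := kd ((1 + Real.cos y) / 2) * (-Real.sin y / 2)

/-- The compactly supported partition function. -/
def chiC (y : ℝ) : ℝ := kp (ccos y / 2)

lemma continuous_chiP : Continuous chiP := contDiff_kp.continuous.comp (by fun_prop)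

lemma continuous_chiD : Continuous chiD :=
  (continuous_kd.comp (by fun_prop)).mul (by fun_prop)

lemma contDiff_chiC : ContDiff ℝ 1 chiC := contDiff_kp.comp (contDiff_ccos.div_const 2)

lemma chiC_of_mem {y : ℝ} (h : |y| ≤ π) : chiC y = chiP y := by
  rw [chiC, chiP, ccos_of_mem h]

lemma chiC_of_gt {y : ℝ} (h : π ≤ |y|) : chiC y = 0 := by
  rw [chiC, ccos_of_gt h, zero_div, kp_zero]

lemma hasDerivAt_chiC (y : ℝ) :
    HasDerivAt chiC (kd (ccos y / 2) * (-Real.sin (clampPi y) / 2)) y :=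
  (hasDerivAt_kp (ccos y / 2)).comp y ((hasDerivAt_ccos y).div_const 2)

lemma chiP_periodic : PeriodicY fun p : Pt => chiP p.2 := fun x y => by
  simp [chiP]

lemma chiD_periodic : PeriodicY fun p : Pt => chiD p.2 := fun x y => by
  simp [chiD]

lemma window_sobolev {z : Pt → ℝ} (hz : ContDiff ℝ 1 z) (hp : PeriodicY z) (hc : XCompact z)
    {s : ℝ} (hs : 0 < s) :
    8 * √Jc * √s * √(∫ p in Dom, (chiP p.2 * z p) ^ 4) ≤
      (∫ p in Dom, chiP p.2 ^ 2 * gradSqX z p)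
        + s ^ 2 * ∫ p in Dom, (chiD p.2 * z p + chiP p.2 * grady z p) ^ 2 := by
  have hzd : Differentiable ℝ z := hz.differentiable one_ne_zero
  have hcs : HasCompactSupport fun p : Pt => chiC p.2 * z p := by
    obtain ⟨K, hK, h0⟩ := hc
    refine HasCompactSupport.of_support_subset_isCompact
      (hK.prod (isCompact_Icc (a := -π) (b := π)))
      fun p hp => ?_
    by_contra hn
    refine hp ?_
    by_cases hk : p.1 ∈ K
    · have : π ≤ |p.2| := by
        by_contra! hlt
        exact hn ⟨hk, (abs_lt.1 hlt).1.le, (abs_lt.1 hlt).2.le⟩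
      simp only [chiC_of_gt this, zero_mul]
    · simp only [h0 p hk, mul_zero]
  have h := scaled_sobolev (f := fun p : Pt => chiC p.2 * z p)
    ((contDiff_chiC.comp contDiff_snd).mul hz) hcs hs
  have hx : ∀ p i, gradx (fun p : Pt => chiC p.2 * z p) p i = chiC p.2 * gradx z p i := fun p i =>
    gradx_mul_snd (hasDerivAt_chiC p.2) (hzd p) i
  have hy : ∀ p, grady (fun p : Pt => chiC p.2 * z p) p
      = kd (ccos p.2 / 2) * (-Real.sin (clampPi p.2) / 2) * z p + chiC p.2 * grady z p := fun p =>
    grady_mul_snd (hasDerivAt_chiC p.2) (hzd p)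
  have hX : ∀ p, gradSqX (fun p : Pt => chiC p.2 * z p) p = chiC p.2 ^ 2 * gradSqX z p :=
      fun p => by
    simp only [gradSqX, hx, mul_pow, Finset.mul_sum]
  have e1 : ∫ p : Pt, (chiC p.2 * z p) ^ 4 = ∫ p in Dom, (chiP p.2 * z p) ^ 4 :=
    integral_eq_of_window ((chiP_periodic.mul hp).pow 4)
      (fun p h => by rw [chiC_of_mem h]) (fun p h => by rw [chiC_of_gt h]; ring)
  have e2 : ∫ p : Pt, gradSqX (fun p : Pt => chiC p.2 * z p) p
      = ∫ p in Dom, chiP p.2 ^ 2 * gradSqX z p :=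
    integral_eq_of_window ((chiP_periodic.pow 2).mul hp.gradSqX)
      (fun p h => by rw [hX, chiC_of_mem h]) (fun p h => by rw [hX, chiC_of_gt h]; ring)
  have e3 : ∫ p : Pt, grady (fun p : Pt => chiC p.2 * z p) p ^ 2
      = ∫ p in Dom, (chiD p.2 * z p + chiP p.2 * grady z p) ^ 2 :=
    integral_eq_of_window (((chiD_periodic.mul hp).add (chiP_periodic.mul hp.grady)).pow 2)
      (fun p h => by rw [hy, chiC_of_mem h, ccos_of_mem h, clampPi_of_mem h]; rfl)
      (fun p h => by rw [hy, chiC_of_gt h, sin_clampPi_of_gt h]; ring)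
  rwa [e1, e2, e3] at h

lemma partition_sq (y : ℝ) : chiP (y + π) ^ 2 + chiP y ^ 2 = 1 := by
  unfold chiP
  rw [Real.cos_add_pi, show (1 + -Real.cos y) / 2 = 1 - (1 + Real.cos y) / 2 by ring]
  have := kp_sq_add ((1 + Real.cos y) / 2)
  linarith

lemma partition_deriv (y z w : ℝ) :
    (chiD y * z + chiP y * w) ^ 2 + (chiD (y + π) * z + chiP (y + π) * w) ^ 2 ≤ z ^ 2 + w ^ 2 := by
  unfold chiP chiD kp kd
  rw [Real.cos_add_pi, Real.sin_add_pi]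
  set c := (1 + Real.cos y) / 2 with hc
  have e1 : (1 + -Real.cos y) / 2 = 1 - c := by rw [hc]; ring
  have e2 : (Real.sin y / 2) ^ 2 = c * (1 - c) := by
    have := Real.sin_sq_add_cos_sq y
    rw [hc]; nlinarith
  have e3 : (1 - c) ^ 2 + (1 - (1 - c)) ^ 2 = c ^ 2 + (1 - c) ^ 2 := by ring
  rw [e1, e3]
  have hD := kp_denom_pos c
  set D := c ^ 2 + (1 - c) ^ 2 with hDdef
  set r := √D
  have hr : 0 < r := Real.sqrt_pos.2 hD
  have hr2 : r ^ 2 = D := Real.sq_sqrt hD.le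
  set t := Real.sin y / 2 with ht
  have e4 : -Real.sin y / 2 = -t := by rw [ht]; ring
  have e5 : - -Real.sin y / 2 = t := by rw [ht]; ring
  rw [e4, e5]
  have key : ((1 - c) / (r * D) * (-t) * z + c / r * w) ^ 2
      + ((1 - (1 - c)) / (r * D) * t * z + (1 - c) / r * w) ^ 2
      = c * (1 - c) / D ^ 2 * z ^ 2 + w ^ 2 := by
    have h1 : ((1 - c) / (r * D) * (-t) * z + c / r * w) ^ 2
      + ((1 - (1 - c)) / (r * D) * t * z + (1 - c) / r * w) ^ 2
      = (D * t ^ 2 / D ^ 2 * z ^ 2 + D * w ^ 2) / r ^ 2 := by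
      have h2 : ((1 - c) / (r * D) * (-t) * z + c / r * w) ^ 2
        + ((1 - (1 - c)) / (r * D) * t * z + (1 - c) / r * w) ^ 2
        = ((c ^ 2 + (1 - c) ^ 2) * t ^ 2 / D ^ 2 * z ^ 2 + (c ^ 2 + (1 - c) ^ 2) * w ^ 2)
          / r ^ 2 := by
        clear_value D r
        field_simp
        ring
      rw [h2, ← hDdef]
    rw [h1, hr2, e2]
    field_simp
  rw [key]
  have hb : c * (1 - c) / D ^ 2 ≤ 1 := by
    rw [div_le_one (by positivity)]
    have h1 : D = 1 - 2 * (c * (1 - c)) := by rw [hDdef]; ring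
    have h2 : c * (1 - c) ≤ 1 / 4 := by nlinarith [sq_nonneg (2 * c - 1)]
    rw [h1]
    nlinarith
  nlinarith [mul_le_mul_of_nonneg_right hb (sq_nonneg z)]

/-- Lebesgue measure on the fundamental domain. -/
abbrev mD : Measure Pt := volume.restrict Dom

/-- The partial derivative in the direction `dir i`. -/
def pd (u : Pt → ℝ) (i : Fin 4) (p : Pt) : ℝ := fderiv ℝ u p (dir i)

lemma gradSqX_eq (u : Pt → ℝ) (p : Pt) : gradSqX u p =
    pd u 0 p ^ 2 + pd u 1 p ^ 2 + pd u 2 p ^ 2 := by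
  simp [gradSqX, gradx, pd, dir, Fin.sum_univ_three]

lemma grady_eq (u : Pt → ℝ) (p : Pt) : grady u p = pd u 3 p := rfl

lemma gradSq_eq (u : Pt → ℝ) (p : Pt) :
    gradSq u p = pd u 0 p ^ 2 + pd u 1 p ^ 2 + pd u 2 p ^ 2 + pd u 3 p ^ 2 := by
  rw [gradSq, gradSqX_eq, grady_eq]

lemma pd_mul {f g : Pt → ℝ} {p : Pt} (hf : DifferentiableAt ℝ f p) (hg : DifferentiableAt ℝ g p)
    (i : Fin 4) : pd (fun p => f p * g p) i p = f p * pd g i p + pd f i p * g p := by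
  unfold pd
  rw [show (fun p => f p * g p) = f * g from rfl, fderiv_mul hf hg]
  simp [mul_comm]

lemma pd_comp {F : ℝ → ℝ} {F' : ℝ} {f : Pt → ℝ} {p : Pt} (hF : HasDerivAt F F' (f p))
    (hf : DifferentiableAt ℝ f p) (i : Fin 4) : pd (fun p => F (f p)) i p = F' * pd f i p := by
  unfold pd
  have h : HasFDerivAt (fun p => F (f p)) (F' • fderiv ℝ f p) p :=
    hF.comp_hasFDerivAt p hf.hasFDerivAt
  rw [h.fderiv]
  simp

lemma pd_const_mul {f : Pt → ℝ} {p : Pt} (hf : DifferentiableAt ℝ f p) (c : ℝ)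
    (i : Fin 4) : pd (fun p => c * f p) i p = c * pd f i p := by
  unfold pd
  rw [fderiv_const_mul hf]
  simp

lemma pd_comp_add (f : Pt → ℝ) (a : Pt) (i : Fin 4) (p : Pt) :
    pd (fun p => f (p + a)) i p = pd f i (p + a) := by
  unfold pd
  rw [fderiv_comp_add_right]

lemma PeriodicY.pd {f : Pt → ℝ} (hf : PeriodicY f) (i : Fin 4) : PeriodicY (Waveguide.pd f i) :=
  hf.fderiv_apply _

lemma measurable_pd (f : Pt → ℝ) (i : Fin 4) : Measurable (pd f i) :=
  measurable_fderiv_apply_const ℝ f (dir i)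

lemma continuous_pd {f : Pt → ℝ} (hf : ContDiff ℝ 1 f) (i : Fin 4) : Continuous (pd f i) :=
  (hf.continuous_fderiv one_ne_zero).clm_apply continuous_const

lemma pd_eq_zero_of_eventuallyEq_const {f : Pt → ℝ} {p : Pt} {c : ℝ} (h : f =ᶠ[nhds p] fun _ => c)
    (i : Fin 4) : pd f i p = 0 := by
  unfold pd
  rw [h.fderiv_eq]
  simp

section CauchySchwarz

variable {α : Type*} [MeasurableSpace α] {μ : Measure α} {f g : α → ℝ}

lemma memLp_two_mul (hf : MemLp f 2 μ) (hg : MemLp g 2 μ) : Integrable (fun p => f p * g p) μ :=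
  hf.integrable_mul hg

lemma memLp_two_of_sq (hf : AEStronglyMeasurable f μ) (h : Integrable (fun p => f p ^ 2) μ) :
    MemLp f 2 μ := (memLp_two_iff_integrable_sq hf).2 h

lemma integral_mul_sq_le (hf : MemLp f 2 μ) (hg : MemLp g 2 μ) :
    (∫ p, f p * g p ∂μ) ^ 2 ≤ (∫ p, f p ^ 2 ∂μ) * ∫ p, g p ^ 2 ∂μ := by
  have h : ∀ t : ℝ, 0 ≤ (∫ p, f p ^ 2 ∂μ) * (t * t) + (2 * ∫ p, f p * g p ∂μ) * t
      + ∫ p, g p ^ 2 ∂μ := fun t => by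
    have h1 : 0 ≤ ∫ p, (t * f p + g p) ^ 2 ∂μ := integral_nonneg fun p => sq_nonneg _
    have h2 : ∫ p, (t * f p + g p) ^ 2 ∂μ
        = ∫ p, (t ^ 2 * f p ^ 2 + 2 * t * (f p * g p)) + g p ^ 2 ∂μ :=
      integral_congr_ae (ae_of_all _ fun p => by ring)
    have h3 : Integrable (fun p => t ^ 2 * f p ^ 2 + 2 * t * (f p * g p)) μ :=
      (hf.integrable_sq.const_mul _).add ((memLp_two_mul hf hg).const_mul _)
    rw [h2, integral_add h3 hg.integrable_sq, integral_add (hf.integrable_sq.const_mul _)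
      ((memLp_two_mul hf hg).const_mul _), integral_const_mul, integral_const_mul] at h1
    linarith
  have := discrim_le_zero h
  unfold discrim at this
  nlinarith

lemma abs_integral_mul_le (hf : MemLp f 2 μ) (hg : MemLp g 2 μ) :
    |∫ p, f p * g p ∂μ| ≤ √(∫ p, f p ^ 2 ∂μ) * √(∫ p, g p ^ 2 ∂μ) := by
  rw [← Real.sqrt_mul (integral_nonneg fun p => sq_nonneg _)]
  exact Real.abs_le_sqrt (integral_mul_sq_le hf hg)

lemma integral_add_sq (hf : MemLp f 2 μ) (hg : MemLp g 2 μ) :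
    ∫ p, (f p + g p) ^ 2 ∂μ = (∫ p, f p ^ 2 ∂μ) + 2 * (∫ p, f p * g p ∂μ) + ∫ p, g p ^ 2 ∂μ := by
  have h2 : ∫ p, (f p + g p) ^ 2 ∂μ = ∫ p, (f p ^ 2 + 2 * (f p * g p)) + g p ^ 2 ∂μ :=
    integral_congr_ae (ae_of_all _ fun p => by ring)
  have h3 : Integrable (fun p => f p ^ 2 + 2 * (f p * g p)) μ :=
    hf.integrable_sq.add ((memLp_two_mul hf hg).const_mul _)
  rw [h2, integral_add h3 hg.integrable_sq, integral_add hf.integrable_sq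
      ((memLp_two_mul hf hg).const_mul _),
    integral_const_mul]

lemma sqrt_integral_add_sq_le (hf : MemLp f 2 μ) (hg : MemLp g 2 μ) :
    √(∫ p, (f p + g p) ^ 2 ∂μ) ≤ √(∫ p, f p ^ 2 ∂μ) + √(∫ p, g p ^ 2 ∂μ) := by
  refine Real.sqrt_le_iff.2 ⟨by positivity, ?_⟩
  rw [integral_add_sq hf hg, add_sq, Real.sq_sqrt (integral_nonneg fun p => sq_nonneg _),
    Real.sq_sqrt (integral_nonneg fun p => sq_nonneg _)]
  linarith [(le_abs_self _).trans (abs_integral_mul_le hf hg)]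

end CauchySchwarz

lemma hv_compact {z : Pt → ℝ} (hz : ContDiff ℝ 1 z) (hp : PeriodicY z) (hc : XCompact z)
    {s : ℝ} (hs : 0 < s) :
    8 * √Jc * √s * √(∫ p in Dom, z p ^ 4) ≤
      (∫ p in Dom, gradSqX z p) + s ^ 2 * ((∫ p in Dom, pd z 3 p ^ 2) + ∫ p in Dom, z p ^ 2) := by
  have hzc := hz.continuous
  have hgy : Continuous (grady z) := continuous_pd hz 3
  have hgX : Continuous (gradSqX z) := by
    rw [funext (gradSqX_eq z)]
    have := continuous_pd hz
    fun_prop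
  have hcy : XCompact (grady z) := hc.fderiv_apply ey
  have hcX : XCompact (gradSqX z) := by
    obtain ⟨K, hK, h0⟩ := hc
    refine ⟨K, hK, fun p hp => ?_⟩
    have : ∀ i, pd z i p = 0 := fun i => pd_eq_zero_of_eventuallyEq_const (c := 0) (by
      filter_upwards [(hK.isClosed.preimage continuous_fst).isOpen_compl.mem_nhds hp] with q hq
      exact h0 q hq) i
    simp [gradSqX_eq, this]
  have hw := window_sobolev hz hp hc hs
  have hw' := window_sobolev (z := fun p => z (p + (0, -π)))
    (hz.comp (contDiff_id.add contDiff_const)) (hp.comp_add _) (by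
      obtain ⟨K, hK, h0⟩ := hc
      exact ⟨K, hK, fun p hp => h0 _ (by simpa using hp)⟩) hs
  have hX : ∀ p, gradSqX (fun p => z (p + (0, -π))) p = gradSqX z (p + (0, -π)) := fun p => by
    simp only [gradSqX_eq, pd_comp_add]
  have hY : ∀ p, grady (fun p => z (p + (0, -π))) p = grady z (p + (0, -π)) := fun p => by
    simp only [grady_eq, pd_comp_add]
  have hch : ∀ p : Pt, chiP p.2 = chiP ((p + (0, -π)).2 + π) := fun p => by simp
  have hcd : ∀ p : Pt, chiD p.2 = chiD ((p + (0, -π)).2 + π) := fun p => by simp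
  have hPp : PeriodicY fun p : Pt => chiP (p.2 + π) := by
    simpa using chiP_periodic.comp_add (0, π)
  have hDp : PeriodicY fun p : Pt => chiD (p.2 + π) := by
    simpa using chiD_periodic.comp_add (0, π)
  simp only [hX, hY] at hw'
  have t1 := ((hPp.mul hp).pow 4).setIntegral_comp_add (0, -π)
  have t2 := ((hPp.pow 2).mul hp.gradSqX).setIntegral_comp_add (0, -π)
  have t3 := (((hDp.mul hp).add (hPp.mul hp.grady)).pow 2).setIntegral_comp_add (0, -π)
  simp only [← hch, ← hcd] at t1 t2 t3
  rw [t1, t2, t3] at hw'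
  have c1 : Continuous fun p : Pt => chiP p.2 := continuous_chiP.comp continuous_snd
  have c2 : Continuous fun p : Pt => chiP (p.2 + π) := continuous_chiP.comp (by fun_prop)
  have c3 : Continuous fun p : Pt => chiD p.2 := continuous_chiD.comp continuous_snd
  have c4 : Continuous fun p : Pt => chiD (p.2 + π) := continuous_chiD.comp (by fun_prop)
  have m1 : MemLp (fun p : Pt => (chiP p.2 * z p) ^ 2) 2 mD := by
    refine memLp_two_of_sq (by fun_prop) ?_
    exact (hc.mono fun p h => by simp [h]).integrableOn (by fun_prop)
  have m2 : MemLp (fun p : Pt => (chiP (p.2 + π) * z p) ^ 2) 2 mD := by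
    refine memLp_two_of_sq (by fun_prop) ?_
    exact (hc.mono fun p h => by simp [h]).integrableOn (by fun_prop)
  have hM := sqrt_integral_add_sq_le m1 m2
  have e0 : ∀ p : Pt, (chiP p.2 * z p) ^ 2 + (chiP (p.2 + π) * z p) ^ 2 = z p ^ 2 := fun p => by
    rw [mul_pow, mul_pow, ← add_mul, add_comm, partition_sq, one_mul]
  simp only [e0, ← pow_mul, Nat.reduceMul] at hM
  have eX : (∫ p in Dom, chiP p.2 ^ 2 * gradSqX z p)
      + ∫ p in Dom, chiP (p.2 + π) ^ 2 * gradSqX z p = ∫ p in Dom, gradSqX z p := by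
    rw [← integral_add]
    · refine integral_congr_ae (ae_of_all _ fun p => ?_)
      change chiP p.2 ^ 2 * gradSqX z p + chiP (p.2 + π) ^ 2 * gradSqX z p = gradSqX z p
      rw [← add_mul, add_comm, partition_sq, one_mul]
    · exact (hcX.mono fun p h => by simp [h]).integrableOn (by fun_prop)
    · exact (hcX.mono fun p h => by simp [h]).integrableOn (by fun_prop)
  have hcz : XCompact fun p => z p ^ 2 + grady z p ^ 2 := by
    obtain ⟨K, hK, h0⟩ := hc
    obtain ⟨K', hK', h0'⟩ := hcy
    refine ⟨K ∪ K', hK.union hK', fun p hp => ?_⟩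
    rw [Set.mem_union, not_or] at hp
    simp [h0 p hp.1, h0' p hp.2]
  have hz0 : ∀ p, z p ^ 2 + grady z p ^ 2 = 0 → z p = 0 ∧ grady z p = 0 := fun p h =>
    ⟨by nlinarith [sq_nonneg (z p), sq_nonneg (grady z p)],
      by nlinarith [sq_nonneg (z p), sq_nonneg (grady z p)]⟩
  have eY : (∫ p in Dom, (chiD p.2 * z p + chiP p.2 * grady z p) ^ 2)
      + ∫ p in Dom, (chiD (p.2 + π) * z p + chiP (p.2 + π) * grady z p) ^ 2
      ≤ (∫ p in Dom, pd z 3 p ^ 2) + ∫ p in Dom, z p ^ 2 := by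
    have i1 : IntegrableOn (fun p => pd z 3 p ^ 2) Dom :=
      (hcz.mono fun p h => by simp [← grady_eq, (hz0 p h).2]).integrableOn
        ((continuous_pd hz 3).pow 2)
    have i2 : IntegrableOn (fun p => z p ^ 2) Dom :=
      (hcz.mono fun p h => by simp [(hz0 p h).1]).integrableOn (by fun_prop)
    have i3 : IntegrableOn (fun p => (chiD p.2 * z p + chiP p.2 * grady z p) ^ 2) Dom :=
      (hcz.mono fun p h => by simp [(hz0 p h).1, (hz0 p h).2]).integrableOn (by fun_prop)
    have i4 : IntegrableOn
        (fun p => (chiD (p.2 + π) * z p + chiP (p.2 + π) * grady z p) ^ 2) Dom :=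
      (hcz.mono fun p h => by simp [(hz0 p h).1, (hz0 p h).2]).integrableOn (by fun_prop)
    rw [← integral_add i3 i4, ← integral_add i1 i2]
    refine integral_mono (i3.add i4) (i1.add i2) fun p => ?_
    have := partition_deriv p.2 (z p) (grady z p)
    rw [← grady_eq]
    linarith
  have h8 : 0 ≤ 8 * √Jc * √s := by positivity
  have h9 := mul_le_mul_of_nonneg_left hM h8
  have h10 := mul_le_mul_of_nonneg_left eY (sq_nonneg s)
  rw [mul_add] at h9 h10
  linarith

lemma bounded_of_xCompact {f : Pt → ℝ} (hf : Continuous f) (hp : PeriodicY f) (hc : XCompact f) :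
    ∃ C, 0 ≤ C ∧ ∀ p, |f p| ≤ C := by
  obtain ⟨K, hK, h0⟩ := hc
  obtain ⟨C, hC⟩ := (hK.prod (isCompact_Icc (a := (0 : ℝ))
    (b := 2 * π))).exists_bound_of_continuousOn
    hf.continuousOn
  refine ⟨|C|, abs_nonneg _, fun p => ?_⟩
  by_cases hk : p.1 ∈ K
  · have hper : Function.Periodic (fun y => f (p.1, y)) (2 * π) := fun y => hp p.1 y
    obtain ⟨y, hy, he⟩ := hper.exists_mem_Ico₀ (by positivity) p.2
    change f p = f (p.1, y) at he
    rw [he]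
    exact (hC (p.1, y) ⟨hk, hy.1, hy.2.le⟩).trans (le_abs_self C)
  · simp [h0 p hk]

/-- The scaling factors of the partial derivatives under `scal a 1`. -/
def sc (a : ℝ) : Fin 4 → ℝ := ![a, a, a, 1]

lemma pd_scal {f : Pt → ℝ} (hf : Differentiable ℝ f) (a : ℝ) (p : Pt) (i : Fin 4) :
    pd (fun p => f (scal a 1 p)) i p = sc a i * pd f i (scal a 1 p) := by
  have hx := gradx_scal hf a 1 p
  have hy := grady_scal hf a 1 p
  unfold gradx at hx
  unfold grady at hy
  unfold pd
  fin_cases i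
  · exact hx 0
  · exact hx 1
  · exact hx 2
  · exact hy

lemma contDiff_pd {f : Pt → ℝ} {n m : WithTop ℕ∞} (hf : ContDiff ℝ n f) (h : m + 1 ≤ n)
    (i : Fin 4) :
    ContDiff ℝ m (pd f i) :=
  (hf.fderiv_right h).clm_apply contDiff_const

/-- A fixed cutoff in the `x` variables. -/
def bumpX : ContDiffBump (0 : Fin 3 → ℝ) := ⟨1, 2, one_pos, one_lt_two⟩

/-- Rescaled cutoffs in the `x` variables. -/
def xcut (n : ℕ) (p : Pt) : ℝ := bumpX ((n + 1 : ℝ)⁻¹ • p.1)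

lemma xcut_eq (n : ℕ) : xcut n = fun p => (fun q : Pt => bumpX q.1) (scal (n + 1 : ℝ)⁻¹ 1 p) := rfl

lemma contDiff_bumpX {n : ℕ∞} : ContDiff ℝ n fun q : Pt => bumpX q.1 :=
  bumpX.contDiff.comp contDiff_fst

lemma contDiff_xcut (k : ℕ) {n : ℕ∞} : ContDiff ℝ n (xcut k) :=
  contDiff_bumpX.comp (contDiff_scal (k + 1 : ℝ)⁻¹ 1)

lemma xcut_nonneg (n : ℕ) (p : Pt) : 0 ≤ xcut n p := bumpX.nonneg

lemma xcut_le_one (n : ℕ) (p : Pt) : xcut n p ≤ 1 := bumpX.le_one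

lemma xcut_periodic (n : ℕ) : PeriodicY (xcut n) := fun _ _ => rfl

lemma xcut_xCompact (n : ℕ) : XCompact (xcut n) := by
  refine ⟨Metric.closedBall 0 (2 * (n + 1)), isCompact_closedBall _ _, fun p hp => ?_⟩
  refine bumpX.zero_of_le_dist ?_
  rw [Metric.mem_closedBall, dist_zero_right, not_le] at hp
  rw [dist_zero_right, norm_smul, norm_inv, Real.norm_of_nonneg (by positivity : (0:ℝ) ≤ n + 1),
    inv_mul_eq_div, le_div_iff₀ (by positivity)]
  exact hp.le

lemma xcut_tendsto (p : Pt) : Tendsto (fun n => xcut n p) atTop (nhds 1) := by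
  refine tendsto_const_nhds.congr' ?_
  filter_upwards [eventually_ge_atTop ⌈‖p.1‖⌉₊] with n hn
  refine (bumpX.one_of_mem_closedBall ?_).symm
  rw [Metric.mem_closedBall, dist_zero_right, norm_smul, norm_inv,
    Real.norm_of_nonneg (by positivity : (0:ℝ) ≤ n + 1), inv_mul_eq_div,
      div_le_iff₀ (by positivity)]
  have := Nat.ceil_le.1 hn
  change _ ≤ 1 * _
  linarith

lemma pd_bumpX_three : pd (fun q : Pt => bumpX q.1) 3 = fun _ => 0 := by
  funext p
  unfold pd
  have h : HasFDerivAt (fun q : Pt => bumpX q.1) _ p :=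
    ((bumpX.contDiff (n := 1)).differentiable one_ne_zero p.1).hasFDerivAt.comp p hasFDerivAt_fst
  rw [h.fderiv]
  simp [dir, ey]

lemma xCompact_bumpX : XCompact fun q : Pt => bumpX q.1 := by
  refine (xcut_xCompact 0).mono fun p h => ?_
  simpa [xcut] using h

lemma pd_xcut (n : ℕ) (i : Fin 4) (p : Pt) :
    pd (xcut n) i p = (n + 1 : ℝ)⁻¹ * pd (fun q : Pt => bumpX q.1) i (scal (n + 1 : ℝ)⁻¹ 1 p) := by
  rw [xcut_eq, pd_scal ((contDiff_bumpX (n := 1)).differentiable one_ne_zero)]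
  by_cases h : i = 3
  · subst h; simp [pd_bumpX_three]
  · congr 1
    fin_cases i <;> simp_all [sc]

lemma pd_pd_xcut (n : ℕ) (i : Fin 4) (p : Pt) :
    pd (pd (xcut n) i) i p
      = ((n + 1 : ℝ)⁻¹) ^ 2 * pd (pd (fun q : Pt => bumpX q.1) i) i (scal (n + 1 : ℝ)⁻¹ 1 p) := by
  have hd : Differentiable ℝ (pd (fun q : Pt => bumpX q.1) i) :=
    (contDiff_pd (contDiff_bumpX (n := 2)) (m := 1) (by norm_num) i).differentiable one_ne_zero
  rw [show pd (xcut n) i = _ from funext (pd_xcut n i), pd_const_mul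
    (f := fun p => pd (fun q : Pt => bumpX q.1) i (scal (n + 1 : ℝ)⁻¹ 1 p))
    ((hd _).comp p (hasFDerivAt_scal _ _ p).differentiableAt), pd_scal hd]
  by_cases h : i = 3
  · subst h; simp [pd_bumpX_three, pd]
  · rw [← mul_assoc, sq]
    congr 2
    fin_cases i <;> simp_all [sc]

lemma exists_bound_pd_xcut : ∃ C, 0 ≤ C ∧ ∀ n i p, |pd (xcut n) i p| ≤ C * (n + 1 : ℝ)⁻¹ ∧
    |pd (pd (xcut n) i) i p| ≤ C * ((n + 1 : ℝ)⁻¹) ^ 2 := by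
  have hper : PeriodicY fun q : Pt => bumpX q.1 := fun _ _ => rfl
  have h1 : ∀ i, ∃ C, 0 ≤ C ∧ ∀ p, |pd (fun q : Pt => bumpX q.1) i p| ≤ C := fun i =>
    bounded_of_xCompact (continuous_pd contDiff_bumpX i) (hper.pd i) (xCompact_bumpX.fderiv_apply _)
  have h2 : ∀ i, ∃ C, 0 ≤ C ∧ ∀ p, |pd (pd (fun q : Pt => bumpX q.1) i) i p| ≤ C := fun i =>
    bounded_of_xCompact
      (continuous_pd (contDiff_pd (contDiff_bumpX (n := 2)) (by norm_num) i) i)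
      ((hper.pd i).pd i) ((xCompact_bumpX.fderiv_apply _).fderiv_apply _)
  choose C1 hC1 h1 using h1
  choose C2 hC2 h2 using h2
  have hs1 : ∀ i, C1 i ≤ ∑ j, C1 j := fun i =>
    Finset.single_le_sum (fun j _ => hC1 j) (Finset.mem_univ i)
  have hs2 : ∀ i, C2 i ≤ ∑ j, C2 j := fun i =>
    Finset.single_le_sum (fun j _ => hC2 j) (Finset.mem_univ i)
  have hn1 : 0 ≤ ∑ j, C1 j := Finset.sum_nonneg fun j _ => hC1 j
  have hn2 : 0 ≤ ∑ j, C2 j := Finset.sum_nonneg fun j _ => hC2 j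
  refine ⟨(∑ j, C1 j) + ∑ j, C2 j, by positivity, fun n i p => ?_⟩
  have hn : (0 : ℝ) ≤ (n + 1 : ℝ)⁻¹ := by positivity
  rw [pd_xcut, pd_pd_xcut, abs_mul, abs_mul, abs_of_nonneg hn, abs_of_nonneg (pow_nonneg hn 2)]
  constructor
  · rw [mul_comm]
    exact mul_le_mul_of_nonneg_right (by linarith [h1 i (scal (n + 1 : ℝ)⁻¹ 1 p), hs1 i]) hn
  · rw [mul_comm]
    exact mul_le_mul_of_nonneg_right (by linarith [h2 i (scal (n + 1 : ℝ)⁻¹ 1 p), hs2 i])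
      (sq_nonneg _)

/-- Continuously differentiable functions of class `H¹`. -/
structure CK (u : Pt → ℝ) : Prop where
  smooth : ContDiff ℝ 1 u
  per : PeriodicY u
  memLp : MemLp u 2 mD
  memLpD : ∀ i, MemLp (pd u i) 2 mD

lemma tendsto_integral_xcut_mul_sq {u : Pt → ℝ} (hu : MemLp u 2 mD) :
    Tendsto (fun n => ∫ p in Dom, (xcut n p * u p) ^ 2) atTop (nhds (∫ p in Dom, u p ^ 2)) := by
  refine tendsto_integral_of_dominated_convergence (fun p => u p ^ 2)
    (fun n => (((contDiff_xcut n (n := 0)).continuous.aestronglyMeasurable.mul hu.1).pow 2))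
    hu.integrable_sq (fun n => ae_of_all _ fun p => ?_) (ae_of_all _ fun p => ?_)
  · rw [Real.norm_of_nonneg (sq_nonneg _), mul_pow]
    exact mul_le_of_le_one_left (sq_nonneg _) (pow_le_one₀ (xcut_nonneg n p) (xcut_le_one n p))
  · simpa using ((xcut_tendsto p).mul_const (u p)).pow 2

lemma CK.tendsto_integral_pd_xcut_mul {u : Pt → ℝ} (hu : CK u) (i : Fin 4) :
    Tendsto (fun n => ∫ p in Dom, pd (fun q => xcut n q * u q) i p ^ 2) atTop
      (nhds (∫ p in Dom, pd u i p ^ 2)) := by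
  obtain ⟨C, hC0, hC⟩ := exists_bound_pd_xcut
  have hud := hu.smooth.differentiable one_ne_zero
  have e : ∀ n p, pd (fun q => xcut n q * u q) i p = xcut n p * pd u i p + pd (xcut n) i p * u p :=
    fun n p => pd_mul ((contDiff_xcut n (n := 1)).differentiable one_ne_zero p) (hud p) i
  simp only [e]
  refine tendsto_integral_of_dominated_convergence
    (fun p => 2 * pd u i p ^ 2 + 2 * C ^ 2 * u p ^ 2) (fun n => ?_)
    (((hu.memLpD i).integrable_sq.const_mul _).add (hu.memLp.integrable_sq.const_mul _))
    (fun n => ae_of_all _ fun p => ?_) (ae_of_all _ fun p => ?_)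
  · have c1 := (contDiff_xcut n (n := 1)).continuous
    have c2 := continuous_pd (contDiff_xcut n (n := 1)) i
    have c3 := continuous_pd hu.smooth i
    have c4 := hu.smooth.continuous
    exact Continuous.aestronglyMeasurable (by fun_prop)
  · rw [Real.norm_of_nonneg (sq_nonneg _)]
    have h1 : (xcut n p * pd u i p) ^ 2 ≤ pd u i p ^ 2 := by
      rw [mul_pow]
      exact mul_le_of_le_one_left (sq_nonneg _) (pow_le_one₀ (xcut_nonneg n p) (xcut_le_one n p))
    have h2 : (pd (xcut n) i p * u p) ^ 2 ≤ C ^ 2 * u p ^ 2 := by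
      rw [mul_pow]
      refine mul_le_mul_of_nonneg_right (sq_le_sq' ?_ ?_) (sq_nonneg _)
      · have := (hC n i p).1
        have h3 : C * (n + 1 : ℝ)⁻¹ ≤ C :=
          mul_le_of_le_one_right hC0 (inv_le_one_of_one_le₀ (by linarith [n.cast_nonneg (α := ℝ)]))
        linarith [(abs_le.1 (this.trans h3)).1]
      · have := (hC n i p).1
        have h3 : C * (n + 1 : ℝ)⁻¹ ≤ C :=
          mul_le_of_le_one_right hC0 (inv_le_one_of_one_le₀ (by linarith [n.cast_nonneg (α := ℝ)]))
        linarith [(abs_le.1 (this.trans h3)).2]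
    nlinarith [sq_nonneg (xcut n p * pd u i p - pd (xcut n) i p * u p)]
  · have h1 : Tendsto (fun n => pd (xcut n) i p) atTop (nhds 0) := by
      refine squeeze_zero_norm (fun n => (hC n i p).1) ?_
      simpa using (tendsto_one_div_add_atTop_nhds_zero_nat (𝕜 := ℝ)).const_mul C
    simpa using (((xcut_tendsto p).mul_const (pd u i p)).add (h1.mul_const (u p))).pow 2

lemma integral_gradSqX {u : Pt → ℝ} (h : ∀ i, MemLp (pd u i) 2 mD) :
    ∫ p in Dom, gradSqX u p
      = (∫ p in Dom, pd u 0 p ^ 2) + (∫ p in Dom, pd u 1 p ^ 2) + ∫ p in Dom, pd u 2 p ^ 2 := by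
  have h01 : Integrable (fun p => pd u 0 p ^ 2 + pd u 1 p ^ 2) mD :=
    (h 0).integrable_sq.add (h 1).integrable_sq
  simp only [gradSqX_eq]
  rw [integral_add h01 (h 2).integrable_sq, integral_add (h 0).integrable_sq (h 1).integrable_sq]

/-- The four Dirichlet integrals, the `x` part. -/
def AF (U : Fin 4 → Pt → ℝ) : ℝ :=
  (∫ p in Dom, U 0 p ^ 2) + (∫ p in Dom, U 1 p ^ 2) + ∫ p in Dom, U 2 p ^ 2

/-- The Dirichlet integral of the `y` derivative. -/
def BF (U : Fin 4 → Pt → ℝ) : ℝ := ∫ p in Dom, U 3 p ^ 2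

/-- The mass. -/
def MF (u : Pt → ℝ) : ℝ := ∫ p in Dom, u p ^ 2

/-- The quartic integral. -/
def NF (u : Pt → ℝ) : ℝ := ∫ p in Dom, u p ^ 4

lemma sq_integral_le_of_xcut {u : Pt → ℝ} (hu : CK u) {s : ℝ} (hs : 0 < s) (n : ℕ) :
    CK (fun q => xcut n q * u q) ∧
    Integrable (fun p => (xcut n p * u p) ^ 4) mD ∧
    8 * √Jc * √s * √(∫ p in Dom, (xcut n p * u p) ^ 4) ≤ AF (pd fun q => xcut n q * u q)
      + s ^ 2 * (BF (pd fun q => xcut n q * u q) + MF fun q => xcut n q * u q) := by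
  have hsm : ContDiff ℝ 1 (fun q => xcut n q * u q) := (contDiff_xcut n).mul hu.smooth
  have hper : PeriodicY (fun q => xcut n q * u q) := (xcut_periodic n).mul hu.per
  have hc : XCompact (fun q => xcut n q * u q) := (xcut_xCompact n).mono fun p h => by simp [h]
  have hcont := hsm.continuous
  have hD : ∀ i, MemLp (pd (fun q => xcut n q * u q) i) 2 mD := fun i => by
    have := continuous_pd hsm i
    refine memLp_two_of_sq this.aestronglyMeasurable ?_
    have hc2 : XCompact (pd (fun q => xcut n q * u q) i) := hc.fderiv_apply (dir i)
    exact (hc2.mono fun p h => by simp [h]).integrableOn (by fun_prop)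
  refine ⟨⟨hsm, hper, ?_, hD⟩, ?_, ?_⟩
  · refine memLp_two_of_sq hcont.aestronglyMeasurable ?_
    exact (hc.mono fun p h => by simp [h]).integrableOn (by fun_prop)
  · exact (hc.mono fun p h => by simp [h]).integrableOn (by fun_prop)
  · have := hv_compact hsm hper hc hs
    rwa [integral_gradSqX hD] at this

lemma CK.l4_hv {u : Pt → ℝ} (hu : CK u) {s : ℝ} (hs : 0 < s) :
    Integrable (fun p => u p ^ 4) mD ∧
    8 * √Jc * √s * √(NF u) ≤ AF (pd u) + s ^ 2 * (BF (pd u) + MF u) := by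
  have hk : 0 < 8 * √Jc * √s := by
    have := Real.sqrt_pos.2 Jc_pos
    have := Real.sqrt_pos.2 hs
    positivity
  have hlim : Tendsto (fun n => AF (pd fun q => xcut n q * u q)
      + s ^ 2 * (BF (pd fun q => xcut n q * u q) + MF fun q => xcut n q * u q)) atTop
      (nhds (AF (pd u) + s ^ 2 * (BF (pd u) + MF u))) :=
    (((hu.tendsto_integral_pd_xcut_mul 0).add (hu.tendsto_integral_pd_xcut_mul 1)).add
      (hu.tendsto_integral_pd_xcut_mul 2)).add
      (((hu.tendsto_integral_pd_xcut_mul 3).add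
        (tendsto_integral_xcut_mul_sq hu.memLp)).const_mul _)
  set R := AF (pd u) + s ^ 2 * (BF (pd u) + MF u) with hR
  have hR0 : 0 ≤ R := by
    have : ∀ f : Pt → ℝ, 0 ≤ ∫ p in Dom, f p ^ 2 := fun f => integral_nonneg fun p => sq_nonneg _
    have h1 := this (pd u 0)
    have h2 := this (pd u 1)
    have h3 := this (pd u 2)
    have h4 := this (pd u 3)
    have h5 := this u
    rw [hR]
    unfold AF BF MF
    positivity
  have h := integral_le_of_fatou (μ := mD) (f := fun n p => (xcut n p * u p) ^ 4)
    (g := fun p => u p ^ 4)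
    (c := fun n => ((AF (pd fun q => xcut n q * u q)
      + s ^ 2 * (BF (pd fun q => xcut n q * u q) + MF fun q => xcut n q * u q))
        / (8 * √Jc * √s)) ^ 2) (C := (R / (8 * √Jc * √s)) ^ 2)
    (fun n => (sq_integral_le_of_xcut hu hs n).2.1) (fun n p => by positivity)
    (fun n => by
      have h1 := (sq_integral_le_of_xcut hu hs n).2.2
      rw [mul_comm, ← le_div_iff₀ hk] at h1
      exact (Real.sqrt_le_iff.1 h1).2)
    ((hlim.div_const _).pow 2)
    (ae_of_all _ fun p => by simpa using ((xcut_tendsto p).mul_const (u p)).pow 4)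
  refine ⟨h.1, ?_⟩
  rw [mul_comm, ← le_div_iff₀ hk]
  exact Real.sqrt_le_iff.2 ⟨by positivity, h.2⟩

/-- Periodic, measurable, square integrable functions. -/
structure L2P (f : Pt → ℝ) : Prop where
  per : PeriodicY f
  meas : Measurable f
  memLp : MemLp f 2 mD

lemma L2P.sq_integrable {f : Pt → ℝ} (h : L2P f) : Integrable (fun p => f p ^ 2) mD :=
  h.memLp.integrable_sq

lemma L2P.add {f g : Pt → ℝ} (hf : L2P f) (hg : L2P g) : L2P fun p => f p + g p :=
  ⟨hf.per.add hg.per, hf.meas.add hg.meas, hf.memLp.add hg.memLp⟩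

lemma L2P.sub {f g : Pt → ℝ} (hf : L2P f) (hg : L2P g) : L2P fun p => f p - g p :=
  ⟨hf.per.sub hg.per, hf.meas.sub hg.meas, hf.memLp.sub hg.memLp⟩

lemma L2P.const_mul {f : Pt → ℝ} (hf : L2P f) (c : ℝ) : L2P fun p => c * f p :=
  ⟨hf.per.const_mul c, hf.meas.const_mul c, hf.memLp.const_mul c⟩

lemma memLp_comp_add {f : Pt → ℝ} (hp : PeriodicY f) (hm : Measurable f) (h : MemLp f 2 mD)
    (a : Pt) :
    MemLp (fun p => f (p + a)) 2 mD :=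
  memLp_two_of_sq (hm.comp (measurable_id.add_const a)).aestronglyMeasurable
    ((hp.pow 2).integrableOn_comp_add a h.integrable_sq)

lemma L2P.comp_add {f : Pt → ℝ} (hf : L2P f) (a : Pt) : L2P fun p => f (p + a) :=
  ⟨hf.per.comp_add a, hf.meas.comp (measurable_id.add_const a),
    memLp_comp_add hf.per hf.meas hf.memLp a⟩

lemma L2P.strip {f : Pt → ℝ} (hf : L2P f) (a : ℝ) : MemLp f 2 (volume.restrict (strip a)) :=
  memLp_two_of_sq hf.meas.aestronglyMeasurable (((hf.per.pow 2).integrableOn_strip_iff a).2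
    hf.sq_integrable)

lemma strip_mem_nhds (p : Pt) : strip (p.2 - π) ∈ nhds p := by
  have : Set.univ ×ˢ Set.Ioc (p.2 - π) (p.2 - π + 2 * π) ∈ nhds (p.1, p.2) :=
    prod_mem_nhds Filter.univ_mem (Ioc_mem_nhds (by linarith [pi_pos]) (by linarith [pi_pos]))
  exact this

lemma PeriodicY.locallyIntegrable {f : Pt → ℝ} (hf : PeriodicY f) (h : IntegrableOn f Dom) :
    LocallyIntegrable f := fun p =>
  ⟨strip (p.2 - π), strip_mem_nhds p, (hf.integrableOn_strip_iff _).2 h⟩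

lemma L2P.locallyIntegrable {f : Pt → ℝ} (hf : L2P f) : LocallyIntegrable f := fun p => by
  refine ⟨Metric.closedBall p 1 ∩ Waveguide.strip (p.2 - π),
    Filter.inter_mem (Metric.closedBall_mem_nhds p one_pos) (strip_mem_nhds p), ?_⟩
  have h : MemLp f 2 (volume.restrict (Metric.closedBall p 1 ∩ Waveguide.strip (p.2 - π))) :=
    (hf.strip (p.2 - π)).mono_measure (Measure.restrict_mono Set.inter_subset_right le_rfl)
  have : IsFiniteMeasure (volume.restrict (Metric.closedBall p 1 ∩ Waveguide.strip (p.2 - π))) :=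
    ⟨by
      rw [Measure.restrict_apply_univ]
      exact (measure_mono Set.inter_subset_left).trans_lt
        (isCompact_closedBall p 1).measure_lt_top⟩
  exact h.integrable one_le_two

/-- Continuous kernels supported in the unit ball. -/
structure Ker (k : Pt → ℝ) : Prop where
  cont : Continuous k
  supp : ∀ ζ, 1 < ‖ζ‖ → k ζ = 0

lemma Ker.hasCompactSupport {k : Pt → ℝ} (hk : Ker k) : HasCompactSupport k :=
  HasCompactSupport.of_support_subset_isCompact (isCompact_closedBall 0 1) fun p hp => by
    by_contra h
    exact hp (hk.supp p (by simpa using h))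

lemma Ker.integrable {k : Pt → ℝ} (hk : Ker k) : Integrable k :=
  hk.cont.integrable_of_hasCompactSupport hk.hasCompactSupport

lemma Ker.sq {k : Pt → ℝ} (hk : Ker k) : Ker fun ζ => k ζ ^ 2 :=
  ⟨hk.cont.pow 2, fun ζ h => by rw [hk.supp ζ h]; simp⟩

lemma Ker.pd {k : Pt → ℝ} (hk : Ker k) (h : ContDiff ℝ 1 k) (i : Fin 4) : Ker (pd k i) := by
  refine ⟨continuous_pd h i, fun ζ hζ => pd_eq_zero_of_eventuallyEq_const (c := 0) ?_ i⟩
  filter_upwards [(isOpen_lt continuous_const continuous_norm).mem_nhds hζ] with q hq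
  exact hk.supp q hq

/-- Convolution. -/
def cv (k f : Pt → ℝ) (p : Pt) : ℝ := ∫ ζ, k ζ * f (p - ζ)

lemma cv_eq_convolution (k f : Pt → ℝ) :
    cv k f = convolution k f (ContinuousLinearMap.lsmul ℝ ℝ) volume := rfl

lemma cv_eq_swap (k f : Pt → ℝ) (p : Pt) : cv k f p = ∫ z, k (p - z) * f z := by
  rw [cv, ← integral_sub_left_eq_self _ volume p]
  simp

lemma PeriodicY.cv {f : Pt → ℝ} (hf : PeriodicY f) (k : Pt → ℝ) : PeriodicY (cv k f) :=
    fun x y => by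
  unfold Waveguide.cv
  congr 1
  ext ζ
  rw [show ((x, y + 2 * π) : Pt) - ζ = (x - ζ.1, y - ζ.2 + 2 * π) by ext <;> simp; ring, hf]
  rfl

lemma continuous_cv {k f : Pt → ℝ} (hk : Ker k) (hf : LocallyIntegrable f) : Continuous (cv k f) :=
  hk.hasCompactSupport.continuous_convolution_left (ContinuousLinearMap.lsmul ℝ ℝ) hk.cont hf

lemma integrable_cv_integrand {k f : Pt → ℝ} (hk : Ker k) (hf : LocallyIntegrable f) (p : Pt) :
    Integrable fun z => k (p - z) * f z :=
  hf.integrable_smul_left_of_hasCompactSupport (hk.cont.comp (by fun_prop))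
    (hk.hasCompactSupport.comp_homeomorph (Homeomorph.subLeft p))

lemma integrable_cv_integrand' {k f : Pt → ℝ} (hk : Ker k) (hf : LocallyIntegrable f) (p : Pt) :
    Integrable fun ζ => k ζ * f (p - ζ) := by
  have := (integrable_cv_integrand hk hf p).comp_sub_left p
  simpa using this

lemma abs_cv_le {k f : Pt → ℝ} (hk : Ker k) (hf : L2P f) (p : Pt) :
    |cv k f p| ≤ √(∫ ζ, k ζ ^ 2) * √(MF f) := by
  have h0 : ∀ z ∉ strip (p.2 - π), k (p - z) * f z = 0 := fun z hz => by
    rw [hk.supp, zero_mul]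
    by_contra! h
    have h1 : |p.2 - z.2| ≤ 1 := (norm_snd_le (p - z)).trans h
    have h3 := pi_gt_three
    rw [abs_le] at h1
    refine hz ⟨Set.mem_univ _, ?_, ?_⟩ <;> linarith
  rw [cv_eq_swap, ← setIntegral_eq_integral_of_forall_compl_eq_zero h0]
  have hsq := hk.sq.integrable.comp_sub_left p
  have hk2 : MemLp (fun z => k (p - z)) 2 (volume.restrict (strip (p.2 - π))) :=
    memLp_two_of_sq (hk.cont.comp (by fun_prop)).aestronglyMeasurable hsq.integrableOn
  refine (abs_integral_mul_le hk2 (hf.strip _)).trans ?_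
  refine mul_le_mul (Real.sqrt_le_sqrt ?_) (Real.sqrt_le_sqrt ?_) (by positivity) (by positivity)
  · rw [← integral_sub_left_eq_self (fun ζ => k ζ ^ 2) volume p]
    exact setIntegral_le_integral hsq (ae_of_all _ fun z => sq_nonneg _)
  · exact ((hf.per.pow 2).setIntegral_strip _).le

lemma integrable_prod_cv {k f : Pt → ℝ} (hk : Integrable k) (hp : PeriodicY f)
    (hm : Measurable f) (hf : IntegrableOn f Dom) (hkm : Measurable k) :
    Integrable (fun q : Pt × Pt => k q.2 * f (q.1 - q.2)) (mD.prod volume) := by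
  have hmeas : Measurable fun q : Pt × Pt => k q.2 * f (q.1 - q.2) :=
    (hkm.comp measurable_snd).mul (hm.comp (measurable_fst.sub measurable_snd))
  rw [integrable_prod_iff' hmeas.aestronglyMeasurable]
  constructor
  · refine ae_of_all _ fun ζ => ?_
    have := (hp.integrableOn_comp_add (-ζ) hf).const_mul (k ζ)
    simpa [← sub_eq_add_neg] using this
  · refine (hk.norm.mul_const (∫ p in Dom, |f p|)).congr (ae_of_all _ fun ζ => ?_)
    have := (hp.comp (|·|)).setIntegral_comp_add (-ζ)
    simp only [norm_mul, ← sub_eq_add_neg] at this ⊢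
    rw [integral_const_mul, ← this]
    rfl

lemma setIntegral_cv {k f : Pt → ℝ} (hk : Ker k) (hp : PeriodicY f)
    (hm : Measurable f) (hf : IntegrableOn f Dom) :
    IntegrableOn (cv k f) Dom ∧ ∫ p in Dom, cv k f p = (∫ ζ, k ζ) * ∫ p in Dom, f p := by
  have h := integrable_prod_cv hk.integrable hp hm hf hk.cont.measurable
  refine ⟨h.integral_prod_left, ?_⟩
  unfold cv
  rw [integral_integral_swap (f := fun p ζ => k ζ * f (p - ζ)) h, ← integral_mul_const]
  congr 1
  ext ζ
  have := hp.setIntegral_comp_add (-ζ)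
  simp only [← sub_eq_add_neg] at this
  rw [integral_const_mul, this]

/-- Probability kernels. -/
structure Mol (k : Pt → ℝ) : Prop extends Ker k where
  nonneg : ∀ ζ, 0 ≤ k ζ
  int : ∫ ζ, k ζ = 1
  even : ∀ ζ, k (-ζ) = k ζ

lemma Mol.jensen {k f : Pt → ℝ} (hk : Mol k) (hf : L2P f) (p : Pt) :
    cv k f p ^ 2 ≤ cv k (fun q => f q ^ 2) p := by
  have i1 := integrable_cv_integrand' hk.toKer hf.locallyIntegrable p
  have i2 := integrable_cv_integrand' hk.toKer ((hf.per.pow 2).locallyIntegrable hf.sq_integrable) p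
  have h : 0 ≤ ∫ ζ, k ζ * (f (p - ζ) - cv k f p) ^ 2 :=
    integral_nonneg fun ζ => mul_nonneg (hk.nonneg ζ) (sq_nonneg _)
  have e : ∫ ζ, k ζ * (f (p - ζ) - cv k f p) ^ 2
      = ∫ ζ, (k ζ * f (p - ζ) ^ 2 - 2 * cv k f p * (k ζ * f (p - ζ))) + cv k f p ^ 2 * k ζ :=
    integral_congr_ae (ae_of_all _ fun ζ => by ring)
  have i3 : Integrable fun ζ => k ζ * f (p - ζ) ^ 2 - 2 * cv k f p * (k ζ * f (p - ζ)) :=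
    i2.sub (i1.const_mul _)
  rw [e, integral_add i3 (hk.integrable.const_mul _), integral_sub i2 (i1.const_mul _),
    integral_const_mul, integral_const_mul, hk.int] at h
  change 0 ≤ cv k (fun q => f q ^ 2) p - 2 * cv k f p * cv k f p + _ at h
  nlinarith

lemma L2P.cv {k f : Pt → ℝ} (hk : Mol k) (hf : L2P f) : L2P (cv k f) ∧ MF (cv k f) ≤ MF f := by
  have hc := continuous_cv hk.toKer hf.locallyIntegrable
  have h := setIntegral_cv hk.toKer (hf.per.pow 2) (hf.meas.pow_const 2) hf.sq_integrable
  have hi : Integrable (fun p => Waveguide.cv k f p ^ 2) mD := by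
    refine h.1.mono' (hc.pow 2).aestronglyMeasurable (ae_of_all _ fun p => ?_)
    rw [Real.norm_of_nonneg (sq_nonneg _)]
    exact hk.jensen hf p
  refine ⟨⟨hf.per.cv k, hc.measurable, memLp_two_of_sq hc.aestronglyMeasurable hi⟩, ?_⟩
  rw [hk.int, one_mul] at h
  exact (integral_mono hi h.1 (hk.jensen hf)).trans h.2.le

lemma setIntegral_cv_mul_comm {k f g : Pt → ℝ} (hk : Mol k) (hf : L2P f) (hg : L2P g) :
    ∫ p in Dom, cv k f p * g p = ∫ p in Dom, f p * cv k g p := by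
  have key : ∀ f g : Pt → ℝ, L2P f → L2P g → ∫ p in Dom, cv k f p * g p
      = ∫ ζ, k ζ * ∫ p in Dom, f (p - ζ) * g p := fun f g hf hg => by
    have hmeas : Measurable fun q : Pt × Pt => k q.2 * f (q.1 - q.2) * g q.1 :=
      ((hk.cont.measurable.comp measurable_snd).mul
        (hf.meas.comp (measurable_fst.sub measurable_snd))).mul (hg.meas.comp measurable_fst)
    have h1 := integrable_prod_cv hk.integrable (hf.per.pow 2) (hf.meas.pow_const 2)
      hf.sq_integrable hk.cont.measurable
    have h2 : Integrable (fun q : Pt × Pt => g q.1 ^ 2 * k q.2) (mD.prod volume) :=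
      hg.sq_integrable.mul_prod hk.integrable
    have h : Integrable (fun q : Pt × Pt => k q.2 * f (q.1 - q.2) * g q.1) (mD.prod volume) := by
      refine (h1.add h2).mono' hmeas.aestronglyMeasurable (ae_of_all _ fun q => ?_)
      have hn := hk.nonneg q.2
      change |_| ≤ k q.2 * f (q.1 - q.2) ^ 2 + g q.1 ^ 2 * k q.2
      rw [mul_assoc, abs_mul, abs_of_nonneg hn]
      have : |f (q.1 - q.2) * g q.1| ≤ f (q.1 - q.2) ^ 2 + g q.1 ^ 2 := by
        rw [abs_le]
        constructor <;> nlinarith [sq_nonneg (f (q.1 - q.2) + g q.1),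
          sq_nonneg (f (q.1 - q.2) - g q.1), sq_nonneg (f (q.1 - q.2)), sq_nonneg (g q.1)]
      nlinarith
    unfold cv
    simp only [← integral_mul_const]
    rw [integral_integral_swap (f := fun p ζ => k ζ * f (p - ζ) * g p) h]
    simp only [mul_assoc, integral_const_mul]
  rw [key f g hf hg]
  simp only [mul_comm (f _)]
  rw [key g f hg hf, ← integral_neg_eq_self]
  congr 1
  ext ζ
  rw [hk.even]
  congr 1
  have t := (hg.per.mul (hf.per.comp_add ζ)).setIntegral_comp_add (-ζ)
  simp only [← sub_eq_add_neg, sub_add_cancel] at t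
  simp only [sub_neg_eq_add]
  exact t.symm

/-- The mollifying bump functions. -/
def mbump (n : ℕ) : ContDiffBump (0 : Pt) :=
  ⟨(2 * (n + 1 : ℝ))⁻¹, (n + 1 : ℝ)⁻¹, by positivity, by
    gcongr
    linarith [n.cast_nonneg (α := ℝ)]⟩

/-- The mollifying kernels. -/
def rho (n : ℕ) : Pt → ℝ := (mbump n).normed volume

lemma contDiff_rho (k : ℕ) {n : ℕ∞} : ContDiff ℝ n (rho k) := (mbump k).contDiff_normed

lemma rho_eq_zero {n : ℕ} {ζ : Pt} (h : (n + 1 : ℝ)⁻¹ ≤ ‖ζ‖) : rho n ζ = 0 := by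
  by_contra hne
  have : ζ ∈ Function.support ((mbump n).normed volume) := hne
  rw [ContDiffBump.support_normed_eq, Metric.mem_ball, dist_zero_right] at this
  exact absurd this (not_lt.2 h)

lemma mol_rho (n : ℕ) : Mol (rho n) where
  cont := (contDiff_rho n (n := 0)).continuous
  supp ζ h := rho_eq_zero ((inv_le_one_of_one_le₀ (by linarith [n.cast_nonneg (α := ℝ)])).trans
    h.le)
  nonneg ζ := (mbump n).nonneg_normed ζ
  int := (mbump n).integral_normed
  even := (mbump n).normed_neg

lemma ae_tendsto_cv_rho {f : Pt → ℝ} (hf : LocallyIntegrable f) :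
    ∀ᵐ p, Tendsto (fun n => cv (rho n) f p) atTop (nhds (f p)) := by
  refine ContDiffBump.ae_convolution_tendsto_right_of_locallyIntegrable (φ := mbump) (K := 2)
    ?_ (Eventually.of_forall fun n => ?_) hf
  · have h := tendsto_one_div_add_atTop_nhds_zero_nat (𝕜 := ℝ)
    simp only [one_div] at h
    exact h
  · change (n + 1 : ℝ)⁻¹ ≤ 2 * (2 * (n + 1 : ℝ))⁻¹
    rw [mul_inv, mul_inv_cancel_left₀ two_ne_zero]

lemma contDiff_cv {k f : Pt → ℝ} {n : ℕ∞} (hk : Ker k) (hs : ContDiff ℝ n k)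
    (hf : LocallyIntegrable f) : ContDiff ℝ n (cv k f) :=
  hk.hasCompactSupport.contDiff_convolution_left (ContinuousLinearMap.lsmul ℝ ℝ) hs hf

lemma pd_cv {k f : Pt → ℝ} (hk : Ker k) (hs : ContDiff ℝ 1 k) (hf : LocallyIntegrable f)
    (i : Fin 4) (p : Pt) : pd (cv k f) i p = cv (pd k i) f p := by
  have h := hk.hasCompactSupport.hasFDerivAt_convolution_left
    (ContinuousLinearMap.lsmul ℝ ℝ) hs hf p
  rw [← cv_eq_convolution] at h
  unfold pd
  rw [h.fderiv, convolution_def, ContinuousLinearMap.integral_apply]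
  · rfl
  · exact (hk.hasCompactSupport.fderiv ℝ).convolutionExists_left _
      (hs.continuous_fderiv one_ne_zero) hf p

/-- Weakly differentiable functions together with their weak partial derivatives. -/
structure WP (u : Pt → ℝ) (U : Fin 4 → Pt → ℝ) : Prop where
  fn : L2P u
  grad : ∀ i, L2P (U i)
  weak : ∀ φ : Pt → ℝ, ContDiff ℝ 1 φ → HasCompactSupport φ → ∀ i,
    ∫ p, u p * pd φ i p = -∫ p, U i p * φ p

lemma integral_mul_pd {u φ : Pt → ℝ} (hu : Differentiable ℝ u) {i : Fin 4}
    (hU : LocallyIntegrable (pd u i)) (hφ : ContDiff ℝ 1 φ) (hc : HasCompactSupport φ) :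
    ∫ p, u p * pd φ i p = -∫ p, pd u i p * φ p := by
  refine integral_mul_fderiv_eq_neg_fderiv_mul_of_integrable (v := dir i) ?_ ?_ ?_
    (fun p _ => hu p) (fun p _ => hφ.differentiable one_ne_zero p)
  · exact (hU.integrable_smul_left_of_hasCompactSupport hφ.continuous hc).congr
      (ae_of_all _ fun p => mul_comm _ _)
  · refine (hu.continuous.mul (continuous_pd hφ i)).integrable_of_hasCompactSupport ?_
    exact (hc.fderiv_apply ℝ (dir i)).mul_left
  · exact (hu.continuous.mul hφ.continuous).integrable_of_hasCompactSupport hc.mul_left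

lemma cv_pd_of_weak {k u : Pt → ℝ} {i : Fin 4} {V : Pt → ℝ}
    (hw : ∀ φ : Pt → ℝ, ContDiff ℝ 1 φ → HasCompactSupport φ →
      ∫ p, u p * pd φ i p = -∫ p, V p * φ p)
    (hk : Ker k) (hs : ContDiff ℝ 1 k) (p : Pt) : cv (pd k i) u p = cv k V p := by
  have h := hw (fun z => k (p - z)) (hs.comp (contDiff_const.sub contDiff_id))
    (hk.hasCompactSupport.comp_homeomorph (Homeomorph.subLeft p))
  have e : ∀ z, pd (fun z => k (p - z)) i z = -pd k i (p - z) := fun z => by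
    have h1 : HasFDerivAt (fun z => k (p - z)) _ z :=
      (hs.differentiable one_ne_zero (p - z)).hasFDerivAt.comp z ((hasFDerivAt_id z).const_sub p)
    unfold pd
    rw [h1.fderiv]
    simp
  rw [cv_eq_swap, cv_eq_swap]
  simp only [e, mul_neg, integral_neg, neg_inj] at h
  simpa only [mul_comm] using h

lemma WP.pd_cv {u k : Pt → ℝ} {U : Fin 4 → Pt → ℝ} (h : WP u U) (hk : Ker k) (hs : ContDiff ℝ 1 k)
    (i : Fin 4) (p : Pt) : pd (cv k u) i p = cv k (U i) p := by
  rw [Waveguide.pd_cv hk hs h.fn.locallyIntegrable,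
    cv_pd_of_weak (fun φ h1 h2 => h.weak φ h1 h2 i) hk hs]

lemma WP.ck_cv {u k : Pt → ℝ} {U : Fin 4 → Pt → ℝ} (h : WP u U) (hk : Mol k)
    (hs : ContDiff ℝ 1 k) : CK (cv k u) where
  smooth := contDiff_cv hk.toKer hs h.fn.locallyIntegrable
  per := h.fn.per.cv k
  memLp := (h.fn.cv hk).1.memLp
  memLpD i := by
    rw [funext (h.pd_cv hk.toKer hs i)]
    exact ((h.grad i).cv hk).1.memLp

lemma CK.l2p {u : Pt → ℝ} (h : CK u) : L2P u := ⟨h.per, h.smooth.continuous.measurable, h.memLp⟩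

lemma CK.l2p_pd {u : Pt → ℝ} (h : CK u) (i : Fin 4) : L2P (pd u i) :=
  ⟨h.per.pd i, measurable_pd u i, h.memLpD i⟩

lemma CK.wp {u : Pt → ℝ} (h : CK u) : WP u (pd u) :=
  ⟨h.l2p, h.l2p_pd, fun _ h1 h2 i =>
    integral_mul_pd (h.smooth.differentiable one_ne_zero) (h.l2p_pd i).locallyIntegrable h1 h2⟩

lemma CK.differentiable {u : Pt → ℝ} (h : CK u) : Differentiable ℝ u :=
  h.smooth.differentiable one_ne_zero

lemma CK.h1 {u : Pt → ℝ} (h : CK u) : H1 u where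
  periodic := h.per
  diff := h.differentiable
  memL2 := h.memLp.integrable_sq
  memGrad := by
    simp only [gradSq_eq]
    exact (((h.memLpD 0).integrable_sq.add (h.memLpD 1).integrable_sq).add
      (h.memLpD 2).integrable_sq).add (h.memLpD 3).integrable_sq
  memL4 := (h.l4_hv one_pos).1

lemma H1.memLpD {u : Pt → ℝ} (h : H1 u) (i : Fin 4) : MemLp (pd u i) 2 mD := by
  refine memLp_two_of_sq (measurable_pd u i).aestronglyMeasurable ?_
  refine h.memGrad.mono' ((measurable_pd u i).pow_const 2).aestronglyMeasurable
    (ae_of_all _ fun p => ?_)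
  rw [Real.norm_of_nonneg (sq_nonneg _), gradSq_eq]
  have h0 := sq_nonneg (pd u 0 p)
  have h1 := sq_nonneg (pd u 1 p)
  have h2 := sq_nonneg (pd u 2 p)
  have h3 := sq_nonneg (pd u 3 p)
  fin_cases i <;> simp only [Fin.zero_eta, Fin.mk_one, Fin.reduceFinMk] <;> linarith

lemma H1.wp {u : Pt → ℝ} (h : H1 u) : WP u (pd u) := by
  have hl : ∀ i, L2P (pd u i) := fun i => ⟨h.periodic.pd i, measurable_pd u i, h.memLpD i⟩
  exact ⟨⟨h.periodic, h.diff.continuous.measurable,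
    memLp_two_of_sq h.diff.continuous.aestronglyMeasurable h.memL2⟩, hl,
    fun _ h1 h2 i => integral_mul_pd h.diff (hl i).locallyIntegrable h1 h2⟩

lemma integral_pd_rho (n : ℕ) (i : Fin 4) : ∫ p, pd (rho n) i p = 0 := by
  have h := (mol_rho n).hasCompactSupport
  have hc := contDiff_rho n (n := 1)
  have hd := hc.differentiable one_ne_zero
  have := integral_mul_fderiv_eq_neg_fderiv_mul_of_integrable (μ := (volume : Measure Pt))
    (f := fun _ => (1 : ℝ)) (g := rho n) (v := dir i) (by simp)
    (by simpa using
      show Integrable (fun x => fderiv ℝ (rho n) x (dir i)) from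
        (continuous_pd hc i).integrable_of_hasCompactSupport (h.fderiv_apply ℝ (dir i)))
    (by simpa using (mol_rho n).integrable) (fun _ _ => differentiableAt_const _) (fun x _ => hd x)
  simpa [pd] using this

lemma setIntegral_pd_eq_zero {H : Pt → ℝ} {i : Fin 4} (hs : ContDiff ℝ 1 H) (hp : PeriodicY H)
    (h1 : IntegrableOn H Dom) (h2 : IntegrableOn (pd H i) Dom) : ∫ p in Dom, pd H i p = 0 := by
  have hm := mol_rho 0
  have hs' := contDiff_rho 0 (n := 1)
  have e := fun p => cv_pd_of_weak (i := i) (fun φ a b => integral_mul_pd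
    (hs.differentiable one_ne_zero) ((hp.pd i).locallyIntegrable h2) a b) hm.toKer hs' p
  have a1 := (setIntegral_cv hm.toKer (hp.pd i) (measurable_pd H i) h2).2
  rw [hm.int, one_mul] at a1
  have a2 := (setIntegral_cv (hm.toKer.pd hs' i) hp hs.continuous.measurable h1).2
  rw [integral_pd_rho, zero_mul] at a2
  rw [← a1, ← a2]
  simp only [e]

lemma CK.ibp {f g : Pt → ℝ} (hf : CK f) (hg : CK g) (i : Fin 4) :
    ∫ p in Dom, f p * pd g i p = -∫ p in Dom, pd f i p * g p := by
  have e : ∀ p, pd (fun q => f q * g q) i p = f p * pd g i p + pd f i p * g p := fun p =>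
    pd_mul (hf.differentiable p) (hg.differentiable p) i
  have h1 := memLp_two_mul hf.memLp (hg.memLpD i)
  have h2 := memLp_two_mul (hf.memLpD i) hg.memLp
  have h := setIntegral_pd_eq_zero (H := fun q => f q * g q) (i := i) (hf.smooth.mul hg.smooth)
    (hf.per.mul hg.per) (memLp_two_mul hf.memLp hg.memLp) (by simp only [funext e]; exact h1.add h2)
  simp only [e] at h
  rw [integral_add h1 h2] at h
  linarith

lemma MF_nonneg (u : Pt → ℝ) : 0 ≤ MF u := integral_nonneg fun _ => sq_nonneg _

lemma NF_nonneg (u : Pt → ℝ) : 0 ≤ NF u := integral_nonneg fun _ => by positivity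

lemma BF_nonneg (U : Fin 4 → Pt → ℝ) : 0 ≤ BF U := MF_nonneg _

lemma AF_nonneg (U : Fin 4 → Pt → ℝ) : 0 ≤ AF U :=
  add_nonneg (add_nonneg (MF_nonneg (U 0)) (MF_nonneg (U 1))) (MF_nonneg (U 2))

section Mollify

variable {u k : Pt → ℝ} {U : Fin 4 → Pt → ℝ}

lemma WP.AF_cv_le (h : WP u U) (hk : Mol k) (hs : ContDiff ℝ 1 k) : AF (pd (cv k u)) ≤ AF U := by
  have e := h.pd_cv hk.toKer hs
  have l := fun i => ((h.grad i).cv hk).2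
  unfold AF
  simp only [e]
  exact add_le_add (add_le_add (l 0) (l 1)) (l 2)

lemma WP.BF_cv_le (h : WP u U) (hk : Mol k) (hs : ContDiff ℝ 1 k) : BF (pd (cv k u)) ≤ BF U := by
  have e := h.pd_cv hk.toKer hs
  unfold BF
  simp only [e]
  exact ((h.grad 3).cv hk).2

lemma WP.fatou {C : ℝ} (h : WP u U) (hC : ∀ n, NF (cv (rho n) u) ≤ C) :
    Integrable (fun p => u p ^ 4) mD ∧ NF u ≤ C := by
  refine integral_le_of_fatou (f := fun n p => cv (rho n) u p ^ 4) (c := fun _ => C)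
    (fun n => ((h.ck_cv (mol_rho n) (contDiff_rho n)).l4_hv one_pos).1)
    (fun n p => by positivity) hC tendsto_const_nhds ?_
  filter_upwards [ae_restrict_of_ae (ae_tendsto_cv_rho h.fn.locallyIntegrable)] with p hp
  exact hp.pow 4

lemma WP.l4_hv (h : WP u U) {s : ℝ} (hs : 0 < s) :
    Integrable (fun p => u p ^ 4) mD ∧ 8 * √Jc * √s * √(NF u) ≤ AF U + s ^ 2 * (BF U + MF u) := by
  have hk : 0 < 8 * √Jc * √s := by
    have := Real.sqrt_pos.2 Jc_pos
    have := Real.sqrt_pos.2 hs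
    positivity
  have hR0 : 0 ≤ AF U + s ^ 2 * (BF U + MF u) := by
    have := AF_nonneg U
    have := BF_nonneg U
    have := MF_nonneg u
    positivity
  have := h.fatou (C := ((AF U + s ^ 2 * (BF U + MF u)) / (8 * √Jc * √s)) ^ 2) fun n => by
    have h1 := ((h.ck_cv (mol_rho n) (contDiff_rho n)).l4_hv hs).2
    have hA := h.AF_cv_le (mol_rho n) (contDiff_rho n)
    have hB := h.BF_cv_le (mol_rho n) (contDiff_rho n)
    have hM := (h.fn.cv (mol_rho n)).2
    have h2 := h1.trans (add_le_add hA (mul_le_mul_of_nonneg_left (add_le_add hB hM) (sq_nonneg s)))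
    rw [mul_comm, ← le_div_iff₀ hk] at h2
    exact (Real.sqrt_le_iff.1 h2).2
  refine ⟨this.1, ?_⟩
  rw [mul_comm, ← le_div_iff₀ hk]
  exact Real.sqrt_le_iff.2 ⟨by positivity, this.2⟩

end Mollify

lemma hv_polynomial {A E N J : ℝ} (hA : 0 ≤ A) (hE : 0 ≤ E) (hN : 0 ≤ N) (hJ : 0 ≤ J)
    (h : ∀ s : ℝ, 0 < s → 8 * √J * √s * √N ≤ A + s ^ 2 * E) :
    432 * J ^ 2 * N ^ 2 ≤ A ^ 3 * E := by
  have key : ∀ η : ℝ, 0 < η → 432 * J ^ 2 * N ^ 2 ≤ (A + η) ^ 3 * (E + η) := by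
    intro η hη
    obtain ⟨a, ha⟩ : ∃ a, a = A + η := ⟨_, rfl⟩
    obtain ⟨e, he⟩ : ∃ e, e = E + η := ⟨_, rfl⟩
    rw [← ha, ← he]
    have ha0 : 0 < a := by linarith
    have he0 : 0 < e := by linarith
    have hs : 0 < √(a / (3 * e)) := Real.sqrt_pos.2 (by positivity)
    have hs2 : √(a / (3 * e)) ^ 2 = a / (3 * e) := Real.sq_sqrt (by positivity)
    have h1 := h _ hs
    generalize √(a / (3 * e)) = s at hs hs2 h1
    have hs3 : s ^ 2 * e = a / 3 := by rw [hs2]; field_simp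
    have h2 : 8 * √J * √s * √N ≤ 4 * a / 3 := by
      have : s ^ 2 * E ≤ s ^ 2 * e := mul_le_mul_of_nonneg_left (by linarith) (sq_nonneg s)
      linarith
    have h3 : (8 * √J * √s * √N) ^ 4 ≤ (4 * a / 3) ^ 4 :=
      pow_le_pow_left₀ (by positivity) h2 4
    have e1 : (8 * √J * √s * √N) ^ 4 = 4096 * J ^ 2 * s ^ 2 * N ^ 2 := by
      have q1 : √J ^ 4 = J ^ 2 := by rw [show √J ^ 4 = (√J ^ 2) ^ 2 by ring, Real.sq_sqrt hJ]
      have q2 : √s ^ 4 = s ^ 2 := by rw [show √s ^ 4 = (√s ^ 2) ^ 2 by ring, Real.sq_sqrt hs.le]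
      have q3 : √N ^ 4 = N ^ 2 := by rw [show √N ^ 4 = (√N ^ 2) ^ 2 by ring, Real.sq_sqrt hN]
      rw [mul_pow, mul_pow, mul_pow, q1, q2, q3]
      norm_num
    rw [e1] at h3
    have h4 : 4096 * J ^ 2 * N ^ 2 * (a / 3) ≤ (4 * a / 3) ^ 4 * e := by
      rw [← hs3]
      nlinarith [mul_le_mul_of_nonneg_right h3 he0.le]
    have h5 : a * (432 * J ^ 2 * N ^ 2) ≤ a * (a ^ 3 * e) := by nlinarith
    exact le_of_mul_le_mul_left h5 ha0
  have hc : Continuous fun η : ℝ => (A + η) ^ 3 * (E + η) := by fun_prop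
  have ht : Tendsto (fun η : ℝ => (A + η) ^ 3 * (E + η)) (nhdsWithin 0 (Set.Ioi 0))
      (nhds (A ^ 3 * E)) := by
    simpa using (hc.tendsto 0).mono_left nhdsWithin_le_nhds
  exact ge_of_tendsto ht (eventually_mem_nhdsWithin.mono key)

lemma WP.hv {u : Pt → ℝ} {U : Fin 4 → Pt → ℝ} (h : WP u U) :
    432 * Jc ^ 2 * NF u ^ 2 ≤ AF U ^ 3 * (BF U + MF u) :=
  hv_polynomial (AF_nonneg U) (add_nonneg (BF_nonneg U) (MF_nonneg u)) (NF_nonneg u) Jc_pos.le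
    fun _ hs => (h.l4_hv hs).2

lemma WP.l4 {u : Pt → ℝ} {U : Fin 4 → Pt → ℝ} (h : WP u U) : Integrable (fun p => u p ^ 4) mD :=
  (h.l4_hv one_pos).1

/-- The scaling-invariant energy functional. -/
def FF (u : Pt → ℝ) (U : Fin 4 → Pt → ℝ) : ℝ := 8 / 27 * AF U ^ 3 / NF u ^ 2 + BF U / 2

/-- The values of the scaling-invariant energy on functions of mass at most `m₀`. -/
def levSet (m₀ : ℝ) : Set ℝ := {c | ∃ u, CK u ∧ MF u ≤ m₀ ∧ 0 < NF u ∧ FF u (pd u) = c}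

/-- The ground state level. -/
def lev (m₀ : ℝ) : ℝ := sInf (levSet m₀)

lemma FF_nonneg (u : Pt → ℝ) (U : Fin 4 → Pt → ℝ) : 0 ≤ FF u U := by
  have := AF_nonneg U
  have := BF_nonneg U
  unfold FF
  positivity

lemma bddBelow_levSet (m₀ : ℝ) : BddBelow (levSet m₀) :=
  ⟨0, by rintro _ ⟨u, _, _, _, rfl⟩; exact FF_nonneg _ _⟩

lemma lev_nonneg (m₀ : ℝ) : 0 ≤ lev m₀ :=
  Real.sInf_nonneg (by rintro _ ⟨u, _, _, _, rfl⟩; exact FF_nonneg _ _)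

lemma FF_mul {u : Pt → ℝ} {U : Fin 4 → Pt → ℝ} (h : 0 < NF u) :
    FF u U * NF u ^ 2 = 8 / 27 * AF U ^ 3 + BF U / 2 * NF u ^ 2 := by
  unfold FF
  field_simp

lemma CK.lev_mul_le {u : Pt → ℝ} {m₀ : ℝ} (h : CK u) (hM : MF u ≤ m₀) :
    lev m₀ * NF u ^ 2 ≤ 8 / 27 * AF (pd u) ^ 3 + BF (pd u) / 2 * NF u ^ 2 := by
  rcases (NF_nonneg u).eq_or_lt with h0 | h0
  · have := AF_nonneg (pd u)
    rw [← h0]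
    norm_num
    positivity
  · rw [← FF_mul h0]
    exact mul_le_mul_of_nonneg_right (csInf_le (bddBelow_levSet m₀) ⟨u, h, hM, h0, rfl⟩)
      (sq_nonneg _)

lemma WP.lev_mul_le {u : Pt → ℝ} {U : Fin 4 → Pt → ℝ} {m₀ : ℝ} (h : WP u U) (hM : MF u ≤ m₀) :
    lev m₀ * NF u ^ 2 ≤ 8 / 27 * AF U ^ 3 + BF U / 2 * NF u ^ 2 := by
  have hA0 := AF_nonneg U
  rcases le_or_gt (lev m₀) (BF U / 2) with h0 | h0
  · have := mul_le_mul_of_nonneg_right h0 (sq_nonneg (NF u))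
    have : 0 ≤ AF U ^ 3 := by positivity
    linarith
  · have hd : 0 < lev m₀ - BF U / 2 := by linarith
    have := h.fatou (C := √(8 / 27 * AF U ^ 3 / (lev m₀ - BF U / 2))) fun n => by
      have h1 := (h.ck_cv (mol_rho n) (contDiff_rho n)).lev_mul_le
        (((h.fn.cv (mol_rho n)).2).trans hM)
      have hA := h.AF_cv_le (mol_rho n) (contDiff_rho n)
      have hB := h.BF_cv_le (mol_rho n) (contDiff_rho n)
      have hA3 := pow_le_pow_left₀ (AF_nonneg _) hA 3
      refine Real.le_sqrt_of_sq_le ?_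
      rw [le_div_iff₀ hd]
      nlinarith [mul_le_mul_of_nonneg_right hB (sq_nonneg (NF (cv (rho n) u)))]
    have h2 := pow_le_pow_left₀ (NF_nonneg u) this.2 2
    rw [Real.sq_sqrt (by positivity), le_div_iff₀ hd] at h2
    linarith

lemma FF_ge_lev {u : Pt → ℝ} {U : Fin 4 → Pt → ℝ} {m₀ : ℝ} (h : WP u U) (hM : MF u ≤ m₀)
    (hN : 0 < NF u) : lev m₀ ≤ FF u U := by
  have h1 := h.lev_mul_le hM
  rw [← FF_mul hN] at h1
  exact le_of_mul_le_mul_right h1 (by positivity)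

/-- Dilation in the `x` variables combined with multiplication by a constant. -/
def dil (c a : ℝ) (u : Pt → ℝ) : Pt → ℝ := fun p => c * u (scal a 1 p)

section Dil

variable {u : Pt → ℝ} {c a : ℝ}

lemma setIntegral_dil_pow (ha : 0 < a) (n : ℕ) :
    ∫ p in Dom, dil c a u p ^ n = c ^ n * (a ^ 3)⁻¹ * ∫ p in Dom, u p ^ n := by
  simp only [dil, mul_pow]
  rw [integral_const_mul, setIntegral_scal ha (fun p => u p ^ n), mul_assoc]

lemma CK.pd_dil (hu : CK u) (i : Fin 4) : pd (dil c a u) i = dil (c * sc a i) a (pd u i) := by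
  funext p
  have h := pd_scal hu.differentiable a p i
  have hd : DifferentiableAt ℝ (fun p => u (scal a 1 p)) p :=
    (hu.smooth.comp (contDiff_scal a 1)).differentiable one_ne_zero p
  have := pd_const_mul hd c i
  unfold dil
  rw [this, h]
  ring

lemma CK.dil (hu : CK u) (ha : 0 < a) : CK (dil c a u) := by
  have key : ∀ (f : Pt → ℝ) (d : ℝ), MemLp f 2 mD → Measurable f →
      MemLp (Waveguide.dil d a f) 2 mD := by
    intro f d hf hm
    have hm' : Measurable (Waveguide.dil d a f) :=
      (hm.comp (contDiff_scal a 1 (n := 0)).continuous.measurable).const_mul d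
    refine memLp_two_of_sq hm'.aestronglyMeasurable ?_
    have := (integrableOn_scal ha (f := fun p => f p ^ 2) hf.integrable_sq).const_mul (d ^ 2)
    simpa only [Waveguide.dil, mul_pow] using this
  refine ⟨contDiff_const.mul (hu.smooth.comp (contDiff_scal a 1)), fun x y => ?_,
    key _ _ hu.memLp hu.smooth.continuous.measurable, fun i => ?_⟩
  · have := hu.per (a • x) y
    simp only [Waveguide.dil, scal, one_mul]
    rw [this]
  · rw [hu.pd_dil]
    exact key _ _ (hu.memLpD i) (measurable_pd u i)

lemma MF_dil (ha : 0 < a) : MF (dil c a u) = c ^ 2 * (a ^ 3)⁻¹ * MF u := setIntegral_dil_pow ha 2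

lemma NF_dil (ha : 0 < a) : NF (dil c a u) = c ^ 4 * (a ^ 3)⁻¹ * NF u := setIntegral_dil_pow ha 4

lemma CK.BF_dil (hu : CK u) (ha : 0 < a) :
    BF (pd (Waveguide.dil c a u)) = c ^ 2 * (a ^ 3)⁻¹ * BF (pd u) := by
  unfold BF
  rw [hu.pd_dil, setIntegral_dil_pow ha 2]
  simp [sc]

lemma CK.AF_dil (hu : CK u) (ha : 0 < a) :
    AF (pd (Waveguide.dil c a u)) = c ^ 2 * a⁻¹ * AF (pd u) := by
  unfold AF
  simp only [hu.pd_dil, setIntegral_dil_pow ha 2]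
  simp only [sc, Matrix.cons_val]
  field_simp

/-- Normalising the balance between the `x`-gradient and the quartic integral. -/
lemma CK.exists_normalized (hu : CK u) (hN : 0 < NF u) : ∃ c a : ℝ, 0 < c ∧ 0 < a ∧
    MF (Waveguide.dil c a u) = MF u ∧
    AF (pd (Waveguide.dil c a u)) = 3 / 4 * NF (Waveguide.dil c a u) ∧
    FF (Waveguide.dil c a u) (pd (Waveguide.dil c a u)) = FF u (pd u) ∧
    0 < NF (Waveguide.dil c a u) := by
  have hA : 0 < AF (pd u) := by
    refine (AF_nonneg _).lt_of_ne fun h => ?_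
    have := hu.wp.hv
    rw [← h] at this
    have := Jc_pos
    have : 0 < 432 * Jc ^ 2 * NF u ^ 2 := by positivity
    norm_num at *
    linarith
  have ha : 0 < AF (pd u) / (3 / 4 * NF u) := by positivity
  obtain ⟨a, hae⟩ : ∃ a, a = AF (pd u) / (3 / 4 * NF u) := ⟨_, rfl⟩
  rw [← hae] at ha
  have hc2 : √(a ^ 3) ^ 2 = a ^ 3 := Real.sq_sqrt (by positivity)
  have hc4 : √(a ^ 3) ^ 4 = a ^ 6 := by
    rw [show √(a ^ 3) ^ 4 = (√(a ^ 3) ^ 2) ^ 2 by ring, hc2]; ring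
  have hN' : NF (Waveguide.dil (√(a ^ 3)) a u) = a ^ 3 * NF u := by
    rw [NF_dil ha, hc4]; field_simp
  have hA' : AF (pd (Waveguide.dil (√(a ^ 3)) a u)) = a ^ 2 * AF (pd u) := by
    rw [hu.AF_dil ha, hc2]; field_simp
  refine ⟨√(a ^ 3), a, Real.sqrt_pos.2 (by positivity), ha, ?_, ?_, ?_, ?_⟩
  · rw [MF_dil ha, hc2]; field_simp
  · rw [hN', hA']
    have : AF (pd u) = a * (3 / 4 * NF u) := by rw [hae]; field_simp
    rw [this]; ring
  · unfold FF
    rw [hN', hA', hu.BF_dil ha, hc2]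
    field_simp
  · rw [hN']; positivity

end Dil

lemma FF_of_balanced {u : Pt → ℝ} {U : Fin 4 → Pt → ℝ} (h : AF U = 3 / 4 * NF u) :
    FF u U = NF u / 8 + BF U / 2 := by
  unfold FF
  rw [h]
  field_simp
  ring

/-- A smooth even periodic approximation of the distance to `2πℤ`. -/
def th (n : ℕ) (y : ℝ) : ℝ := arccos ((1 - (n + 2 : ℝ)⁻¹) * cos y)

lemma th_arg_bounds (n : ℕ) : 0 < 1 - (n + 2 : ℝ)⁻¹ ∧ 1 - (n + 2 : ℝ)⁻¹ < 1 := by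
  have : (1 : ℝ) < n + 2 := by linarith [n.cast_nonneg (α := ℝ)]
  have h1 := inv_lt_one_of_one_lt₀ this
  have h2 : (0 : ℝ) < (n + 2 : ℝ)⁻¹ := by positivity
  constructor <;> linarith

lemma th_arg_mem (n : ℕ) (y : ℝ) :
    -1 < (1 - (n + 2 : ℝ)⁻¹) * cos y ∧ (1 - (n + 2 : ℝ)⁻¹) * cos y < 1 := by
  obtain ⟨h0, h1⟩ := th_arg_bounds n
  have := neg_one_le_cos y
  have := cos_le_one y
  constructor <;> nlinarith

lemma contDiff_th (n : ℕ) : ContDiff ℝ 1 (th n) := contDiff_iff_contDiffAt.2 fun y =>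
  (contDiffAt_arccos (th_arg_mem n y).1.ne' (th_arg_mem n y).2.ne).comp y
    (contDiff_const.mul contDiff_cos).contDiffAt

lemma exists_hasDerivAt_th (n : ℕ) (y : ℝ) : ∃ t, HasDerivAt (th n) t y ∧ t ^ 2 ≤ 1 := by
  obtain ⟨h0, h1⟩ := th_arg_bounds n
  have hm := th_arg_mem n y
  have h := (hasDerivAt_arccos hm.1.ne' hm.2.ne).comp y
    ((hasDerivAt_cos y).const_mul (1 - (n + 2 : ℝ)⁻¹))
  refine ⟨_, h, ?_⟩
  generalize 1 - (n + 2 : ℝ)⁻¹ = d at *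
  have hp : 0 < 1 - (d * cos y) ^ 2 := by nlinarith
  rw [mul_pow, neg_sq, div_pow, Real.sq_sqrt hp.le, one_pow, div_mul_eq_mul_div, one_mul,
    div_le_one hp]
  have := sin_sq_add_cos_sq y
  nlinarith [mul_pow d (cos y) 2]

lemma th_tendsto (y : ℝ) : Tendsto (fun n => th n y) atTop (nhds (arccos (cos y))) := by
  refine (continuous_arccos.tendsto _).comp ?_
  have h : Tendsto (fun n : ℕ => (n + 2 : ℝ)⁻¹) atTop (nhds 0) :=
    tendsto_inv_atTop_zero.comp (tendsto_atTop_add_const_right _ _ tendsto_natCast_atTop_atTop)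
  simpa using (h.const_sub 1).mul_const (cos y)

/-- Folding the waveguide onto a slab. -/
def fm (a : ℝ) (n : ℕ) (p : Pt) : Pt := (a • p.1, a * th n p.2)

lemma contDiff_fm (a : ℝ) (n : ℕ) : ContDiff ℝ 1 (fm a n) :=
  ((contDiff_const (c := a)).smul contDiff_fst).prodMk
    ((contDiff_const (c := a)).mul ((contDiff_th n).comp contDiff_snd))

lemma fm_add_two_pi (a : ℝ) (n : ℕ) (x : Fin 3 → ℝ) (y : ℝ) :
    fm a n (x, y + 2 * π) = fm a n (x, y) := by
  simp [fm, th]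

/-- The profile `(1+|x|²)⁻²` dominating the relevant densities. -/
def hx (x : Fin 3 → ℝ) : ℝ := bub (x, 0) ^ 2

lemma bub_le_hx (p : Pt) : bub p ^ 2 ≤ hx p.1 := by
  refine pow_le_pow_left₀ (bub_pos p).le ?_ 2
  unfold bub
  refine one_div_le_one_div_of_le (by have := nsq_nonneg (p.1, 0); linarith) ?_
  have : 0 ≤ p.2 ^ 2 := sq_nonneg _
  simp only [nsq]
  linarith

lemma continuous_hx : Continuous hx :=
  (continuous_bub.comp (continuous_id.prodMk continuous_const)).pow 2

lemma integrable_hx : Integrable hx := by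
  have h := integrable_rpow_neg_one_add_norm_sq (E := Fin 3 → ℝ) (μ := volume) (r := 4)
    (by simp; norm_num)
  refine h.mono' continuous_hx.aestronglyMeasurable (ae_of_all _ fun x => ?_)
  rw [show ‖hx x‖ = hx x from Real.norm_of_nonneg (sq_nonneg _)]
  have := bub_rpow_le (s := 2) (by norm_num) ((x, 0) : Pt)
  have hn : ‖((x, 0) : Pt)‖ = ‖x‖ := by simp [Prod.norm_def]
  rw [hn] at this
  unfold hx
  convert this using 2
  · norm_num
  · norm_num

lemma mD_eq : mD = (volume : Measure (Fin 3 → ℝ)).prod (volume.restrict (Set.Ioc 0 (2 * π))) := by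
  rw [mD, Dom, Measure.volume_eq_prod, ← Measure.prod_restrict, Measure.restrict_univ]

lemma integrable_hx_smul {a : ℝ} (ha : a ≠ 0) : Integrable (fun p : Pt => hx (a • p.1)) mD := by
  rw [mD_eq]
  exact (integrable_hx.comp_smul ha).comp_fst _

section Fold

variable {F : Pt → ℝ} {a : ℝ}

lemma integrable_fold (hF : Continuous F) (h : ∀ p, |F p| ≤ hx p.1) (ha : 0 < a) (n : ℕ) :
    Integrable (fun p => F (fm a n p)) mD :=
  (integrable_hx_smul ha.ne').mono' (hF.comp (contDiff_fm a n).continuous).aestronglyMeasurable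
    (ae_of_all _ fun p => h (fm a n p))

/-- The slab of half-width `aπ`. -/
def slab (a : ℝ) : Set Pt := Set.univ ×ˢ Set.Ioc (-(a * π)) (a * π)

lemma measurableSet_slab (a : ℝ) : MeasurableSet (slab a) :=
    MeasurableSet.univ.prod measurableSet_Ioc

lemma tendsto_integral_fold (hF : Continuous F) (h : ∀ p, |F p| ≤ hx p.1) (ha : 0 < a)
    (he : ∀ x y, F (x, -y) = F (x, y)) :
    Tendsto (fun n => ∫ p in Dom, F (fm a n p)) atTop
      (nhds ((a ^ 3)⁻¹ * a⁻¹ * ∫ p in slab a, F p)) := by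
  have h1 : ∫ p in Dom, F (a • p.1, a * arccos (cos p.2)) =
      (a ^ 3)⁻¹ * a⁻¹ * ∫ p in slab a, F p := by
    have hper : PeriodicY fun p => F (a • p.1, a * arccos (cos p.2)) := fun x y => by simp
    rw [← hper.setIntegral_strip (-π), ← integral_indicator (measurableSet_strip _),
      ← integral_indicator (measurableSet_slab a), ← integral_scal ha ha]
    congr 1
    funext p
    have hm : p ∈ strip (-π) ↔ scal a a p ∈ slab a := by
      simp only [strip, slab, scal, Set.mem_prod, Set.mem_univ, true_and, Set.mem_Ioc]
      rw [← mul_neg, mul_lt_mul_iff_right₀ ha, mul_le_mul_iff_right₀ ha]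
      constructor <;> rintro ⟨h1, h2⟩ <;> exact ⟨h1, by linarith⟩
    by_cases hp : p ∈ strip (-π)
    · rw [Set.indicator_of_mem hp, Set.indicator_of_mem (hm.1 hp)]
      simp only [strip, Set.mem_prod, Set.mem_univ, true_and, Set.mem_Ioc] at hp
      unfold scal
      rcases le_total 0 p.2 with h0 | h0
      · rw [arccos_cos h0 (by linarith)]
      · rw [← cos_neg, arccos_cos (by linarith) (by linarith), mul_neg, he]
    · rw [Set.indicator_of_notMem hp, Set.indicator_of_notMem fun h => hp (hm.2 h)]
  rw [← h1]
  refine tendsto_integral_of_dominated_convergence (fun p => hx (a • p.1))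
    (fun n => (hF.comp (contDiff_fm a n).continuous).aestronglyMeasurable)
    (integrable_hx_smul ha.ne') (fun n => ae_of_all _ fun p => h (fm a n p))
      (ae_of_all _ fun p => ?_)
  exact (hF.tendsto _).comp (tendsto_const_nhds.prodMk_nhds ((th_tendsto p.2).const_mul a))

end Fold

/-- The folded, rescaled profile. -/
def tst (a : ℝ) (n : ℕ) (p : Pt) : ℝ := √8 * a * bub (fm a n p)

lemma exists_pd_tst (a : ℝ) (n : ℕ) (p : Pt) : ∃ t : ℝ, t ^ 2 ≤ 1 ∧ ∀ i,
    pd (tst a n) i p =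
      √8 * a ^ 2 * ![1, 1, 1, t] i * (-2 * co i (fm a n p) * bub (fm a n p) ^ 2) := by
  obtain ⟨t, ht, ht1⟩ := exists_hasDerivAt_th n p.2
  refine ⟨t, ht1, fun i => ?_⟩
  have h1 : HasFDerivAt (fun p : Pt => (a • p.1, a * th n p.2)) _ p :=
    ((hasFDerivAt_fst (𝕜 := ℝ) (p := p)).const_smul a).prodMk
      ((ht.comp_hasFDerivAt p (hasFDerivAt_snd (𝕜 := ℝ))).const_mul a)
  have h2 : HasFDerivAt (tst a n) _ p := ((hasFDerivAt_bub (fm a n p)).comp p h1).const_mul (√8 * a)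
  have hd : ∀ i, (((a • ContinuousLinearMap.fst ℝ (Fin 3 → ℝ) ℝ).prod
      (a • t • ContinuousLinearMap.snd ℝ (Fin 3 → ℝ) ℝ)) : Pt →L[ℝ] Pt) (dir i)
        = (a * ![1, 1, 1, t] i) • dir i := by
    intro i
    fin_cases i <;> ext j <;> simp [dir, ex, ey]
  unfold pd
  rw [h2.fderiv]
  have e := hd i
  simp only [_root_.smul_apply, ContinuousLinearMap.comp_apply, smul_eq_mul] at e ⊢
  rw [e, map_smul, fderiv_nsq, smul_eq_mul]
  ring

lemma dens_bound (i : Fin 4) (p : Pt) : |co i p ^ 2 * bub p ^ 4| ≤ hx p.1 := by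
  have h0 := bub_pos p
  have h1 := bub_le_one p
  have h2 := bub_mul p
  have h3 := co_sq_le i p
  rw [abs_of_nonneg (by positivity)]
  refine le_trans ?_ (bub_le_hx p)
  have h4 : co i p ^ 2 * bub p ≤ 1 := by nlinarith
  have h5 : co i p ^ 2 * bub p ^ 4 = co i p ^ 2 * bub p * bub p * bub p ^ 2 := by ring
  rw [h5]
  have : co i p ^ 2 * bub p * bub p ≤ 1 := by nlinarith [sq_nonneg (co i p)]
  nlinarith [sq_nonneg (bub p)]

lemma pow_bound (p : Pt) : |bub p ^ 4| ≤ hx p.1 := by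
  have h0 := bub_pos p
  have h1 := bub_le_one p
  rw [abs_of_nonneg (by positivity)]
  exact (pow_le_pow_of_le_one h0.le h1 (by norm_num)).trans (bub_le_hx p)

lemma sq_bound (p : Pt) : |bub p ^ 2| ≤ hx p.1 := by
  rw [abs_of_nonneg (sq_nonneg _)]
  exact bub_le_hx p

lemma continuous_dens (i : Fin 4) : Continuous fun p => co i p ^ 2 * bub p ^ 4 :=
  ((contDiff_co i (n := 0)).continuous.pow 2).mul (continuous_bub.pow 4)

lemma pd_tst_sq_le (a : ℝ) (n : ℕ) (p : Pt) (i : Fin 4) :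
    pd (tst a n) i p ^ 2 ≤ 32 * a ^ 4 * (co i (fm a n p) ^ 2 * bub (fm a n p) ^ 4) := by
  obtain ⟨t, ht, he⟩ := exists_pd_tst a n p
  have h8 : √8 ^ 2 = 8 := Real.sq_sqrt (by norm_num)
  have hw : (![1, 1, 1, t] i) ^ 2 ≤ 1 := by fin_cases i <;> simp [-sq_le_one_iff_abs_le_one, ht]
  have e : pd (tst a n) i p ^ 2 = (![1, 1, 1, t] i) ^ 2 *
      (32 * a ^ 4 * (co i (fm a n p) ^ 2 * bub (fm a n p) ^ 4)) := by
    rw [he i]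
    linear_combination (a ^ 4 * (![1, 1, 1, t] i) ^ 2 * 4 * co i (fm a n p) ^ 2 *
      bub (fm a n p) ^ 4) * h8
  rw [e]
  have h0 : 0 ≤ 32 * a ^ 4 * (co i (fm a n p) ^ 2 * bub (fm a n p) ^ 4) := by positivity
  nlinarith

lemma ck_tst {a : ℝ} (ha : 0 < a) (n : ℕ) : CK (tst a n) := by
  have hs : ContDiff ℝ 1 (tst a n) := contDiff_const.mul (contDiff_bub.comp (contDiff_fm a n))
  have hp : PeriodicY (tst a n) := fun x y => by simp only [tst, fm_add_two_pi]
  refine ⟨hs, hp, memLp_two_of_sq hs.continuous.aestronglyMeasurable ?_, fun i =>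
    memLp_two_of_sq (continuous_pd hs i).aestronglyMeasurable ?_⟩
  · have := (integrable_fold (F := fun p => bub p ^ 2)
      (continuous_bub.pow 2) sq_bound ha n).const_mul ((√8 * a) ^ 2)
    simpa only [tst, mul_pow] using this
  · refine ((integrable_fold (continuous_dens i) (dens_bound i) ha n).const_mul (32 * a ^ 4)).mono'
      ((continuous_pd hs i).pow 2).aestronglyMeasurable (ae_of_all _ fun p => ?_)
    rw [Real.norm_of_nonneg (sq_nonneg _)]
    exact pd_tst_sq_le a n p i

lemma integral_pd_tst_le {a : ℝ} (ha : 0 < a) (n : ℕ) (i : Fin 4) :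
    ∫ p in Dom, pd (tst a n) i p ^ 2 ≤
    32 * a ^ 4 * ∫ p in Dom, co i (fm a n p) ^ 2 * bub (fm a n p) ^ 4 := by
  rw [← integral_const_mul]
  exact integral_mono ((ck_tst ha n).memLpD i).integrable_sq
    ((integrable_fold (continuous_dens i) (dens_bound i) ha n).const_mul _)
    (fun p => pd_tst_sq_le a n p i)

lemma MF_tst_le {a : ℝ} (ha : 0 < a) (n : ℕ) : MF (tst a n) ≤ 8 * a⁻¹ * ∫ p in Dom, hx p.1 := by
  have h8 : √8 ^ 2 = 8 := Real.sq_sqrt (by norm_num)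
  have h1 : MF (tst a n) ≤ ∫ p in Dom, 8 * a ^ 2 * hx (a • p.1) := by
    refine integral_mono (ck_tst ha n).memLp.integrable_sq
      ((integrable_hx_smul ha.ne').const_mul _) fun p => ?_
    simp only [tst, mul_pow, h8]
    exact mul_le_mul_of_nonneg_left (bub_le_hx (fm a n p)) (by positivity)
  have h2 := setIntegral_scal ha (fun p => hx p.1)
  simp only [scal] at h2
  rw [integral_const_mul, h2] at h1
  refine h1.trans_eq ?_
  field_simp

/-- Testing the level with a folded profile. -/
lemma lev_mul_slab_le {a m₀ : ℝ} (ha : 0 < a) (hM : 8 * a⁻¹ * (∫ p in Dom, hx p.1) ≤ m₀) :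
    lev m₀ * (64 * ∫ p in slab a, bub p ^ 4) ^ 2 ≤
      8 / 27 * (32 * ((∫ p in slab a, co 0 p ^ 2 * bub p ^ 4) +
        (∫ p in slab a, co 1 p ^ 2 * bub p ^ 4)
        + ∫ p in slab a, co 2 p ^ 2 * bub p ^ 4)) ^ 3
      + (32 * ∫ p in slab a, co 3 p ^ 2 * bub p ^ 4) / 2 * (64 * ∫ p in slab a, bub p ^ 4) ^ 2 := by
  have hd := fun i => tendsto_integral_fold (continuous_dens i) (dens_bound i) ha fun x y => by
    fin_cases i <;> simp [co, bub, nsq]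
  have hN := tendsto_integral_fold (F := fun p => bub p ^ 4)
      (continuous_bub.pow 4) pow_bound ha fun x y => by
    simp [bub, nsq]
  have h8 : √8 ^ 4 = 64 := by
    rw [show √8 ^ 4 = (√8 ^ 2) ^ 2 by ring, Real.sq_sqrt (by norm_num)]; norm_num
  have hN' : Tendsto (fun n => NF (tst a n)) atTop (nhds (64 * ∫ p in slab a, bub p ^ 4)) := by
    have := hN.const_mul (64 * a ^ 4)
    convert this using 2
    · unfold NF
      rw [← integral_const_mul]
      simp only [tst, mul_pow, h8]
    · field_simp
  have hd' : ∀ i, Tendsto (fun n => 32 * a ^ 4 * ∫ p in Dom, co i (fm a n p) ^ 2 *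
    bub (fm a n p) ^ 4)
      atTop (nhds (32 * ∫ p in slab a, co i p ^ 2 * bub p ^ 4)) := by
    intro i
    convert (hd i).const_mul (32 * a ^ 4) using 2
    field_simp
  have hl := (hN'.pow 2).const_mul (lev m₀)
  have hr := (((((hd' 0).add (hd' 1)).add (hd' 2)).pow 3).const_mul (8 / 27)).add
    (((hd' 3).div_const 2).mul (hN'.pow 2))
  rw [← mul_add, ← mul_add] at hr
  refine le_of_tendsto_of_tendsto' hl hr fun n => ?_
  refine ((ck_tst ha n).lev_mul_le ((MF_tst_le ha n).trans hM)).trans ?_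
  have hA : AF (pd (tst a n)) ≤ _ := add_le_add (add_le_add (integral_pd_tst_le ha n 0)
    (integral_pd_tst_le ha n 1)) (integral_pd_tst_le ha n 2)
  have hB : BF (pd (tst a n)) ≤ _ := integral_pd_tst_le ha n 3
  have h1 := pow_le_pow_left₀ (AF_nonneg _) hA 3
  have h2 := mul_le_mul_of_nonneg_right hB (sq_nonneg (NF (tst a n)))
  linarith

lemma slab_mono {a b : ℝ} (h : a ≤ b) : slab a ⊆ slab b := by
  have := mul_le_mul_of_nonneg_right h pi_pos.le
  exact Set.prod_mono le_rfl (Set.Ioc_subset_Ioc (by linarith) this)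

lemma iUnion_slab : ⋃ n : ℕ, slab (n + 1) = Set.univ := by
  refine Set.eq_univ_of_forall fun p => Set.mem_iUnion.2 ?_
  obtain ⟨n, hn⟩ := exists_nat_gt |p.2|
  refine ⟨n, Set.mem_univ _, ?_⟩
  have h1 : (n : ℝ) + 1 ≤ (n + 1) * π := by
    have := Real.pi_gt_three
    have := n.cast_nonneg (α := ℝ)
    nlinarith
  have := abs_lt.1 hn
  constructor <;> linarith

lemma tendsto_integral_slab {f : Pt → ℝ} (hf : Integrable f) :
    Tendsto (fun n : ℕ => ∫ p in slab (n + 1), f p) atTop (nhds (∫ p, f p)) := by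
  have := tendsto_setIntegral_of_monotone (μ := volume) (f := f) (s := fun n : ℕ => slab (n + 1))
    (fun n => measurableSet_slab _) (fun m n h => slab_mono (by exact_mod_cast Nat.succ_le_succ h))
    hf.integrableOn
  rwa [iUnion_slab, setIntegral_univ] at this

lemma lev_threshold_algebra {J α τ ν L : ℝ} (hJ : 0 < J) (h0 : 0 ≤ α) (h1 : α ≤ τ) (hτ : 0 < τ)
    (hτJ : τ ≤ J / 2) (hντ : 16 * ν ≤ τ)
    (h : L * (64 * (J - ν)) ^ 2 ≤ 8 / 27 * (32 * (3 * J / 2 - α / 4)) ^ 3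
      + (32 * (J / 2 - (τ - α) / 4)) / 2 * (64 * (J - ν)) ^ 2) : L < 16 * J := by
  by_contra hL
  push Not at hL
  have e : 8 / 27 * (32 * (3 * J / 2 - α / 4)) ^ 3 = 4096 / 27 * (6 * J - α) ^ 3 := by ring
  rw [e] at h
  have hc : (6 * J - α) ^ 3 ≤ 27 * (8 * J ^ 3 - 4 * J ^ 2 * α + 2 / 3 * J * α ^ 2) := by
    nlinarith [pow_nonneg h0 3]
  have h2 : L * (J - ν) ^ 2 ≤ 8 * J ^ 3 - 4 * J ^ 2 * α + 2 / 3 * J * α ^ 2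
      + (8 * J - 4 * (τ - α)) * (J - ν) ^ 2 := by nlinarith
  have h3 : 16 * J * (J - ν) ^ 2 ≤ L * (J - ν) ^ 2 :=
    mul_le_mul_of_nonneg_right hL (sq_nonneg _)
  have h4 : 0 ≤ 8 * J ^ 3 - 4 * J ^ 2 * α + 2 / 3 * J * α ^ 2
      - (8 * J + 4 * (τ - α)) * (J - ν) ^ 2 := by linarith
  have h5 : (8 * J + 4 * (τ - α)) * (J ^ 2 - 2 * J * ν) ≤ (8 * J + 4 * (τ - α)) * (J - ν) ^ 2 :=
    mul_le_mul_of_nonneg_left (by nlinarith [sq_nonneg ν]) (by linarith)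
  have h6 : J * α ^ 2 ≤ J * τ * (J / 2) := by
    have : α ^ 2 ≤ τ * (J / 2) := by nlinarith
    nlinarith
  have h7 : J * ν * J ≤ J * J * (τ / 16) := by nlinarith [mul_pos hJ hJ]
  have h8 : J * ν * (τ - α) ≤ J * (τ / 16) * (J / 2) := by
    have : ν * (τ - α) ≤ τ / 16 * (J / 2) :=
      mul_le_mul (by linarith) (by linarith) (by linarith) (by linarith)
    nlinarith
  have h9 : 0 < J ^ 2 * τ := by positivity
  nlinarith

lemma lev_lt {m₀ : ℝ} (hm : 0 < m₀) : lev m₀ < 16 * Jc := by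
  have tail : ∀ (f : Pt → ℝ), Integrable f → ∀ a, ∫ p in slab a, f p =
      (∫ p, f p) - ∫ p in (slab a)ᶜ, f p := by
    intro f hf a
    have := integral_add_compl (measurableSet_slab a) hf
    linarith
  have hns : Integrable fun p => nsq p * bub p ^ 4 := by
    have : (fun p => nsq p * bub p ^ 4) = fun p => ∑ i, co i p ^ 2 * bub p ^ 4 := by
      funext p; rw [← sum_co_sq, Finset.sum_mul]
    rw [this]
    exact integrable_finsetSum _ fun i _ => integrable_co_sq_bub i
  have hτt : Tendsto (fun n : ℕ => 4 * ∫ p in (slab (n + 1))ᶜ, nsq p * bub p ^ 4) atTop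
      (nhds 0) := by
    have h1 := ((tendsto_integral_slab hns).const_sub (∫ p, nsq p * bub p ^ 4)).const_mul 4
    rw [sub_self, mul_zero] at h1
    refine h1.congr fun n => ?_
    rw [tail _ hns]; ring
  have hMt : Tendsto (fun n : ℕ => 8 * (n + 1 : ℝ)⁻¹ * ∫ p in Dom, hx p.1) atTop (nhds 0) := by
    have h := tendsto_one_div_add_atTop_nhds_zero_nat (𝕜 := ℝ)
    simp only [one_div] at h
    simpa using (h.const_mul 8).mul_const (∫ p in Dom, hx p.1)
  have hJ := Jc_pos
  obtain ⟨n, hn1, hn2⟩ := ((hτt.eventually_lt_const (half_pos hJ)).and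
    (hMt.eventually_lt_const hm)).exists
  have hlev := lev_mul_slab_le (a := n + 1) (by positivity) hn2.le
  generalize hs : slab ((n : ℝ) + 1) = S at *
  have hSm : MeasurableSet Sᶜ := by rw [← hs]; exact (measurableSet_slab _).compl
  have hSp : ∀ p ∈ Sᶜ, 4 ≤ nsq p := by
    intro p hp
    rw [← hs] at hp
    simp only [slab, Set.mem_compl_iff, Set.mem_prod, Set.mem_univ, true_and, Set.mem_Ioc,
        not_and_or,
      not_lt, not_le] at hp
    have h1 : (2 : ℝ) ≤ (n + 1) * π := by
      have := Real.pi_gt_three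
      have := n.cast_nonneg (α := ℝ)
      nlinarith
    have h2 : 4 ≤ p.2 ^ 2 := by rcases hp with hp | hp <;> nlinarith
    unfold nsq
    nlinarith [sq_nonneg (p.1 0), sq_nonneg (p.1 1), sq_nonneg (p.1 2)]
  have tail' : ∀ (f : Pt → ℝ), Integrable f → ∫ p in S, f p = (∫ p, f p) - ∫ p in Sᶜ, f p :=
    fun f hf => hs ▸ tail f hf _
  have hsum : ∫ p in Sᶜ, nsq p * bub p ^ 4 = (∫ p in Sᶜ, co 0 p ^ 2 * bub p ^ 4)
      + (∫ p in Sᶜ, co 1 p ^ 2 * bub p ^ 4) + (∫ p in Sᶜ, co 2 p ^ 2 * bub p ^ 4)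
      + ∫ p in Sᶜ, co 3 p ^ 2 * bub p ^ 4 := by
    rw [← Fin.sum_univ_four (fun i => ∫ p in Sᶜ, co i p ^ 2 * bub p ^ 4),
      ← integral_finsetSum _ fun i _ => (integrable_co_sq_bub i).integrableOn]
    congr 1
    funext p; rw [← sum_co_sq, Finset.sum_mul]
  have hpos : ∀ i, 0 ≤ ∫ p in Sᶜ, co i p ^ 2 * bub p ^ 4 := fun i =>
    integral_nonneg fun p => by positivity
  have hν : 4 * ∫ p in Sᶜ, bub p ^ 4 ≤ ∫ p in Sᶜ, nsq p * bub p ^ 4 := by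
    rw [← integral_const_mul]
    refine setIntegral_mono_on (integrable_bub_pow_four.integrableOn.const_mul _) hns.integrableOn
      hSm
      fun p hp => mul_le_mul_of_nonneg_right (hSp p hp) (pow_nonneg (bub_pos p).le 4)
  have hν0 : 0 < ∫ p in Sᶜ, bub p ^ 4 := by
    rw [setIntegral_pos_iff_support_of_nonneg_ae
      (ae_of_all _ fun p => pow_nonneg (bub_pos p).le 4) integrable_bub_pow_four.integrableOn]
    have h1 : Function.support (fun p => bub p ^ 4) = Set.univ :=
      Set.eq_univ_of_forall fun p => (pow_pos (bub_pos p) 4).ne'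
    rw [h1, Set.univ_inter]
    have hsub : Set.univ ×ˢ Set.Ioi ((n + 1 : ℝ) * π) ⊆ Sᶜ := by
      rintro p ⟨-, hp⟩
      rw [← hs]
      exact fun h => not_lt.2 h.2.2 hp
    refine lt_of_lt_of_le ?_ (measure_mono hsub)
    exact (isOpen_univ.prod isOpen_Ioi).measure_pos volume ⟨(0, (n + 1 : ℝ) * π + 1), by simp⟩
  simp only [tail' _ integrable_bub_pow_four, tail' _ (integrable_co_sq_bub _),
    integral_co_sq_bub] at hlev
  refine lev_threshold_algebra (α := 4 * ((∫ p in Sᶜ, co 0 p ^ 2 * bub p ^ 4)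
      + (∫ p in Sᶜ, co 1 p ^ 2 * bub p ^ 4) + ∫ p in Sᶜ, co 2 p ^ 2 * bub p ^ 4))
    (τ := 4 * ∫ p in Sᶜ, nsq p * bub p ^ 4) (ν := ∫ p in Sᶜ, bub p ^ 4) hJ ?_ ?_ ?_ hn1.le ?_ ?_
  · have := hpos 0; have := hpos 1; have := hpos 2; positivity
  · rw [hsum]; have := hpos 3; linarith
  · linarith
  · linarith
  · rw [hsum]
    unfold Jc at *
    convert hlev using 2
    · ring
    · ring

lemma integral_integral_le {α : Type*} [MeasurableSpace α] {ν : Measure α} [SFinite ν]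
    {G : Pt × α → ℝ}
    (hm : Measurable G) (h0 : ∀ q, 0 ≤ G q) {c : α → ℝ} (hc : Integrable c ν)
    (hi : ∀ t, Integrable (fun p => G (p, t)) mD) (hle : ∀ t, ∫ p, G (p, t) ∂mD ≤ c t) :
    Integrable (fun p => ∫ t, G (p, t) ∂ν) mD ∧ ∫ p, ∫ t, G (p, t) ∂ν ∂mD ≤ ∫ t, c t ∂ν := by
  have hFG : Integrable G (mD.prod ν) := by
    rw [integrable_prod_iff' hm.aestronglyMeasurable]
    refine ⟨ae_of_all _ hi, hc.mono' ?_ (ae_of_all _ fun t => ?_)⟩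
    · exact (hm.norm.stronglyMeasurable.integral_prod_left').aestronglyMeasurable
    · simp only [Real.norm_of_nonneg (h0 _)]
      rw [Real.norm_of_nonneg (integral_nonneg fun p => h0 _)]
      exact hle t
  refine ⟨hFG.integral_prod_left, ?_⟩
  have e := integral_integral_swap (f := fun p t => G (p, t)) hFG
  rw [e]
  exact integral_mono hFG.integral_prod_right hc hle

lemma fderiv_sq_le (u : Pt → ℝ) (p ζ : Pt) :
    fderiv ℝ u p ζ ^ 2 ≤ 4 * ‖ζ‖ ^ 2 * ∑ i, pd u i p ^ 2 := by
  have e : ζ = ∑ i, co i ζ • dir i := by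
    ext j
    · fin_cases j <;> simp [Fin.sum_univ_four, co, dir, ex, ey]
    · simp [Fin.sum_univ_four, co, dir, ex, ey]
  have hco : ∀ i, co i ζ ^ 2 ≤ ‖ζ‖ ^ 2 := fun i => by
    have : |co i ζ| ≤ ‖ζ‖ := by
      have h1 := norm_fst_le ζ
      have h2 := norm_snd_le ζ
      have h3 := fun j => (norm_le_pi_norm ζ.1 j).trans h1
      fin_cases i
      exacts [h3 0, h3 1, h3 2, h2]
    exact sq_le_sq' (by linarith [neg_abs_le (co i ζ)]) ((le_abs_self _).trans this)
  have h1 : fderiv ℝ u p ζ = ∑ i, co i ζ * pd u i p := by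
    conv_lhs => rw [e]
    rw [map_sum]
    simp only [map_smul, smul_eq_mul]
    rfl
  rw [h1]
  have h2 : ∑ i, co i ζ ^ 2 ≤ 4 * ‖ζ‖ ^ 2 := by
    refine (Finset.sum_le_sum fun i _ => hco i).trans_eq ?_
    simp
  exact (Finset.sum_mul_sq_le_sq_mul_sq _ _ _).trans
    (mul_le_mul_of_nonneg_right h2 (Finset.sum_nonneg fun i _ => sq_nonneg _))

lemma integral_sum_pd_sq {U : Fin 4 → Pt → ℝ} (h : ∀ i, MemLp (U i) 2 mD) :
    ∫ p, ∑ i, U i p ^ 2 ∂mD = AF U + BF U := by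
  rw [integral_finsetSum _ fun i _ => (h i).integrable_sq, Fin.sum_univ_four]
  rfl

lemma CK.shift_le {u : Pt → ℝ} (hu : CK u) (ζ : Pt) :
    Integrable (fun p => (u p - u (p - ζ)) ^ 2) mD ∧
    ∫ p in Dom, (u p - u (p - ζ)) ^ 2 ≤ 4 * ‖ζ‖ ^ 2 * (AF (pd u) + BF (pd u)) := by
  have hi1 : Integrable (fun p => (u p - u (p - ζ)) ^ 2) mD := by
    have := (hu.l2p.sub (hu.l2p.comp_add (-ζ))).sq_integrable
    simpa only [← sub_eq_add_neg] using this
  refine ⟨hi1, ?_⟩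
  have hdc : Continuous fun p => fderiv ℝ u p := hu.smooth.continuous_fderiv one_ne_zero
  let D : Pt → ℝ := fun p => ∑ i, pd u i p ^ 2
  have hDc : Continuous D := continuous_finsetSum _ fun i _ => (continuous_pd hu.smooth i).pow 2
  have hDp : PeriodicY D := PeriodicY.sum fun i _ => (hu.per.pd i).pow 2
  have hDi : IntegrableOn D Dom := integrable_finsetSum _ fun i _ => (hu.memLpD i).integrable_sq
  have hD : ∫ p in Dom, D p = AF (pd u) + BF (pd u) := integral_sum_pd_sq hu.memLpD
  have pt : ∀ p, (u p - u (p - ζ)) ^ 2 ≤ ∫ t in Set.Ioc (0 : ℝ) 1, 4 * ‖ζ‖ ^ 2 * D (p - t • ζ) := by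
    intro p
    have hder : ∀ t : ℝ, HasDerivAt (fun t : ℝ => u (p - t • ζ))
        (-(fderiv ℝ u (p - t • ζ) ζ)) t := by
      intro t
      have h1 : HasDerivAt (fun t : ℝ => p - t • ζ) (-ζ) t := by
        simpa using ((hasDerivAt_id t).smul_const ζ).const_sub p
      exact ((hu.differentiable (p - t • ζ)).hasFDerivAt.comp_hasDerivAt t h1).congr_deriv
        (map_neg _ _)
    have hcont : Continuous fun t : ℝ => -(fderiv ℝ u (p - t • ζ) ζ) :=
      ((hdc.comp (by fun_prop)).clm_apply continuous_const).neg
    have h1 := intervalIntegral.integral_eq_sub_of_hasDerivAt (fun t _ => hder t)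
      (hcont.intervalIntegrable 0 1)
    simp only [one_smul, zero_smul, sub_zero] at h1
    rw [intervalIntegral.integral_of_le zero_le_one] at h1
    have h2 : (u p - u (p - ζ)) ^ 2
        = (∫ t in Set.Ioc (0 : ℝ) 1, 1 * -(fderiv ℝ u (p - t • ζ) ζ)) ^ 2 := by
      simp only [one_mul]
      rw [h1]; ring
    have hfin : ∀ g : ℝ → ℝ, Continuous g → IntegrableOn g (Set.Ioc (0 : ℝ) 1) := fun g hg =>
      (hg.integrableOn_Icc).mono_set Set.Ioc_subset_Icc_self
    rw [h2]
    refine (integral_mul_sq_le (μ := volume.restrict (Set.Ioc (0 : ℝ) 1))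
      (memLp_two_of_sq aestronglyMeasurable_const (hfin _ (by fun_prop)))
      (memLp_two_of_sq hcont.aestronglyMeasurable (hfin _ (hcont.pow 2)))).trans ?_
    have h3 : ∫ t in Set.Ioc (0 : ℝ) 1, (1 : ℝ) ^ 2 = 1 := by simp
    rw [h3, one_mul]
    refine integral_mono (hfin _ (hcont.pow 2))
      (hfin _ (continuous_const.mul (hDc.comp (by fun_prop)))) fun t => ?_
    simp only [neg_sq]
    exact fderiv_sq_le u _ ζ
  have fub := integral_integral_le (ν := volume.restrict (Set.Ioc (0 : ℝ) 1))
    (G := fun q : Pt × ℝ => 4 * ‖ζ‖ ^ 2 * D (q.1 - q.2 • ζ))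
    (c := fun _ => 4 * ‖ζ‖ ^ 2 * (AF (pd u) + BF (pd u)))
    (continuous_const.mul (hDc.comp (by fun_prop))).measurable
    (fun q => by have : 0 ≤ D (q.1 - q.2 • ζ) := Finset.sum_nonneg fun i _ => sq_nonneg _
                 positivity)
    (integrable_const _)
    (fun t => by
      have := (hDp.integrableOn_comp_add (-(t • ζ)) hDi).const_mul (4 * ‖ζ‖ ^ 2)
      simpa only [← sub_eq_add_neg] using this)
    (fun t => by
      have := hDp.setIntegral_comp_add (-(t • ζ))
      simp only [← sub_eq_add_neg] at this
      change ∫ p in Dom, 4 * ‖ζ‖ ^ 2 * D (p - t • ζ) ≤ _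
      rw [integral_const_mul, this, hD])
  refine (integral_mono hi1 fub.1 pt).trans (fub.2.trans_eq ?_)
  simp

lemma Mol.sq_integral_le {k h : Pt → ℝ} (hk : Mol k) (hh : Continuous h) :
    (∫ ζ, k ζ * h ζ) ^ 2 ≤ ∫ ζ, k ζ * h ζ ^ 2 := by
  have i1 : Integrable fun ζ => k ζ * h ζ :=
    (hk.cont.mul hh).integrable_of_hasCompactSupport hk.hasCompactSupport.mul_right
  have i2 : Integrable fun ζ => k ζ * h ζ ^ 2 :=
    (hk.cont.mul (hh.pow 2)).integrable_of_hasCompactSupport hk.hasCompactSupport.mul_right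
  obtain ⟨m, hm⟩ : ∃ m, m = ∫ ζ, k ζ * h ζ := ⟨_, rfl⟩
  have h0 : 0 ≤ ∫ ζ, k ζ * (h ζ - m) ^ 2 :=
    integral_nonneg fun ζ => mul_nonneg (hk.nonneg ζ) (sq_nonneg _)
  have e : ∀ ζ, k ζ * (h ζ - m) ^ 2 = k ζ * h ζ ^ 2 - 2 * m * (k ζ * h ζ) + m ^ 2 * k ζ :=
    fun ζ => by ring
  simp only [e] at h0
  have i3 : Integrable fun ζ => k ζ * h ζ ^ 2 - 2 * m * (k ζ * h ζ) := i2.sub (i1.const_mul _)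
  rw [integral_add i3 (hk.integrable.const_mul _), integral_sub i2 (i1.const_mul _),
    integral_const_mul, integral_const_mul, hk.int, ← hm] at h0
  rw [← hm]
  linarith

lemma CK.sub_cv_le {u k : Pt → ℝ} (hu : CK u) (hk : Mol k) {ε : ℝ}
    (hs : ∀ ζ, ε ≤ ‖ζ‖ → k ζ = 0) :
    ∫ p in Dom, (u p - cv k u p) ^ 2 ≤ 4 * ε ^ 2 * (AF (pd u) + BF (pd u)) := by
  have hAB : 0 ≤ AF (pd u) + BF (pd u) := add_nonneg (AF_nonneg _) (BF_nonneg _)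
  have hL := hu.l2p.sub (hu.l2p.cv hk).1
  have pt : ∀ p, (u p - cv k u p) ^ 2 ≤ ∫ ζ, k ζ * (u p - u (p - ζ)) ^ 2 := by
    intro p
    refine le_of_eq_of_le ?_ (hk.sq_integral_le (h := fun ζ => u p - u (p - ζ))
      (continuous_const.sub (hu.smooth.continuous.comp (by fun_prop))))
    congr 1
    simp only [mul_sub]
    rw [integral_sub (hk.integrable.mul_const _)
      (integrable_cv_integrand' hk.toKer hu.l2p.locallyIntegrable p), integral_mul_const, hk.int,
      one_mul]
    rfl
  have fub := integral_integral_le (ν := (volume : Measure Pt))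
    (G := fun q : Pt × Pt => k q.2 * (u q.1 - u (q.1 - q.2)) ^ 2)
    (c := fun ζ => k ζ * (4 * ε ^ 2 * (AF (pd u) + BF (pd u))))
    (by
      have := hk.cont
      have := hu.smooth.continuous
      exact Continuous.measurable (by fun_prop))
    (fun q => mul_nonneg (hk.nonneg _) (sq_nonneg _))
    (hk.integrable.mul_const _)
    (fun ζ => (hu.shift_le ζ).1.const_mul (k ζ))
    (fun ζ => by
      change ∫ p in Dom, k ζ * (u p - u (p - ζ)) ^ 2 ≤ _
      rw [integral_const_mul]
      rcases le_or_gt ε ‖ζ‖ with h | h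
      · rw [hs ζ h, zero_mul, zero_mul]
      · refine mul_le_mul_of_nonneg_left ((hu.shift_le ζ).2.trans ?_) (hk.nonneg ζ)
        have : ‖ζ‖ ^ 2 ≤ ε ^ 2 := pow_le_pow_left₀ (norm_nonneg _) h.le 2
        nlinarith)
  refine (integral_mono hL.sq_integrable fub.1 pt).trans (fub.2.trans_eq ?_)
  rw [integral_mul_const, hk.int, one_mul]

/-- A smooth approximation of `√w`. -/
def rad (δ w : ℝ) : ℝ := √(w + δ ^ 2) - δ

lemma rad_nonneg {δ w : ℝ} (hw : 0 ≤ w) : 0 ≤ rad δ w :=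
  sub_nonneg.2 (Real.le_sqrt_of_sq_le (by linarith))

lemma rad_sq_le {δ w : ℝ} (hδ : 0 < δ) (hw : 0 ≤ w) : rad δ w ^ 2 ≤ w := by
  have h1 : √(w + δ ^ 2) ^ 2 = w + δ ^ 2 := Real.sq_sqrt (by positivity)
  have h2 := rad_nonneg (δ := δ) hw
  unfold rad at *
  nlinarith

lemma rad_tendsto {w : ℝ} :
    Tendsto (fun n : ℕ => rad (1 / ((n : ℝ) + 1)) w) atTop (nhds √w) := by
  have h : Continuous fun δ : ℝ => rad δ w := by unfold rad; fun_prop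
  have h2 := (h.tendsto 0).comp (tendsto_one_div_add_atTop_nhds_zero_nat (𝕜 := ℝ))
  have e : rad 0 w = √w := by simp [rad]
  rw [e] at h2
  exact h2

lemma contDiff_rad {δ : ℝ} (hδ : 0 < δ) {u v : Pt → ℝ} (hu : ContDiff ℝ 1 u) (hv : ContDiff ℝ 1 v) :
    ContDiff ℝ 1 fun p => rad δ (u p ^ 2 + v p ^ 2) := by
  unfold rad
  exact (((hu.pow 2).add (hv.pow 2)).add contDiff_const |>.sqrt fun p => by positivity).sub
    contDiff_const

lemma hasFDerivAt_rad {δ : ℝ} (hδ : 0 < δ) {u v : Pt → ℝ} {p : Pt} (hu : DifferentiableAt ℝ u p)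
    (hv : DifferentiableAt ℝ v p) :
    HasFDerivAt (fun p => rad δ (u p ^ 2 + v p ^ 2))
      ((√(u p ^ 2 + v p ^ 2 + δ ^ 2))⁻¹ • (u p • fderiv ℝ u p + v p • fderiv ℝ v p)) p := by
  have h1 := ((hu.hasFDerivAt.pow 2).add (hv.hasFDerivAt.pow 2)).add_const (δ ^ 2)
  have h2 := (h1.sqrt (by change u p ^ 2 + v p ^ 2 + δ ^ 2 ≠ 0; positivity)).sub_const δ
  refine h2.congr_fderiv ?_
  ext q <;> simp <;> field_simp

lemma pd_rad_sq_le {δ : ℝ} (hδ : 0 < δ) {u v : Pt → ℝ} {p : Pt} (hu : DifferentiableAt ℝ u p)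
    (hv : DifferentiableAt ℝ v p) (i : Fin 4) :
    pd (fun p => rad δ (u p ^ 2 + v p ^ 2)) i p ^ 2 ≤ pd u i p ^ 2 + pd v i p ^ 2 := by
  have e : pd (fun p => rad δ (u p ^ 2 + v p ^ 2)) i p
      = (√(u p ^ 2 + v p ^ 2 + δ ^ 2))⁻¹ * (u p * pd u i p + v p * pd v i p) := by
    unfold pd
    rw [(hasFDerivAt_rad hδ hu hv).fderiv]
    simp [mul_add]
  have hs : 0 < u p ^ 2 + v p ^ 2 + δ ^ 2 := by positivity
  rw [e, mul_pow, inv_pow, Real.sq_sqrt hs.le, inv_mul_le_iff₀ hs]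
  nlinarith [sq_nonneg (u p * pd v i p - v p * pd u i p), sq_nonneg δ, sq_nonneg (pd u i p),
    sq_nonneg (pd v i p), mul_nonneg (sq_nonneg δ) (sq_nonneg (pd u i p)),
    mul_nonneg (sq_nonneg δ) (sq_nonneg (pd v i p))]

lemma H1.rad_wp {δ : ℝ} (hδ : 0 < δ) {u v : Pt → ℝ} (hu : H1 u) (hv : H1 v) :
    WP (fun p => rad δ (u p ^ 2 + v p ^ 2)) (pd fun p => rad δ (u p ^ 2 + v p ^ 2)) := by
  have hd : Differentiable ℝ fun p => rad δ (u p ^ 2 + v p ^ 2) := fun p =>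
    (hasFDerivAt_rad hδ (hu.diff p) (hv.diff p)).differentiableAt
  have hp : PeriodicY fun p => rad δ (u p ^ 2 + v p ^ 2) :=
    hu.periodic.comp₂ hv.periodic fun a b => rad δ (a ^ 2 + b ^ 2)
  have hw : ∀ p, 0 ≤ u p ^ 2 + v p ^ 2 := fun p => by positivity
  have hi2 : Integrable (fun p => rad δ (u p ^ 2 + v p ^ 2) ^ 2) mD :=
    (hu.memL2.add hv.memL2).mono' (hd.continuous.pow 2).aestronglyMeasurable
        (ae_of_all _ fun p => by
      rw [Real.norm_of_nonneg (sq_nonneg _)]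
      exact rad_sq_le hδ (hw p))
  have hi4 : Integrable (fun p => rad δ (u p ^ 2 + v p ^ 2) ^ 4) mD :=
    ((hu.memL4.const_mul 2).add (hv.memL4.const_mul 2)).mono'
      (hd.continuous.pow 4).aestronglyMeasurable (ae_of_all _ fun p => by
        have h1 := rad_sq_le hδ (hw p)
        rw [Real.norm_of_nonneg (by positivity)]
        change rad δ (u p ^ 2 + v p ^ 2) ^ 4 ≤ 2 * u p ^ 4 + 2 * v p ^ 4
        nlinarith [pow_le_pow_left₀ (sq_nonneg _) h1 2, sq_nonneg (u p ^ 2 - v p ^ 2)])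
  have hg : ∀ i, Integrable (fun p => pd (fun p => rad δ (u p ^ 2 + v p ^ 2)) i p ^ 2) mD :=
      fun i =>
    ((hu.memLpD i).integrable_sq.add (hv.memLpD i).integrable_sq).mono'
      ((measurable_pd _ i).pow_const 2).aestronglyMeasurable (ae_of_all _ fun p => by
        rw [Real.norm_of_nonneg (sq_nonneg _)]
        exact pd_rad_sq_le hδ (hu.diff p) (hv.diff p) i)
  refine H1.wp ⟨hp, hd, hi2, ?_, hi4⟩
  simp only [gradSq_eq]
  exact (((hg 0).add (hg 1)).add (hg 2)).add (hg 3)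

lemma tendsto_NF_rad {u v : Pt → ℝ} (hu : H1 u) (hv : H1 v) :
    Tendsto (fun n : ℕ => NF fun p => rad (1 / ((n : ℝ) + 1)) (u p ^ 2 + v p ^ 2)) atTop
      (nhds (∫ p in Dom, (u p ^ 2 + v p ^ 2) ^ 2)) := by
  have hw : ∀ p, 0 ≤ u p ^ 2 + v p ^ 2 := fun p => by positivity
  have hcu := hu.diff.continuous
  have hcv := hv.diff.continuous
  refine tendsto_integral_of_dominated_convergence (fun p => 2 * u p ^ 4 + 2 * v p ^ 4)
    (fun n => ?_) ((hu.memL4.const_mul 2).add (hv.memL4.const_mul 2))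
    (fun n => ae_of_all _ fun p => ?_) (ae_of_all _ fun p => ?_)
  · unfold rad
    fun_prop
  · have h1 := rad_sq_le (δ := 1 / ((n : ℝ) + 1)) (by positivity) (hw p)
    rw [Real.norm_of_nonneg (by positivity)]
    nlinarith [pow_le_pow_left₀ (sq_nonneg _) h1 2, sq_nonneg (u p ^ 2 - v p ^ 2)]
  · have h1 := (rad_tendsto (w := u p ^ 2 + v p ^ 2)).pow 4
    have e : √(u p ^ 2 + v p ^ 2) ^ 4 = (u p ^ 2 + v p ^ 2) ^ 2 := by
      rw [show (4 : ℕ) = 2 * 2 from rfl, pow_mul, Real.sq_sqrt (hw p)]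
    rwa [e] at h1

lemma CK.zero : CK fun _ => 0 := by
  refine ⟨contDiff_const, fun _ _ => rfl, by simp, fun i => ?_⟩
  have : pd (fun _ : Pt => (0 : ℝ)) i = fun _ => 0 := by
    funext p
    simp [pd]
  rw [this]
  simp

lemma CK.rad_zero {δ : ℝ} (hδ : 0 < δ) {u : Pt → ℝ} (hu : CK u) :
    CK (fun p => rad δ (u p ^ 2 + 0 ^ 2)) :=
  have h := H1.rad_wp hδ hu.h1 CK.zero.h1
  ⟨contDiff_rad hδ hu.smooth contDiff_const, h.fn.per, h.fn.memLp, fun i => (h.grad i).memLp⟩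

lemma levSet_nonempty {m₀ : ℝ} (hm : 0 < m₀) : (levSet m₀).Nonempty := by
  have hI : 0 ≤ ∫ p in Dom, hx p.1 := integral_nonneg fun p => sq_nonneg _
  obtain ⟨a, ha, hle⟩ : ∃ a : ℝ, 0 < a ∧ 8 * a⁻¹ * (∫ p in Dom, hx p.1) ≤ m₀ := by
    refine ⟨8 * ((∫ p in Dom, hx p.1) + 1) / m₀, by positivity, ?_⟩
    rw [inv_div]
    rw [mul_div_assoc', div_mul_eq_mul_div, div_le_iff₀ (by positivity)]
    nlinarith
  have hu := ck_tst ha 0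
  refine ⟨_, tst a 0, hu, (MF_tst_le ha 0).trans hle, ?_, rfl⟩
  have hpos : ∀ p, 0 < tst a 0 p ^ 4 := fun p => by
    have := bub_pos (fm a 0 p)
    unfold tst
    positivity
  refine (integral_pos_iff_support_of_nonneg (fun p => (hpos p).le) hu.wp.l4).2 ?_
  have : Function.support (fun p => tst a 0 p ^ 4) = Set.univ :=
    Set.eq_univ_of_forall fun p => (hpos p).ne'
  rw [this, Measure.restrict_apply_univ]
  refine lt_of_lt_of_le ?_ (measure_mono (s := Set.univ ×ˢ Set.Ioo 0 (2 * π))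
    (Set.prod_mono_right Set.Ioo_subset_Ioc_self))
  exact (isOpen_univ.prod isOpen_Ioo).measure_pos _
    ⟨(0, 1), Set.mem_univ _, by norm_num, by linarith [Real.pi_gt_three]⟩

/-- Near-minimizers can be taken nonnegative and balanced. -/
lemma exists_nonneg_balanced {m₀ c : ℝ} (hm : 0 < m₀) (hc : lev m₀ < c) : ∃ u : Pt → ℝ, CK u ∧
    (∀ p, 0 ≤ u p) ∧ MF u ≤ m₀ ∧ 0 < NF u ∧ AF (pd u) = 3 / 4 * NF u ∧ FF u (pd u) < c := by
  obtain ⟨_, ⟨u, hu, hM, hN, rfl⟩, hlt⟩ := exists_lt_of_csInf_lt (levSet_nonempty hm) hc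
  let r : ℕ → Pt → ℝ := fun n p => rad (1 / ((n : ℝ) + 1)) (u p ^ 2 + 0 ^ 2)
  have hδ : ∀ n : ℕ, 0 < 1 / ((n : ℝ) + 1) := fun n => by positivity
  have hr : ∀ n, CK (r n) := fun n => hu.rad_zero (hδ n)
  have hNr : Tendsto (fun n => NF (r n)) atTop (nhds (NF u)) := by
    have h := tendsto_NF_rad hu.h1 CK.zero.h1
    have e : ∫ p in Dom, (u p ^ 2 + 0 ^ 2) ^ 2 = NF u :=
      integral_congr_ae (ae_of_all _ fun p => by ring)
    rwa [e] at h
  have hz : ∀ p i, pd (fun _ : Pt => (0 : ℝ)) i p = 0 := fun p i => by simp [pd]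
  have hpd : ∀ n i p, pd (r n) i p ^ 2 ≤ pd u i p ^ 2 := fun n i p => by
    have := pd_rad_sq_le (hδ n) (hu.differentiable p) (CK.zero.differentiable p) i
    rw [hz] at this
    exact this.trans_eq (by ring)
  have hFG : ∀ n i, ∫ p in Dom, pd (r n) i p ^ 2 ≤ ∫ p in Dom, pd u i p ^ 2 := fun n i =>
    integral_mono ((hr n).memLpD i).integrable_sq (hu.memLpD i).integrable_sq (hpd n i)
  have hA : ∀ n, AF (pd (r n)) ≤ AF (pd u) := fun n =>
    add_le_add (add_le_add (hFG n 0) (hFG n 1)) (hFG n 2)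
  have hB : ∀ n, BF (pd (r n)) ≤ BF (pd u) := fun n => hFG n 3
  have hFlim : Tendsto (fun n => 8 / 27 * AF (pd u) ^ 3 / NF (r n) ^ 2 + BF (pd u) / 2) atTop
      (nhds (FF u (pd u))) :=
    (tendsto_const_nhds.div (hNr.pow 2) (by positivity)).add tendsto_const_nhds
  obtain ⟨n, hn1, hn2⟩ := ((hNr.eventually (lt_mem_nhds hN)).and
    (hFlim.eventually (gt_mem_nhds hlt))).exists
  have hF : FF (r n) (pd (r n)) < c := by
    refine lt_of_le_of_lt ?_ hn2
    have h1 : AF (pd (r n)) ^ 3 ≤ AF (pd u) ^ 3 := pow_le_pow_left₀ (AF_nonneg _) (hA n) 3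
    have h2 := hB n
    unfold FF
    gcongr
  have hMr : MF (r n) ≤ MF u :=
    integral_mono (hr n).l2p.sq_integrable hu.l2p.sq_integrable fun p => by
      exact (rad_sq_le (hδ n) (w := u p ^ 2 + 0 ^ 2) (by positivity)).trans_eq (by ring)
  obtain ⟨b, a, hb, ha, h1, h2, h3, h4⟩ := (hr n).exists_normalized hn1
  exact ⟨_, (hr n).dil ha, fun p => mul_nonneg hb.le (rad_nonneg (by positivity)),
    h1.le.trans (hMr.trans hM), h4, h2, h3.trans_lt hF⟩

/-- A `C¹` version of `s ↦ (s - k)₊`. -/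
def gk (k s : ℝ) : ℝ := (max (s - k) 0 ^ 2 - max (s - k - 1) 0 ^ 2) / 2

/-- The derivative of `gk k`. -/
def gk' (k s : ℝ) : ℝ := max (s - k) 0 - max (s - k - 1) 0

lemma hasDerivAt_max_sq (x : ℝ) : HasDerivAt (fun s : ℝ => max s 0 ^ 2) (2 * max x 0) x := by
  rcases lt_trichotomy x 0 with h | h | h
  · rw [max_eq_right h.le, mul_zero]
    refine (hasDerivAt_const x (0 : ℝ)).congr_of_eventuallyEq ?_
    filter_upwards [gt_mem_nhds h] with s hs
    simp [max_eq_right hs.le]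
  · subst h
    rw [max_self, mul_zero, hasDerivAt_iff_isLittleO]
    have h1 : (fun s : ℝ => s ^ 2) =o[nhds 0] fun s => s := by
      simpa using Asymptotics.isLittleO_pow_id (𝕜 := ℝ) (n := 2) one_lt_two
    refine (Asymptotics.IsBigO.of_bound 1 (Eventually.of_forall fun s => ?_)).trans_isLittleO
      (by simpa using h1)
    rcases le_total s 0 with hs | hs
    · simp [max_eq_right hs]
      positivity
    · simp [max_eq_left hs]
  · rw [max_eq_left h.le]
    have h1 : HasDerivAt (fun s : ℝ => s ^ 2) (2 * x) x := by simpa using hasDerivAt_pow 2 x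
    refine h1.congr_of_eventuallyEq ?_
    filter_upwards [lt_mem_nhds h] with s hs
    simp [max_eq_left hs.le]

lemma hasDerivAt_gk (k s : ℝ) : HasDerivAt (gk k) (gk' k s) s := by
  have h1 := (hasDerivAt_max_sq (s - k)).comp s ((hasDerivAt_id s).sub_const k)
  have h2 := (hasDerivAt_max_sq (s - k - 1)).comp s (((hasDerivAt_id s).sub_const k).sub_const 1)
  exact ((h1.sub h2).div_const 2).congr_deriv (by unfold gk'; ring)

lemma continuous_gk' (k : ℝ) : Continuous (gk' k) := by unfold gk'; fun_prop

lemma contDiff_gk (k : ℝ) : ContDiff ℝ 1 (gk k) := by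
  rw [contDiff_one_iff_deriv]
  refine ⟨fun s => (hasDerivAt_gk k s).differentiableAt, ?_⟩
  rw [show deriv (gk k) = gk' k from funext fun s => (hasDerivAt_gk k s).deriv]
  exact continuous_gk' k

lemma gk'_nonneg (k s : ℝ) : 0 ≤ gk' k s :=
  sub_nonneg.2 (max_le_max (by linarith) le_rfl)

lemma gk'_le_one (k s : ℝ) : gk' k s ≤ 1 := by
  unfold gk'
  rcases le_total (s - k) 0 with h | h <;> rcases le_total (s - k - 1) 0 with h' | h' <;>
    simp [h, h'] <;> linarith

lemma gk_eq_zero {k s : ℝ} (h : s ≤ k) : gk k s = 0 := by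
  unfold gk
  rw [max_eq_right (by linarith), max_eq_right (by linarith)]
  ring

lemma gk_of_le {k s : ℝ} (h : k ≤ s) (h' : s ≤ k + 1) : gk k s = (s - k) ^ 2 / 2 := by
  unfold gk
  rw [max_eq_left (by linarith), max_eq_right (by linarith)]
  ring

lemma gk_of_ge {k s : ℝ} (h' : k + 1 ≤ s) : gk k s = s - k - 1 / 2 := by
  unfold gk
  rw [max_eq_left (by linarith), max_eq_left (by linarith)]
  ring

lemma gk_nonneg (k s : ℝ) : 0 ≤ gk k s := by
  rcases le_total s k with h | h
  · exact (gk_eq_zero h).ge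
  · rcases le_total s (k + 1) with h' | h'
    · rw [gk_of_le h h']; positivity
    · rw [gk_of_ge h']; linarith

lemma gk_le {k s : ℝ} (h : k ≤ s) : gk k s ≤ s - k := by
  rcases le_total s (k + 1) with h' | h'
  · rw [gk_of_le h h']; nlinarith
  · rw [gk_of_ge h']; linarith

lemma sub_gk_le {k s : ℝ} (h : k ≤ s) : s - gk k s ≤ k + 1 / 2 := by
  rcases le_total s (k + 1) with h' | h'
  · rw [gk_of_le h h']; nlinarith [sq_nonneg (s - k - 1)]
  · rw [gk_of_ge h']; linarith

lemma gk_le_abs {k : ℝ} (hk : 0 ≤ k) (s : ℝ) : gk k s ≤ |s| := by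
  rcases le_total s k with h | h
  · rw [gk_eq_zero h]; positivity
  · exact (gk_le h).trans ((by linarith : s - k ≤ s).trans (le_abs_self s))

lemma pd_gk {u : Pt → ℝ} {p : Pt} (hu : DifferentiableAt ℝ u p) (k : ℝ) (i : Fin 4) :
    pd (fun p => gk k (u p)) i p = gk' k (u p) * pd u i p :=
  pd_comp (hasDerivAt_gk k (u p)) hu i

lemma L2P.gk {u : Pt → ℝ} (hu : L2P u) {k : ℝ} (hk : 0 ≤ k) : L2P fun p => gk k (u p) := by
  have hm : Measurable fun p => Waveguide.gk k (u p) :=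
    (contDiff_gk k).continuous.measurable.comp hu.meas
  refine ⟨hu.per.comp _, hm, hu.memLp.mono hm.aestronglyMeasurable (ae_of_all _ fun p => ?_)⟩
  rw [Real.norm_of_nonneg (gk_nonneg _ _)]
  exact gk_le_abs hk _

lemma CK.gk {u : Pt → ℝ} (hu : CK u) {k : ℝ} (hk : 0 ≤ k) : CK fun p => gk k (u p) := by
  refine ⟨(contDiff_gk k).comp hu.smooth, hu.per.comp _, (hu.l2p.gk hk).memLp, fun i => ?_⟩
  refine (hu.memLpD i).mono (measurable_pd _ i).aestronglyMeasurable (ae_of_all _ fun p => ?_)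
  rw [pd_gk (hu.differentiable p), norm_mul, Real.norm_of_nonneg (gk'_nonneg _ _)]
  exact mul_le_of_le_one_left (norm_nonneg _) (gk'_le_one _ _)

lemma pd_gk_sq_le {u : Pt → ℝ} (hu : CK u) (k : ℝ) (i : Fin 4) (p : Pt) :
    pd (fun p => gk k (u p)) i p ^ 2 ≤ pd u i p ^ 2 := by
  rw [pd_gk (hu.differentiable p), mul_pow]
  exact mul_le_of_le_one_left (sq_nonneg _) (pow_le_one₀ (gk'_nonneg _ _) (gk'_le_one _ _))

lemma CK.AF_gk_le {u : Pt → ℝ} (hu : CK u) {k : ℝ} (hk : 0 ≤ k) :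
    AF (pd fun p => Waveguide.gk k (u p)) ≤ AF (pd u) ∧
      BF (pd fun p => Waveguide.gk k (u p)) ≤ BF (pd u) := by
  have hFG : ∀ i, ∫ p in Dom, pd (fun p => Waveguide.gk k (u p)) i p ^ 2
      ≤ ∫ p in Dom, pd u i p ^ 2 := fun i =>
    integral_mono ((hu.gk hk).memLpD i).integrable_sq (hu.memLpD i).integrable_sq
      (pd_gk_sq_le hu k i)
  exact ⟨add_le_add (add_le_add (hFG 0) (hFG 1)) (hFG 2), hFG 3⟩

lemma gk_one_sq_le {s : ℝ} (hs : 0 ≤ s) : gk 1 s ^ 2 ≤ s ^ 3 := by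
  rcases le_total s 1 with h | h
  · rw [gk_eq_zero h, zero_pow two_ne_zero]; positivity
  · have h1 := gk_le h
    have h2 := gk_nonneg 1 s
    nlinarith [mul_nonneg hs (sub_nonneg.2 h), mul_nonneg (mul_nonneg hs hs) (sub_nonneg.2 h)]

lemma pow_four_le_gk_one {s : ℝ} (hs : 0 ≤ s) : s ^ 4 ≤ gk 1 s ^ 4 + 6 * s ^ 3 := by
  rcases le_total s 1 with h | h
  · rw [gk_eq_zero h]
    nlinarith [pow_nonneg hs 3, mul_nonneg (pow_nonneg hs 3) (sub_nonneg.2 h)]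
  · have h1 := gk_le h
    have h2 := gk_nonneg 1 s
    have h3 := sub_gk_le h
    generalize gk 1 s = z at *
    have hz : z ≤ s := by linarith
    have e : s ^ 4 - z ^ 4 = (s - z) * ((s + z) * (s ^ 2 + z ^ 2)) := by ring
    have h4 : (s + z) * (s ^ 2 + z ^ 2) ≤ (2 * s) * (2 * s ^ 2) := by
      gcongr
      · linarith
      · nlinarith
    have h5 : (s - z) * ((s + z) * (s ^ 2 + z ^ 2)) ≤ (3 / 2) * ((2 * s) * (2 * s ^ 2)) :=
      mul_le_mul (by linarith) h4 (by positivity) (by norm_num)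
    nlinarith

/-- A function in `H¹` with small `L³` norm has small excess over its `hv` bound. -/
lemma CK.hv_of_cube {u : Pt → ℝ} (hu : CK u) (h0 : ∀ p, 0 ≤ u p)
    (h3 : Integrable (fun p => u p ^ 3) mD) {c : ℝ} (hc : ∫ p in Dom, u p ^ 3 ≤ c)
      (hcN : 6 * c ≤ NF u) :
    432 * Jc ^ 2 * (NF u - 6 * c) ^ 2 ≤ AF (pd u) ^ 3 * (BF (pd u) + c) := by
  have hz := hu.gk (k := 1) zero_le_one
  have hv := hz.wp.hv
  obtain ⟨hA, hB⟩ := hu.AF_gk_le (k := 1) zero_le_one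
  have hM : MF (fun p => Waveguide.gk 1 (u p)) ≤ c :=
    (integral_mono hz.l2p.sq_integrable h3 fun p => gk_one_sq_le (h0 p)).trans hc
  have hN : NF u - 6 * c ≤ NF fun p => Waveguide.gk 1 (u p) := by
    have : NF u ≤ NF (fun p => Waveguide.gk 1 (u p)) + 6 * ∫ p in Dom, u p ^ 3 := by
      unfold NF
      rw [← integral_const_mul, ← integral_add hz.wp.l4 (h3.const_mul 6)]
      exact integral_mono hu.wp.l4 (hz.wp.l4.add (h3.const_mul 6)) fun p =>
        pow_four_le_gk_one (h0 p)
    linarith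
  have hA0 := AF_nonneg (pd fun p => Waveguide.gk 1 (u p))
  have hB0 := BF_nonneg (pd fun p => Waveguide.gk 1 (u p))
  have hM0 := MF_nonneg fun p => Waveguide.gk 1 (u p)
  have h1 : (NF u - 6 * c) ^ 2 ≤ NF (fun p => Waveguide.gk 1 (u p)) ^ 2 :=
    pow_le_pow_left₀ (by linarith) hN 2
  calc 432 * Jc ^ 2 * (NF u - 6 * c) ^ 2
      ≤ 432 * Jc ^ 2 * NF (fun p => Waveguide.gk 1 (u p)) ^ 2 := by gcongr
    _ ≤ _ := hv
    _ ≤ _ := by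
      have := pow_nonneg (AF_nonneg (pd u)) 3
      gcongr

lemma L2P.integrable_cube {u : Pt → ℝ} (hu : L2P u) (h4 : Integrable (fun p => u p ^ 4) mD) :
    Integrable (fun p => u p ^ 3) mD :=
  (hu.sq_integrable.add h4).mono' (hu.meas.pow_const 3).aestronglyMeasurable
    (ae_of_all _ fun p => by
      change |u p ^ 3| ≤ u p ^ 2 + u p ^ 4
      rw [abs_le]
      constructor <;> nlinarith [sq_nonneg (u p ^ 2 - u p), sq_nonneg (u p ^ 2 + u p),
          sq_nonneg (u p),
        sq_nonneg (u p ^ 2)])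

lemma L2P.memLp_sq {u : Pt → ℝ} (hu : L2P u) (h4 : Integrable (fun p => u p ^ 4) mD) :
    MemLp (fun p => u p ^ 2) 2 mD :=
  memLp_two_of_sq (hu.meas.pow_const 2).aestronglyMeasurable
    (h4.congr (ae_of_all _ fun p => by ring))

/-- Vanishing of local averages forces smallness of the `L³` norm. -/
lemma CK.cube_le {u k : Pt → ℝ} (hu : CK u) (hk : Mol k) {ε S : ℝ}
    (hε : 0 ≤ ε) (hs : ∀ ζ, ε ≤ ‖ζ‖ → k ζ = 0) (hS : ∀ p, cv k u p ≤ S) :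
    ∫ p in Dom, u p ^ 3 ≤ 2 * ε * √(NF u) * √(AF (pd u) + BF (pd u)) + S * MF u := by
  have hL := hu.l2p.sub (hu.l2p.cv hk).1
  have h4 := hu.l2p.memLp_sq hu.wp.l4
  have hcs := abs_integral_mul_le h4 hL.memLp
  have hsub := hu.sub_cv_le hk hs
  have hAB : 0 ≤ AF (pd u) + BF (pd u) := add_nonneg (AF_nonneg _) (BF_nonneg _)
  have e1 : √(∫ p in Dom, (u p ^ 2) ^ 2) = √(NF u) := by
    congr 1
    exact integral_congr_ae (ae_of_all _ fun p => by ring)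
  rw [e1] at hcs
  have h2 : √(∫ p in Dom, (u p - cv k u p) ^ 2) ≤ 2 * ε * √(AF (pd u) + BF (pd u)) := by
    refine Real.sqrt_le_iff.2 ⟨by positivity, hsub.trans_eq ?_⟩
    rw [mul_pow, Real.sq_sqrt hAB]
    ring
  have i1 := memLp_two_mul h4 hL.memLp
  have i2 : Integrable (fun p => S * u p ^ 2) mD := hu.l2p.sq_integrable.const_mul S
  have h3 : ∫ p in Dom, u p ^ 3 ≤ ∫ p in Dom, (u p ^ 2 * (u p - cv k u p) + S * u p ^ 2) := by
    refine integral_mono (hu.l2p.integrable_cube hu.wp.l4) (i1.add i2) fun p => ?_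
    change u p ^ 3 ≤ u p ^ 2 * (u p - cv k u p) + S * u p ^ 2
    nlinarith [mul_nonneg (sq_nonneg (u p)) (sub_nonneg.2 (hS p))]
  rw [integral_add i1 i2, integral_const_mul] at h3
  have h5 := (le_abs_self _).trans hcs
  have h6 : √(NF u) * √(∫ p in Dom, (u p - cv k u p) ^ 2)
      ≤ √(NF u) * (2 * ε * √(AF (pd u) + BF (pd u))) := by gcongr
  unfold MF
  linarith

/-- A minimizing sequence for `lev m₀` along which all the functionals converge. -/
structure MinSeq (m₀ : ℝ) (u : ℕ → Pt → ℝ) (A B N M : ℝ) : Prop where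
  ck : ∀ n, CK (u n)
  nonneg : ∀ n p, 0 ≤ u n p
  mass : ∀ n, MF (u n) ≤ m₀
  tendsA : Tendsto (fun n => AF (pd (u n))) atTop (nhds A)
  tendsB : Tendsto (fun n => BF (pd (u n))) atTop (nhds B)
  tendsN : Tendsto (fun n => NF (u n)) atTop (nhds N)
  tendsM : Tendsto (fun n => MF (u n)) atTop (nhds M)
  balanced : A = 3 / 4 * N
  level : lev m₀ = N / 8 + B / 2
  pos : 0 < N

lemma exists_minSeq {m₀ : ℝ} (hm : 0 < m₀) : ∃ u A B N M, MinSeq m₀ u A B N M := by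
  have h : ∀ n : ℕ, lev m₀ < lev m₀ + 1 / ((n : ℝ) + 1) := fun n =>
    lt_add_of_pos_right _ (by positivity)
  choose u hu h0 hM hN hA hF using fun n => exists_nonneg_balanced hm (h n)
  have hFlim : Tendsto (fun n => FF (u n) (pd (u n))) atTop (nhds (lev m₀)) := by
    have h1 := (tendsto_one_div_add_atTop_nhds_zero_nat (𝕜 := ℝ)).const_add (lev m₀)
    rw [add_zero] at h1
    exact tendsto_of_tendsto_of_tendsto_of_le_of_le tendsto_const_nhds h1
      (fun n => FF_ge_lev (hu n).wp (hM n) (hN n)) fun n => (hF n).le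
  have hFe := fun n => FF_of_balanced (hA n)
  have hFb : ∀ n, FF (u n) (pd (u n)) ≤ lev m₀ + 1 := fun n => (hF n).le.trans (by
    gcongr
    rw [div_le_one (by positivity)]
    linarith [n.cast_nonneg (α := ℝ)])
  let C := 8 * (lev m₀ + 1) + m₀
  have hl := lev_nonneg m₀
  have hmem : ∀ n, ((NF (u n), BF (pd (u n)), MF (u n)) : ℝ × ℝ × ℝ) ∈
      Set.Icc ((0, 0, 0) : ℝ × ℝ × ℝ) (C, C, C) := fun n => by
    have h1 := NF_nonneg (u n)
    have h2 := BF_nonneg (pd (u n))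
    have h3 := MF_nonneg (u n)
    have h4 := hFb n
    rw [hFe n] at h4
    have h5 := hM n
    refine ⟨⟨h1, h2, h3⟩, ?_, ?_, ?_⟩ <;> simp only [C] <;> linarith
  obtain ⟨⟨N, B, M⟩, hlim, φ, hφ, ht⟩ := isCompact_Icc.tendsto_subseq hmem
  have tN : Tendsto (fun n => NF (u (φ n))) atTop (nhds N) := (continuous_fst.tendsto _).comp ht
  have tBM := (continuous_snd.tendsto _).comp ht
  have tB : Tendsto (fun n => BF (pd (u (φ n)))) atTop (nhds B) :=
    (continuous_fst.tendsto _).comp tBM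
  have tM : Tendsto (fun n => MF (u (φ n))) atTop (nhds M) := (continuous_snd.tendsto _).comp tBM
  have tA : Tendsto (fun n => AF (pd (u (φ n)))) atTop (nhds (3 / 4 * N)) := by
    simp only [hA]
    exact tN.const_mul _
  have hlow : ∀ n, 1024 * Jc ^ 2 ≤ NF (u n) * (BF (pd (u n)) + MF (u n)) := fun n => by
    have hv := (hu n).wp.hv
    rw [hA n] at hv
    have hp := pow_pos (hN n) 2
    refine le_of_mul_le_mul_left ?_ hp
    nlinarith
  have hlow' := le_of_tendsto_of_tendsto' tendsto_const_nhds (tN.mul (tB.add tM)) fun n =>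
    hlow (φ n)
  have hlev : lev m₀ = N / 8 + B / 2 := by
    refine tendsto_nhds_unique (hFlim.comp hφ.tendsto_atTop) ?_
    have := (tN.div_const 8).add (tB.div_const 2)
    simpa only [Function.comp_def, hFe] using this
  refine ⟨fun n => u (φ n), _, B, N, M, fun n => hu _, fun n => h0 _, fun n => hM _, tA, tB, tN, tM,
    rfl, hlev, ?_⟩
  have h0N : (0 : ℝ) ≤ N := ge_of_tendsto' tN fun n => NF_nonneg _
  refine lt_of_le_of_ne h0N fun h => ?_
  rw [← h, zero_mul] at hlow'
  have := pow_pos Jc_pos 2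
  linarith

namespace MinSeq

variable {m₀ A B N M : ℝ} {u : ℕ → Pt → ℝ}

lemma comp (h : MinSeq m₀ u A B N M) {φ : ℕ → ℕ} (hφ : StrictMono φ) :
    MinSeq m₀ (fun n => u (φ n)) A B N M where
  ck _ := h.ck _
  nonneg _ := h.nonneg _
  mass _ := h.mass _
  tendsA := h.tendsA.comp hφ.tendsto_atTop
  tendsB := h.tendsB.comp hφ.tendsto_atTop
  tendsN := h.tendsN.comp hφ.tendsto_atTop
  tendsM := h.tendsM.comp hφ.tendsto_atTop
  balanced := h.balanced
  level := h.level
  pos := h.pos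

lemma le_cube_of_vanishing (hm : 0 < m₀) (h : MinSeq m₀ u A B N M)
    (hv : ∀ j : ℕ, ∀ c : ℝ, 0 < c → ∀ᶠ n in atTop, ∀ p, cv (rho j) (u n) p ≤ c) {η : ℝ}
      (hη : 0 < η) :
    ∀ᶠ n in atTop, ∫ p in Dom, u n p ^ 3 ≤ η := by
  have hK := (h.tendsN.sqrt).mul ((h.tendsA.add h.tendsB).sqrt)
  set K := √N * √(A + B) with hKdef
  have hK0 : 0 ≤ K := by positivity
  obtain ⟨j, hj⟩ := exists_nat_one_div_lt (show (0 : ℝ) < η / (4 * (K + 1)) by positivity)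
  have hj' : ((j : ℝ) + 1)⁻¹ * (4 * (K + 1)) < η := by
    rw [one_div, lt_div_iff₀ (by positivity)] at hj
    exact hj
  filter_upwards [hK.eventually (gt_mem_nhds (lt_add_one K)),
    hv j (η / (2 * m₀)) (by positivity)] with n h1 h2
  have h3 := (h.ck n).cube_le (mol_rho j) (ε := ((j : ℝ) + 1)⁻¹) (by positivity)
    (fun ζ hζ => rho_eq_zero hζ) h2
  have h4 : η / (2 * m₀) * MF (u n) ≤ η / 2 := by
    calc η / (2 * m₀) * MF (u n) ≤ η / (2 * m₀) * m₀ := by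
          have := h.mass n
          gcongr
      _ = η / 2 := by field_simp
  have h5 : 2 * ((j : ℝ) + 1)⁻¹ * √(NF (u n)) * √(AF (pd (u n)) + BF (pd (u n)))
      ≤ 2 * ((j : ℝ) + 1)⁻¹ * (K + 1) := by
    rw [mul_assoc]
    gcongr
  linarith

lemma exists_average (hm : 0 < m₀) (h : MinSeq m₀ u A B N M) : ∃ j : ℕ, ∃ c : ℝ, 0 < c ∧
    ∃ᶠ n in atTop, ∃ p, c ≤ cv (rho j) (u n) p := by
  by_contra hcon
  push Not at hcon
  have hv : ∀ j : ℕ, ∀ c : ℝ, 0 < c → ∀ᶠ n in atTop, ∀ p, cv (rho j) (u n) p ≤ c := fun j c hc => by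
    filter_upwards [hcon j c hc] with n hn p using (hn p).le
  have key : ∀ η : ℝ, 0 < η → 6 * η < N → 432 * Jc ^ 2 * (N - 6 * η) ^ 2 ≤ A ^ 3 * (B + η) := by
    intro η hη hηN
    refine le_of_tendsto_of_tendsto (((h.tendsN.sub_const _).pow 2).const_mul _)
      ((h.tendsA.pow 3).mul (h.tendsB.add_const η)) ?_
    filter_upwards [h.le_cube_of_vanishing hm hv hη, h.tendsN.eventually (lt_mem_nhds hηN)]
      with n h1 h2
    exact (h.ck n).hv_of_cube (h.nonneg n) ((h.ck n).l2p.integrable_cube (h.ck n).wp.l4) h1 h2.le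
  have hlim : 432 * Jc ^ 2 * (N - 6 * 0) ^ 2 ≤ A ^ 3 * (B + 0) := by
    have c1 : Continuous fun η : ℝ => 432 * Jc ^ 2 * (N - 6 * η) ^ 2 := by fun_prop
    have c2 : Continuous fun η : ℝ => A ^ 3 * (B + η) := by fun_prop
    refine le_of_tendsto_of_tendsto (b := nhdsWithin 0 (Set.Ioi 0))
      (c1.continuousWithinAt (s := Set.Ioi 0) (x := 0))
        (c2.continuousWithinAt (s := Set.Ioi 0) (x := 0)) ?_
    have hN6 : 0 < N / 6 := by linarith [h.pos]
    filter_upwards [Ioo_mem_nhdsGT hN6] with η hη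
    exact key η hη.1 (by linarith [hη.2])
  rw [mul_zero, sub_zero, add_zero, h.balanced] at hlim
  have h1 : 1024 * Jc ^ 2 ≤ N * B := by
    refine le_of_mul_le_mul_left ?_ (pow_pos h.pos 2)
    nlinarith
  have h2 := lev_lt hm
  have hJ := Jc_pos
  have h3 := lev_nonneg m₀
  have h4 : lev m₀ ^ 2 < (16 * Jc) ^ 2 := pow_lt_pow_left₀ h2 h3 two_ne_zero
  rw [h.level] at h4
  nlinarith [sq_nonneg (N / 8 - B / 2)]

end MinSeq

lemma CK.comp_add {u : Pt → ℝ} (hu : CK u) (a : Pt) : CK fun p => u (p + a) := by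
  refine ⟨hu.smooth.comp (contDiff_id.add contDiff_const), hu.per.comp_add a,
    (hu.l2p.comp_add a).memLp, fun i => ?_⟩
  rw [show pd (fun p => u (p + a)) i = fun p => pd u i (p + a) from funext (pd_comp_add u a i)]
  exact ((hu.l2p_pd i).comp_add a).memLp

lemma PeriodicY.setIntegral_pow_comp_add {f : Pt → ℝ} (hf : PeriodicY f) (a : Pt) (n : ℕ) :
    ∫ p in Dom, f (p + a) ^ n = ∫ p in Dom, f p ^ n :=
  (hf.pow n).setIntegral_comp_add a

lemma CK.setIntegral_pd_comp_add {u : Pt → ℝ} (hu : CK u) (a : Pt) (i : Fin 4) :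
    ∫ p in Dom, pd (fun p => u (p + a)) i p ^ 2 = ∫ p in Dom, pd u i p ^ 2 := by
  simp only [pd_comp_add]
  exact (hu.per.pd i).setIntegral_pow_comp_add a 2

lemma cv_comp_add (k u : Pt → ℝ) (a p : Pt) : cv k (fun q => u (q + a)) p = cv k u (p + a) := by
  unfold cv
  simp only [sub_add_eq_add_sub]

lemma MinSeq.translate {m₀ A B N M : ℝ} {u : ℕ → Pt → ℝ} (h : MinSeq m₀ u A B N M) (a : ℕ → Pt) :
    MinSeq m₀ (fun n p => u n (p + a n)) A B N M := by
  have eM : ∀ n, MF (fun p => u n (p + a n)) = MF (u n) := fun n =>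
    (h.ck n).per.setIntegral_pow_comp_add _ 2
  have eN : ∀ n, NF (fun p => u n (p + a n)) = NF (u n) := fun n =>
    (h.ck n).per.setIntegral_pow_comp_add _ 4
  have eA : ∀ n, AF (pd fun p => u n (p + a n)) = AF (pd (u n)) := fun n => by
    unfold AF
    simp only [(h.ck n).setIntegral_pd_comp_add]
  have eB : ∀ n, BF (pd fun p => u n (p + a n)) = BF (pd (u n)) := fun n =>
    (h.ck n).setIntegral_pd_comp_add _ 3
  exact ⟨fun n => (h.ck n).comp_add _, fun n p => h.nonneg n _, fun n => (eM n).le.trans (h.mass n),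
    by simpa only [eA] using h.tendsA, by simpa only [eB] using h.tendsB,
    by simpa only [eN] using h.tendsN, by simpa only [eM] using h.tendsM,
    h.balanced, h.level, h.pos⟩

lemma exists_minSeq_average {m₀ : ℝ} (hm : 0 < m₀) : ∃ u A B N M, MinSeq m₀ u A B N M ∧
    ∃ j : ℕ, ∃ c : ℝ, 0 < c ∧ ∀ n, c ≤ cv (rho j) (u n) 0 := by
  obtain ⟨u, A, B, N, M, h⟩ := exists_minSeq hm
  obtain ⟨j, c, hc, hf⟩ := h.exists_average hm
  obtain ⟨φ, hφ, hp⟩ := extraction_of_frequently_atTop hf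
  choose a ha using hp
  refine ⟨_, A, B, N, M, (h.comp hφ).translate a, j, c, hc, fun n => ?_⟩
  rw [cv_comp_add, zero_add]
  exact ha n

lemma exists_weak_subseq {H : Type*} [NormedAddCommGroup H] [InnerProductSpace ℝ H]
    [CompleteSpace H]
    [TopologicalSpace.SeparableSpace H] (x : ℕ → H) (C : ℝ) (h : ∀ n, ‖x n‖ ≤ C) :
    ∃ a : H, ∃ φ : ℕ → ℕ, StrictMono φ ∧
      ∀ y, Tendsto (fun n => inner ℝ (x (φ n)) y) atTop (nhds (inner ℝ a y)) := by
  let T : ℕ → WeakDual ℝ H := fun n => StrongDual.toWeakDual (InnerProductSpace.toDual ℝ H (x n))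
  have hT : ∀ n, T n ∈ WeakDual.toStrongDual ⁻¹' Metric.closedBall (0 : StrongDual ℝ H) C :=
      fun n => by
    simp only [Set.mem_preimage, mem_closedBall_zero_iff]
    change ‖InnerProductSpace.toDual ℝ H (x n)‖ ≤ C
    rw [LinearIsometryEquiv.norm_map]
    exact h n
  obtain ⟨l, -, φ, hφ, ht⟩ := WeakDual.isSeqCompact_closedBall ℝ H 0 C hT
  refine ⟨(InnerProductSpace.toDual ℝ H).symm (WeakDual.toStrongDual l), φ, hφ, fun y => ?_⟩
  have h1 := ((WeakDual.eval_continuous y).tendsto l).comp ht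
  have h2 : inner ℝ ((InnerProductSpace.toDual ℝ H).symm (WeakDual.toStrongDual l)) y = l y := by
    rw [InnerProductSpace.toDual_symm_apply]
    rfl
  rw [h2]
  exact h1

/-- The representative of `y` modulo `2π` in `(a, a + 2π]`. -/
def perY (a y : ℝ) : ℝ := y - 2 * π * (⌈(y - a) / (2 * π)⌉ - 1)

lemma perY_add (a y : ℝ) : perY a (y + 2 * π) = perY a y := by
  unfold perY
  have : (y + 2 * π - a) / (2 * π) = (y - a) / (2 * π) + 1 := by
    have := Real.pi_pos
    field_simp
    ring
  rw [this, Int.ceil_add_one]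
  push_cast
  ring

lemma perY_of_mem {a y : ℝ} (h : y ∈ Set.Ioc a (a + 2 * π)) : perY a y = y := by
  have hpi := Real.two_pi_pos
  have : ⌈(y - a) / (2 * π)⌉ = 1 := by
    rw [Int.ceil_eq_iff]
    constructor
    · push_cast
      rw [sub_self]
      exact div_pos (by linarith [h.1]) hpi
    · push_cast
      rw [div_le_one hpi]
      linarith [h.2]
  rw [perY, this]
  simp

lemma measurable_perY (a : ℝ) : Measurable (perY a) := by
  unfold perY
  have : Measurable fun y : ℝ => (⌈(y - a) / (2 * π)⌉ : ℝ) :=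
    measurable_from_top.comp ((measurable_id.sub_const a).div_const (2 * π)).ceil
  fun_prop

/-- The `2π`-periodic extension in `y` of the restriction of `g` to `strip a`. -/
def pext (a : ℝ) (g : Pt → ℝ) (p : Pt) : ℝ := g (p.1, perY a p.2)

lemma pext_periodic (a : ℝ) (g : Pt → ℝ) : PeriodicY (pext a g) := fun x y => by
  simp only [pext, perY_add]

lemma pext_eq {a : ℝ} (g : Pt → ℝ) {p : Pt} (hp : p ∈ strip a) : pext a g p = g p := by
  rw [pext, perY_of_mem hp.2]

lemma measurable_pext (a : ℝ) {g : Pt → ℝ} (hg : Measurable g) : Measurable (pext a g) :=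
  hg.comp (measurable_fst.prodMk ((measurable_perY a).comp measurable_snd))

/-- Weak convergence in `L²(ℝ³ × 𝕋)`. -/
def WC (f : ℕ → Pt → ℝ) (g : Pt → ℝ) : Prop := ∀ w, MemLp w 2 mD →
  Tendsto (fun n => ∫ p in Dom, f n p * w p) atTop (nhds (∫ p in Dom, g p * w p))

lemma WC.comp {f : ℕ → Pt → ℝ} {g : Pt → ℝ} (h : WC f g) {φ : ℕ → ℕ} (hφ : StrictMono φ) :
    WC (fun n => f (φ n)) g := fun w hw => (h w hw).comp hφ.tendsto_atTop

lemma WC.congr {f : ℕ → Pt → ℝ} {g g' : Pt → ℝ} (h : WC f g) (hg : g =ᵐ[mD] g') : WC f g' :=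
  fun w hw => by
    have e : ∫ p in Dom, g' p * w p = ∫ p in Dom, g p * w p :=
      integral_congr_ae (by filter_upwards [hg] with p hp; rw [hp])
    rw [e]
    exact h w hw

lemma exists_wc {f : ℕ → Pt → ℝ} (hf : ∀ n, L2P (f n)) {C : ℝ} (hC : ∀ n, MF (f n) ≤ C) :
    ∃ g, L2P g ∧ ∃ φ : ℕ → ℕ, StrictMono φ ∧ WC (fun n => f (φ n)) g := by
  let x : ℕ → Lp ℝ 2 mD := fun n => (hf n).memLp.toLp
  have inner_eq : ∀ (u v : Lp ℝ 2 mD), inner ℝ u v = ∫ p in Dom, u p * v p := fun u v => by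
    rw [L2.inner_def]
    simp [mul_comm]
  have hx : ∀ n, ‖x n‖ ≤ √C := fun n => by
    refine Real.le_sqrt_of_sq_le ?_
    rw [← real_inner_self_eq_norm_sq, inner_eq]
    refine le_trans (le_of_eq ?_) (hC n)
    refine integral_congr_ae ?_
    filter_upwards [(hf n).memLp.coeFn_toLp] with p hp
    rw [hp]
    ring
  have : Fact ((2 : ENNReal) ≠ ⊤) := ⟨by simp⟩
  have : SFinite mD := inferInstanceAs (SFinite (volume.restrict Dom))
  have : IsSeparable mD := inferInstance
  have : SecondCountableTopology (Lp ℝ 2 mD) := Lp.SecondCountableTopology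
  obtain ⟨a, φ, hφ, ht⟩ := exists_weak_subseq x _ hx
  have ha := (Lp.memLp a).1
  let a' := ha.mk a
  have hae : a' =ᵐ[mD] a := ha.ae_eq_mk.symm
  have hext : pext 0 a' =ᵐ[mD] a' := by
    filter_upwards [ae_restrict_mem measurableSet_Dom] with p hp
    exact pext_eq _ (by rwa [strip_zero])
  have hg : pext 0 a' =ᵐ[mD] a := hext.trans hae
  refine ⟨pext 0 a', ⟨pext_periodic _ _, measurable_pext _ ha.stronglyMeasurable_mk.measurable,
    (memLp_congr_ae hg).2 (Lp.memLp a)⟩, φ, hφ, fun w hw => ?_⟩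
  have h1 := ht (hw.toLp w)
  simp only [inner_eq] at h1
  have e1 : ∀ n, ∫ p in Dom, x (φ n) p * hw.toLp w p = ∫ p in Dom, f (φ n) p * w p := fun n => by
    refine integral_congr_ae ?_
    filter_upwards [(hf (φ n)).memLp.coeFn_toLp, hw.coeFn_toLp] with p hp hp'
    rw [hp, hp']
  have e2 : ∫ p in Dom, a p * hw.toLp w p = ∫ p in Dom, pext 0 a' p * w p := by
    refine integral_congr_ae ?_
    filter_upwards [hg, hw.coeFn_toLp] with p hp hp'
    rw [hp, hp']
  simp only [e1, e2] at h1
  exact h1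

lemma exists_wc_family {ι : Type*} [DecidableEq ι] (s : Finset ι) {f : ι → ℕ → Pt → ℝ}
    (hf : ∀ i n, L2P (f i n)) {C : ℝ} (hC : ∀ i n, MF (f i n) ≤ C) :
    ∃ g : ι → Pt → ℝ, ∃ φ : ℕ → ℕ, StrictMono φ ∧
      ∀ i ∈ s, L2P (g i) ∧ WC (fun n => f i (φ n)) (g i) := by
  induction s using Finset.induction_on with
  | empty => exact ⟨fun _ _ => 0, id, strictMono_id, by simp⟩
  | insert j s hj ih =>
    obtain ⟨g, φ, hφ, h⟩ := ih
    obtain ⟨w, hw, ψ, hψ, hc⟩ := exists_wc (fun n => hf j (φ n)) (fun n => hC j (φ n))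
    refine ⟨Function.update g j w, φ ∘ ψ, hφ.comp hψ, fun i hi => ?_⟩
    by_cases hij : i = j
    · subst hij
      rw [Function.update_self]
      exact ⟨hw, hc⟩
    · rw [Function.update_of_ne hij]
      have hi' := h i ((Finset.mem_insert.1 hi).resolve_left hij)
      exact ⟨hi'.1, hi'.2.comp hψ⟩

lemma WC.tendsto_strip {f : ℕ → Pt → ℝ} {g : Pt → ℝ} (h : WC f g) (hf : ∀ n, L2P (f n)) (hg : L2P g)
    {φ : Pt → ℝ} (hφ : Continuous φ) (hc : HasCompactSupport φ) (a : ℝ) :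
    Tendsto (fun n => ∫ p in strip a, f n p * φ p) atTop (nhds (∫ p in strip a, g p * φ p)) := by
  have hP : PeriodicY fun p => pext a φ p ^ 2 := (pext_periodic a φ).pow 2
  have hm : Measurable (pext a φ) := measurable_pext a hφ.measurable
  have hi : IntegrableOn (fun p => φ p ^ 2) (strip a) := by
    have : HasCompactSupport fun p => φ p ^ 2 := hc.comp_left (g := fun t => t ^ 2) (by simp)
    exact ((hφ.pow 2).integrable_of_hasCompactSupport this).integrableOn
  have hi2 : IntegrableOn (fun p => pext a φ p ^ 2) (strip a) :=
    hi.congr_fun (fun p hp => by simp only [pext_eq φ hp]) (measurableSet_strip a)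
  have hw : MemLp (pext a φ) 2 mD :=
    memLp_two_of_sq hm.aestronglyMeasurable ((hP.integrableOn_strip_iff a).1 hi2)
  have e : ∀ u, PeriodicY u → ∫ p in strip a, u p * φ p = ∫ p in Dom, u p * pext a φ p :=
      fun u hu => by
    rw [← (hu.mul (pext_periodic a φ)).setIntegral_strip a]
    exact setIntegral_congr_fun (measurableSet_strip a) fun p hp => by simp only [pext_eq φ hp]
  rw [e g hg.per]
  simp only [e _ (hf _).per]
  exact h _ hw

lemma WC.tendsto_integral {f : ℕ → Pt → ℝ} {g : Pt → ℝ} (h : WC f g) (hf : ∀ n, L2P (f n))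
    (hg : L2P g)
    {φ : Pt → ℝ} (hφ : Continuous φ) (hc : HasCompactSupport φ) :
    Tendsto (fun n => ∫ p, f n p * φ p) atTop (nhds (∫ p, g p * φ p)) := by
  have hFG : ∀ u, L2P u → Integrable fun p => u p * φ p := fun u hu => by
    have := hu.locallyIntegrable.integrable_smul_left_of_hasCompactSupport hφ hc
    simpa [mul_comm] using this
  have hpi := Real.two_pi_pos
  let big : ℝ → ℕ → Set Pt := fun a m => Set.univ ×ˢ Set.Ioc a (a + m * (2 * π))
  have hbig : ∀ (a : ℝ) (m : ℕ) u, L2P u → ∫ p in big a (m + 1), u p * φ p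
      = (∫ p in big a m, u p * φ p) + ∫ p in strip (a + m * (2 * π)), u p * φ p :=
          fun a m u hu => by
    have hun : big a (m + 1) = big a m ∪ strip (a + m * (2 * π)) := by
      have h1 : a ≤ a + m * (2 * π) := le_add_of_nonneg_right (by positivity)
      have h2 : a + m * (2 * π) ≤ a + m * (2 * π) + 2 * π := by linarith
      have := Set.Ioc_union_Ioc_eq_Ioc h1 h2
      simp only [big, strip, ← Set.prod_union, this]
      push_cast
      ring_nf
    rw [hun, setIntegral_union ?_ (measurableSet_strip _) (hFG u hu).integrableOn
      (hFG u hu).integrableOn]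
    refine Set.disjoint_left.2 fun p hp hp' => ?_
    exact absurd hp.2.2 (not_le.2 hp'.2.1)
  have ht : ∀ (a : ℝ) (m : ℕ), Tendsto (fun n => ∫ p in big a m, f n p * φ p) atTop
      (nhds (∫ p in big a m, g p * φ p)) := fun a m => by
    induction m with
    | zero => simp [big]
    | succ m ih =>
      rw [hbig a m g hg]
      simp only [hbig a m _ (hf _)]
      exact ih.add (h.tendsto_strip hf hg hφ hc _)
  obtain ⟨R, hR⟩ := hc.isCompact.isBounded.subset_closedBall 0
  obtain ⟨m, hm⟩ := exists_nat_gt (R / (2 * π))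
  have hmR : R < m * (2 * π) := by rwa [div_lt_iff₀ hpi] at hm
  have e : ∀ u : Pt → ℝ, ∫ p, u p * φ p = ∫ p in big (-(m * (2 * π))) (2 * m), u p * φ p :=
      fun u => by
    refine (setIntegral_eq_integral_of_forall_compl_eq_zero fun p hp => ?_).symm
    have : φ p = 0 := by
      by_contra hne
      have h1 := hR (subset_tsupport φ hne)
      rw [mem_closedBall_zero_iff] at h1
      have h2 := (norm_snd_le p).trans h1
      rw [Real.norm_eq_abs, abs_le] at h2
      refine hp ⟨Set.mem_univ _, ?_, ?_⟩
      · linarith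
      · push_cast
        linarith
    rw [this, mul_zero]
  rw [e g]
  simp only [e]
  exact ht _ _

lemma WC.tendsto_cv {f : ℕ → Pt → ℝ} {g k : Pt → ℝ} (h : WC f g) (hf : ∀ n, L2P (f n)) (hg : L2P g)
    (hk : Ker k) (p : Pt) : Tendsto (fun n => cv k (f n) p) atTop (nhds (cv k g p)) := by
  simp only [cv_eq_swap, mul_comm (k _)]
  exact h.tendsto_integral hf hg (hk.cont.comp (by fun_prop))
    (hk.hasCompactSupport.comp_homeomorph (Homeomorph.subLeft p))

lemma WC.wp {f : ℕ → Pt → ℝ} {F : Fin 4 → ℕ → Pt → ℝ} {g : Pt → ℝ} {G : Fin 4 → Pt → ℝ}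
    (hw : ∀ n, WP (f n) fun i => F i n) (hg : L2P g) (hG : ∀ i, L2P (G i)) (h : WC f g)
    (hF : ∀ i, WC (F i) (G i)) : WP g G := by
  refine ⟨hg, hG, fun φ hφ hc i => ?_⟩
  have hc' : HasCompactSupport (pd φ i) := hc.fderiv_apply (𝕜 := ℝ) (dir i)
  have h1 := h.tendsto_integral (fun n => (hw n).fn) hg (continuous_pd hφ i) hc'
  have h2 := (hF i).tendsto_integral (fun n => (hw n).grad i) (hG i) hφ.continuous hc
  simp only [(hw _).weak φ hφ hc i] at h1
  exact tendsto_nhds_unique h1 h2.neg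

section BrezisLieb

variable {α : Type*} [MeasurableSpace α] {μ : Measure α}

lemma tendsto_integral_abs_zero_of_le {f h : ℕ → α → ℝ} {g : ℝ → α → ℝ} {C : ℝ}
    (hf : ∀ n, Integrable (f n) μ) (hl : ∀ᵐ x ∂μ, Tendsto (fun n => f n x) atTop (nhds 0))
    (hh : ∀ n, Integrable (h n) μ) (hC : ∀ n, ∫ x, h n x ∂μ ≤ C) (h0 : ∀ n x, 0 ≤ h n x)
    (hg : ∀ η, 0 < η → Integrable (g η) μ)
    (hle : ∀ η, 0 < η → ∀ n x, |f n x| ≤ η * h n x + g η x) :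
    Tendsto (fun n => ∫ x, |f n x| ∂μ) atTop (nhds 0) := by
  have hC0 : 0 ≤ C := (integral_nonneg (h0 0)).trans (hC 0)
  refine tendsto_order.2 ⟨fun a ha => Eventually.of_forall fun n =>
    ha.trans_le (integral_nonneg fun x => abs_nonneg _), fun ε hε => ?_⟩
  set η := ε / (2 * (C + 1)) with hη
  have hη0 : 0 < η := by positivity
  let W : ℕ → α → ℝ := fun n x => max (|f n x| - η * h n x) 0
  have hWi : ∀ n, Integrable (W n) μ := fun n =>
    ((hf n).abs.sub ((hh n).const_mul η)).pos_part
  have hW : Tendsto (fun n => ∫ x, W n x ∂μ) atTop (nhds (∫ _, (0 : ℝ) ∂μ)) := by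
    refine tendsto_integral_of_dominated_convergence (fun x => |g η x|)
      (fun n => (hWi n).aestronglyMeasurable) (hg η hη0).abs
        (fun n => Eventually.of_forall fun x => ?_) ?_
    · rw [Real.norm_eq_abs, abs_of_nonneg (le_max_right _ _)]
      exact max_le (by linarith [hle η hη0 n x, le_abs_self (g η x)]) (abs_nonneg _)
    · filter_upwards [hl] with x hx
      have hx' : Tendsto (fun n => |f n x|) atTop (nhds 0) := by simpa using hx.abs
      refine squeeze_zero (fun n => le_max_right _ _) (fun n => max_le ?_ (abs_nonneg _)) hx'
      linarith [mul_nonneg hη0.le (h0 n x)]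
  rw [integral_zero] at hW
  filter_upwards [(tendsto_order.1 hW).2 (ε / 2) (by positivity)] with n hn
  have h1 : ∫ x, |f n x| ∂μ ≤ ∫ x, (η * h n x + W n x) ∂μ :=
    integral_mono (hf n).abs (((hh n).const_mul η).add (hWi n)) fun x => by
      have := le_max_left (|f n x| - η * h n x) 0
      change |f n x| ≤ η * h n x + W n x
      simp only [W]
      linarith
  rw [integral_add ((hh n).const_mul η) (hWi n), integral_const_mul] at h1
  have h2 : η * ∫ x, h n x ∂μ ≤ ε / 2 := by
    calc η * ∫ x, h n x ∂μ ≤ η * (C + 1) := by gcongr; linarith [hC n]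
      _ = ε / 2 := by rw [hη]; field_simp
  linarith

lemma tendsto_integral_of_abs_sub {f : ℕ → α → ℝ} {g : α → ℝ} (hf : ∀ n, Integrable (f n) μ)
    (hg : Integrable g μ) (h : Tendsto (fun n => ∫ x, |f n x - g x| ∂μ) atTop (nhds 0)) :
    Tendsto (fun n => ∫ x, f n x ∂μ) atTop (nhds (∫ x, g x ∂μ)) := by
  rw [tendsto_iff_norm_sub_tendsto_zero]
  refine squeeze_zero (fun n => norm_nonneg _) (fun n => ?_) h
  rw [← integral_sub (hf n) hg]
  exact norm_integral_le_integral_norm _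

lemma exists_seq_tendsto_ae_of_integral {f : ℕ → α → ℝ} (hf : ∀ n, Integrable (f n) μ)
    (h0 : ∀ n x, 0 ≤ f n x) (h : Tendsto (fun n => ∫ x, f n x ∂μ) atTop (nhds 0)) :
    ∃ φ : ℕ → ℕ, StrictMono φ ∧ ∀ᵐ x ∂μ, Tendsto (fun n => f (φ n) x) atTop (nhds 0) := by
  have e : ∀ n, eLpNorm (f n - fun _ => 0) 1 μ = ENNReal.ofReal (∫ x, f n x ∂μ) := fun n => by
    rw [ofReal_integral_eq_lintegral_ofReal (hf n) (Eventually.of_forall (h0 n)),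
      eLpNorm_one_eq_lintegral_enorm]
    refine lintegral_congr fun x => ?_
    simp only [Pi.sub_apply, sub_zero]
    exact Real.enorm_of_nonneg (h0 n x)
  have h1 : Tendsto (fun n => eLpNorm (f n - fun _ => 0) 1 μ) atTop (nhds 0) := by
    simp only [e]
    simpa using ENNReal.tendsto_ofReal h
  exact (tendstoInMeasure_of_tendsto_eLpNorm one_ne_zero (fun n => (hf n).aestronglyMeasurable)
    aestronglyMeasurable_const h1).exists_seq_tendsto_ae

end BrezisLieb

lemma quartic_split {η : ℝ} (hη : 0 < η) (w u : ℝ) :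
    |(w + u) ^ 4 - w ^ 4 - u ^ 4| ≤ η * w ^ 4 + 14 / min 1 (η / 14) ^ 3 * u ^ 4 := by
  set t := min 1 (η / 14) with ht
  have ht0 : 0 < t := lt_min one_pos (by positivity)
  have ht1 : t ≤ 1 := min_le_left _ _
  have ht2 : 14 * t ≤ η := by linarith [min_le_right 1 (η / 14)]
  have e : (w + u) ^ 4 - w ^ 4 - u ^ 4 =
    4 * (w ^ 3 * u) + 6 * (w ^ 2 * u ^ 2) + 4 * (w * u ^ 3) := by ring
  have h1 : |(w + u) ^ 4 - w ^ 4 - u ^ 4|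
      ≤ 4 * (|w| ^ 3 * |u|) + 6 * (|w| ^ 2 * |u| ^ 2) + 4 * (|w| * |u| ^ 3) := by
    rw [e]
    refine (abs_add_le _ _).trans (add_le_add ((abs_add_le _ _).trans (add_le_add ?_ ?_)) ?_) <;>
      simp [abs_mul]
  have hw4 : w ^ 4 = |w| ^ 4 := by rw [← abs_pow, abs_of_nonneg (by positivity)]
  have hu4 : u ^ 4 = |u| ^ 4 := by rw [← abs_pow, abs_of_nonneg (by positivity)]
  have hwn := abs_nonneg w
  have hun := abs_nonneg u
  refine h1.trans ?_
  rw [hw4, hu4]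
  clear h1 hw4 hu4 e
  generalize |w| = a at *
  generalize |u| = b at *
  rcases le_total b (t * a) with hb | hb
  · have hba : b ≤ t * a := hb
    have i1 : a ^ 3 * b ≤ t * a ^ 4 := by
      calc a ^ 3 * b ≤ a ^ 3 * (t * a) := by gcongr
        _ = t * a ^ 4 := by ring
    have i0 : b ≤ a := hb.trans (mul_le_of_le_one_left hwn ht1)
    have i2 : a ^ 2 * b ^ 2 ≤ a ^ 3 * b := by
      calc a ^ 2 * b ^ 2 = a ^ 2 * b * b := by ring
        _ ≤ a ^ 2 * b * a := by gcongr
        _ = a ^ 3 * b := by ring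
    have i3 : a * b ^ 3 ≤ a ^ 2 * b ^ 2 := by
      calc a * b ^ 3 = a * b ^ 2 * b := by ring
        _ ≤ a * b ^ 2 * a := by gcongr
        _ = a ^ 2 * b ^ 2 := by ring
    have i4 : 14 * (t * a ^ 4) ≤ η * a ^ 4 := by
      rw [← mul_assoc]
      gcongr
    have i5 : 0 ≤ 14 / t ^ 3 * b ^ 4 := by positivity
    linarith
  · have ha : a ≤ b / t := by rwa [le_div_iff₀ ht0, mul_comm]
    have hb' : b ≤ b / t := by rw [le_div_iff₀ ht0]; exact mul_le_of_le_one_right hun ht1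
    have i1 : a ^ 3 * b ≤ (b / t) ^ 3 * b := by gcongr
    have i2 : a ^ 2 * b ^ 2 ≤ (b / t) ^ 3 * b := by
      calc a ^ 2 * b ^ 2 = a ^ 2 * b * b := by ring
        _ ≤ (b / t) ^ 2 * (b / t) * b := by gcongr
        _ = (b / t) ^ 3 * b := by ring
    have i3 : a * b ^ 3 ≤ (b / t) ^ 3 * b := by
      calc a * b ^ 3 = a * b ^ 2 * b := by ring
        _ ≤ (b / t) * (b / t) ^ 2 * b := by gcongr
        _ = (b / t) ^ 3 * b := by ring
    have i4 : (b / t) ^ 3 * b = 1 / t ^ 3 * b ^ 4 := by field_simp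
    have i5 : 0 ≤ η * a ^ 4 := by positivity
    have i6 : 14 / t ^ 3 * b ^ 4 = 14 * (1 / t ^ 3 * b ^ 4) := by ring
    linarith

lemma MF_le_of_tendsto {f : ℕ → Pt → ℝ} {g : Pt → ℝ} {C : ℝ} (hf : ∀ n, L2P (f n)) (hg : L2P g)
    (h : Tendsto (fun n => ∫ p in Dom, f n p * g p) atTop (nhds (∫ p in Dom, g p ^ 2)))
    (hC : ∀ n, MF (f n) ≤ C) : MF g ≤ C := by
  have h1 : ∀ n, ∫ p in Dom, f n p * g p ≤ (C + MF g) / 2 := fun n => by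
    have i1 : ∫ p in Dom, f n p * g p ≤ ∫ p in Dom, (f n p ^ 2 / 2 + g p ^ 2 / 2) :=
      integral_mono (memLp_two_mul (hf n).memLp hg.memLp)
        (((hf n).sq_integrable.div_const 2).add (hg.sq_integrable.div_const 2)) fun p => by
          change f n p * g p ≤ f n p ^ 2 / 2 + g p ^ 2 / 2
          nlinarith [sq_nonneg (f n p - g p)]
    rw [integral_add ((hf n).sq_integrable.div_const 2) (hg.sq_integrable.div_const 2),
      integral_div, integral_div] at i1
    have i2 := hC n
    unfold MF at *
    linarith
  have h2 := le_of_tendsto' h h1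
  change MF g ≤ _ at h2
  linarith

lemma WC.split {f : ℕ → Pt → ℝ} {g : Pt → ℝ} {C : ℝ} (h : WC f g) (hf : ∀ n, L2P (f n)) (hg : L2P g)
    (hC : Tendsto (fun n => ∫ p in Dom, f n p ^ 2) atTop (nhds C)) :
    Tendsto (fun n => ∫ p in Dom, (f n p - g p) ^ 2) atTop (nhds (C - ∫ p in Dom, g p ^ 2)) := by
  have e : ∀ n, ∫ p in Dom, (f n p - g p) ^ 2
      = (∫ p in Dom, f n p ^ 2) - 2 * (∫ p in Dom, f n p * g p) + ∫ p in Dom, g p ^ 2 := fun n => by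
    have := integral_add_sq (hf n).memLp (hg.const_mul (-1)).memLp
    have e1 : ∫ p in Dom, f n p * (-1 * g p) = -∫ p in Dom, f n p * g p := by
      rw [← integral_neg]
      exact integral_congr_ae (Eventually.of_forall fun p => by ring)
    rw [e1] at this
    simp only [neg_one_mul, neg_sq, ← sub_eq_add_neg] at this
    rw [this]
    ring
  simp only [e]
  have h1 := h g hg.memLp
  have e2 : ∫ p in Dom, g p * g p = ∫ p in Dom, g p ^ 2 := by simp only [sq]
  rw [e2] at h1
  refine ((hC.sub (h1.const_mul 2)).add_const (∫ p in Dom, g p ^ 2)).trans (le_of_eq ?_)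
  congr 1
  ring

lemma hx_pos (x : Fin 3 → ℝ) : 0 < hx x := pow_pos (bub_pos _) 2

lemma hx_le_one (x : Fin 3 → ℝ) : hx x ≤ 1 := pow_le_one₀ (bub_pos _).le (bub_le_one _)

lemma integrable_hx_fst : Integrable (fun p : Pt => hx p.1) mD := by
  simpa using integrable_hx_smul one_ne_zero

lemma L2P.integrable_sq_hx {f : Pt → ℝ} (hf : L2P f) : Integrable (fun p => f p ^ 2 * hx p.1) mD :=
  hf.sq_integrable.mono ((hf.meas.pow_const 2).mul
    (continuous_hx.measurable.comp measurable_fst)).aestronglyMeasurable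
    (Eventually.of_forall fun p => by
      rw [Real.norm_eq_abs, Real.norm_eq_abs, abs_mul, abs_of_pos (hx_pos p.1)]
      exact mul_le_of_le_one_right (abs_nonneg _) (hx_le_one _))

section Local

variable {f : ℕ → Pt → ℝ} {u : Pt → ℝ} {K : ℝ}

lemma WC.sub_cv_le (h : WC f u) (hf : ∀ n, CK (f n)) (hu : L2P u)
    (hK : ∀ n, AF (pd (f n)) + BF (pd (f n)) ≤ K) {k : Pt → ℝ} (hk : Mol k)
    {ε : ℝ} (hε : ∀ ζ, ε ≤ ‖ζ‖ → k ζ = 0) : MF (fun p => u p - cv k u p) ≤ 4 * ε ^ 2 * K := by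
  have hg := hu.sub (hu.cv hk).1
  have e : ∀ w, L2P w → ∫ p in Dom, (w p - cv k w p) * (u p - cv k u p)
      = ∫ p in Dom, w p * ((u p - cv k u p) - cv k (fun p => u p - cv k u p) p) := fun w hw => by
    have h1 := setIntegral_cv_mul_comm hk hw hg
    have i1 := memLp_two_mul hw.memLp hg.memLp
    have i2 := memLp_two_mul (hw.cv hk).1.memLp hg.memLp
    have i3 := memLp_two_mul hw.memLp (hg.cv hk).1.memLp
    simp only [sub_mul _ _ (u _ - cv k u _), mul_sub (w _) (u _ - cv k u _)]
    rw [integral_sub i1 i2, integral_sub i1 i3, h1]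
  refine MF_le_of_tendsto (f := fun n p => f n p - cv k (f n) p)
    (fun n => (hf n).l2p.sub ((hf n).l2p.cv hk).1) hg ?_ fun n => ((hf n).sub_cv_le hk hε).trans ?_
  · have e2 : ∫ p in Dom, (u p - cv k u p) ^ 2 =
        ∫ p in Dom, (u p - cv k u p) * (u p - cv k u p) := by
      simp only [sq]
    rw [e2, e u hu]
    simp only [e _ (hf _).l2p]
    exact h _ (hg.sub (hg.cv hk).1).memLp
  · have := hK n
    gcongr

lemma WC.tendsto_local_cv (h : WC f u) (hf : ∀ n, L2P (f n)) (hu : L2P u) {C : ℝ}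
    (hC : ∀ n, MF (f n) ≤ C) {k : Pt → ℝ} (hk : Mol k) :
    Tendsto (fun n => ∫ p in Dom, (cv k (f n) p - cv k u p) ^ 2 * hx p.1) atTop (nhds 0) := by
  set D := √(∫ ζ, k ζ ^ 2) * √C + √(∫ ζ, k ζ ^ 2) * √(MF u) with hD
  have hi : ∀ n, L2P fun p => cv k (f n) p - cv k u p := fun n => ((hf n).cv hk).1.sub (hu.cv hk).1
  have := tendsto_integral_of_dominated_convergence (μ := mD)
    (F := fun n p => (cv k (f n) p - cv k u p) ^ 2 * hx p.1) (f := fun _ => 0)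
    (fun p => D ^ 2 * hx p.1) (fun n => (hi n).integrable_sq_hx.aestronglyMeasurable)
    (integrable_hx_fst.const_mul _) (fun n => Eventually.of_forall fun p => ?_)
    (Eventually.of_forall fun p => ?_)
  · simpa using this
  · have h1 : |cv k (f n) p - cv k u p| ≤ D := by
      refine (abs_sub _ _).trans (add_le_add ((abs_cv_le hk.toKer (hf n) p).trans ?_)
        (abs_cv_le hk.toKer hu p))
      exact mul_le_mul_of_nonneg_left (Real.sqrt_le_sqrt (hC n)) (Real.sqrt_nonneg _)
    rw [Real.norm_eq_abs, abs_mul, abs_of_pos (hx_pos p.1), abs_pow]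
    exact mul_le_mul_of_nonneg_right (pow_le_pow_left₀ (abs_nonneg _) h1 2) (hx_pos _).le
  · have h1 := (h.tendsto_cv hf hu hk.toKer p).sub_const (cv k u p)
    simpa using (h1.pow 2).mul_const (hx p.1)

lemma WC.tendsto_local (h : WC f u) (hf : ∀ n, CK (f n)) (hu : L2P u)
    (hK : ∀ n, AF (pd (f n)) + BF (pd (f n)) ≤ K) {C : ℝ} (hC : ∀ n, MF (f n) ≤ C) :
    Tendsto (fun n => ∫ p in Dom, (f n p - u p) ^ 2 * hx p.1) atTop (nhds 0) := by
  have hK0 : 0 ≤ K := (add_nonneg (AF_nonneg _) (BF_nonneg _)).trans (hK 0)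
  refine tendsto_order.2 ⟨fun a ha => Eventually.of_forall fun n => ha.trans_le
    (integral_nonneg fun p => mul_nonneg (sq_nonneg _) (hx_pos _).le), fun η hη => ?_⟩
  have hj : Tendsto (fun j : ℕ => 24 * K * ((1 : ℝ) / (j + 1)) ^ 2) atTop (nhds 0) := by
    simpa using (tendsto_one_div_add_atTop_nhds_zero_nat (𝕜 := ℝ)).pow 2 |>.const_mul (24 * K)
  obtain ⟨j, hj⟩ := ((tendsto_order.1 hj).2 (η / 2) (by positivity)).exists
  set k := rho j
  have hk := mol_rho j
  have hε : ∀ ζ, (1 : ℝ) / (j + 1) ≤ ‖ζ‖ → k ζ = 0 := fun ζ hζ =>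
    rho_eq_zero (by rwa [one_div] at hζ)
  filter_upwards [(tendsto_order.1 (h.tendsto_local_cv (fun n => (hf n).l2p) hu hC hk)).2 (η / 6)
    (by positivity)] with n hn
  have i1 := (hf n).sub_cv_le hk hε
  have i2 := h.sub_cv_le hf hu hK hk hε
  have l1 := ((hf n).l2p.sub ((hf n).l2p.cv hk).1)
  have l2 := (hu.sub (hu.cv hk).1)
  have l3 := (((hf n).l2p.cv hk).1.sub (hu.cv hk).1)
  have j1 : Integrable (fun p => 3 * (f n p - cv k (f n) p) ^ 2 + 3 * (u p - cv k u p) ^ 2) mD :=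
    (l1.sq_integrable.const_mul 3).add (l2.sq_integrable.const_mul 3)
  have i3 : ∫ p in Dom, (f n p - u p) ^ 2 * hx p.1 ≤ ∫ p in Dom,
      (3 * (f n p - cv k (f n) p) ^ 2 + 3 * (u p - cv k u p) ^ 2
        + 3 * ((cv k (f n) p - cv k u p) ^ 2 * hx p.1)) := by
    refine integral_mono ((hf n).l2p.sub hu).integrable_sq_hx
      (j1.add (l3.integrable_sq_hx.const_mul 3)) fun p => ?_
    change (f n p - u p) ^ 2 * hx p.1 ≤ 3 * (f n p - cv k (f n) p) ^ 2 + 3 * (u p - cv k u p) ^ 2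
        + 3 * ((cv k (f n) p - cv k u p) ^ 2 * hx p.1)
    have b1 := hx_le_one p.1
    have b0 := (hx_pos p.1).le
    generalize hx p.1 = t at *
    generalize cv k (f n) p = b
    generalize cv k u p = c
    have q : (f n p - u p) ^ 2 ≤ 3 * (f n p - b) ^ 2 + 3 * (u p - c) ^ 2 + 3 * (b - c) ^ 2 := by
      nlinarith [sq_nonneg ((f n p - b) + (u p - c)), sq_nonneg ((u p - c) + (b - c)),
        sq_nonneg ((f n p - b) - (b - c))]
    have r1 : (f n p - b) ^ 2 * t ≤ (f n p - b) ^ 2 := mul_le_of_le_one_right (sq_nonneg _) b1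
    have r2 : (u p - c) ^ 2 * t ≤ (u p - c) ^ 2 := mul_le_of_le_one_right (sq_nonneg _) b1
    have := mul_le_mul_of_nonneg_right q b0
    linarith
  rw [integral_add j1 (l3.integrable_sq_hx.const_mul 3),
    integral_add (l1.sq_integrable.const_mul 3) (l2.sq_integrable.const_mul 3), integral_const_mul,
    integral_const_mul, integral_const_mul] at i3
  have i4 : 4 * ((1 : ℝ) / (j + 1)) ^ 2 * (AF (pd (f n)) + BF (pd (f n)))
      ≤ 4 * ((1 : ℝ) / (j + 1)) ^ 2 * K := by
    have := hK n
    gcongr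
  unfold MF at i2
  linarith

lemma WC.exists_ae (h : WC f u) (hf : ∀ n, CK (f n)) (hu : L2P u)
    (hK : ∀ n, AF (pd (f n)) + BF (pd (f n)) ≤ K) {C : ℝ} (hC : ∀ n, MF (f n) ≤ C) :
    ∃ φ : ℕ → ℕ, StrictMono φ ∧ ∀ᵐ p ∂mD, Tendsto (fun n => f (φ n) p) atTop (nhds (u p)) := by
  obtain ⟨φ, hφ, hl⟩ := exists_seq_tendsto_ae_of_integral
    (fun n => ((hf n).l2p.sub hu).integrable_sq_hx)
    (fun n p => mul_nonneg (sq_nonneg _) (hx_pos _).le) (h.tendsto_local hf hu hK hC)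
  refine ⟨φ, hφ, ?_⟩
  filter_upwards [hl] with p hp
  have h1 := hp.div_const (hx p.1)
  simp only [mul_div_cancel_right₀ _ (hx_pos p.1).ne', zero_div] at h1
  have h2 := h1.sqrt
  simp only [Real.sqrt_sq_eq_abs, Real.sqrt_zero] at h2
  have h3 := (tendsto_zero_iff_abs_tendsto_zero _).2 h2
  simpa using h3.add_const (u p)

end Local

/-- A weak limit of a translated minimizing sequence, with nonnegative nonzero representative. -/
structure Lim (m₀ : ℝ) (f : ℕ → Pt → ℝ) (u : Pt → ℝ) (U : Fin 4 → Pt → ℝ) (A B N M : ℝ) : Prop where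
  seq : MinSeq m₀ f A B N M
  wp : WP u U
  wc : WC f u
  wcD : ∀ i, WC (fun n => pd (f n) i) (U i)
  ae : ∀ᵐ p ∂mD, Tendsto (fun n => f n p) atTop (nhds (u p))
  nonneg : ∀ p, 0 ≤ u p
  pos : 0 < MF u

lemma exists_lim {m₀ : ℝ} (hm : 0 < m₀) : ∃ f u U A B N M, Lim m₀ f u U A B N M := by
  obtain ⟨f, A, B, N, M, hf, j, c, hc, hj⟩ := exists_minSeq_average hm
  obtain ⟨K, hK⟩ := ((hf.tendsA.add hf.tendsB).isBoundedUnder_le).bddAbove_range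
  have hK' : ∀ n, AF (pd (f n)) + BF (pd (f n)) ≤ K := fun n => hK ⟨n, rfl⟩
  obtain ⟨g, hg, φ, hφ, hw⟩ := exists_wc (fun n => (hf.ck n).l2p) hf.mass
  have hMi : ∀ (i : Fin 4) n, MF (pd (f (φ n)) i) ≤ K := fun i n => by
    refine le_trans ?_ (hK' (φ n))
    rw [← integral_sum_pd_sq fun i => ((hf.ck (φ n)).l2p_pd i).memLp]
    refine integral_mono ((hf.ck (φ n)).l2p_pd i).sq_integrable
      (integrable_finsetSum _ fun i _ => ((hf.ck (φ n)).l2p_pd i).sq_integrable) fun p => ?_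
    exact Finset.single_le_sum (f := fun i => pd (f (φ n)) i p ^ 2) (fun i _ => sq_nonneg _)
      (Finset.mem_univ i)
  obtain ⟨U, ψ, hψ, hU⟩ := exists_wc_family (Finset.univ : Finset (Fin 4))
    (f := fun i n => pd (f (φ n)) i) (fun i n => (hf.ck (φ n)).l2p_pd i) hMi
  have hw1 := hw.comp hψ
  obtain ⟨χ, hχ, hae⟩ := hw1.exists_ae (fun n => hf.ck _) hg (fun n => hK' _) (fun n => hf.mass _)
  have hw2 := hw1.comp hχ
  set u : Pt → ℝ := fun p => max (g p) 0
  have hug : g =ᵐ[mD] u := by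
    filter_upwards [hae] with p hp
    exact (max_eq_left (ge_of_tendsto' hp fun n => hf.nonneg _ _)).symm
  have hu : L2P u := ⟨fun x y => by simp only [u, hg.per x y], hg.meas.max measurable_const,
    (memLp_congr_ae hug).1 hg.memLp⟩
  have hwu := hw2.congr hug
  have hseq := hf.comp ((hφ.comp hψ).comp hχ)
  have hD : ∀ i, WC (fun n => pd (f (φ (ψ (χ n)))) i) (U i) := fun i =>
    (hU i (Finset.mem_univ i)).2.comp hχ
  refine ⟨_, u, U, A, B, N, M, hseq,
    WC.wp (fun n => (hseq.ck n).wp) hu (fun i => (hU i (Finset.mem_univ i)).1) hwu hD, hwu, hD, ?_,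
    fun p => le_max_right _ _, ?_⟩
  · filter_upwards [hae, hug] with p hp hp'
    rw [← hp']
    exact hp
  · refine lt_of_le_of_ne (MF_nonneg u) fun h0 => ?_
    have h1 := hwu.tendsto_cv (fun n => (hseq.ck n).l2p) hu (mol_rho j).toKer 0
    have h2 : c ≤ cv (rho j) u 0 := ge_of_tendsto' h1 fun n => hj _
    have h3 := abs_cv_le (mol_rho j).toKer hu 0
    rw [← h0, Real.sqrt_zero, mul_zero] at h3
    linarith [le_abs_self (cv (rho j) u 0)]

lemma WP.add {u v : Pt → ℝ} {U V : Fin 4 → Pt → ℝ} (hu : WP u U) (hv : WP v V) :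
    WP (fun p => u p + v p) fun i p => U i p + V i p := by
  refine ⟨hu.fn.add hv.fn, fun i => (hu.grad i).add (hv.grad i), fun φ hφ hc i => ?_⟩
  have hFG : ∀ w, L2P w → ∀ ψ : Pt → ℝ, Continuous ψ → HasCompactSupport ψ →
      Integrable fun p => w p * ψ p := fun w hw ψ h1 h2 => by
    have := hw.locallyIntegrable.integrable_smul_left_of_hasCompactSupport h1 h2
    simpa [mul_comm] using this
  have hc' : HasCompactSupport (pd φ i) := hc.fderiv_apply (𝕜 := ℝ) (dir i)
  simp only [add_mul]
  rw [integral_add (hFG u hu.fn _ (continuous_pd hφ i) hc')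
      (hFG v hv.fn _ (continuous_pd hφ i) hc'),
    integral_add (hFG _ (hu.grad i) _ hφ.continuous hc) (hFG _ (hv.grad i) _ hφ.continuous hc),
    hu.weak φ hφ hc i, hv.weak φ hφ hc i]
  ring

lemma WP.const_mul {u : Pt → ℝ} {U : Fin 4 → Pt → ℝ} (hu : WP u U) (c : ℝ) :
    WP (fun p => c * u p) fun i p => c * U i p := by
  refine ⟨hu.fn.const_mul c, fun i => (hu.grad i).const_mul c, fun φ hφ hc i => ?_⟩
  simp only [mul_assoc, integral_const_mul, hu.weak φ hφ hc i, mul_neg]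

lemma MF_const_mul (c : ℝ) (u : Pt → ℝ) : MF (fun p => c * u p) = c ^ 2 * MF u := by
  simp only [MF, mul_pow, integral_const_mul]

lemma NF_const_mul (c : ℝ) (u : Pt → ℝ) : NF (fun p => c * u p) = c ^ 4 * NF u := by
  simp only [NF, mul_pow, integral_const_mul]

lemma BF_const_mul (c : ℝ) (U : Fin 4 → Pt → ℝ) : BF (fun i p => c * U i p) = c ^ 2 * BF U := by
  simp only [BF, mul_pow, integral_const_mul]

lemma AF_const_mul (c : ℝ) (U : Fin 4 → Pt → ℝ) : AF (fun i p => c * U i p) = c ^ 2 * AF U := by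
  simp only [AF, mul_pow, integral_const_mul]
  ring

/-- The polarization of `AF`. -/
def AF₂ (U V : Fin 4 → Pt → ℝ) : ℝ :=
  (∫ p in Dom, U 0 p * V 0 p) + (∫ p in Dom, U 1 p * V 1 p) + ∫ p in Dom, U 2 p * V 2 p

lemma L2P.integral_add_smul_sq {u v : Pt → ℝ} (hu : L2P u) (hv : L2P v) (s : ℝ) :
    ∫ p in Dom, (u p + s * v p) ^ 2
      = (∫ p in Dom, u p ^ 2) + 2 * s * (∫ p in Dom, u p * v p) + s ^ 2 * ∫ p in Dom, v p ^ 2 := by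
  have h := integral_add_sq hu.memLp (hv.const_mul s).memLp
  have e1 : ∫ p in Dom, u p * (s * v p) = s * ∫ p in Dom, u p * v p := by
    rw [← integral_const_mul]
    exact integral_congr_ae (Eventually.of_forall fun p => by ring)
  have e2 : ∫ p in Dom, (s * v p) ^ 2 = s ^ 2 * ∫ p in Dom, v p ^ 2 := MF_const_mul s v
  rw [h, e1, e2]
  ring

lemma AF_add_smul {U V : Fin 4 → Pt → ℝ} (hU : ∀ i, L2P (U i)) (hV : ∀ i, L2P (V i)) (s : ℝ) :
    AF (fun i p => U i p + s * V i p) = AF U + 2 * s * AF₂ U V + s ^ 2 * AF V := by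
  simp only [AF, AF₂, (hU _).integral_add_smul_sq (hV _)]
  ring

lemma integrable_mul_sq {u v : Pt → ℝ} (hu : L2P u) (hv : L2P v)
    (hu4 : Integrable (fun p => u p ^ 4) mD) (hv4 : Integrable (fun p => v p ^ 4) mD) :
    MemLp (fun p => u p * v p) 2 mD :=
  memLp_two_of_sq (hu.meas.mul hv.meas).aestronglyMeasurable
    ((memLp_two_mul (hu.memLp_sq hu4) (hv.memLp_sq hv4)).congr (ae_of_all _ fun p => by ring))

lemma integrable_cube_mul {u v : Pt → ℝ} (hu : L2P u) (hv : L2P v)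
    (hu4 : Integrable (fun p => u p ^ 4) mD) (hv4 : Integrable (fun p => v p ^ 4) mD) :
    Integrable (fun p => u p ^ 3 * v p) mD :=
  (memLp_two_mul (hu.memLp_sq hu4) (integrable_mul_sq hu hv hu4 hv4)).congr
    (ae_of_all _ fun p => by ring)

lemma NF_add_smul {u v : Pt → ℝ} (hu : L2P u) (hv : L2P v)
    (hu4 : Integrable (fun p => u p ^ 4) mD) (hv4 : Integrable (fun p => v p ^ 4) mD) (s : ℝ) :
    Integrable (fun p => (u p + s * v p) ^ 4) mD ∧
    NF (fun p => u p + s * v p) = NF u + 4 * s * (∫ p in Dom, u p ^ 3 * v p)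
      + 6 * s ^ 2 * (∫ p in Dom, u p ^ 2 * v p ^ 2) + 4 * s ^ 3 * (∫ p in Dom, v p ^ 3 * u p)
      + s ^ 4 * NF v := by
  have i1 := integrable_cube_mul hu hv hu4 hv4
  have i2 := memLp_two_mul (hu.memLp_sq hu4) (hv.memLp_sq hv4)
  have i3 := integrable_cube_mul hv hu hv4 hu4
  have e : (fun p => (u p + s * v p) ^ 4) = fun p => u p ^ 4 + 4 * s * (u p ^ 3 * v p)
      + 6 * s ^ 2 * (u p ^ 2 * v p ^ 2) + 4 * s ^ 3 * (v p ^ 3 * u p) + s ^ 4 * v p ^ 4 := by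
    funext p
    ring
  have j1 : Integrable (fun p => u p ^ 4 + 4 * s * (u p ^ 3 * v p)) mD := hu4.add (i1.const_mul _)
  have j2 : Integrable (fun p => u p ^ 4 + 4 * s * (u p ^ 3 * v p)
      + 6 * s ^ 2 * (u p ^ 2 * v p ^ 2)) mD := j1.add (i2.const_mul _)
  have j3 : Integrable (fun p => u p ^ 4 + 4 * s * (u p ^ 3 * v p)
      + 6 * s ^ 2 * (u p ^ 2 * v p ^ 2) + 4 * s ^ 3 * (v p ^ 3 * u p)) mD := j2.add (i3.const_mul _)
  refine ⟨e ▸ j3.add (hv4.const_mul _), ?_⟩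
  unfold NF
  rw [e, integral_add j3 (hv4.const_mul _), integral_add j2 (i3.const_mul _),
    integral_add j1 (i2.const_mul _), integral_add hu4 (i1.const_mul _)]
  simp only [integral_const_mul]

lemma WP.lev_mul_le_scaled {w : Pt → ℝ} {W : Fin 4 → Pt → ℝ} (h : WP w W) {m₀ μ : ℝ} (h0 : 0 ≤ μ)
    (hμ : μ ≤ m₀) : lev m₀ * μ * MF w * NF w ^ 2
      ≤ 8 / 27 * AF W ^ 3 * MF w ^ 2 + μ ^ 2 * BF W * NF w ^ 2 / 2 := by
  have hA := AF_nonneg W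
  have hB := BF_nonneg W
  have hN := NF_nonneg w
  rcases (MF_nonneg w).eq_or_lt with hM | hM
  · rw [← hM]
    have : 0 ≤ μ ^ 2 * BF W * NF w ^ 2 / 2 := by positivity
    linarith
  rcases h0.eq_or_lt with rfl | h0
  · have : 0 ≤ 8 / 27 * AF W ^ 3 * MF w ^ 2 := by positivity
    linarith
  set t := √(μ / MF w) with ht
  have ht2 : t ^ 2 = μ / MF w := Real.sq_sqrt (by positivity)
  have htM : t ^ 2 * MF w = μ := by rw [ht2]; field_simp
  have h1 := (h.const_mul t).lev_mul_le (m₀ := m₀) (by rw [MF_const_mul, htM]; exact hμ)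
  rw [NF_const_mul, AF_const_mul, BF_const_mul] at h1
  have ht0 : 0 < t ^ 2 := by rw [ht2]; positivity
  rw [show t ^ 4 = (t ^ 2) ^ 2 by ring] at h1
  generalize t ^ 2 = x at *
  have h2 : x ^ 3 * (lev m₀ * x * NF w ^ 2) ≤
      x ^ 3 * (8 / 27 * AF W ^ 3 + x ^ 2 * BF W / 2 * NF w ^ 2) :=
    (le_of_eq (by ring)).trans (h1.trans_eq (by ring))
  have h3 := le_of_mul_le_mul_left h2 (by positivity)
  have h4 := mul_le_mul_of_nonneg_left h3 (sq_nonneg (MF w))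
  rw [← htM]
  exact (le_of_eq (by ring)).trans (h4.trans_eq (by ring))

lemma euler_lagrange_algebra {A B N M a α b β μ ν c d e g m : ℝ} (hA : A = 3 / 4 * N)
    (hm : m = N / 8 + B / 2) (hN : 0 < N) (hM : 0 < M)
    (h : ∀ s : ℝ, m * M * (M + 2 * s * μ + s ^ 2 * ν)
        * (N + 4 * s * c + 6 * s ^ 2 * d + 4 * s ^ 3 * e + s ^ 4 * g) ^ 2
      ≤ 8 / 27 * (A + 2 * s * a + s ^ 2 * α) ^ 3 * (M + 2 * s * μ + s ^ 2 * ν) ^ 2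
        + M ^ 2 * (B + 2 * s * b + s ^ 2 * β)
          * (N + 4 * s * c + 6 * s ^ 2 * d + 4 * s ^ 3 * e + s ^ 4 * g) ^ 2 / 2) :
    a + b + (N / 4 - B) / M * μ = c := by
  have quad : ∀ x y z : ℝ, HasDerivAt (fun s : ℝ => x + 2 * s * y + s ^ 2 * z) (2 * y) 0 :=
    fun x y z => by
      have := (((((hasDerivAt_id (0 : ℝ)).const_mul 2).mul_const y).const_add x).add
        (((hasDerivAt_id (0 : ℝ)).pow 2).mul_const z))
      exact this.congr_deriv (by simp)
  have hdN : HasDerivAt (fun s : ℝ => N + 4 * s * c + 6 * s ^ 2 * d + 4 * s ^ 3 * e + s ^ 4 * g)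
      (4 * c) 0 := by
    have h0 := hasDerivAt_id (0 : ℝ)
    have := ((((h0.const_mul 4).mul_const c).const_add N).add
      (((h0.pow 2).const_mul 6).mul_const d) |>.add (((h0.pow 3).const_mul 4).mul_const e)).add
      ((h0.pow 4).mul_const g)
    exact this.congr_deriv (by simp)
  have hG := (((((quad A a α).pow 3).const_mul (8 / 27)).mul ((quad M μ ν).pow 2)).add
    ((((quad B b β).const_mul (M ^ 2)).mul (hdN.pow 2)).div_const 2)).sub
    (((quad M μ ν).const_mul (m * M)).mul (hdN.pow 2))
  have hmin : IsLocalMin (fun s : ℝ => 8 / 27 * (A + 2 * s * a + s ^ 2 * α) ^ 3 *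
    (M + 2 * s * μ + s ^ 2 * ν) ^ 2
        + M ^ 2 * (B + 2 * s * b + s ^ 2 * β)
          * (N + 4 * s * c + 6 * s ^ 2 * d + 4 * s ^ 3 * e + s ^ 4 * g) ^ 2 / 2
        - m * M * (M + 2 * s * μ + s ^ 2 * ν)
        * (N + 4 * s * c + 6 * s ^ 2 * d + 4 * s ^ 3 * e + s ^ 4 * g) ^ 2) (0 : ℝ) := by
    refine Eventually.of_forall fun s => ?_
    have h0 : 8 / 27 * A ^ 3 * M ^ 2 + M ^ 2 * B * N ^ 2 / 2 - m * M * M * N ^ 2 = 0 := by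
      rw [hm, hA]
      ring
    have := h s
    simp only [mul_zero, zero_mul, add_zero, ne_eq, OfNat.ofNat_ne_zero, not_false_eq_true,
      zero_pow]
    linarith
  have h1 := hmin.hasDerivAt_eq_zero hG
  norm_num at h1
  have h2 : N ^ 2 * M * (M * (a + b - c) + (N / 4 - B) * μ) = 0 := by
    rw [← h1, hm, hA]
    ring
  have h3 : M * (a + b - c) + (N / 4 - B) * μ = 0 := by
    rcases mul_eq_zero.1 h2 with h | h
    · exact absurd h (by positivity)
    · exact h
  field_simp
  linarith

namespace Lim

variable {m₀ A B N M : ℝ} {f : ℕ → Pt → ℝ} {u : Pt → ℝ} {U : Fin 4 → Pt → ℝ}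

lemma exists_bound (h : Lim m₀ f u U A B N M) : ∃ C, ∀ n, NF (f n) ≤ C := by
  obtain ⟨K, hK⟩ := h.seq.tendsN.isBoundedUnder_le.bddAbove_range
  exact ⟨K, fun n => hK ⟨n, rfl⟩⟩

lemma tendsto_NF_add (h : Lim m₀ f u U A B N M) {φ : Pt → ℝ} (hφ : L2P φ)
    (h4 : Integrable (fun p => φ p ^ 4) mD) :
    Tendsto (fun n => NF fun p => f n p + φ p) atTop
        (nhds (N + (NF (fun p => u p + φ p) - NF u))) := by
  obtain ⟨C, hC⟩ := h.exists_bound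
  have hf4 := fun n => (h.seq.ck n).wp.l4
  have hu4 := h.wp.l4
  have e1 : ∀ w, L2P w → Integrable (fun p => w p ^ 4) mD →
      Integrable (fun p => (w p + φ p) ^ 4) mD := fun w hw hw4 => by
    simpa using (NF_add_smul hw hφ hw4 h4 1).1
  have hi := fun n => (e1 _ (h.seq.ck n).l2p (hf4 n)).sub (hf4 n)
  have hiu := (e1 _ h.wp.fn hu4).sub hu4
  have key := tendsto_integral_abs_zero_of_le (μ := mD)
    (f := fun n p => ((f n p + φ p) ^ 4 - f n p ^ 4) - ((u p + φ p) ^ 4 - u p ^ 4))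
    (h := fun n p => f n p ^ 4) (C := C)
    (g := fun η p => 14 / min 1 (η / 14) ^ 3 * φ p ^ 4 + φ p ^ 4 + |(u p + φ p) ^ 4 - u p ^ 4|)
    (fun n => (hi n).sub hiu) ?_ hf4 hC (fun n p => by positivity)
    (fun η _ => ((h4.const_mul _).add h4).add hiu.abs) (fun η hη n p => ?_)
  · have h1 := tendsto_integral_of_abs_sub hi hiu key
    have h2 := h.seq.tendsN.add h1
    have e2 : ∀ w, L2P w → Integrable (fun p => w p ^ 4) mD →
        ∫ p in Dom, ((w p + φ p) ^ 4 - w p ^ 4) = NF (fun p => w p + φ p) - NF w :=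
      fun w hw hw4 => integral_sub (e1 w hw hw4) hw4
    simp only [Pi.sub_apply] at h2
    rw [e2 u h.wp.fn hu4] at h2
    simp only [e2 _ (h.seq.ck _).l2p (hf4 _), add_sub_cancel] at h2
    exact h2
  · filter_upwards [h.ae] with p hp
    have h1 := ((hp.add_const (φ p)).pow 4).sub (hp.pow 4)
    have h2 := h1.sub_const ((u p + φ p) ^ 4 - u p ^ 4)
    rwa [sub_self] at h2
  · have h1 := quartic_split hη (f n p) (φ p)
    have h2 : 0 ≤ φ p ^ 4 := by positivity
    refine (abs_sub _ _).trans ?_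
    have h3 : |(f n p + φ p) ^ 4 - f n p ^ 4| ≤ |(f n p + φ p) ^ 4 - f n p ^ 4 - φ p ^ 4| +
        φ p ^ 4 := by
      have := abs_add_le ((f n p + φ p) ^ 4 - f n p ^ 4 - φ p ^ 4) (φ p ^ 4)
      rwa [sub_add_cancel, abs_of_nonneg h2] at this
    linarith

lemma mass_pos (h : Lim m₀ f u U A B N M) : MF u ≤ M := by
  have h1 := h.wc.split (fun n => (h.seq.ck n).l2p) h.wp.fn h.seq.tendsM
  have := ge_of_tendsto' h1 fun n => integral_nonneg fun p => sq_nonneg _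
  change 0 ≤ M - MF u at this
  linarith

/-- The Lagrange multiplier. -/
def mult (B N M : ℝ) : ℝ := (N / 4 - B) / M

theorem euler_lagrange (h : Lim m₀ f u U A B N M) {φ : Pt → ℝ} {Φ : Fin 4 → Pt → ℝ} (hφ : WP φ Φ) :
    AF₂ U Φ + (∫ p in Dom, U 3 p * Φ 3 p) + mult B N M * ∫ p in Dom, u p * φ p
      = ∫ p in Dom, u p ^ 3 * φ p := by
  have hM : 0 < M := h.pos.trans_le h.mass_pos
  refine euler_lagrange_algebra (α := AF Φ) (β := BF Φ) (ν := MF φ)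
    (d := ∫ p in Dom, u p ^ 2 * φ p ^ 2) (e := ∫ p in Dom, φ p ^ 3 * u p) (g := NF φ)
    h.seq.balanced h.seq.level h.seq.pos hM fun s => ?_
  have hck := h.seq.ck
  have hineq := fun n => ((hck n).wp.add (hφ.const_mul s)).lev_mul_le_scaled (MF_nonneg (f n))
    (h.seq.mass n)
  have tM : Tendsto (fun n => MF fun p => f n p + s * φ p) atTop
      (nhds (M + 2 * s * (∫ p in Dom, u p * φ p) + s ^ 2 * MF φ)) := by
    simp only [MF, (hck _).l2p.integral_add_smul_sq hφ.fn]
    exact (h.seq.tendsM.add ((h.wc _ hφ.fn.memLp).const_mul _)).add_const _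
  have tB : Tendsto (fun n => BF fun i p => pd (f n) i p + s * Φ i p) atTop
      (nhds (B + 2 * s * (∫ p in Dom, U 3 p * Φ 3 p) + s ^ 2 * BF Φ)) := by
    simp only [BF, ((hck _).l2p_pd 3).integral_add_smul_sq (hφ.grad 3)]
    exact (h.seq.tendsB.add ((h.wcD 3 _ (hφ.grad 3).memLp).const_mul _)).add_const _
  have tA : Tendsto (fun n => AF fun i p => pd (f n) i p + s * Φ i p) atTop
      (nhds (A + 2 * s * AF₂ U Φ + s ^ 2 * AF Φ)) := by
    simp only [AF_add_smul (hck _).l2p_pd hφ.grad]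
    refine (h.seq.tendsA.add (Tendsto.const_mul _ ?_)).add_const _
    exact ((h.wcD 0 _ (hφ.grad 0).memLp).add (h.wcD 1 _ (hφ.grad 1).memLp)).add
      (h.wcD 2 _ (hφ.grad 2).memLp)
  have tN := h.tendsto_NF_add (hφ.const_mul s).fn (hφ.const_mul s).l4
  rw [(NF_add_smul h.wp.fn hφ.fn h.wp.l4 hφ.l4 s).2] at tN
  have tN' : Tendsto (fun n => NF fun p => f n p + s * φ p) atTop (nhds (N
      + 4 * s * (∫ p in Dom, u p ^ 3 * φ p) + 6 * s ^ 2 * (∫ p in Dom, u p ^ 2 * φ p ^ 2)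
      + 4 * s ^ 3 * (∫ p in Dom, φ p ^ 3 * u p) + s ^ 4 * NF φ)) :=
    tN.trans (le_of_eq (congrArg nhds (by ring)))
  exact le_of_tendsto_of_tendsto'
    (((h.seq.tendsM.const_mul (lev m₀)).mul tM).mul (tN'.pow 2))
    ((((tA.pow 3).const_mul (8 / 27)).mul (tM.pow 2)).add
      ((((h.seq.tendsM.pow 2).mul tB).mul (tN'.pow 2)).div_const 2)) hineq

end Lim

lemma NF_pos_of_MF_pos {u : Pt → ℝ} (h4 : Integrable (fun p => u p ^ 4) mD) (hM : 0 < MF u) :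
    0 < NF u := by
  refine lt_of_le_of_ne (NF_nonneg u) fun h0 => hM.ne' ?_
  have h1 := (integral_eq_zero_iff_of_nonneg (fun p => by positivity) h4).1 h0.symm
  have h2 : (fun p => u p ^ 2) =ᵐ[mD] fun _ => 0 := by
    filter_upwards [h1] with p hp
    have : u p = 0 := by simpa using hp
    simp [this]
  exact (integral_congr_ae h2).trans (integral_zero _ _)

lemma AF₂_self (U : Fin 4 → Pt → ℝ) : AF₂ U U = AF U := by
  simp only [AF₂, AF, sq]

namespace Lim

variable {m₀ A B N M : ℝ} {f : ℕ → Pt → ℝ} {u : Pt → ℝ} {U : Fin 4 → Pt → ℝ}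

lemma AF_split (h : Lim m₀ f u U A B N M) :
    Tendsto (fun n => AF fun i p => pd (f n) i p + -1 * U i p) atTop (nhds (A - AF U)) := by
  simp only [AF_add_smul (h.seq.ck _).l2p_pd h.wp.grad]
  have h2 : Tendsto (fun n => AF₂ (pd (f n)) U) atTop (nhds (AF₂ U U)) :=
    ((h.wcD 0 _ (h.wp.grad 0).memLp).add (h.wcD 1 _ (h.wp.grad 1).memLp)).add
      (h.wcD 2 _ (h.wp.grad 2).memLp)
  rw [AF₂_self] at h2
  refine ((h.seq.tendsA.add (h2.const_mul _)).add_const _).trans (le_of_eq ?_)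
  congr 1
  ring

lemma BF_split (h : Lim m₀ f u U A B N M) :
    Tendsto (fun n => BF fun i p => pd (f n) i p + -1 * U i p) atTop (nhds (B - BF U)) := by
  have := (h.wcD 3).split (fun n => (h.seq.ck n).l2p_pd 3) (h.wp.grad 3) h.seq.tendsB
  simpa only [BF, neg_one_mul, ← sub_eq_add_neg] using this

lemma MF_split (h : Lim m₀ f u U A B N M) :
    Tendsto (fun n => MF fun p => f n p + -1 * u p) atTop (nhds (M - MF u)) := by
  have := h.wc.split (fun n => (h.seq.ck n).l2p) h.wp.fn h.seq.tendsM
  simpa only [MF, neg_one_mul, ← sub_eq_add_neg] using this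

lemma NF_split (h : Lim m₀ f u U A B N M) :
    Tendsto (fun n => NF fun p => f n p + -1 * u p) atTop (nhds (N - NF u)) := by
  have h1 := h.tendsto_NF_add (h.wp.const_mul (-1)).fn (h.wp.const_mul (-1)).l4
  have e : NF (fun p => u p + -1 * u p) = 0 := by
    simp [NF]
  rw [e, zero_sub, ← sub_eq_add_neg] at h1
  exact h1

lemma MF_le (h : Lim m₀ f u U A B N M) : MF u ≤ m₀ :=
  h.mass_pos.trans (le_of_tendsto' h.seq.tendsM h.seq.mass)

lemma AF_le (h : Lim m₀ f u U A B N M) : AF U ≤ A := by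
  linarith [ge_of_tendsto' h.AF_split fun n => AF_nonneg _]

lemma BF_le (h : Lim m₀ f u U A B N M) : BF U ≤ B := by
  linarith [ge_of_tendsto' h.BF_split fun n => BF_nonneg _]

lemma AF_le_NF (h : Lim m₀ f u U A B N M) : AF U ≤ 3 / 4 * NF u := by
  by_contra! hlt
  have hA := h.AF_split
  have hN := h.NF_split
  have hB := h.BF_split
  have hM : ∀ᶠ n in atTop, MF (fun p => f n p + -1 * u p) < m₀ := (tendsto_order.1 h.MF_split).2 _
    (by linarith [h.pos, le_of_tendsto' h.seq.tendsM h.seq.mass])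
  have hle : lev m₀ * (N - NF u) ^ 2
      ≤ 8 / 27 * (A - AF U) ^ 3 + (B - BF U) / 2 * (N - NF u) ^ 2 := by
    refine le_of_tendsto_of_tendsto ((hN.pow 2).const_mul _)
      (((hA.pow 3).const_mul _).add ((hB.div_const 2).mul (hN.pow 2))) ?_
    filter_upwards [hM] with n hn
    exact ((h.seq.ck n).wp.add (h.wp.const_mul (-1))).lev_mul_le hn.le
  have hA0 : 0 ≤ A - AF U := by linarith [h.AF_le]
  have hbal := h.seq.balanced
  have hlev := h.seq.level
  have hlt' : A - AF U < 3 / 4 * (N - NF u) := by linarith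
  have hN0 : 0 < N - NF u := by linarith
  have hcube : 8 / 27 * (A - AF U) ^ 3 ≤ (A - AF U) / 6 * (N - NF u) ^ 2 := by
    have : (A - AF U) ^ 2 ≤ (3 / 4 * (N - NF u)) ^ 2 := pow_le_pow_left₀ hA0 hlt'.le 2
    have := mul_le_mul_of_nonneg_left this hA0
    nlinarith
  have h1 : lev m₀ * (N - NF u) ^ 2 ≤ ((A - AF U) / 6 + (B - BF U) / 2) * (N - NF u) ^ 2 := by
    linarith
  have h2 := le_of_mul_le_mul_right h1 (by positivity)
  have := NF_nonneg u
  have := BF_nonneg U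
  linarith

theorem attained (h : Lim m₀ f u U A B N M) : AF U = A ∧ BF U = B ∧ NF u = N := by
  have hN := NF_pos_of_MF_pos h.wp.l4 h.pos
  have h1 := h.wp.lev_mul_le h.MF_le
  have hA0 := AF_nonneg U
  have h34 := h.AF_le_NF
  have hbal := h.seq.balanced
  have hlev := h.seq.level
  have hNpos := h.seq.pos
  have hcube : 8 / 27 * AF U ^ 3 ≤ AF U / 6 * NF u ^ 2 := by
    have : AF U ^ 2 ≤ (3 / 4 * NF u) ^ 2 := pow_le_pow_left₀ hA0 h34 2
    have := mul_le_mul_of_nonneg_left this hA0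
    nlinarith
  have h2 : lev m₀ * NF u ^ 2 ≤ (AF U / 6 + BF U / 2) * NF u ^ 2 := by linarith
  have h3 := le_of_mul_le_mul_right h2 (by positivity)
  have hAle := h.AF_le
  have hBle := h.BF_le
  have eA : AF U = A := by linarith
  have eB : BF U = B := by linarith
  refine ⟨eA, eB, ?_⟩
  have hA1 : 0 < AF U := by linarith
  have h4 : AF U * (AF U / 6 * NF u ^ 2) ≤ AF U * (8 / 27 * AF U ^ 3) := by
    refine mul_le_mul_of_nonneg_left ?_ hA0
    have : lev m₀ = AF U / 6 + BF U / 2 := by rw [eA, eB]; linarith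
    rw [this] at h1
    linarith
  have h5 : AF U ^ 2 * (9 / 16 * NF u ^ 2) ≤ AF U ^ 2 * AF U ^ 2 := by linarith
  have h6 := le_of_mul_le_mul_left h5 (by positivity)
  have h7 : 3 / 4 * NF u ≤ AF U := by
    refine le_of_sq_le_sq ?_ hA0
    linarith
  linarith

lemma MF_eq (h : Lim m₀ f u U A B N M) (hl : 0 < mult B N M) : MF u = m₀ := by
  obtain ⟨eA, eB, eN⟩ := h.attained
  have hM : 0 < M := h.pos.trans_le h.mass_pos
  have hNB : B < N / 4 := by
    have := (div_pos_iff_of_pos_right hM).1 hl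
    linarith
  have hbal := h.seq.balanced
  have hlev := h.seq.level
  have hNpos := h.seq.pos
  refine h.MF_le.antisymm (not_lt.1 fun hlt => ?_)
  have key : ∀ x : ℝ, 1 < x → x * MF u ≤ m₀ → N / 4 ≤ B * x := fun x hx hxm => by
    have hx0 : 0 < x := by linarith
    have h1 := (h.wp.const_mul √x).lev_mul_le (m₀ := m₀)
      (by rw [MF_const_mul, Real.sq_sqrt hx0.le]; exact hxm)
    rw [NF_const_mul, AF_const_mul, BF_const_mul, show √x ^ 4 = (√x ^ 2) ^ 2 by ring,
      Real.sq_sqrt hx0.le, eA, eB, eN, hlev, hbal] at h1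
    have h2 : x ^ 3 * N ^ 2 * ((N / 8 + B / 2) * x) ≤ x ^ 3 * N ^ 2 * (N / 8 + B / 2 * x ^ 2) :=
      (le_of_eq (by ring)).trans (h1.trans_eq (by ring))
    have h3 := le_of_mul_le_mul_left h2 (by positivity)
    have h4 : 0 ≤ (x - 1) * (B * x - N / 4) := by linarith
    have := nonneg_of_mul_nonneg_right h4 (by linarith)
    linarith
  have hpos := h.pos
  have hB : 0 ≤ B := eB ▸ BF_nonneg U
  have hlim : Tendsto (fun x : ℝ => B * x) (nhdsWithin 1 (Set.Ioi 1)) (nhds (B * 1)) :=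
    (tendsto_id.const_mul B).mono_left nhdsWithin_le_nhds
  have hr : 1 < m₀ / MF u := (one_lt_div hpos).2 hlt
  have := ge_of_tendsto hlim (b := N / 4) (by
    filter_upwards [Ioo_mem_nhdsGT hr] with x hx
    exact key x hx.1 ((le_div_iff₀ hpos).1 hx.2.le))
  linarith

end Lim

lemma L2P.ae_tendsto_cv {f : Pt → ℝ} (hf : L2P f) :
    ∀ᵐ p ∂mD, Tendsto (fun n => Waveguide.cv (rho n) f p) atTop (nhds (f p)) :=
  ae_restrict_of_ae (ae_tendsto_cv_rho hf.locallyIntegrable)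

lemma L2P.tendsto_sub_cv {f : Pt → ℝ} (hf : L2P f) :
    Tendsto (fun n => ∫ p in Dom, (Waveguide.cv (rho n) f p - f p) ^ 2) atTop (nhds 0) := by
  have hc := fun n => hf.cv (mol_rho n)
  have hi := fun n => memLp_two_mul (hc n).1.memLp hf.memLp
  have key := tendsto_integral_abs_zero_of_le (μ := mD) (C := MF f)
    (f := fun n p => Waveguide.cv (rho n) f p * f p - f p ^ 2)
      (h := fun n p => Waveguide.cv (rho n) f p ^ 2)
    (g := fun η p => (1 / η + 1) * f p ^ 2) (fun n => (hi n).sub hf.sq_integrable) ?_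
    (fun n => (hc n).1.sq_integrable) (fun n => (hc n).2) (fun n p => sq_nonneg _)
    (fun η _ => hf.sq_integrable.const_mul _) fun η hη n p => ?_
  · have h1 := tendsto_integral_of_abs_sub hi hf.sq_integrable key
    have h2 : Tendsto (fun n => 2 * (∫ p in Dom, f p ^ 2) -
      2 * ∫ p in Dom, Waveguide.cv (rho n) f p * f p)
        atTop (nhds 0) := by
      have := (h1.const_mul 2).const_sub (2 * ∫ p in Dom, f p ^ 2)
      rwa [sub_self] at this
    refine squeeze_zero (fun n => integral_nonneg fun p => sq_nonneg _) (fun n => ?_) h2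
    have h3 := integral_add_sq (hc n).1.memLp (hf.const_mul (-1)).memLp
    have e1 : ∫ p in Dom, Waveguide.cv (rho n) f p * (-1 * f p) =
        -∫ p in Dom, Waveguide.cv (rho n) f p * f p := by
      rw [← integral_neg]
      exact integral_congr_ae (Eventually.of_forall fun p => by ring)
    rw [e1] at h3
    simp only [neg_one_mul, neg_sq, ← sub_eq_add_neg] at h3
    rw [h3]
    have := (hc n).2
    unfold MF at this
    linarith
  · filter_upwards [hf.ae_tendsto_cv] with p hp
    have := (hp.mul_const (f p)).sub_const (f p ^ 2)
    rwa [show f p * f p - f p ^ 2 = 0 by ring] at this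
  · generalize Waveguide.cv (rho n) f p = a
    generalize f p = b
    have h1 : |a * b| ≤ η * a ^ 2 + 1 / η * b ^ 2 := by
      rw [abs_mul, ← sq_abs a, ← sq_abs b]
      have : η * |a| ^ 2 + 1 / η * |b| ^ 2 - |a| * |b|
          = (η * |a| - |b| / 2) ^ 2 / η + 3 / 4 * (|b| ^ 2 / η) := by
        field_simp
        ring
      have h2 : 0 ≤ (η * |a| - |b| / 2) ^ 2 / η + 3 / 4 * (|b| ^ 2 / η) := by positivity
      linarith
    have h2 := abs_sub (a * b) (b ^ 2)
    rw [abs_of_nonneg (sq_nonneg b)] at h2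
    linarith

lemma WC.of_tendsto {f : ℕ → Pt → ℝ} {g : Pt → ℝ} (hf : ∀ n, L2P (f n)) (hg : L2P g)
    (h : Tendsto (fun n => ∫ p in Dom, (f n p - g p) ^ 2) atTop (nhds 0)) : WC f g := by
  intro w hw
  rw [tendsto_iff_norm_sub_tendsto_zero]
  have h1 : Tendsto (fun n => √(∫ p in Dom, (f n p - g p) ^ 2) * √(∫ p in Dom, w p ^ 2)) atTop
      (nhds 0) := by simpa using h.sqrt.mul_const (√(∫ p in Dom, w p ^ 2))
  refine squeeze_zero (fun n => norm_nonneg _) (fun n => ?_) h1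
  rw [← integral_sub (memLp_two_mul (hf n).memLp hw) (memLp_two_mul hg.memLp hw), Real.norm_eq_abs]
  simp only [← sub_mul]
  exact abs_integral_mul_le ((hf n).sub hg).memLp hw

lemma abs_gk_sub_le (k a b : ℝ) : |gk k a - gk k b| ≤ |a - b| := by
  have h := Convex.norm_image_sub_le_of_norm_hasDerivWithin_le (f := gk k) (f' := gk' k) (C := 1)
    (s := Set.univ) (x := b) (y := a) (fun x _ => (hasDerivAt_gk k x).hasDerivWithinAt)
    (fun x _ => by rw [Real.norm_of_nonneg (gk'_nonneg _ _)]; exact gk'_le_one _ _) convex_univ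
    (Set.mem_univ _) (Set.mem_univ _)
  simpa using h

lemma L2P.gk'_mul {u v : Pt → ℝ} (hu : L2P u) (hv : L2P v) (k : ℝ) : L2P fun p =>
    gk' k (u p) * v p := by
  have hm : Measurable fun p => gk' k (u p) * v p :=
    ((continuous_gk' k).measurable.comp hu.meas).mul hv.meas
  refine ⟨(hu.per.comp (gk' k)).mul hv.per, hm, hv.memLp.mono hm.aestronglyMeasurable
    (ae_of_all _ fun p => ?_)⟩
  rw [norm_mul, Real.norm_of_nonneg (gk'_nonneg _ _)]
  exact mul_le_of_le_one_left (norm_nonneg _) (gk'_le_one _ _)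

lemma WP.gk {u : Pt → ℝ} {U : Fin 4 → Pt → ℝ} (h : WP u U) {k : ℝ} (hk : 0 ≤ k) :
    WP (fun p => Waveguide.gk k (u p)) fun i p => gk' k (u p) * U i p := by
  have hck := fun n => h.ck_cv (mol_rho n) (contDiff_rho n)
  have hz := fun n => (hck n).gk hk
  have hG := fun i => h.fn.gk'_mul (h.grad i) k
  refine WC.wp (fun n => (hz n).wp) (h.fn.gk hk) hG
    (WC.of_tendsto (fun n => (hz n).l2p) (h.fn.gk hk) ?_)
    fun i => WC.of_tendsto (fun n => (hz n).l2p_pd i) (hG i) ?_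
  · refine squeeze_zero (fun n => integral_nonneg fun p => sq_nonneg _) (fun n => ?_)
      h.fn.tendsto_sub_cv
    refine integral_mono ((hz n).l2p.sub (h.fn.gk hk)).sq_integrable
      ((hck n).l2p.sub h.fn).sq_integrable fun p => ?_
    exact sq_le_sq.2 (abs_gk_sub_le k _ _)
  · have hlim : Tendsto (fun n => 2 * (∫ p in Dom, (cv (rho n) (U i) p - U i p) ^ 2)
        + 2 * ∫ p in Dom, ((gk' k (cv (rho n) u p) - gk' k (u p)) * U i p) ^ 2) atTop (nhds 0) := by
      have h2 := tendsto_integral_of_dominated_convergence (μ := mD)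
        (F := fun n p => ((gk' k (cv (rho n) u p) - gk' k (u p)) * U i p) ^ 2) (f := fun _ => 0)
        (fun p => U i p ^ 2) (fun n => ?_) (h.grad i).sq_integrable
        (fun n => Eventually.of_forall fun p => ?_) ?_
      · rw [integral_zero] at h2
        simpa using ((h.grad i).tendsto_sub_cv.const_mul 2).add (h2.const_mul 2)
      · have := (((hck n).l2p.gk'_mul (h.grad i) k).sub (hG i)).sq_integrable.aestronglyMeasurable
        simpa only [← sub_mul] using this
      · rw [Real.norm_of_nonneg (sq_nonneg _), mul_pow]
        refine mul_le_of_le_one_left (sq_nonneg _) ((sq_le_one_iff_abs_le_one _).2 (abs_le.2 ?_))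
        constructor <;> linarith [gk'_nonneg k (cv (rho n) u p), gk'_le_one k (cv (rho n) u p),
          gk'_nonneg k (u p), gk'_le_one k (u p)]
      · filter_upwards [h.fn.ae_tendsto_cv] with p hp
        have h1 := (((continuous_gk' k).tendsto (u p)).comp hp).sub_const (gk' k (u p))
        rw [sub_self] at h1
        simpa using (h1.mul_const (U i p)).pow 2
    refine squeeze_zero (fun n => integral_nonneg fun p => sq_nonneg _) (fun n => ?_) hlim
    have l1 := (((h.grad i).cv (mol_rho n)).1.sub (h.grad i))
    have l2 : L2P fun p => (gk' k (cv (rho n) u p) - gk' k (u p)) * U i p := by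
      simpa only [← sub_mul] using ((hck n).l2p.gk'_mul (h.grad i) k).sub (hG i)
    rw [← integral_const_mul, ← integral_const_mul,
      ← integral_add (l1.sq_integrable.const_mul 2) (l2.sq_integrable.const_mul 2)]
    refine integral_mono (((hz n).l2p_pd i).sub (hG i)).sq_integrable
      ((l1.sq_integrable.const_mul 2).add (l2.sq_integrable.const_mul 2)) fun p => ?_
    change _ ≤ 2 * (cv (rho n) (U i) p - U i p) ^ 2
      + 2 * ((gk' k (cv (rho n) u p) - gk' k (u p)) * U i p) ^ 2
    rw [pd_gk ((hck n).differentiable p), h.pd_cv (mol_rho n).toKer (contDiff_rho n)]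
    have h0 := gk'_nonneg k (cv (rho n) u p)
    have h1 := gk'_le_one k (cv (rho n) u p)
    generalize gk' k (cv (rho n) u p) = a at *
    generalize gk' k (u p) = b
    generalize cv (rho n) (U i) p = V
    generalize U i p = W
    have h3 : (a * (V - W)) ^ 2 ≤ (V - W) ^ 2 := by
      rw [mul_pow]
      exact mul_le_of_le_one_left (sq_nonneg _) (pow_le_one₀ h0 h1)
    nlinarith [sq_nonneg (a * (V - W) - (a - b) * W)]

/-- The quartic integral over a superlevel set. -/
def NL (u : Pt → ℝ) (k : ℝ) : ℝ := ∫ p in Dom, {p | k < u p}.indicator (fun p => u p ^ 4) p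

lemma measurableSet_lt_fn {u : Pt → ℝ} (hu : L2P u) (k : ℝ) : MeasurableSet {p | k < u p} :=
  measurableSet_lt measurable_const hu.meas

lemma NL_nonneg (u : Pt → ℝ) (k : ℝ) : 0 ≤ NL u k :=
  integral_nonneg fun p => Set.indicator_nonneg (fun p _ => by positivity) p

lemma NL_anti {u : Pt → ℝ} (hu : L2P u) (h4 : Integrable (fun p => u p ^ 4) mD) {k l : ℝ}
    (h : k ≤ l) :
    NL u l ≤ NL u k :=
  integral_mono (h4.indicator (measurableSet_lt_fn hu l)) (h4.indicator (measurableSet_lt_fn hu k))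
    fun p => Set.indicator_le_indicator_of_subset (fun p (hp : l < u p) => h.trans_lt hp)
      (fun p => by positivity) p

lemma NL_tendsto {u : Pt → ℝ} (hu : L2P u) (h4 : Integrable (fun p => u p ^ 4) mD) :
    Tendsto (fun n : ℕ => NL u n) atTop (nhds 0) := by
  have := tendsto_integral_of_dominated_convergence (μ := mD)
    (F := fun (n : ℕ) p => {p | (n : ℝ) < u p}.indicator (fun p => u p ^ 4) p) (f := fun _ => 0)
    (fun p => u p ^ 4) (fun n => (h4.indicator (measurableSet_lt_fn hu n)).aestronglyMeasurable) h4
    (fun n => Eventually.of_forall fun p => ?_) (Eventually.of_forall fun p => ?_)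
  · simpa [NL] using this
  · rw [Real.norm_of_nonneg (Set.indicator_nonneg (fun p _ => by positivity) p)]
    exact Set.indicator_le_self' (fun p _ => by positivity) p
  · obtain ⟨n, hn⟩ := exists_nat_gt (u p)
    refine tendsto_const_nhds.congr' ?_
    filter_upwards [eventually_ge_atTop n] with m hm
    refine (Set.indicator_of_notMem (fun hp : (m : ℝ) < u p => ?_) _).symm
    have : (n : ℝ) ≤ m := by exact_mod_cast hm
    linarith

lemma gk_lower {k l δ s : ℝ} (hδ : 0 < δ) (hδ1 : δ ≤ 1) (hl : 1 ≤ l) (hkl : k ≤ (1 - δ) * l)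
    (hs : l < s) :
    δ ^ 2 / 2 * s ≤ gk k s := by
  have h1 : δ * s ≤ s - k := by nlinarith
  have hs0 : 0 < s := by linarith
  have h2 : 0 < δ * s := by positivity
  rcases le_total s (k + 1) with h | h
  · rw [gk_of_le (by linarith) h]
    have h3 : (δ * s) ^ 2 ≤ (s - k) ^ 2 := pow_le_pow_left₀ h2.le h1 2
    nlinarith [mul_nonneg (sq_nonneg δ) (by nlinarith : 0 ≤ s * (s - 1))]
  · rw [gk_of_ge h]
    have : δ ^ 2 * s ≤ δ * s := by nlinarith
    linarith

namespace Lim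

variable {m₀ A B N M : ℝ} {f : ℕ → Pt → ℝ} {u : Pt → ℝ} {U : Fin 4 → Pt → ℝ}

lemma energy_gk_le (h : Lim m₀ f u U A B N M) {k : ℝ} (hk : 1 ≤ k) :
    √432 * Jc * NF (fun p => gk k (u p)) ≤ (2 + |mult B N M|) ^ 2 * NL u k ^ 2 := by
  have hk0 : 0 ≤ k := by linarith
  have hz := h.wp.gk hk0
  have h4 := h.wp.l4
  set z : Pt → ℝ := fun p => gk k (u p) with hzdef
  set Z : Fin 4 → Pt → ℝ := fun i p => gk' k (u p) * U i p with hZdef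
  have hNi : Integrable ({p | k < u p}.indicator fun p => u p ^ 4) mD :=
    h4.indicator (measurableSet_lt_fn h.wp.fn k)
  have hpt : ∀ p, u p ^ 3 * z p ≤ {p | k < u p}.indicator (fun p => u p ^ 4) p ∧
      u p * z p ≤ {p | k < u p}.indicator (fun p => u p ^ 4) p ∧
      z p ^ 2 ≤ {p | k < u p}.indicator (fun p => u p ^ 4) p := fun p => by
    rcases le_or_gt (u p) k with hp | hp
    · have hz0 : z p = 0 := gk_eq_zero hp
      rw [Set.indicator_of_notMem (show p ∉ {p | k < u p} from fun h' => absurd h' (not_lt.2 hp)),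
        hz0]
      simp
    · rw [Set.indicator_of_mem (show p ∈ {p | k < u p} from hp)]
      have h1 : z p ≤ u p := (gk_le hp.le).trans (by linarith)
      have h0 : 0 ≤ z p := gk_nonneg _ _
      have hu1 : 1 ≤ u p := by linarith
      have hu0 := h.nonneg p
      have h2 : u p ^ 2 ≤ u p ^ 4 := pow_le_pow_right₀ hu1 (by norm_num)
      refine ⟨?_, ?_, ?_⟩
      · calc u p ^ 3 * z p ≤ u p ^ 3 * u p := by gcongr
          _ = u p ^ 4 := by ring
      · calc u p * z p ≤ u p * u p := by gcongr
          _ ≤ u p ^ 4 := by rwa [← sq]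
      · exact (pow_le_pow_left₀ h0 h1 2).trans h2
  have i1 : ∫ p in Dom, u p ^ 3 * z p ≤ NL u k :=
    integral_mono (integrable_cube_mul h.wp.fn hz.fn h4 hz.l4) hNi fun p => (hpt p).1
  have i2 : ∫ p in Dom, u p * z p ≤ NL u k :=
    integral_mono (memLp_two_mul h.wp.fn.memLp hz.fn.memLp) hNi fun p => (hpt p).2.1
  have i3 : MF z ≤ NL u k := integral_mono hz.fn.sq_integrable hNi fun p => (hpt p).2.2
  have i4 : 0 ≤ ∫ p in Dom, u p * z p :=
    integral_nonneg fun p => mul_nonneg (h.nonneg p) (gk_nonneg _ _)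
  have hE : ∀ i, ∫ p in Dom, Z i p ^ 2 ≤ ∫ p in Dom, U i p * Z i p := fun i =>
    integral_mono (hz.grad i).sq_integrable (memLp_two_mul (h.wp.grad i).memLp (hz.grad i).memLp)
      fun p => by
        change (gk' k (u p) * U i p) ^ 2 ≤ U i p * (gk' k (u p) * U i p)
        have h0 := gk'_nonneg k (u p)
        have h1 := gk'_le_one k (u p)
        generalize gk' k (u p) = a at *
        nlinarith [mul_nonneg (mul_nonneg h0 (sub_nonneg.2 h1)) (sq_nonneg (U i p))]
  have hEL := h.euler_lagrange hz
  have hAB : AF Z + BF Z ≤ (∫ p in Dom, u p ^ 3 * z p) - mult B N M * ∫ p in Dom, u p * z p := by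
    have := hE 0
    have := hE 1
    have := hE 2
    have := hE 3
    unfold AF BF
    unfold AF₂ at hEL
    linarith
  have hlam : -(mult B N M * ∫ p in Dom, u p * z p) ≤ |mult B N M| * NL u k := by
    calc -(mult B N M * ∫ p in Dom, u p * z p) = -mult B N M * ∫ p in Dom, u p * z p := by ring
      _ ≤ |mult B N M| * ∫ p in Dom, u p * z p := by gcongr; exact neg_le_abs _
      _ ≤ _ := by gcongr
  have hAn := AF_nonneg Z
  have hBn := BF_nonneg Z
  have hMn := MF_nonneg z
  have hsum : AF Z + (BF Z + MF z) ≤ (2 + |mult B N M|) * NL u k := by linarith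
  have hv := hz.hv
  have hS : AF Z ^ 3 * (BF Z + MF z) ≤ (AF Z + (BF Z + MF z)) ^ 4 := by
    set D := BF Z + MF z
    have hD : 0 ≤ D := add_nonneg hBn hMn
    calc AF Z ^ 3 * D ≤ (AF Z + D) ^ 3 * (AF Z + D) := by gcongr <;> linarith
      _ = (AF Z + D) ^ 4 := by ring
  have hS2 : (AF Z + (BF Z + MF z)) ^ 4 ≤ ((2 + |mult B N M|) * NL u k) ^ 4 := by gcongr
  refine le_of_sq_le_sq ?_ (by positivity)
  calc (√432 * Jc * NF z) ^ 2 = 432 * Jc ^ 2 * NF z ^ 2 := by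
        rw [mul_pow, mul_pow, Real.sq_sqrt (by norm_num)]
    _ ≤ ((2 + |mult B N M|) * NL u k) ^ 4 := (hv.trans hS).trans hS2
    _ = ((2 + |mult B N M|) ^ 2 * NL u k ^ 2) ^ 2 := by ring

lemma NL_step (h : Lim m₀ f u U A B N M) : ∃ C : ℝ, 0 < C ∧ ∀ k l δ : ℝ, 1 ≤ k → 0 < δ → δ ≤ 1 → 1 ≤
    l →
    k ≤ (1 - δ) * l → δ ^ 8 * NL u l ≤ C * NL u k ^ 2 := by
  have hJ := Jc_pos
  refine ⟨16 * (2 + |mult B N M|) ^ 2 / (√432 * Jc), by positivity, fun k l δ hk hδ hδ1 hl hkl =>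
      ?_⟩
  have h1 := h.energy_gk_le hk
  have hz := h.wp.gk (k := k) (by linarith)
  have h2 : δ ^ 8 / 16 * NL u l ≤ NF fun p => gk k (u p) := by
    unfold NL
    rw [← integral_const_mul]
    refine integral_mono ((h.wp.l4.indicator (measurableSet_lt_fn h.wp.fn l)).const_mul _) hz.l4
      fun p => ?_
    change δ ^ 8 / 16 * {p | l < u p}.indicator (fun p => u p ^ 4) p ≤ gk k (u p) ^ 4
    rcases le_or_gt (u p) l with hp | hp
    · rw [Set.indicator_of_notMem (show p ∉ {p | l < u p} from fun h' => absurd h' (not_lt.2 hp)),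
        mul_zero]
      have := gk_nonneg k (u p)
      positivity
    · rw [Set.indicator_of_mem (show p ∈ {p | l < u p} from hp)]
      have := h.nonneg p
      calc δ ^ 8 / 16 * u p ^ 4 = (δ ^ 2 / 2 * u p) ^ 4 := by ring
        _ ≤ gk k (u p) ^ 4 := by gcongr; exact gk_lower hδ hδ1 hl hkl hp
  rw [div_mul_eq_mul_div, le_div_iff₀ (by positivity)]
  have h3 : √432 * Jc * (δ ^ 8 / 16 * NL u l) ≤ √432 * Jc * NF fun p => gk k (u p) := by gcongr
  linarith

theorem bounded (h : Lim m₀ f u U A B N M) : ∃ K, ∀ᵐ p ∂mD, u p ≤ K := by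
  obtain ⟨C, hC, hstep⟩ := h.NL_step
  have hlim := NL_tendsto h.wp.fn h.wp.l4
  obtain ⟨K, hK1, hKs⟩ : ∃ K : ℕ, 1 ≤ K ∧ NL u K * (C * 4 ^ 8 * 2 ^ 8 * 2 ^ 8) < 1 := by
    have h1 := hlim.mul_const (C * 4 ^ 8 * 2 ^ 8 * 2 ^ 8)
    rw [zero_mul] at h1
    have h2 := ((tendsto_order.1 h1).2 1 one_pos).and (eventually_ge_atTop 1)
    obtain ⟨K, hK⟩ := h2.exists
    exact ⟨K, hK.2, hK.1⟩
  have hK1' : (1 : ℝ) ≤ K := by exact_mod_cast hK1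
  let lv : ℕ → ℝ := fun j => K * (2 - (1 / 2) ^ j)
  have hlv1 : ∀ j, 1 ≤ lv j := fun j => by
    have : ((1 : ℝ) / 2) ^ j ≤ 1 := pow_le_one₀ (by norm_num) (by norm_num)
    simp only [lv]
    nlinarith
  have hdec : ∀ j, NL u (lv j) ≤ NL u K * ((1 / 2) ^ j) ^ 8 := fun j => by
    induction j with
    | zero => simp only [lv]; norm_num
    | succ j ih =>
      set x : ℝ := (1 / 2) ^ j with hx
      have hx0 : 0 < x := by positivity
      have hx1 : x ≤ 1 := pow_le_one₀ (by norm_num) (by norm_num)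
      have e1 : lv (j + 1) = K * (2 - x / 2) := by
        simp only [lv, pow_succ, hx]
        ring
      have h1 := hstep (lv j) (lv (j + 1)) (x / 4) (hlv1 j) (by positivity) (by linarith)
        (hlv1 (j + 1)) (by
          rw [e1]
          change K * (2 - x) ≤ (1 - x / 4) * (K * (2 - x / 2))
          nlinarith [mul_nonneg (by linarith : (0 : ℝ) ≤ K) (sq_nonneg x)])
      have h2 : C * NL u (lv j) ^ 2 ≤ C * (NL u K * x ^ 8) ^ 2 := by
        have := NL_nonneg u (lv j)
        gcongr
      have h3 := NL_nonneg u K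
      have h4 : x ^ 8 * NL u (lv (j + 1)) ≤ x ^ 8 * (NL u K * (x * (1 / 2)) ^ 8) := by
        have h5 : x ^ 8 * NL u (lv (j + 1)) ≤ 4 ^ 8 * C * (NL u K * x ^ 8) ^ 2 := by
          have : (x / 4) ^ 8 * NL u (lv (j + 1)) = x ^ 8 * NL u (lv (j + 1)) / 4 ^ 8 := by ring
          rw [this] at h1
          have := h1.trans h2
          rw [div_le_iff₀ (by positivity)] at this
          linarith
        have h6 : NL u K * (C * 4 ^ 8 * 2 ^ 8) ≤ 1 := by
          have : 0 ≤ NL u K * (C * 4 ^ 8 * 2 ^ 8) := by positivity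
          nlinarith
        have h7 : 0 ≤ NL u K * x ^ 16 := by positivity
        have h8 := mul_le_mul_of_nonneg_left h6 h7
        refine h5.trans ?_
        have e2 : x ^ 8 * (NL u K * (x * (1 / 2)) ^ 8) = NL u K * x ^ 16 * 1 / 2 ^ 8 := by ring
        rw [e2, le_div_iff₀ (by positivity)]
        exact (le_of_eq (by ring)).trans h8
      have h9 := le_of_mul_le_mul_left h4 (by positivity)
      rw [pow_succ]
      exact h9
  have hzero : NL u (2 * K) = 0 := by
    refine le_antisymm ?_ (NL_nonneg _ _)
    have hl : Tendsto (fun j : ℕ => NL u K * (((1 : ℝ) / 2) ^ j) ^ 8) atTop (nhds 0) := by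
      have := ((tendsto_pow_atTop_nhds_zero_of_lt_one (by norm_num : (0 : ℝ) ≤ 1 / 2)
        (by norm_num)).pow 8).const_mul (NL u K)
      simpa using this
    refine ge_of_tendsto' hl fun j => (NL_anti h.wp.fn h.wp.l4 ?_).trans (hdec j)
    have : (0 : ℝ) ≤ (1 / 2) ^ j := by positivity
    simp only [lv]
    nlinarith
  refine ⟨2 * K, ?_⟩
  have h1 := (integral_eq_zero_iff_of_nonneg (Set.indicator_nonneg fun p _ => by positivity)
    (h.wp.l4.indicator (measurableSet_lt_fn h.wp.fn (2 * K)))).1 hzero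
  filter_upwards [h1] with p hp
  by_contra! hlt
  rw [Set.indicator_of_mem (show p ∈ {p | 2 * K < u p} from hlt)] at hp
  have : 0 < u p := by linarith
  exact (pow_pos this 4).ne' hp

end Lim

lemma L2P.ae_eq {f g : Pt → ℝ} (hf : L2P f) (hg : L2P g) (h : f =ᵐ[mD] g) : f =ᵐ[volume] g := by
  have h0 : MF (fun p => f p - g p) = 0 := by
    refine integral_eq_zero_of_ae ?_
    filter_upwards [h] with p hp
    simp [hp]
  have hd := hf.sub hg
  filter_upwards [ae_tendsto_cv_rho hd.locallyIntegrable] with p hp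
  have hz : ∀ n, Waveguide.cv (rho n) (fun p => f p - g p) p = 0 := fun n => by
    have := abs_cv_le (mol_rho n).toKer hd p
    rw [h0, Real.sqrt_zero, mul_zero] at this
    exact abs_nonpos_iff.1 this
  simp only [hz] at hp
  exact sub_eq_zero.1 (tendsto_nhds_unique hp tendsto_const_nhds)

lemma eq_of_ae_eq {f g : Pt → ℝ} (hf : Continuous f) (hg : Continuous g) (pf : PeriodicY f)
    (pg : PeriodicY g) (h : f =ᵐ[mD] g) : f = g := by
  have hd : L2P fun p => f p - g p := ⟨pf.sub pg, (hf.sub hg).measurable,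
    (MemLp.zero (ε := ℝ)).ae_eq (by filter_upwards [h] with p hp; simp [hp])⟩
  have h1 := hd.ae_eq ⟨fun _ _ => rfl, measurable_const, MemLp.zero⟩
    (by filter_upwards [h] with p hp; simp [hp] : _ =ᵐ[mD] fun _ => (0 : ℝ))
  have h2 := (Continuous.ae_eq_iff_eq volume (hf.sub hg) continuous_const).1 h1
  exact funext fun p => sub_eq_zero.1 (congrFun h2 p)

lemma ck_of_xCompact {ψ : Pt → ℝ} (hs : ContDiff ℝ 1 ψ) (hp : PeriodicY ψ) (hx : XCompact ψ) :
    CK ψ where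
  smooth := hs
  per := hp
  memLp := (memLp_two_iff_integrable_sq hs.continuous.aestronglyMeasurable).2
    ((hx.mono (g := fun p => ψ p ^ 2) fun p h => by simp [h]).integrableOn (hs.continuous.pow 2))
  memLpD i := by
    have hc := continuous_pd hs i
    exact (memLp_two_iff_integrable_sq hc.aestronglyMeasurable).2
      (((hx.fderiv_apply (dir i)).mono (g := fun p => pd ψ i p ^ 2) fun p h => by
        change fderiv ℝ ψ p (dir i) ^ 2 = 0
        simp [h]).integrableOn (hc.pow 2))

lemma ibp_xCompact {f ψ : Pt → ℝ} (hf : ContDiff ℝ 1 f) (pf : PeriodicY f) (hs : ContDiff ℝ 1 ψ)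
    (hp : PeriodicY ψ) (hx : XCompact ψ) (i : Fin 4) :
    Integrable (fun p => pd f i p * ψ p) mD ∧ Integrable (fun p => f p * pd ψ i p) mD ∧
    ∫ p in Dom, f p * pd ψ i p = -∫ p in Dom, pd f i p * ψ p := by
  have hF := continuous_pd hf i
  have hG := continuous_pd hs i
  have i1 : Integrable (fun p => pd f i p * ψ p) mD :=
    (hx.mono (g := fun p => pd f i p * ψ p) fun p h => by simp [h]).integrableOn
      (hF.mul hs.continuous)
  have i2 : Integrable (fun p => f p * pd ψ i p) mD :=
    ((hx.fderiv_apply (dir i)).mono (g := fun p => f p * pd ψ i p) fun p h => by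
      change f p * fderiv ℝ ψ p (dir i) = 0
      simp [h]).integrableOn (hf.continuous.mul hG)
  refine ⟨i1, i2, ?_⟩
  have e : pd (fun q => f q * ψ q) i = fun p => f p * pd ψ i p + pd f i p * ψ p := funext fun p =>
    pd_mul (hf.differentiable one_ne_zero p) (hs.differentiable one_ne_zero p) i
  have h := setIntegral_pd_eq_zero (H := fun q => f q * ψ q) (i := i) (hf.mul hs) (pf.mul hp)
    ((hx.mono (g := fun p => f p * ψ p) fun p h => by simp [h]).integrableOn
      (hf.continuous.mul hs.continuous))
    (by rw [e]; exact i2.add i1)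
  rw [e, integral_add i2 i1] at h
  linarith

/-- The Laplacian in all four variables. -/
def lap (v : Pt → ℝ) (p : Pt) : ℝ := ∑ i, pd (pd v i) i p

lemma contDiff_pd_succ {v : Pt → ℝ} {n : ℕ} (hv : ContDiff ℝ (n + 1 : ℕ) v) (i : Fin 4) :
    ContDiff ℝ n (pd v i) :=
  (hv.fderiv_right (m := n) (by norm_cast)).clm_apply contDiff_const

lemma pd_pd_comm {v : Pt → ℝ} (hv : ContDiff ℝ 2 v) (i j : Fin 4) : pd (pd v i) j =
    pd (pd v j) i := by
  have hd : Differentiable ℝ (fderiv ℝ v) :=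
    (hv.fderiv_right (m := 1) (by norm_num)).differentiable one_ne_zero
  have e : ∀ i j p, pd (pd v i) j p = fderiv ℝ (fderiv ℝ v) p (dir j) (dir i) := fun i j p => by
    have h : HasFDerivAt (pd v i) ((fderiv ℝ (fderiv ℝ v) p).flip (dir i)) p :=
      (ContinuousLinearMap.apply ℝ ℝ (dir i)).hasFDerivAt.comp p (hd p).hasFDerivAt
    change fderiv ℝ (pd v i) p (dir j) = _
    rw [h.fderiv]
    rfl
  funext p
  rw [e, e]
  exact (hv.contDiffAt.isSymmSndFDerivAt (by simp)).eq _ _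

lemma lap_pd {v : Pt → ℝ} (hv : ContDiff ℝ 3 v) (i : Fin 4) : lap (pd v i) = pd (lap v) i := by
  have h2 : ContDiff ℝ 2 v := hv.of_le (by norm_num)
  funext p
  have hd : ∀ j, DifferentiableAt ℝ (pd (pd v j) j) p := fun j =>
    (contDiff_pd_succ (n := 1) (contDiff_pd_succ (n := 2) hv j) j).differentiable one_ne_zero p
  have h : HasFDerivAt (lap v) (∑ j, fderiv ℝ (pd (pd v j) j) p) p :=
    HasFDerivAt.fun_sum fun j _ => (hd j).hasFDerivAt
  change _ = fderiv ℝ (lap v) p (dir i)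
  rw [h.fderiv, _root_.sum_apply]
  refine Finset.sum_congr rfl fun j _ => ?_
  rw [pd_pd_comm h2 i j, pd_pd_comm (contDiff_pd_succ (n := 2) hv j) i j]
  rfl

namespace Lim

variable {m₀ A B N M : ℝ} {f : ℕ → Pt → ℝ} {u : Pt → ℝ} {U : Fin 4 → Pt → ℝ}

lemma congr (h : Lim m₀ f u U A B N M) {g : Pt → ℝ} (hg : L2P g) (h0 : ∀ p, 0 ≤ g p)
    (he : u =ᵐ[mD] g) :
    Lim m₀ f g U A B N M where
  seq := h.seq
  wp := WC.wp (F := fun i n => pd (f n) i) (fun n => (h.seq.ck n).wp) hg h.wp.grad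
    (h.wc.congr he) h.wcD
  wc := h.wc.congr he
  wcD := h.wcD
  ae := by filter_upwards [h.ae, he] with p h1 h2; rwa [← h2]
  nonneg := h0
  pos := h.pos.trans_le (integral_congr_ae (by filter_upwards [he] with p hp; simp [hp])).le

lemma exists_le (h : Lim m₀ f u U A B N M) : ∃ K g, (∀ p, g p ≤ K) ∧ u =ᵐ[mD] g ∧
    Lim m₀ f g U A B N M := by
  obtain ⟨K, hK⟩ := h.bounded
  have he : u =ᵐ[mD] fun p => min (u p) |K| := by
    filter_upwards [hK] with p hp
    exact (min_eq_left (hp.trans (le_abs_self K))).symm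
  refine ⟨|K|, fun p => min (u p) |K|, fun p => min_le_right _ _, he, h.congr ?_ (fun p => ?_) he⟩
  · exact ⟨fun x y => by rw [h.wp.fn.per], h.wp.fn.meas.min measurable_const,
        h.wp.fn.memLp.ae_eq he⟩
  · exact le_min (h.nonneg p) (abs_nonneg K)

/-- The right-hand side of `Δu = mult · u - u³`. -/
def rhs (c : ℝ) (u : Pt → ℝ) (p : Pt) : ℝ := c * u p - u p ^ 3

lemma l2p_cube (h : Lim m₀ f u U A B N M) {K : ℝ} (hK : ∀ p, u p ≤ K) : L2P fun p => u p ^ 3 :=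
  ⟨h.wp.fn.per.pow 3, h.wp.fn.meas.pow_const 3, h.wp.fn.memLp.of_le_mul (c := K ^ 2)
    (h.wp.fn.meas.pow_const 3).aestronglyMeasurable (Eventually.of_forall fun p => by
      have h0 := h.nonneg p
      rw [Real.norm_of_nonneg h0, Real.norm_of_nonneg (by positivity), pow_succ]
      have := hK p
      gcongr)⟩

lemma l2p_rhs (h : Lim m₀ f u U A B N M) {K : ℝ} (hK : ∀ p, u p ≤ K) (c : ℝ) : L2P (rhs c u) :=
  (h.wp.fn.const_mul c).sub (h.l2p_cube hK)

lemma lap_cv (h : Lim m₀ f u U A B N M) {K : ℝ} (hK : ∀ p, u p ≤ K) (n : ℕ) :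
    lap (cv (rho n) u) = cv (rho n) (rhs (mult B N M) u) := by
  set c := mult B N M
  set v := cv (rho n) u with hv
  have hrho := mol_rho n
  have hr := h.l2p_rhs hK c
  have hv3 : ContDiff ℝ 3 v := contDiff_cv (n := 3) hrho.toKer
    (contDiff_rho n) h.wp.fn.locallyIntegrable
  have hpv : ∀ i, ContDiff ℝ 2 (pd v i) := fun i => contDiff_pd_succ (n := 2) hv3 i
  have hper : PeriodicY v := h.wp.fn.per.cv _
  have pe : ∀ i, pd v i = cv (rho n) (U i) := fun i => funext fun p =>
    h.wp.pd_cv hrho.toKer (contDiff_rho n) i p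
  have clap : ContDiff ℝ 1 (lap v) := ContDiff.sum fun i _ => contDiff_pd_succ (n := 1) (hpv i) i
  have plap : PeriodicY (lap v) := fun x y => Finset.sum_congr rfl fun i _ => (hper.pd i).pd i x y
  set D := fun p => lap v p - cv (rho n) (rhs c u) p with hD
  have cD : ContDiff ℝ 1 D := clap.sub
    (contDiff_cv (n := 1) hrho.toKer (contDiff_rho n) hr.locallyIntegrable)
  have pD : PeriodicY D := plap.sub (hr.per.cv _)
  have key : ∀ ψ : Pt → ℝ, ContDiff ℝ 1 ψ → PeriodicY ψ → XCompact ψ → ∫ p in Dom, D p * ψ p =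
      0 := by
    intro ψ hs hp hx
    have ck := ck_of_xCompact hs hp hx
    have hφ := ck.wp.ck_cv hrho (contDiff_rho n)
    have hE := h.euler_lagrange hφ.wp
    have e1 : ∀ i, ∫ p in Dom, U i p * pd (cv (rho n) ψ) i p = -∫ p in Dom, pd (pd v i) i p * ψ p :=
      fun i => by
        rw [← (ibp_xCompact ((hpv i).of_le (by norm_num)) (hper.pd i) hs hp hx i).2.2, pe i,
          setIntegral_cv_mul_comm hrho (h.wp.grad i) (ck.l2p_pd i)]
        simp only [ck.wp.pd_cv hrho.toKer (contDiff_rho n)]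
    have e2 : ∫ p in Dom, lap v p * ψ p = ∑ i, ∫ p in Dom, pd (pd v i) i p * ψ p := by
      rw [← integral_finsetSum _ fun i _ =>
        (ibp_xCompact ((hpv i).of_le (by norm_num)) (hper.pd i) hs hp hx i).1]
      simp only [lap, Finset.sum_mul]
    have i1 : Integrable (fun p => c * u p * cv (rho n) ψ p) mD := by
      have := memLp_two_mul (h.wp.fn.const_mul c).memLp hφ.memLp
      exact this
    have i2 : Integrable (fun p => u p ^ 3 * cv (rho n) ψ p) mD :=
      memLp_two_mul (h.l2p_cube hK).memLp hφ.memLp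
    have e3 : ∫ p in Dom, cv (rho n) (rhs c u) p * ψ p
        = c * (∫ p in Dom, u p * cv (rho n) ψ p) - ∫ p in Dom, u p ^ 3 * cv (rho n) ψ p := by
      rw [setIntegral_cv_mul_comm hrho hr ck.l2p, ← integral_const_mul]
      simp only [← mul_assoc]
      rw [← integral_sub i1 i2]
      simp only [rhs, sub_mul]
    have j1 : Integrable (fun p => lap v p * ψ p) mD :=
      (hx.mono (g := fun p => lap v p * ψ p) fun p h => by simp [h]).integrableOn
        (clap.continuous.mul hs.continuous)
    have j2 : Integrable (fun p => cv (rho n) (rhs c u) p * ψ p) mD :=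
      memLp_two_mul (hr.cv hrho).1.memLp ck.memLp
    simp only [hD, sub_mul]
    rw [integral_sub j1 j2, e2, e3, Fin.sum_univ_four]
    unfold AF₂ at hE
    simp only [e1] at hE
    linarith
  have hz : ∀ k, ∀ᵐ p ∂mD, xcut k p * D p = 0 := fun k => by
    have hx : XCompact fun p => xcut k p * D p := (xcut_xCompact k).mono fun p h => by simp [h]
    have c1 : ContDiff ℝ 1 fun p => xcut k p * D p := (contDiff_xcut k).mul cD
    have h1 := key _ c1 ((xcut_periodic k).mul pD) hx
    have hx2 : XCompact fun p => D p * (xcut k p * D p) := hx.mono fun p h => by simp [h]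
    have h2 := (integral_eq_zero_iff_of_nonneg (fun p => ?_)
      (hx2.integrableOn (cD.continuous.mul c1.continuous))).1 h1
    · filter_upwards [h2] with p hp
      rcases mul_eq_zero.1 hp with h3 | h3
      · rw [h3, mul_zero]
      · exact h3
    · change 0 ≤ D p * (xcut k p * D p)
      nlinarith [mul_nonneg (xcut_nonneg k p) (sq_nonneg (D p))]
  have hae : lap v =ᵐ[mD] cv (rho n) (rhs c u) := by
    filter_upwards [ae_all_iff.2 hz] with p hp
    have := (xcut_tendsto p).mul_const (D p)
    simp only [hp, one_mul] at this
    exact sub_eq_zero.1 (tendsto_nhds_unique tendsto_const_nhds this).symm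
  exact eq_of_ae_eq clap.continuous (continuous_cv hrho.toKer hr.locallyIntegrable) plap
    (hr.per.cv _) hae

end Lim

lemma deriv_expNegInvGlue_of_nonpos {x : ℝ} (hx : x ≤ 0) : deriv expNegInvGlue x = 0 :=
  IsLocalMin.deriv_eq_zero (Eventually.of_forall fun y => by
    rw [expNegInvGlue.zero_of_nonpos hx]
    exact expNegInvGlue.nonneg y)

lemma expNegInvGlue_le_deriv {x : ℝ} (hx : x ≤ 1) : expNegInvGlue x ≤ deriv expNegInvGlue x := by
  rcases le_or_gt x 0 with h | h
  · rw [deriv_expNegInvGlue_of_nonpos h, expNegInvGlue.zero_of_nonpos h]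
  · have e : expNegInvGlue =ᶠ[nhds x] fun y => Real.exp (-y⁻¹) := by
      filter_upwards [Ioi_mem_nhds h] with y hy
      simp [expNegInvGlue, not_le.2 (show 0 < y from hy)]
    have hd : HasDerivAt (fun y : ℝ => Real.exp (-y⁻¹)) (Real.exp (-x⁻¹) * -(-(x ^ 2)⁻¹)) x :=
      (hasDerivAt_inv h.ne').neg.exp
    rw [e.deriv_eq, hd.deriv, e.self_of_nhds, neg_neg]
    refine le_mul_of_one_le_right (Real.exp_pos _).le ((one_le_inv₀ (by positivity)).2 ?_)
    exact pow_le_one₀ h.le hx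

/-- A radial bump on `Pt`. -/
def pot (ζ : Pt) : ℝ := expNegInvGlue (1 - nsq ζ)

/-- The averaging weight `η` with `∇ pot = -η · id`. -/
def wgt (ζ : Pt) : ℝ := 2 * deriv expNegInvGlue (1 - nsq ζ)

lemma contDiff_pot {n : ℕ∞} : ContDiff ℝ n pot :=
    expNegInvGlue.contDiff.comp (contDiff_const.sub contDiff_nsq)

lemma contDiff_wgt : ContDiff ℝ 1 wgt :=
  contDiff_const.mul (((expNegInvGlue.contDiff (n := 2)).iterate_deriv' 1 1).comp
    (contDiff_const.sub contDiff_nsq))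

lemma one_lt_nsq {ζ : Pt} (h : 1 < ‖ζ‖) : 1 < nsq ζ := by
  have := norm_sq_le_nsq ζ
  nlinarith

lemma ker_pot : Ker pot where
  cont := (contDiff_pot (n := 0)).continuous
  supp ζ h := expNegInvGlue.zero_of_nonpos (by linarith [one_lt_nsq h])

lemma ker_wgt : Ker wgt where
  cont := contDiff_wgt.continuous
  supp ζ h := by
    unfold wgt
    rw [deriv_expNegInvGlue_of_nonpos (by linarith [one_lt_nsq h]), mul_zero]

lemma pd_pot (i : Fin 4) (ζ : Pt) : pd pot i ζ = -(wgt ζ * co i ζ) := by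
  have h := pd_comp (F := fun t => expNegInvGlue (1 - t)) (f := nsq) (p := ζ)
    (((expNegInvGlue.contDiff (n := 1)).differentiable one_ne_zero _).hasDerivAt.comp_const_sub 1
      (nsq ζ))
    (hasFDerivAt_nsq ζ).differentiableAt i
  change pd pot i ζ = _ at h
  rw [h]
  unfold pd wgt
  rw [fderiv_nsq]
  ring

lemma pot_nonneg (ζ : Pt) : 0 ≤ pot ζ := expNegInvGlue.nonneg _

lemma pot_le_wgt (ζ : Pt) : 2 * pot ζ ≤ wgt ζ :=
  mul_le_mul_of_nonneg_left (expNegInvGlue_le_deriv (by linarith [nsq_nonneg ζ])) zero_le_two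

lemma wgt_nonneg (ζ : Pt) : 0 ≤ wgt ζ := by linarith [pot_nonneg ζ, pot_le_wgt ζ]

lemma wgt_pos {ζ : Pt} (h : nsq ζ < 1) : 0 < wgt ζ := by
  have : 0 < pot ζ := expNegInvGlue.pos_of_pos (by linarith)
  linarith [pot_le_wgt ζ]

lemma integral_wgt_pos : 0 < ∫ ζ, wgt ζ := by
  refine ker_wgt.cont.integral_pos_of_hasCompactSupport_nonneg_nonzero ker_wgt.hasCompactSupport
    wgt_nonneg (x := 0) (wgt_pos ?_).ne'
  simp [nsq]

lemma integrable_prod_Ioc {G : Pt × ℝ → ℝ} (hG : Continuous G) (h0 : ∀ ζ r, 1 < ‖ζ‖ → G (ζ, r) = 0)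
    (R : ℝ) :
    Integrable G (volume.prod (volume.restrict (Set.Ioc 0 R))) := by
  have hc : IntegrableOn G (Metric.closedBall 0 1 ×ˢ Set.Icc 0 R) (volume.prod volume) :=
    hG.continuousOn.integrableOn_compact ((isCompact_closedBall 0 1).prod isCompact_Icc)
  have h1 : IntegrableOn G (Set.univ ×ˢ Set.Ioc 0 R) (volume.prod volume) :=
    hc.of_forall_sdiff_eq_zero (MeasurableSet.univ.prod measurableSet_Ioc) fun q hq => by
      refine h0 q.1 q.2 (not_le.1 fun hle => hq.2 ⟨?_, Set.Ioc_subset_Icc_self hq.1.2⟩)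
      simpa using hle
  rwa [IntegrableOn, ← Measure.prod_restrict, Measure.restrict_univ] at h1

/-- The weighted average of `g` over the ball of radius `r`. -/
def avg (k g : Pt → ℝ) (p : Pt) (r : ℝ) : ℝ := ∫ ζ, k ζ * g (p + r • ζ)

lemma Ker.integrable_avg {k g : Pt → ℝ} (hk : Ker k) (hg : Continuous g) (p : Pt) (r : ℝ) :
    Integrable fun ζ => k ζ * g (p + r • ζ) :=
  (hk.cont.mul (hg.comp (by fun_prop))).integrable_of_hasCompactSupport
    hk.hasCompactSupport.mul_right

lemma continuous_avg {k g : Pt → ℝ} (hk : Ker k) (hg : Continuous g) (p : Pt) :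
    Continuous (avg k g p) := by
  have h := continuous_parametric_integral_of_continuous (μ := (volume : Measure Pt))
    (f := fun (r : ℝ) ζ => k ζ * g (p + r • ζ)) (s := Metric.closedBall 0 1) (by
      have := hk.cont
      fun_prop) (isCompact_closedBall 0 1)
  refine h.congr fun r => setIntegral_eq_integral_of_forall_compl_eq_zero fun ζ hζ => ?_
  rw [hk.supp, zero_mul]
  simpa using hζ

lemma hasDerivAt_ray {v : Pt → ℝ} (hv : Differentiable ℝ v) (p ζ : Pt) (r : ℝ) :
    HasDerivAt (fun r : ℝ => v (p + r • ζ)) (fderiv ℝ v (p + r • ζ) ζ) r := by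
  have h : HasDerivAt (fun r : ℝ => p + r • ζ) ζ r := by
    simpa using ((hasDerivAt_id r).smul_const ζ).const_add p
  exact (hv _).hasFDerivAt.comp_hasDerivAt r h

lemma pd_dilate {g : Pt → ℝ} (hg : Differentiable ℝ g) (p : Pt) (r : ℝ) (i : Fin 4) (ζ : Pt) :
    pd (fun ζ => g (p + r • ζ)) i ζ = r * pd g i (p + r • ζ) := by
  have h : HasFDerivAt (fun ζ : Pt => p + r • ζ) (r • ContinuousLinearMap.id ℝ Pt) ζ :=
    ((hasFDerivAt_id ζ).const_smul r).const_add p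
  have h2 := (hg (p + r • ζ)).hasFDerivAt.comp ζ h
  change HasFDerivAt (fun ζ => g (p + r • ζ)) _ ζ at h2
  unfold pd
  rw [h2.fderiv]
  simp

lemma avg_pd {k g : Pt → ℝ} (hk : Ker k) (hs : ContDiff ℝ 1 k) (hg : ContDiff ℝ 1 g) (i : Fin 4)
    (p : Pt)
    (r : ℝ) : r * avg k (pd g i) p r = -avg (pd k i) g p r := by
  have hd := hg.differentiable one_ne_zero
  have e := funext (pd_dilate hd p r i)
  have h := integral_mul_pd (u := fun ζ => g (p + r • ζ)) (i := i) (hd.comp (by fun_prop)) (by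
    rw [e]
    exact (continuous_const.mul ((continuous_pd hg i).comp (by fun_prop))).locallyIntegrable)
    hs hk.hasCompactSupport
  rw [e] at h
  unfold avg
  rw [← integral_const_mul]
  have e1 : ∀ ζ, r * pd g i (p + r • ζ) * k ζ = r * (k ζ * pd g i (p + r • ζ)) := fun ζ => by ring
  simp only [e1] at h
  simp only [mul_comm (pd k i _), h, neg_neg]

lemma fderiv_eq_sum (v : Pt → ℝ) (p ζ : Pt) : fderiv ℝ v p ζ = ∑ i, co i ζ * pd v i p := by
  have e : ζ = ∑ i, co i ζ • dir i := by
    ext j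
    · fin_cases j <;> simp [Fin.sum_univ_four, co, dir, ex, ey]
    · simp [Fin.sum_univ_four, co, dir, ex, ey]
  conv_lhs => rw [e, map_sum]
  simp [pd]

theorem avg_sub {v : Pt → ℝ} (hv : ContDiff ℝ 2 v) (p : Pt) {R : ℝ} (hR : 0 ≤ R) :
    avg wgt v p R - (∫ ζ, wgt ζ) * v p = ∫ r in 0..R, r * avg pot (lap v) p r := by
  have hd : Differentiable ℝ v := hv.differentiable two_ne_zero
  have hcf : Continuous (fderiv ℝ v) := hv.continuous_fderiv two_ne_zero
  have hp : ∀ i, ContDiff ℝ 1 (pd v i) := fun i => contDiff_pd hv (by norm_num) i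
  set G : Pt × ℝ → ℝ := fun q => wgt q.1 * fderiv ℝ v (p + q.2 • q.1) q.1
  have hG : Continuous G := by
    have := ker_wgt.cont
    fun_prop
  have hGi := integrable_prod_Ioc hG (fun ζ r h => by simp [G, ker_wgt.supp ζ h]) R
  have e1 : ∀ ζ, wgt ζ * v (p + R • ζ) - wgt ζ * v p = ∫ r in Set.Ioc 0 R, G (ζ, r) := fun ζ => by
    have h := intervalIntegral.integral_eq_sub_of_hasDerivAt (a := 0) (b := R)
      (fun r _ => hasDerivAt_ray hd p ζ r) (Continuous.intervalIntegrable (by fun_prop) _ _)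
    rw [intervalIntegral.integral_of_le hR] at h
    simp only [zero_smul, add_zero] at h
    change _ = ∫ r in Set.Ioc 0 R, wgt ζ * fderiv ℝ v (p + r • ζ) ζ
    rw [integral_const_mul, h]
    ring
  have e2 : ∀ r, ∫ ζ, G (ζ, r) = r * avg pot (lap v) p r := fun r => by
    have h1 : ∀ ζ, G (ζ, r) = ∑ i, -(pd pot i ζ * pd v i (p + r • ζ)) := fun ζ => by
      simp only [G, fderiv_eq_sum, Finset.mul_sum, pd_pot]
      exact Finset.sum_congr rfl fun i _ => by ring
    have h2 : avg pot (lap v) p r = ∑ i, avg pot (pd (pd v i) i) p r := by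
      unfold avg lap
      rw [← integral_finsetSum _ fun i _ => ker_pot.integrable_avg (continuous_pd (hp i) i) p r]
      simp only [Finset.mul_sum]
    have h3 : ∀ i, Integrable fun ζ => -(pd pot i ζ * pd v i (p + r • ζ)) := fun i =>
      ((ker_pot.pd contDiff_pot i).integrable_avg (hp i).continuous p r).neg
    rw [integral_congr_ae (ae_of_all _ h1), integral_finsetSum _ fun i _ =>
      h3 i, h2, Finset.mul_sum]
    refine Finset.sum_congr rfl fun i _ => ?_
    rw [integral_neg, avg_pd ker_pot (contDiff_pot (n := 1)) (hp i)]
    rfl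
  unfold avg at e2 ⊢
  rw [← integral_mul_const, ← integral_sub (ker_wgt.integrable_avg hd.continuous p R)
    (ker_wgt.integrable.mul_const _), integral_congr_ae (ae_of_all _ e1),
        integral_integral_swap hGi,
    intervalIntegral.integral_of_le hR]
  simp only [e2]

lemma abs_avg_le {k g : Pt → ℝ} (hk : Ker k) {b : ℝ} (hb : ∀ p, |g p| ≤ b) (p : Pt) (r : ℝ) :
    |avg k g p r| ≤ (∫ ζ, |k ζ|) * b := by
  rw [← integral_mul_const, ← Real.norm_eq_abs]
  unfold avg
  refine norm_integral_le_of_norm_le (hk.integrable.norm.mul_const b) (ae_of_all _ fun ζ => ?_)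
  rw [norm_mul]
  exact mul_le_mul_of_nonneg_left (hb _) (norm_nonneg _)

theorem exists_abs_pd_le : ∃ C : ℝ, 0 ≤ C ∧ ∀ (v : Pt → ℝ) (a b : ℝ), ContDiff ℝ 3 v →
    (∀ p, |v p| ≤ a) →
    (∀ p, |lap v p| ≤ b) → ∀ i p, |pd v i p| ≤ C * (a + b) := by
  have hc := integral_wgt_pos
  set c := ∫ ζ, wgt ζ
  set s : Fin 4 → ℝ := fun i => (∫ ζ, |pd wgt i ζ|) + ∫ ζ, |pd pot i ζ|
  have hs : ∀ i, 0 ≤ s i := fun i => by positivity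
  refine ⟨(∑ i, s i) / c, div_nonneg (Finset.sum_nonneg fun i _ => hs i) hc.le,
    fun v a b hv ha hb i p => ?_⟩
  have ha0 : 0 ≤ a := (abs_nonneg _).trans (ha 0)
  have hb0 : 0 ≤ b := (abs_nonneg _).trans (hb 0)
  have h2 : ContDiff ℝ 2 (pd v i) := contDiff_pd hv (by norm_num) i
  have hl : ContDiff ℝ 1 (lap v) := ContDiff.sum fun j _ =>
    contDiff_pd (contDiff_pd hv (m := 2) (by norm_num) j) (by norm_num) j
  have h := avg_sub h2 p zero_le_one
  rw [lap_pd hv] at h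
  simp only [avg_pd ker_pot (contDiff_pot (n := 1)) hl] at h
  have h1 := avg_pd ker_wgt contDiff_wgt (hv.of_le (by norm_num) : ContDiff ℝ 1 v) i p 1
  rw [one_mul] at h1
  rw [h1] at h
  have b1 := abs_avg_le (ker_wgt.pd contDiff_wgt i) ha p 1
  have b2 : |∫ r in (0 : ℝ)..1, -avg (pd pot i) (lap v) p r| ≤ (∫ ζ, |pd pot i ζ|) * b := by
    rw [← Real.norm_eq_abs]
    refine (intervalIntegral.norm_integral_le_of_norm_le_const fun r _ => ?_).trans_eq
      (by rw [sub_zero, abs_one, mul_one])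
    rw [norm_neg]
    exact abs_avg_le (ker_pot.pd contDiff_pot i) hb p r
  have e : pd v i p * c = -avg (pd wgt i) v p 1 - ∫ r in (0 : ℝ)..1,
      -avg (pd pot i) (lap v) p r := by
    rw [← h]
    ring
  rw [div_mul_eq_mul_div, le_div_iff₀ hc, ← abs_of_pos hc, ← abs_mul, e]
  refine (abs_sub _ _).trans ?_
  rw [abs_neg]
  have h3 : s i * (a + b) ≤ (∑ i, s i) * (a + b) := by
    gcongr
    exact Finset.single_le_sum (fun j _ => hs j) (Finset.mem_univ i)
  refine (add_le_add b1 b2).trans (le_trans ?_ h3)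
  have h4 : 0 ≤ ∫ ζ, |pd wgt i ζ| := by positivity
  have h5 : 0 ≤ ∫ ζ, |pd pot i ζ| := by positivity
  simp only [s]
  nlinarith [mul_nonneg h4 hb0, mul_nonneg h5 ha0]

lemma Mol.abs_cv_sub_le {k f : Pt → ℝ} (hk : Mol k) (hf : LocallyIntegrable f) {p : Pt} {c D : ℝ}
    (h : ∀ ζ, k ζ ≠ 0 → |f (p - ζ) - c| ≤ D) : |cv k f p - c| ≤ D := by
  have e : cv k f p - c = ∫ ζ, k ζ * (f (p - ζ) - c) := by
    simp only [mul_sub]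
    rw [integral_sub (integrable_cv_integrand' hk.toKer hf p) (hk.integrable.mul_const c),
      integral_mul_const, hk.int, one_mul]
    rfl
  have e2 : ∫ ζ, k ζ * D = D := by rw [integral_mul_const, hk.int, one_mul]
  rw [e, ← e2, ← Real.norm_eq_abs]
  refine norm_integral_le_of_norm_le (hk.integrable.mul_const D) (ae_of_all _ fun ζ => ?_)
  rw [norm_mul, Real.norm_of_nonneg (hk.nonneg ζ)]
  rcases eq_or_ne (k ζ) 0 with h0 | h0
  · simp [h0]
  · exact mul_le_mul_of_nonneg_left (h ζ h0) (hk.nonneg ζ)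

lemma abs_cv_rho_sub_le {f : Pt → ℝ} {L : NNReal} (hf : LipschitzWith L f) (n : ℕ) (p : Pt) :
    |cv (rho n) f p - f p| ≤ L * (n + 1 : ℝ)⁻¹ :=
  (mol_rho n).abs_cv_sub_le hf.continuous.locallyIntegrable fun ζ h0 => by
    refine (hf.norm_sub_le _ _).trans ?_
    rw [sub_sub_cancel_left, norm_neg]
    gcongr
    by_contra! h
    exact h0 (rho_eq_zero h.le)

lemma Mol.lipschitz_cv {k f : Pt → ℝ} (hk : Mol k) {L : NNReal} (hf : LipschitzWith L f) :
    LipschitzWith L (cv k f) := LipschitzWith.of_dist_le_mul fun p q => by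
  have hl := hf.continuous.locallyIntegrable (μ := volume)
  have h := hk.abs_cv_sub_le (f := fun z => f z - f (z + (q - p))) (p := p) (c := 0)
    (D := L * dist p q)
    (hf.continuous.sub (hf.continuous.comp (by fun_prop))).locallyIntegrable fun ζ _ => by
      rw [sub_zero]
      refine (hf.dist_le_mul _ _).trans_eq ?_
      rw [show p - ζ + (q - p) = q - ζ by abel, dist_sub_right]
  rw [Real.dist_eq]
  have e : cv k (fun z => f z - f (z + (q - p))) p = cv k f p - cv k f q := by
    unfold cv
    rw [← integral_sub (integrable_cv_integrand' hk.toKer hl p)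
      (integrable_cv_integrand' hk.toKer hl q)]
    congr 1
    ext ζ
    change k ζ * (f (p - ζ) - f (p - ζ + (q - p))) = _
    rw [show p - ζ + (q - p) = q - ζ by abel]
    ring
  rwa [e, sub_zero] at h

lemma abs_co_le (i : Fin 4) (ζ : Pt) : |co i ζ| ≤ ‖ζ‖ := by
  have h1 : ∀ j, |ζ.1 j| ≤ ‖ζ‖ := fun j => (norm_le_pi_norm ζ.1 j).trans (norm_fst_le ζ)
  fin_cases i
  · exact h1 0
  · exact h1 1
  · exact h1 2
  · exact norm_snd_le ζ

lemma abs_sum_co_le {a : Fin 4 → ℝ} {C : ℝ} (ha : ∀ i, |a i| ≤ C) (ζ : Pt) :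
    |∑ i, co i ζ * a i| ≤ 4 * C * ‖ζ‖ := by
  refine (Finset.abs_sum_le_sum_abs _ _).trans
    ((Finset.sum_le_card_nsmul _ _ (‖ζ‖ * C) fun i _ => ?_).trans_eq ?_)
  · rw [abs_mul]
    exact mul_le_mul (abs_co_le i ζ) (ha i) (abs_nonneg _) (norm_nonneg _)
  · simp
    ring

lemma lipschitz_of_pd_le {v : Pt → ℝ} (hv : Differentiable ℝ v) {C : ℝ}
    (h : ∀ i p, |pd v i p| ≤ C) :
    LipschitzWith (4 * C).toNNReal v := by
  have hC : 0 ≤ C := (abs_nonneg _).trans (h 0 0)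
  refine lipschitzWith_of_nnnorm_fderiv_le (𝕜 := ℝ) hv fun p => ?_
  rw [← NNReal.coe_le_coe, Real.coe_toNNReal _ (by positivity), coe_nnnorm]
  refine ContinuousLinearMap.opNorm_le_bound _ (by positivity) fun ζ => ?_
  rw [fderiv_eq_sum]
  exact abs_sum_co_le (fun i => h i p) ζ

lemma norm_dir_le (i : Fin 4) : ‖dir i‖ ≤ 1 := by
  have h : ∀ j, ‖ex j‖ ≤ 1 := fun j => by
    rw [Prod.norm_def]
    refine max_le ((pi_norm_le_iff_of_nonneg zero_le_one).2 fun k => ?_) (by simp [ex])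
    simp only [ex]
    split_ifs <;> simp
  fin_cases i
  · exact h 0
  · exact h 1
  · exact h 2
  · simp [dir, ey, Prod.norm_def]

lemma abs_pd_le_of_lipschitz {v : Pt → ℝ} {L : NNReal} (h : LipschitzWith L v) (i : Fin 4)
    (p : Pt) :
    |pd v i p| ≤ L := by
  refine ((fderiv ℝ v p).le_opNorm (dir i)).trans ?_
  exact (mul_le_mul (norm_fderiv_le_of_lipschitz ℝ h) (norm_dir_le i) (norm_nonneg _) L.2).trans_eq
    (mul_one _)

lemma exists_lipschitz_rep {f : Pt → ℝ} (hf : L2P f) {L : NNReal}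
    (h : ∀ n, LipschitzWith L (cv (rho n) f)) :
    ∃ g, LipschitzWith L g ∧ L2P g ∧ f =ᵐ[volume] g := by
  have hae := ae_tendsto_cv_rho hf.locallyIntegrable
  have hon : LipschitzOnWith L f {p | Tendsto (fun n => cv (rho n) f p) atTop (nhds (f p))} :=
    LipschitzOnWith.of_dist_le_mul fun p hp q hq =>
      le_of_tendsto' (hp.dist hq) fun n => (h n).dist_le_mul p q
  obtain ⟨g, hg, he⟩ := hon.extend_real
  have hfg : f =ᵐ[volume] g := by
    filter_upwards [hae] with p hp
    exact he hp
  refine ⟨g, hg, ⟨fun x y => ?_, hg.continuous.measurable, hf.memLp.ae_eq (ae_restrict_of_ae hfg)⟩,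
      hfg⟩
  have h1 := (measurePreserving_add_right volume
    ((0, 2 * π) : Pt)).quasiMeasurePreserving.ae_eq_comp hfg
  have h2 : (fun p => g (p + (0, 2 * π))) =ᵐ[volume] g := by
    filter_upwards [h1, hfg] with p e1 e2
    rw [← e2]
    refine e1.symm.trans ?_
    have := hf.per p.1 p.2
    simpa [Prod.add_def] using this
  have h3 := (Continuous.ae_eq_iff_eq volume (hg.continuous.comp (by fun_prop)) hg.continuous).1 h2
  have h4 := congrFun h3 (x, y)
  simpa using h4

namespace Lim

variable {m₀ A B N M : ℝ} {f : ℕ → Pt → ℝ} {u : Pt → ℝ} {U : Fin 4 → Pt → ℝ}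

lemma congr_grad (h : Lim m₀ f u U A B N M) {V : Fin 4 → Pt → ℝ} (hV : ∀ i, L2P (V i))
    (he : ∀ i, U i =ᵐ[mD] V i) : Lim m₀ f u V A B N M where
  seq := h.seq
  wp := WC.wp (F := fun i n => pd (f n) i) (fun n => (h.seq.ck n).wp) h.wp.fn hV h.wc fun i =>
    (h.wcD i).congr (he i)
  wc := h.wc
  wcD i := (h.wcD i).congr (he i)
  ae := h.ae
  nonneg := h.nonneg
  pos := h.pos

lemma abs_cv_le (h : Lim m₀ f u U A B N M) {K : ℝ} (hK : ∀ p, u p ≤ K) (n : ℕ) (p : Pt) :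
    |cv (rho n) u p| ≤ K := by
  have := (mol_rho n).abs_cv_sub_le h.wp.fn.locallyIntegrable (p := p) (c := 0)
      (D := K) fun ζ _ => by
    rw [sub_zero, abs_of_nonneg (h.nonneg _)]
    exact hK _
  rwa [sub_zero] at this

lemma contDiff_cv (h : Lim m₀ f u U A B N M) (n : ℕ) (k : ℕ) : ContDiff ℝ k (cv (rho n) u) :=
  Waveguide.contDiff_cv (n := k) (mol_rho n).toKer (contDiff_rho n) h.wp.fn.locallyIntegrable

lemma exists_lipschitz (h : Lim m₀ f u U A B N M) {K : ℝ} (hK : ∀ p, u p ≤ K) :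
    ∃ L g, LipschitzWith L g ∧ (∀ p, g p ≤ K) ∧ Lim m₀ f g U A B N M := by
  obtain ⟨C, hC, hb⟩ := exists_abs_pd_le
  set c := mult B N M
  have hK0 : 0 ≤ K := (h.nonneg 0).trans (hK 0)
  have hlip : ∀ n, LipschitzWith (4 * (C * (K + (|c| * K + K ^ 3)))).toNNReal (cv (rho n) u) :=
      fun n => by
    refine lipschitz_of_pd_le ((h.contDiff_cv n 1).differentiable one_ne_zero) fun i p =>
      hb _ _ _ (h.contDiff_cv n 3) (h.abs_cv_le hK n) (fun q => ?_) i p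
    rw [h.lap_cv hK]
    have := (mol_rho n).abs_cv_sub_le (h.l2p_rhs hK c).locallyIntegrable (p := q) (c := 0)
      (D := |c| * K + K ^ 3) fun ζ _ => by
        rw [sub_zero]
        refine (abs_sub _ _).trans ?_
        have h0 := h.nonneg (q - ζ)
        rw [abs_mul, abs_of_nonneg h0, abs_of_nonneg (pow_nonneg h0 3)]
        have := hK (q - ζ)
        gcongr
    rwa [sub_zero] at this
  obtain ⟨g, hg, hgL, he⟩ := exists_lipschitz_rep h.wp.fn hlip
  have hcl : ∀ p, g p ∈ Set.Icc 0 K := by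
    have hd : Dense {p | u p = g p} := Measure.dense_of_ae he
    intro p
    have := hd.closure_eq ▸ Set.mem_univ p
    exact (isClosed_Icc.preimage hg.continuous).closure_subset_iff.2
      (fun q (hq : u q = g q) => ⟨hq ▸ h.nonneg q, hq ▸ hK q⟩) this
  exact ⟨_, g, hg, fun p => (hcl p).2, h.congr hgL (fun p => (hcl p).1) (ae_restrict_of_ae he)⟩

lemma lipschitz_rhs {L : NNReal} (hu : LipschitzWith L u) {K : ℝ} (h0 : ∀ p, 0 ≤ u p)
    (hK : ∀ p, u p ≤ K)
    (c : ℝ) : LipschitzWith ((|c| + 3 * K ^ 2).toNNReal * L) (rhs c u) :=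
  LipschitzWith.of_dist_le_mul fun p q => by
    rw [NNReal.coe_mul, Real.coe_toNNReal _ (by positivity), Real.dist_eq]
    have h1 := hu.dist_le_mul p q
    rw [Real.dist_eq] at h1
    have e : rhs c u p - rhs c u q = (c - (u p ^ 2 + u p * u q + u q ^ 2)) * (u p - u q) := by
      unfold rhs
      ring
    rw [e, abs_mul, mul_assoc]
    refine mul_le_mul ((abs_sub _ _).trans (add_le_add_right ?_ _)) h1 (abs_nonneg _)
      (by positivity)
    have a0 := h0 p
    have b0 := h0 q
    have a1 := hK p
    have b1 := hK q
    rw [abs_of_nonneg (by positivity)]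
    nlinarith

theorem exists_differentiable (h : Lim m₀ f u U A B N M) {K : ℝ} (hK : ∀ p, u p ≤ K) {L : NNReal}
    (hL : LipschitzWith L u) : ContDiff ℝ 1 u ∧ Lim m₀ f u (pd u) A B N M := by
  obtain ⟨C, hC, hb⟩ := exists_abs_pd_le
  set c := mult B N M
  have hr := lipschitz_rhs hL h.nonneg hK c
  set R := (|c| + 3 * K ^ 2).toNNReal * L
  have pe : ∀ n i, pd (cv (rho n) u) i = cv (rho n) (U i) := fun n i => funext fun p =>
    h.wp.pd_cv (mol_rho n).toKer (contDiff_rho n) i p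
  have hlip : ∀ i n, LipschitzWith (4 * (C * (L + R))).toNNReal (cv (rho n) (U i)) := fun i n => by
    rw [← pe]
    have hs : ContDiff ℝ 3 (pd (cv (rho n) u) i) := contDiff_pd (h.contDiff_cv n 4) (by norm_num) i
    refine lipschitz_of_pd_le (hs.differentiable three_ne_zero) fun j p => hb _ _ _ hs
      (abs_pd_le_of_lipschitz ((mol_rho n).lipschitz_cv hL) i) (fun q => ?_) j p
    rw [lap_pd (h.contDiff_cv n 3), h.lap_cv hK]
    exact abs_pd_le_of_lipschitz ((mol_rho n).lipschitz_cv hr) i q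
  choose g hg hgL he using fun i => exists_lipschitz_rep (h.wp.grad i) (hlip i)
  have hcg : ∀ n i, pd (cv (rho n) u) i = cv (rho n) (g i) := fun n i => by
    rw [pe]
    funext p
    rw [cv_eq_swap, cv_eq_swap]
    refine integral_congr_ae ?_
    filter_upwards [he i] with q hq
    rw [hq]
  have hco : ∀ i p ζ, fderiv ℝ (co i) p ζ = co i ζ := fun i p ζ => by
    rw [fderiv_eq_sum]
    simp [pd, fderiv_co]
  have hunif : TendstoUniformly (fun n p => fderiv ℝ (cv (rho n) u) p)
      (fun p => ∑ i, g i p • fderiv ℝ (co i) 0) atTop := by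
    refine Metric.tendstoUniformly_iff.2 fun ε hε => ?_
    have hlim : Tendsto (fun n : ℕ => 4 * ((4 * (C * (L + R))).toNNReal * (n + 1 : ℝ)⁻¹)) atTop
        (nhds 0) := by
      have := (tendsto_one_div_add_atTop_nhds_zero_nat (𝕜 := ℝ)).const_mul
        (4 * ((4 * (C * (L + R))).toNNReal : ℝ))
      simpa [mul_assoc] using this
    filter_upwards [(tendsto_order.1 hlim).2 ε hε] with n hn p
    refine lt_of_le_of_lt ?_ hn
    rw [dist_comm, dist_eq_norm]
    refine ContinuousLinearMap.opNorm_le_bound _ (by positivity) fun ζ => ?_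
    have e : (fderiv ℝ (cv (rho n) u) p - ∑ i, g i p • fderiv ℝ (co i) 0) ζ
        = ∑ i, co i ζ * (cv (rho n) (g i) p - g i p) := by
      rw [_root_.sub_apply, fderiv_eq_sum, _root_.sum_apply,
        ← Finset.sum_sub_distrib]
      refine Finset.sum_congr rfl fun i _ => ?_
      rw [hcg, _root_.smul_apply, hco, smul_eq_mul]
      ring
    rw [e]
    exact abs_sum_co_le (fun i => abs_cv_rho_sub_le (hg i) n p) ζ
  have hder := fun p => hasFDerivAt_of_tendstoUniformly hunif
    (fun n p => ((h.contDiff_cv n 1).differentiable one_ne_zero p).hasFDerivAt)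
    (fun p => tendsto_iff_norm_sub_tendsto_zero.2 (squeeze_zero (fun n => norm_nonneg _)
      (fun n => abs_cv_rho_sub_le hL n p) (by
        have := (tendsto_one_div_add_atTop_nhds_zero_nat (𝕜 := ℝ)).const_mul (L : ℝ)
        simpa using this))) p
  have hpd : pd u = g := by
    funext i p
    unfold pd
    rw [(hder p).fderiv, _root_.sum_apply]
    simp [fderiv_co]
  refine ⟨contDiff_one_iff_fderiv.2 ⟨fun p => (hder p).differentiableAt, ?_⟩,
      hpd ▸ h.congr_grad hgL fun i => ae_restrict_of_ae (he i)⟩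
  rw [funext fun p => (hder p).fderiv]
  exact continuous_finsetSum _ fun i _ => (hg i).continuous.smul continuous_const

end Lim

lemma Mol.cv_mono {k f g : Pt → ℝ} (hk : Mol k) (hf : LocallyIntegrable f)
    (hg : LocallyIntegrable g)
    (h : ∀ p, f p ≤ g p) (p : Pt) : cv k f p ≤ cv k g p :=
  integral_mono (integrable_cv_integrand' hk.toKer hf p) (integrable_cv_integrand' hk.toKer hg p)
    fun ζ => mul_le_mul_of_nonneg_left (h _) (hk.nonneg ζ)

lemma avg_const (k : Pt → ℝ) (c : ℝ) (p : Pt) (r : ℝ) : avg k (fun _ => c) p r = (∫ ζ, k ζ) * c :=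
  integral_mul_const c k

lemma Ker.avg_le {k g g' : Pt → ℝ} (hk : Ker k) (h0 : ∀ ζ, 0 ≤ k ζ) (hg : Continuous g)
    (hg' : Continuous g')
    {D : ℝ} (h : ∀ p, g p ≤ g' p + D) (p : Pt) (r : ℝ) : avg k g p r ≤
        avg k g' p r + (∫ ζ, k ζ) * D := by
  rw [← avg_const k D p r]
  unfold avg
  rw [← integral_add (hk.integrable_avg hg' p r) (hk.integrable.mul_const D)]
  refine integral_mono (hk.integrable_avg hg p r)
    ((hk.integrable_avg hg' p r).add (hk.integrable.mul_const D)) fun ζ => ?_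
  exact (mul_le_mul_of_nonneg_left (h _) (h0 ζ)).trans_eq (mul_add _ _ _)

namespace Lim

variable {m₀ A B N M : ℝ} {f : ℕ → Pt → ℝ} {u : Pt → ℝ} {U : Fin 4 → Pt → ℝ}

lemma lap_cv_le (h : Lim m₀ f u U A B N M) {K : ℝ} (hK : ∀ p, u p ≤ K) (n : ℕ) (p : Pt) :
    lap (cv (rho n) u) p ≤ |mult B N M| * cv (rho n) u p := by
  rw [h.lap_cv hK]
  refine ((mol_rho n).cv_mono (h.l2p_rhs hK _).locallyIntegrable
    (h.wp.fn.const_mul |mult B N M|).locallyIntegrable (fun q => ?_) p).trans_eq ?_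
  · have h0 := h.nonneg q
    have := mul_le_mul_of_nonneg_right (le_abs_self (mult B N M)) h0
    have := pow_nonneg h0 3
    unfold rhs
    linarith
  · unfold cv
    rw [← integral_const_mul]
    congr 1
    ext ζ
    ring

lemma avg_wgt_le (h : Lim m₀ f u U A B N M) {K : ℝ} (hK : ∀ p, u p ≤ K) {L : NNReal}
    (hL : LipschitzWith L u)
    (p : Pt) {R S : ℝ} (hR : 0 ≤ R) (hS : ∀ r ∈ Set.Icc 0 R, avg wgt u p r ≤ S) :
    avg wgt u p R ≤ (∫ ζ, wgt ζ) * u p + |mult B N M| / 2 * R ^ 2 * S := by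
  set c := ∫ ζ, wgt ζ
  set l := |mult B N M|
  have hl : 0 ≤ l := abs_nonneg _
  have hcv : ∀ n, Continuous (cv (rho n) u) := fun n => (h.contDiff_cv n 1).continuous
  have hv0 : ∀ n q, 0 ≤ cv (rho n) u q := fun n q =>
    integral_nonneg fun ζ => mul_nonneg ((mol_rho n).nonneg ζ) (h.nonneg _)
  have hd := fun n q => abs_le.1 (abs_cv_rho_sub_le hL n q)
  have key : ∀ n : ℕ, avg wgt u p R ≤ c * u p + l / 2 * R ^ 2 * S
      + (2 * c + l / 2 * R ^ 2 * c) * (L * (n + 1 : ℝ)⁻¹) := fun n => by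
    set D := L * (n + 1 : ℝ)⁻¹
    have h1 := ker_wgt.avg_le wgt_nonneg hL.continuous (hcv n) (D := D)
      (fun q => by linarith [(hd n q).1]) p R
    have h2 : ∀ r ∈ Set.Icc 0 R, avg wgt (cv (rho n) u) p r ≤ S + c * D := fun r hr =>
      (ker_wgt.avg_le wgt_nonneg (hcv n) hL.continuous (D := D)
        (fun q => by linarith [(hd n q).2]) p r).trans
        (add_le_add_left (hS r hr) _)
    have h3 := avg_sub (h.contDiff_cv n 2) p hR
    have hlc : Continuous (lap (cv (rho n) u)) := by
      rw [h.lap_cv hK]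
      exact continuous_cv (mol_rho n).toKer (h.l2p_rhs hK _).locallyIntegrable
    have h4 : ∫ r in 0..R, r * avg pot (lap (cv (rho n) u)) p r ≤
        ∫ _ in 0..R, R * (l / 2 * (S + c * D)) := by
      refine intervalIntegral.integral_mono_on hR
        ((continuous_id.mul (continuous_avg ker_pot hlc p)).intervalIntegrable _ _)
        intervalIntegrable_const fun r hr => ?_
      have h5 : avg pot (lap (cv (rho n) u)) p r ≤ l / 2 * avg wgt (cv (rho n) u) p r := by
        unfold avg
        rw [← integral_const_mul]
        refine integral_mono (ker_pot.integrable_avg hlc p r)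
          ((ker_wgt.integrable_avg (hcv n) p r).const_mul _) fun ζ => ?_
        refine (mul_le_mul_of_nonneg_left (h.lap_cv_le hK n _) (pot_nonneg ζ)).trans ?_
        have := mul_le_mul_of_nonneg_right (pot_le_wgt ζ) (mul_nonneg hl (hv0 n (p + r • ζ)))
        change _ ≤ l / 2 * (wgt ζ * cv (rho n) u (p + r • ζ))
        linarith
      have h6 : 0 ≤ avg wgt (cv (rho n) u) p r :=
        integral_nonneg fun ζ => mul_nonneg (wgt_nonneg ζ) (hv0 n _)
      have h7 := h2 r hr
      refine (mul_le_mul_of_nonneg_left (h5.trans (mul_le_mul_of_nonneg_left h7 (by positivity)))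
        hr.1).trans ?_
      exact mul_le_mul_of_nonneg_right hr.2 (mul_nonneg (by positivity) (h6.trans h7))
    rw [intervalIntegral.integral_const, smul_eq_mul, sub_zero] at h4
    have h8 : c * cv (rho n) u p ≤ c * (u p + D) :=
      mul_le_mul_of_nonneg_left (by linarith [(hd n p).2]) integral_wgt_pos.le
    linarith
  refine ge_of_tendsto' (x := atTop) ?_ key
  have := (tendsto_one_div_add_atTop_nhds_zero_nat (𝕜 := ℝ)).const_mul
    ((2 * c + l / 2 * R ^ 2 * c) * L) |>.const_add (c * u p + l / 2 * R ^ 2 * S)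
  simpa [mul_assoc] using this

lemma eventually_eq_zero (h : Lim m₀ f u U A B N M) {K : ℝ} (hK : ∀ p, u p ≤ K) {L : NNReal}
    (hL : LipschitzWith L u) {p : Pt} (hp : u p = 0) : ∀ᶠ q in nhds p, u q = 0 := by
  set l := |mult B N M|
  have hl : 0 ≤ l := abs_nonneg _
  set R := (l + 1)⁻¹
  have hR : 0 < R := by positivity
  have hlR : l * R ^ 2 ≤ 1 := by
    have h1 : R ≤ 1 := inv_le_one_of_one_le₀ (by linarith)
    have h2 : (l + 1) * R = 1 := mul_inv_cancel₀ (by positivity)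
    nlinarith
  obtain ⟨r₀, hr₀, hmax⟩ := isCompact_Icc.exists_isMaxOn (Set.nonempty_Icc.2 hR.le)
    (continuous_avg ker_wgt hL.continuous p).continuousOn
  have hnn : ∀ r, 0 ≤ avg wgt u p r := fun r =>
    integral_nonneg fun ζ => mul_nonneg (wgt_nonneg ζ) (h.nonneg _)
  have h1 := h.avg_wgt_le hK hL p hr₀.1 fun r hr => hmax ⟨hr.1, hr.2.trans hr₀.2⟩
  rw [hp, mul_zero, zero_add] at h1
  have h2 : avg wgt u p R = 0 := by
    have h3 : l / 2 * r₀ ^ 2 ≤ 1 / 2 := by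
      have : r₀ ^ 2 ≤ R ^ 2 := pow_le_pow_left₀ hr₀.1 hr₀.2 2
      nlinarith
    have h4 := mul_le_mul_of_nonneg_right h3 (hnn r₀)
    have h5 : avg wgt u p R ≤ avg wgt u p r₀ := hmax (Set.right_mem_Icc.2 hR.le)
    exact le_antisymm (by linarith) (hnn R)
  have h3 := (integral_eq_zero_iff_of_nonneg (fun ζ => mul_nonneg (wgt_nonneg ζ) (h.nonneg _))
    (ker_wgt.integrable_avg hL.continuous p R)).1 h2
  have h4 := (Continuous.ae_eq_iff_eq volume
    (ker_wgt.cont.mul (hL.continuous.comp (by fun_prop))) continuous_const).1 h3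
  have h5 : ∀ᶠ q in nhds p, nsq (R⁻¹ • (q - p)) < 1 := by
    have hc : Continuous fun q => nsq (R⁻¹ • (q - p)) :=
      (contDiff_nsq (n := 0)).continuous.comp (by fun_prop)
    exact (isOpen_lt hc continuous_const).mem_nhds (by simp [nsq])
  filter_upwards [h5] with q hq
  have h6 : wgt (R⁻¹ • (q - p)) * u (p + R • R⁻¹ • (q - p)) = 0 := congrFun h4 (R⁻¹ • (q - p))
  rw [smul_inv_smul₀ hR.ne', add_sub_cancel] at h6
  exact (mul_eq_zero.1 h6).resolve_left (wgt_pos hq).ne'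

theorem pos_of_lipschitz (h : Lim m₀ f u U A B N M) {K : ℝ} (hK : ∀ p, u p ≤ K) {L : NNReal}
    (hL : LipschitzWith L u) (p : Pt) : 0 < u p := by
  refine lt_of_le_of_ne (h.nonneg p) fun h0 => ?_
  have hcl : IsClopen {q | u q = 0} := ⟨isClosed_eq hL.continuous continuous_const,
    isOpen_iff_mem_nhds.2 fun q hq => h.eventually_eq_zero hK hL hq⟩
  have hu := hcl.eq_univ ⟨p, h0.symm⟩
  have hz : ∀ q, u q = 0 := fun q => (hu.symm ▸ Set.mem_univ q : q ∈ {q | u q = 0})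
  have := h.pos
  simp [MF, hz] at this

end Lim

lemma exists_bound_lap_xcut : ∃ C, 0 ≤ C ∧ ∀ n p, |lap (xcut n) p| ≤ C * bub (p.1, 0) ∧
    |lap (xcut n) p| ≤ C * ((n + 1 : ℝ)⁻¹) ^ 2 := by
  set Φ : Pt → ℝ := fun q => bumpX q.1
  have hper : PeriodicY Φ := fun _ _ => rfl
  have hc : Continuous (lap Φ) := continuous_finsetSum _ fun i _ =>
    continuous_pd (contDiff_pd (contDiff_bumpX (n := 2)) (by norm_num) i) i
  obtain ⟨C, hC, hb⟩ := bounded_of_xCompact (f := fun p => (1 + nsq (p.1, 0)) * lap Φ p)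
    ((continuous_const.add ((contDiff_nsq (n := 0)).continuous.comp (by fun_prop))).mul hc)
    (fun x y => congrArg _ (Finset.sum_congr rfl fun i _ => (hper.pd i).pd i x y))
    (by
      choose K hK h0 using fun i : Fin 4 =>
        (xCompact_bumpX.fderiv_apply (dir i)).fderiv_apply (dir i)
      refine ⟨⋃ i, K i, isCompact_iUnion hK, fun p hp => mul_eq_zero_of_right _ ?_⟩
      exact Finset.sum_eq_zero fun i _ => h0 i p fun h' => hp (Set.mem_iUnion_of_mem i h'))
  refine ⟨C, hC, fun n p => ?_⟩
  set a := (n + 1 : ℝ)⁻¹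
  have ha : 0 < a := by positivity
  have ha1 : a ≤ 1 := inv_le_one_of_one_le₀ (by linarith [n.cast_nonneg (α := ℝ)])
  have e : lap (xcut n) p = a ^ 2 * lap Φ (scal a 1 p) := by
    unfold lap
    rw [Finset.mul_sum]
    exact Finset.sum_congr rfl fun i _ => pd_pd_xcut n i p
  have h1 := hb (scal a 1 p)
  have e2 : nsq ((scal a 1 p).1, 0) = a ^ 2 * nsq (p.1, 0) := by
    simp [scal, nsq]
    ring
  have hn : 0 ≤ nsq (p.1, 0) := by unfold nsq; positivity
  rw [e2, abs_mul, abs_of_pos (by positivity)] at h1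
  rw [e, abs_mul, abs_of_pos (by positivity)]
  have h2 := abs_nonneg (lap Φ (scal a 1 p))
  have ha2 : a ^ 2 ≤ 1 := pow_le_one₀ ha.le ha1
  constructor
  · unfold bub
    rw [mul_one_div, le_div_iff₀ (by positivity)]
    nlinarith [mul_nonneg (sub_nonneg.2 ha2) h2]
  · nlinarith [mul_nonneg (mul_nonneg (sq_nonneg a) hn) h2, sq_nonneg a]

lemma memLp_bub_fst : MemLp (fun p : Pt => bub (p.1, 0)) 2 mD :=
  memLp_two_of_sq (by
    have := continuous_bub
    fun_prop) integrable_hx_fst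

namespace Lim

variable {m₀ A B N M : ℝ} {f : ℕ → Pt → ℝ} {u : Pt → ℝ} {U : Fin 4 → Pt → ℝ}

lemma integral_cube_xcut (h : Lim m₀ f u (pd u) A B N M) (hu : ContDiff ℝ 1 u) (n : ℕ) :
    ∫ p in Dom, u p ^ 3 * xcut n p
      = mult B N M * (∫ p in Dom, u p * xcut n p) - ∫ p in Dom, u p * lap (xcut n) p := by
  have ck : CK u := ⟨hu, h.wp.fn.per, h.wp.fn.memLp, fun i => (h.wp.grad i).memLp⟩
  have hx := ck_of_xCompact (contDiff_xcut n) (xcut_periodic n) (xcut_xCompact n)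
  have hd : ∀ i, CK (pd (xcut n) i) := fun i => ck_of_xCompact
    (contDiff_pd (contDiff_xcut n (n := 2)) (by norm_num) i) ((xcut_periodic n).pd i)
    ((xcut_xCompact n).fderiv_apply _)
  have hI : ∀ i, Integrable (fun p => u p * pd (pd (xcut n) i) i p) mD := fun i =>
    memLp_two_mul ck.memLp ((hd i).memLpD i)
  have e : ∫ p in Dom, u p * lap (xcut n) p = ∑ i, ∫ p in Dom, u p * pd (pd (xcut n) i) i p := by
    rw [← integral_finsetSum _ fun i _ => hI i]
    congr 1
    ext p
    exact Finset.mul_sum _ _ _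
  rw [← h.euler_lagrange hx.wp, e, Finset.sum_congr rfl fun i _ =>
    ck.ibp (hd i) i, Fin.sum_univ_four]
  unfold AF₂
  ring

theorem mult_pos (h : Lim m₀ f u (pd u) A B N M) (hu : ContDiff ℝ 1 u) {K : ℝ} (hK : ∀ p, u p ≤ K) :
    0 < mult B N M := by
  by_contra! hl
  obtain ⟨C, hC, hb⟩ := exists_bound_lap_xcut
  have hmeas := h.wp.fn.meas
  have hbd : ∀ p, ‖u p ^ 3‖ ≤ K * u p ^ 2 := fun p => by
    rw [Real.norm_of_nonneg (pow_nonneg (h.nonneg p) 3), pow_succ']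
    exact mul_le_mul_of_nonneg_right (hK p) (sq_nonneg _)
  have hi3 : Integrable (fun p => u p ^ 3) mD := (h.wp.fn.sq_integrable.const_mul K).mono'
    (hmeas.pow_const 3).aestronglyMeasurable (ae_of_all _ hbd)
  have hxm : ∀ n, Measurable (xcut n) := fun n => (contDiff_xcut n (n := 0)).continuous.measurable
  have t1 : Tendsto (fun n => ∫ p in Dom, u p ^ 3 * xcut n p) atTop
      (nhds (∫ p in Dom, u p ^ 3)) := by
    refine tendsto_integral_of_dominated_convergence (fun p => u p ^ 3)
      (fun n => ((hmeas.pow_const 3).mul (hxm n)).aestronglyMeasurable) hi3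
      (fun n => ae_of_all _ fun p => ?_) (ae_of_all _ fun p => ?_)
    · have := pow_nonneg (h.nonneg p) 3
      rw [Real.norm_of_nonneg (mul_nonneg this (xcut_nonneg n p))]
      exact mul_le_of_le_one_right this (xcut_le_one n p)
    · simpa using (xcut_tendsto p).const_mul (u p ^ 3)
  have t2 : Tendsto (fun n => ∫ p in Dom, u p * lap (xcut n) p) atTop (nhds 0) := by
    have := tendsto_integral_of_dominated_convergence (μ := mD)
      (F := fun n p => u p * lap (xcut n) p)
      (f := fun _ => 0) (fun p => C * (u p * bub (p.1, 0)))
      (fun n => (hmeas.mul (Finset.measurable_fun_sum _ fun i _ =>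
        measurable_pd _ i)).aestronglyMeasurable)
      ((memLp_two_mul h.wp.fn.memLp memLp_bub_fst).const_mul C)
      (fun n => ae_of_all _ fun p => ?_) (ae_of_all _ fun p => ?_)
    · simpa using this
    · rw [norm_mul, Real.norm_of_nonneg (h.nonneg p), mul_left_comm]
      exact mul_le_mul_of_nonneg_left (hb n p).1 (h.nonneg p)
    · have t : Tendsto (fun n : ℕ => C * ((n + 1 : ℝ)⁻¹) ^ 2) atTop (nhds 0) := by
        simpa using ((tendsto_one_div_add_atTop_nhds_zero_nat (𝕜 := ℝ)).pow 2).const_mul C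
      have t' := squeeze_zero_norm (f := fun n => lap (xcut n) p) (fun n => (hb n p).2) t
      simpa using t'.const_mul (u p)
  have h0 : ∫ p in Dom, u p ^ 3 ≤ 0 := by
    refine le_of_tendsto_of_tendsto' t1 (by simpa using t2.neg) fun n => ?_
    rw [h.integral_cube_xcut hu]
    have : 0 ≤ ∫ p in Dom, u p * xcut n p := integral_nonneg fun p =>
      mul_nonneg (h.nonneg p) (xcut_nonneg n p)
    linarith [mul_nonpos_of_nonpos_of_nonneg hl this]
  have h3 : ∀ p, 0 ≤ u p ^ 3 := fun p => pow_nonneg (h.nonneg p) 3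
  have hz := (integral_eq_zero_iff_of_nonneg h3 hi3).1 (le_antisymm h0 (integral_nonneg h3))
  have hM : MF u = 0 := by
    refine integral_eq_zero_of_ae ?_
    filter_upwards [hz] with p hp
    have : u p = 0 := pow_eq_zero_iff three_ne_zero |>.1 hp
    simp [this]
  exact h.pos.ne' hM

end Lim

lemma H1.integral_gradSqX {u : Pt → ℝ} (h : H1 u) :
    Integrable (gradSqX u) mD ∧ ∫ p in Dom, gradSqX u p = AF (pd u) := by
  have hi := fun i => (h.memLpD i).integrable_sq
  have h01 : Integrable (fun p => pd u 0 p ^ 2 + pd u 1 p ^ 2) mD := (hi 0).add (hi 1)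
  simp only [funext fun p => gradSqX_eq u p]
  refine ⟨h01.add (hi 2), ?_⟩
  rw [integral_add h01 (hi 2), integral_add (hi 0) (hi 1)]
  rfl

lemma H1.integral_gradSq {u : Pt → ℝ} (h : H1 u) :
    ∫ p in Dom, gradSq u p = AF (pd u) + BF (pd u) := by
  rw [← h.integral_gradSqX.2]
  exact integral_add h.integral_gradSqX.1 (h.memLpD 3).integrable_sq

lemma nonlin_eq (u v : Pt → ℝ) (p : Pt) : nonlin u v p = (u p ^ 2 + v p ^ 2) ^ 2 := by
  unfold nonlin
  ring

lemma svirial_eq {u v : Pt → ℝ} (hu : H1 u) (hv : H1 v) : svirial u v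
    = AF (pd u) + AF (pd v) - 3 / 4 * ∫ p in Dom, (u p ^ 2 + v p ^ 2) ^ 2 := by
  unfold svirial
  rw [integral_add hu.integral_gradSqX.1 hv.integral_gradSqX.1, hu.integral_gradSqX.2,
    hv.integral_gradSqX.2]
  simp only [nonlin_eq]

lemma energy_eq {u v : Pt → ℝ} (hu : H1 u) (hv : H1 v) : energy u v
    = (AF (pd u) + BF (pd u) + (AF (pd v) + BF (pd v))) / 2
      - (∫ p in Dom, (u p ^ 2 + v p ^ 2) ^ 2) / 4 := by
  unfold energy
  rw [integral_add hu.memGrad hv.memGrad, hu.integral_gradSq, hv.integral_gradSq]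
  simp only [nonlin_eq]
  ring

/-- The scalar level bounds the energy of an admissible pair from below. -/
lemma lev_le_energy {u v : Pt → ℝ} {m₀ : ℝ} (hu : H1 u) (hv : H1 v) (hm : MF u + MF v ≤ m₀)
    (hM : 0 < MF u) (hQ : svirial u v = 0) : lev m₀ ≤ energy u v := by
  rw [svirial_eq hu hv] at hQ
  rw [energy_eq hu hv]
  have ht := tendsto_NF_rad hu hv
  have hNu : NF u ≤ ∫ p in Dom, (u p ^ 2 + v p ^ 2) ^ 2 := by
    refine integral_mono hu.memL4 ?_ fun p => ?_
    · have hcu := hu.diff.continuous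
      have hcv := hv.diff.continuous
      refine ((hu.memL4.const_mul 2).add (hv.memL4.const_mul 2)).mono'
        (Continuous.aestronglyMeasurable (by fun_prop)) (ae_of_all _ fun p => ?_)
      rw [Real.norm_of_nonneg (sq_nonneg _)]
      change _ ≤ 2 * u p ^ 4 + 2 * v p ^ 4
      nlinarith [sq_nonneg (u p ^ 2 - v p ^ 2)]
    · change u p ^ 4 ≤ _
      nlinarith [mul_nonneg (sq_nonneg (u p)) (sq_nonneg (v p)), sq_nonneg (v p ^ 2)]
  have hN := (NF_pos_of_MF_pos hu.memL4 hM).trans_le hNu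
  set N := ∫ p in Dom, (u p ^ 2 + v p ^ 2) ^ 2
  have hδ : ∀ n : ℕ, 0 < 1 / ((n : ℝ) + 1) := fun n => by positivity
  have hFG : ∀ (n : ℕ) i, ∫ p in Dom, pd (fun p => rad (1 / ((n : ℝ) + 1)) (u p ^ 2 + v p ^ 2)) i
    p ^ 2
      ≤ (∫ p in Dom, pd u i p ^ 2) + ∫ p in Dom, pd v i p ^ 2 := fun n i => by
    have i1 := (hu.memLpD i).integrable_sq
    have i2 := (hv.memLpD i).integrable_sq
    rw [← integral_add i1 i2]
    exact integral_mono ((hu.rad_wp (hδ n) hv).grad i).sq_integrable (i1.add i2) fun p =>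
      pd_rad_sq_le (hδ n) (hu.diff p) (hv.diff p) i
  have key := fun n : ℕ => by
    have hw := hu.rad_wp (hδ n) hv
    have hmass : MF (fun p => rad (1 / ((n : ℝ) + 1)) (u p ^ 2 + v p ^ 2)) ≤ m₀ := by
      refine le_trans ?_ hm
      unfold MF
      rw [← integral_add hu.memL2 hv.memL2]
      exact integral_mono hw.fn.sq_integrable (hu.memL2.add hv.memL2) fun p =>
        rad_sq_le (hδ n) (by positivity)
    have hA : AF (pd fun p => rad (1 / ((n : ℝ) + 1)) (u p ^ 2 + v p ^ 2)) ≤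
        AF (pd u) + AF (pd v) := by
      unfold AF
      linarith [hFG n 0, hFG n 1, hFG n 2]
    have hB : BF (pd fun p => rad (1 / ((n : ℝ) + 1)) (u p ^ 2 + v p ^ 2)) ≤
      BF (pd u) + BF (pd v) := hFG n 3
    have hA3 := pow_le_pow_left₀ (AF_nonneg _) hA 3
    have hB2 := mul_le_mul_of_nonneg_right hB
      (sq_nonneg (NF fun p => rad (1 / ((n : ℝ) + 1)) (u p ^ 2 + v p ^ 2)))
    have := hw.lev_mul_le hmass
    exact this.trans (by linarith :
      _ ≤ 8 / 27 * (AF (pd u) + AF (pd v)) ^ 3 + (BF (pd u) + BF (pd v)) / 2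
        * (NF fun p => rad (1 / ((n : ℝ) + 1)) (u p ^ 2 + v p ^ 2)) ^ 2)
  have h := le_of_tendsto_of_tendsto' ((ht.pow 2).const_mul (lev m₀))
    (((ht.pow 2).const_mul ((BF (pd u) + BF (pd v)) / 2)).const_add _) key
  rw [show AF (pd u) + AF (pd v) = 3 / 4 * N by linarith] at h
  refine le_of_mul_le_mul_right (h.trans_eq ?_) (pow_pos hN 2)
  rw [show AF (pd u) + BF (pd u) + (AF (pd v) + BF (pd v)) =
    3 / 4 * N + (BF (pd u) + BF (pd v)) by linarith]
  ring

lemma l2_eq {u : Pt → ℝ} {Θ : ℝ} (hΘ : 0 ≤ Θ) : l2 u = Θ ↔ MF u = Θ ^ 2 := by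
  unfold l2 MF
  rw [Real.sqrt_eq_iff_eq_sq (integral_nonneg fun p => sq_nonneg _) hΘ]

lemma TestFun.ck {φ : Pt → ℝ} (h : TestFun φ) : CK φ :=
    ck_of_xCompact (h.1.of_le (by simp)) h.2.1 h.2.2

lemma CK.integral_weak {u φ : Pt → ℝ} (hu : CK u) (hφ : CK φ) (l : ℝ) :
    ∫ p in Dom, ((∑ i, gradx u p i * gradx φ p i) + grady u p * grady φ p + l * u p * φ p)
      = AF₂ (pd u) (pd φ) + (∫ p in Dom, pd u 3 p * pd φ 3 p) + l * ∫ p in Dom, u p * φ p := by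
  have hi := fun i => memLp_two_mul (hu.memLpD i) (hφ.memLpD i)
  have h01 : Integrable (fun p => pd u 0 p * pd φ 0 p + pd u 1 p * pd φ 1 p) mD := (hi 0).add (hi 1)
  have h012 : Integrable (fun p => pd u 0 p * pd φ 0 p + pd u 1 p * pd φ 1 p + pd u 2 p * pd φ 2 p)
      mD :=
    h01.add (hi 2)
  have h0123 : Integrable (fun p => pd u 0 p * pd φ 0 p + pd u 1 p * pd φ 1 p + pd u 2 p * pd φ 2 p
    + pd u 3 p * pd φ 3 p) mD := h012.add (hi 3)
  unfold AF₂
  rw [← integral_const_mul, ← integral_add (hi 0) (hi 1), ← integral_add h01 (hi 2),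
    ← integral_add h012 (hi 3), ← integral_add h0123
      ((memLp_two_mul hu.memLp hφ.memLp).const_mul l)]
  congr 1
  ext p
  simp [gradx, grady, pd, dir, Fin.sum_univ_three, mul_assoc]

/-- For every `Θ > 0` there exist `λ₁, λ₂` with `λ₁ + λ₂ > 0` and positive
functions `u, v ∈ H¹(ℝ³ × 𝕋)` with `‖u‖₂ = ‖v‖₂ = Θ` solving the coupled system weakly,
and `(u,v)` can be taken to be a minimizer of `m_Θ`. -/
theorem existence_of_normalized_solution (Θ : ℝ) (hΘ : 0 < Θ) :
    ∃ (lam1 lam2 : ℝ) (u v : Pt → ℝ),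
      0 < lam1 + lam2 ∧
      H1 u ∧ H1 v ∧
      (∀ p : Pt, 0 < u p) ∧ (∀ p : Pt, 0 < v p) ∧
      l2 u = Θ ∧ l2 v = Θ ∧
      svirial u v = 0 ∧ energy u v = mlevel Θ ∧
      WeakSol lam1 u (fun p => (u p) ^ 3 + u p * (v p) ^ 2) ∧
      WeakSol lam2 v (fun p => (v p) ^ 3 + v p * (u p) ^ 2) := by
  obtain ⟨f, w₀, U, A, B, N, M, h₀⟩ := exists_lim (show 0 < 2 * Θ ^ 2 by positivity)
  obtain ⟨K, w₁, hK₁, -, h₁⟩ := h₀.exists_le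
  obtain ⟨L, w, hL, hK, h₂⟩ := h₁.exists_lipschitz hK₁
  obtain ⟨hs, h⟩ := h₂.exists_differentiable hK hL
  have hpos := h.pos_of_lipschitz hK hL
  have hl := h.mult_pos hs hK
  have hM := h.MF_eq hl
  obtain ⟨hA, hB, hN⟩ := h.attained
  have hbal := h.seq.balanced
  have hlev := h.seq.level
  set l := Lim.mult B N M
  obtain ⟨c, hc, hc2⟩ : ∃ c : ℝ, 0 < c ∧ c ^ 2 = 1 / 2 :=
    ⟨√(1 / 2), by positivity, Real.sq_sqrt (by norm_num)⟩
  set u : Pt → ℝ := fun p => c * w p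
  have hpd : pd u = fun i p => c * pd w i p := funext₂ fun i p =>
    pd_const_mul (hs.differentiable one_ne_zero p) c i
  have hwp := h.wp.const_mul c
  have ck : CK u := ⟨contDiff_const.mul hs, hwp.fn.per, hwp.fn.memLp, fun i =>
      hpd ▸ (hwp.grad i).memLp⟩
  have hH := ck.h1
  have hmass : MF u = Θ ^ 2 := by
    rw [MF_const_mul, hM, hc2]
    ring
  have hAu : AF (pd u) = A / 2 := by rw [hpd, AF_const_mul, hA, hc2]; ring
  have hBu : BF (pd u) = B / 2 := by rw [hpd, BF_const_mul, hB, hc2]; ring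
  have hNu : ∫ p in Dom, (u p ^ 2 + u p ^ 2) ^ 2 = N := by
    rw [← hN]
    unfold NF
    congr 1
    ext p
    rw [mul_pow, hc2]
    ring
  have hvir : svirial u u = 0 := by
    rw [svirial_eq hH hH, hNu, hAu]
    linarith
  have hen : energy u u = lev (2 * Θ ^ 2) := by
    rw [energy_eq hH hH, hNu, hAu, hBu]
    linarith
  have hl2 : l2 u = Θ := (l2_eq hΘ.le).2 hmass
  have hmin : mlevel Θ = energy u u := by
    refine IsLeast.csInf_eq ⟨⟨u, u, ⟨hH, hl2⟩, ⟨hH, hl2⟩, hvir, rfl⟩, ?_⟩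
    rintro _ ⟨u', v', ⟨hu', hu2⟩, ⟨hv', hv2⟩, hQ, rfl⟩
    rw [l2_eq hΘ.le] at hu2 hv2
    rw [hen]
    exact lev_le_energy hu' hv' (by linarith) (by rw [hu2]; positivity) hQ
  have hsol : WeakSol l u fun p => u p ^ 3 + u p * u p ^ 2 := fun φ hφ => by
    rw [ck.integral_weak hφ.ck]
    have e := congrArg (c * ·) (h.euler_lagrange hφ.ck.wp)
    have e1 : ∫ p in Dom, (u p ^ 3 + u p * u p ^ 2) * φ p = c * ∫ p in Dom, w p ^ 3 * φ p := by
      rw [← integral_const_mul]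
      congr 1
      ext p
      linear_combination 2 * c * w p ^ 3 * φ p * hc2
    have e2 : ∀ a b : Pt → ℝ, ∫ p in Dom, c * a p * b p = c * ∫ p in Dom, a p * b p := fun a b => by
      simp only [mul_assoc, integral_const_mul]
    rw [e1, ← e, hpd]
    unfold AF₂
    simp only [e2, u]
    ring
  have hup : ∀ p, 0 < u p := fun p => mul_pos hc (hpos p)
  exact ⟨l, l, u, u, add_pos hl hl, hH, hH, hup, hup, hl2, hl2, hvir, hmin.symm, hsol, hsol⟩

end Waveguide
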